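/- Let x ≥ 4 and 1 ≤ Q₁ ≤ Q ≤ x^{1/2}. Then Σ_{q ≤ Q, l(q) > Q₁} max_{2 ≤ y ≤ x} max_{a : gcd(a,q)=1} |ψ(y;q,a) − ψ(y)/φ(q)| < c₁·(14x/Q₁ + 4x^{1/2}Q + 15x^{2/3}Q^{1/2} + 4x^{5/6}·log(Q/Q₁))·(log x)^{7/2}. -/

import Mathlib

open Real ArithmeticFunction

noncomputable def psi (x : ℝ) : ℝ := ∑ n ∈ Finset.Icc 1 ⌊x⌋₊, Λ n

noncomputable def A₀ : ℝ := psi 113 / 113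

noncomputable def E₀ : ℝ := ∏' p : Nat.Primes, (1 + 1 / ((p : ℝ) * ((p : ℝ) - 1)))

noncomputable def c₀ : ℝ :=
  Real.sqrt (2 * A₀) * 2 ^ 5 / (3 ^ ((3 : ℝ) / 2) * π * Real.log 2 ^ 2) *
    (2 + Real.log (Real.log 2) / Real.log (4 / 3))

noncomputable def c₁ : ℝ := 5 / 4 * E₀ * c₀ + 1

noncomputable def psiMod (y : ℝ) (q a : ℕ) : ℝ :=
  ∑ n ∈ (Finset.Icc 1 ⌊y⌋₊).filter (fun n : ℕ => (n : ZMod q) = (a : ZMod q)), Λ n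


set_option linter.unusedVariables false
set_option linter.unusedSectionVars false
set_option linter.style.haveILetI false

namespace BV

/-- symmetric sums over integers -/
lemma sum_symm {E : Type*} [AddCommMonoid E] (f : ℤ → E) (N : ℕ) :
    ∑ k ∈ Finset.Icc (-(N:ℤ)) N, f k
      = f 0 + ∑ n ∈ Finset.range N, (f (n+1) + f (-(n+1))) := by
  induction N with
  | zero => simp
  | succ N ih =>
    rw [Finset.sum_range_succ, ← add_assoc, ← ih]
    have h : Finset.Icc (-((N+1:ℕ):ℤ)) ((N+1:ℕ):ℤ)
        = insert ((N:ℤ)+1) (insert (-((N:ℤ)+1)) (Finset.Icc (-(N:ℤ)) N)) := by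
      ext k
      simp only [Finset.mem_Icc, Finset.mem_insert]
      push_cast
      omega
    rw [h, Finset.sum_insert, Finset.sum_insert]
    · rw [← add_assoc, add_comm]
    · simp only [Finset.mem_Icc]; omega
    · simp only [Finset.mem_Icc, Finset.mem_insert]; omega

lemma bern_cos {u : ℝ} (h0 : 0 ≤ u) (h1 : u ≤ 1) :
    HasSum (fun n : ℕ => 1 / (n:ℝ)^2 * Real.cos (2 * π * n * u)) (π^2 * (u^2 - u + 1/6)) := by
  have h := hasSum_one_div_nat_pow_mul_cos (k := 1) one_ne_zero (x := u) ⟨h0, h1⟩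
  convert h using 1
  rw [show 2 * 1 = 2 from rfl, Polynomial.bernoulli]
  simp [Finset.sum_range_succ, bernoulli, bernoulli'_two, Nat.choose, Nat.factorial]
  ring

lemma bern_abs {u : ℝ} (h1 : |u| ≤ 1) :
    HasSum (fun n : ℕ => 1 / (n:ℝ)^2 * Real.cos (2 * π * n * u)) (π^2 * (u^2 - |u| + 1/6)) := by
  have h := bern_cos (abs_nonneg u) h1
  rw [sq_abs] at h
  convert h using 2 with n
  rcases abs_choice u with h | h <;> rw [h]
  rw [show 2 * π * (n:ℝ) * -u = -(2 * π * n * u) by ring, Real.cos_neg]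

noncomputable def tw (t : ℝ) (n : ℕ) : ℂ := Complex.exp (Complex.I * ((t * Real.log n : ℝ) : ℂ))

lemma tw_norm (t : ℝ) (n : ℕ) : ‖tw t n‖ = 1 := by
  unfold tw
  rw [mul_comm, Complex.norm_exp_ofReal_mul_I]

lemma tw_mul (t : ℝ) {m n : ℕ} (hm : m ≠ 0) (hn : n ≠ 0) : tw t (m*n) = tw t m * tw t n := by
  unfold tw
  rw [← Complex.exp_add]
  congr 1
  push_cast
  rw [Real.log_mul (by exact_mod_cast hm) (by exact_mod_cast hn)]
  push_cast
  ring

lemma tw_zero (n : ℕ) : tw 0 n = 1 := by simp [tw]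

noncomputable def gam (δ : ℝ) (k : ℤ) : ℝ :=
  if k = 0 then 1 else min (1 / (π * |(k:ℝ)|)) (1 / (π^2 * δ * (k:ℝ)^2))

lemma gam_zero (δ : ℝ) : gam δ 0 = 1 := by simp [gam]
lemma gam_neg (δ : ℝ) (k : ℤ) : gam δ (-k) = gam δ k := by simp [gam]
lemma gam_nonneg {δ : ℝ} (hδ : 0 ≤ δ) (k : ℤ) : 0 ≤ gam δ k := by
  unfold gam; split_ifs
  · norm_num
  · exact le_min (by positivity) (by positivity)

noncomputable def kap (δ θ : ℝ) (n : ℤ) : ℂ :=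
  Complex.exp (Complex.I * ((2*π*n*δ : ℝ):ℂ)) - 1 - Complex.exp (Complex.I * ((-(2*π*n*θ) : ℝ):ℂ))
    + Complex.exp (Complex.I * ((-(2*π*n*(θ+δ)) : ℝ):ℂ))

lemma kap_le {δ θ : ℝ} (hδ : 0 ≤ δ) (n : ℤ) : ‖kap δ θ n‖ ≤ 2 * min 2 (2*π*|(n:ℝ)| * δ) := by
  have hn (y : ℝ) : ‖Complex.exp (Complex.I * (y:ℂ)) - 1‖ ≤ min 2 |y| := by
    refine le_min ?_ (by simpa using Real.norm_exp_I_mul_ofReal_sub_one_le (x := y))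
    refine (norm_sub_le _ _).trans ?_
    rw [mul_comm, Complex.norm_exp_ofReal_mul_I]
    norm_num
  have e : kap δ θ n = (Complex.exp (Complex.I * ((2*π*n*δ : ℝ):ℂ)) - 1)
      + Complex.exp (Complex.I * ((-(2*π*n*θ) : ℝ):ℂ)) *
        (Complex.exp (Complex.I * ((-(2*π*n*δ) : ℝ):ℂ)) - 1) := by
    unfold kap
    rw [mul_sub, ← Complex.exp_add, mul_one]
    rw [← mul_add, ← Complex.ofReal_add, show -(2*π*n*θ) + -(2*π*n*δ) = -(2*π*n*(θ+δ)) by ring]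
    ring
  rw [e]
  refine (norm_add_le _ _).trans ?_
  rw [norm_mul]
  have h1 := hn (2*π*n*δ)
  have h2 := hn (-(2*π*n*δ))
  rw [abs_neg] at h2
  have h3 : |2*π*n*δ| = 2*π*|(n:ℝ)| * δ := by
    rw [abs_mul, abs_mul, abs_of_nonneg hδ, abs_of_nonneg (by positivity : (0:ℝ) ≤ 2*π)]
  rw [h3] at h1 h2
  rw [mul_comm Complex.I ((-(2*π*n*θ) : ℝ):ℂ), Complex.norm_exp_ofReal_mul_I]
  linarith

noncomputable def coef (δ θ : ℝ) (k : ℤ) : ℂ :=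
  if k = 0 then ((δ + θ : ℝ) : ℂ) else -(1 / (4 * π^2 * δ * (k:ℝ)^2) : ℝ) * kap δ θ k

lemma coef_le {δ θ : ℝ} (hδ : 0 < δ) (hθ : 0 ≤ θ) (h1 : δ + θ ≤ 1) (k : ℤ) :
    ‖coef δ θ k‖ ≤ gam δ k := by
  unfold coef gam
  split_ifs with h
  · rw [Complex.norm_real, Real.norm_of_nonneg (by positivity)]; exact h1
  · have hk : (0:ℝ) < |(k:ℝ)| := by positivity
    rw [norm_mul, norm_neg, Complex.norm_real, Real.norm_of_nonneg (by positivity)]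
    have h2 := kap_le (θ := θ) hδ.le k
    rw [← sq_abs (k:ℝ)]
    refine (mul_le_mul_of_nonneg_left h2 (by positivity)).trans ?_
    refine le_min ?_ ?_
    · calc _ ≤ 1 / (4 * π^2 * δ * |(k:ℝ)|^2) * (2 * (2*π*|(k:ℝ)| * δ)) := by
            gcongr; exact min_le_right _ _
        _ = _ := by field_simp; norm_num
    · calc _ ≤ 1 / (4 * π^2 * δ * |(k:ℝ)|^2) * (2 * 2) := by
            gcongr; exact min_le_left _ _
        _ = _ := by field_simp; norm_num

lemma sep_real {δ θy θ : ℝ} (hδ : 0 < δ) (hδ1 : δ ≤ 1/2) (hy : 0 ≤ θy) (hy1 : θy ≤ 1/2)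
    (h0 : 0 ≤ θ) (h1 : θ ≤ 1/2) (hdi : θ ≤ θy ∨ θy + δ ≤ θ) :
    Filter.Tendsto (fun N : ℕ => ∑ k ∈ Finset.Icc (-(N:ℤ)) N,
      coef δ θy k * Complex.exp (Complex.I * ((2*π*k*θ : ℝ) : ℂ))) Filter.atTop
      (nhds (if θ ≤ θy then 1 else 0)) := by
  have a1 := bern_abs (u := θ + δ) (by rw [abs_le]; constructor <;> linarith)
  have a2 := bern_abs (u := θ) (by rw [abs_le]; constructor <;> linarith)
  have a3 := bern_abs (u := θ - θy) (by rw [abs_le]; constructor <;> linarith)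
  have a4 := bern_abs (u := θ - θy - δ) (by rw [abs_le]; constructor <;> linarith)
  have A := (((a1.sub a2).sub a3).add a4).mul_left (-(1/(2*π^2*δ)))
  rw [← hasSum_nat_add_iff' 1] at A
  have B := (A.tendsto_sum_nat).const_add (δ + θy)
  have C := (Complex.continuous_ofReal.tendsto _).comp B
  convert C using 1
  · funext N
    rw [sum_symm]
    simp only [Function.comp]
    push_cast
    congr 1
    · simp [coef]
    · apply Finset.sum_congr rfl
      intro n _
      have hn : ((n:ℂ)+1) ≠ 0 := by exact_mod_cast Nat.succ_ne_zero n
      have hn' : ((n:ℤ)+1) ≠ 0 := by omega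
      have hn'' : (-((n:ℤ)+1)) ≠ 0 := by omega
      have hpi : (π:ℂ) ≠ 0 := by exact_mod_cast Real.pi_ne_zero
      have hd : (δ:ℂ) ≠ 0 := by exact_mod_cast hδ.ne'
      have key : ∀ p : ℂ, (Complex.exp (Complex.I * (p*δ)) - 1 - Complex.exp (Complex.I * (-(p*θy)))
          + Complex.exp (Complex.I * (-(p*(θy+δ))))) * Complex.exp (Complex.I * (p*θ))
          = Complex.exp (p*(θ+δ) * Complex.I) - Complex.exp (p*θ*Complex.I)
            - Complex.exp (p*(θ-θy)*Complex.I) + Complex.exp (p*(θ-θy-δ)*Complex.I) := by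
        intro p
        simp only [sub_mul, add_mul, one_mul, ← Complex.exp_add]
        congr 1
        · congr 1
          · congr 1
            · congr 1; ring
            · congr 1; ring
          · congr 1; ring
        · congr 1; ring
      have k1 := key (2*π*((n:ℂ)+1))
      have k2 := key (2*π*(-((n:ℂ)+1)))
      simp only [coef, if_neg hn', if_neg hn'', kap, Complex.cos]
      push_cast
      rw [mul_assoc (-(1 / (4 * (π:ℂ)^2 * δ * ((n:ℂ)+1)^2))), k1, mul_assoc (-(1 / (4 * (π:ℂ)^2 * δ * (-((n:ℂ)+1))^2))), k2]
      simp only [mul_neg, neg_mul]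
      field_simp
      ring
  · congr 1
    have h5 : |θ + δ| = θ + δ := abs_of_nonneg (by positivity)
    have h6 : |θ| = θ := abs_of_nonneg (by positivity)
    have hpi := Real.pi_ne_zero
    rw [h5, h6]
    rcases hdi with h | h
    · rw [if_pos h, abs_of_nonpos (by linarith : θ - θy ≤ 0), abs_of_nonpos (by linarith : θ - θy - δ ≤ 0)]
      rw [← Complex.ofReal_one]
      congr 1
      simp
      field_simp
      ring
    · rw [if_neg (by linarith), abs_of_nonneg (by linarith : 0 ≤ θ - θy), abs_of_nonneg (by linarith : 0 ≤ θ - θy - δ)]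
      rw [← Complex.ofReal_zero]
      congr 1
      simp
      field_simp
      ring

/-- frequency -/
noncomputable def fr (L : ℝ) (k : ℤ) : ℝ := 2 * π * k / L

/-- separation of variables -/
lemma sep_nat {L δ : ℝ} (hL : 0 < L) (hδ : 0 < δ) (hδ1 : δ ≤ 1/2) {Y : ℕ} (hY : 1 ≤ Y)
    (hYL : Real.log Y ≤ L/2) (hgap : δ * L * (Y+1) ≤ 1) :
    ∃ c : ℤ → ℂ, (∀ k, ‖c k‖ ≤ gam δ k) ∧ ∀ m : ℕ, 1 ≤ m → Real.log m ≤ L/2 →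
      Filter.Tendsto (fun N : ℕ => ∑ k ∈ Finset.Icc (-(N:ℤ)) N, c k * tw (fr L k) m) Filter.atTop
        (nhds (if m ≤ Y then 1 else 0)) := by
  have hY0 : (0:ℝ) < Y := by exact_mod_cast hY
  have ty : 0 ≤ Real.log Y / L := div_nonneg (Real.log_natCast_nonneg _) hL.le
  have ty1 : Real.log Y / L ≤ 1/2 := by rw [div_le_iff₀ hL]; linarith
  refine ⟨coef δ (Real.log Y / L), fun k => coef_le hδ ty (by linarith) k, ?_⟩
  intro m hm hmL
  have hm0 : (0:ℝ) < m := by exact_mod_cast hm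
  have tm : 0 ≤ Real.log m / L := div_nonneg (Real.log_natCast_nonneg _) hL.le
  have tm1 : Real.log m / L ≤ 1/2 := by rw [div_le_iff₀ hL]; linarith
  have hdi : (m ≤ Y ∧ Real.log m / L ≤ Real.log Y / L) ∨
      (¬ m ≤ Y ∧ Real.log Y / L + δ ≤ Real.log m / L) := by
    by_cases h : m ≤ Y
    · left
      refine ⟨h, ?_⟩
      gcongr
    · right
      refine ⟨h, ?_⟩
      have h1 : (Y:ℝ) + 1 ≤ m := by exact_mod_cast (not_le.mp h)
      rw [← sub_nonneg, show Real.log m / L - (Real.log Y / L + δ)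
        = (Real.log m - Real.log Y - δ * L)/L by field_simp; ring]
      apply div_nonneg _ hL.le
      have h2 : Real.log (Y+1) ≤ Real.log m := Real.log_le_log (by positivity) h1
      have h3 := Real.one_sub_inv_le_log_of_pos (x := (Y+1)/(Y:ℝ)) (by positivity)
      rw [Real.log_div (by positivity) (by positivity)] at h3
      have h4 : 1 - ((Y+1)/(Y:ℝ))⁻¹ = 1/(Y+1) := by field_simp; ring
      rw [h4] at h3
      have h5 : δ * L ≤ 1/(Y+1) := by rw [le_div_iff₀ (by positivity)]; exact hgap
      linarith
  have h := sep_real (θ := Real.log m / L) hδ hδ1 ty ty1 tm tm1 (by tauto)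
  convert h using 1
  · funext N
    refine Finset.sum_congr rfl fun k _ => ?_
    unfold tw fr
    congr 3
    push_cast
    ring
  · congr 1
    rcases hdi with ⟨h1, h2⟩ | ⟨h1, h2⟩
    · rw [if_pos h1, if_pos h2]
    · rw [if_neg h1, if_neg (by linarith)]

end BV

namespace BV
open MeasureTheory

lemma mult_lower {t h : ℝ} (hh : 0 < h) (ht : |t| * h ≤ 2) :
    5/6 * h ≤ ‖∫ v in (-h)..0, Complex.exp (Complex.I * ((t * v : ℝ) : ℂ))‖ := by
  rcases eq_or_ne t 0 with rfl | h0
  · simp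
    rw [abs_of_pos hh]; linarith
  · have e : ∀ v : ℝ, Complex.exp (Complex.I * ((t * v : ℝ) : ℂ)) = Complex.exp ((Complex.I * t) * v) := by
      intro v; congr 1; push_cast; ring
    have hne : Complex.I * (t:ℂ) ≠ 0 := mul_ne_zero Complex.I_ne_zero (by exact_mod_cast h0)
    simp_rw [e]
    rw [integral_exp_mul_complex hne, norm_div]
    simp only [norm_mul, Complex.norm_I, one_mul, Complex.norm_real]
    rw [← norm_neg, neg_sub]
    have e2 : Complex.exp (Complex.I * (t:ℂ) * ((-h:ℝ):ℂ)) - Complex.exp (Complex.I * t * ((0:ℝ):ℂ))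
        = Complex.exp (Complex.I * ((-(t*h) : ℝ):ℂ)) - 1 := by
      simp only [Complex.ofReal_zero, mul_zero, Complex.exp_zero]
      congr 2; push_cast; ring
    rw [e2, Complex.norm_exp_I_mul_ofReal_sub_one, norm_mul, Real.norm_eq_abs, Real.norm_eq_abs, Real.norm_eq_abs]
    have ht0 : 0 < |t| := by positivity
    rw [le_div_iff₀ ht0]
    have h1 : |Real.sin (-(t*h)/2)| = Real.sin (|t| * h/2) := by
      rcases abs_choice t with h' | h'
      · rw [show -(t*h)/2 = -(|t| * h/2) by rw [h']; ring, Real.sin_neg, abs_neg, abs_of_nonneg]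
        apply Real.sin_nonneg_of_nonneg_of_le_pi (by positivity)
        linarith [Real.pi_gt_three]
      · rw [show -(t*h)/2 = (|t| * h/2) by rw [h']; ring, abs_of_nonneg]
        apply Real.sin_nonneg_of_nonneg_of_le_pi (by positivity)
        linarith [Real.pi_gt_three]
    rw [h1]
    have h2 := Real.sin_ge_sub_cube (x := |t| * h/2) (by positivity)
    have h3 : 0 ≤ |t| * h/2 := by positivity
    have h4 : |t| * h/2 ≤ 1 := by linarith
    have h5 : (|t| * h/2)^3 ≤ |t| * h/2 := by
      nlinarith [mul_nonneg h3 (sub_nonneg.2 h4), mul_nonneg (mul_nonneg h3 h3) (sub_nonneg.2 h4)]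
    rw [show |(2:ℝ)| = 2 by norm_num]
    nlinarith

lemma int_window (t h : ℝ) (n : ℕ) :
    ∫ u in (Real.log n - h)..(Real.log n), Complex.exp (Complex.I * ((t * u : ℝ) : ℂ))
      = tw t n * ∫ v in (-h)..0, Complex.exp (Complex.I * ((t * v : ℝ) : ℂ)) := by
  have := intervalIntegral.integral_comp_add_right (a := -h) (b := 0)
    (fun u : ℝ => Complex.exp (Complex.I * ((t * u : ℝ) : ℂ))) (Real.log n)
  rw [zero_add, show -h + Real.log n = Real.log n - h by ring] at this
  rw [← this, ← intervalIntegral.integral_const_mul]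
  congr 1
  funext v
  unfold tw
  rw [← Complex.exp_add]
  congr 1
  push_cast; ring

noncomputable def win (h : ℝ) (S : Finset ℕ) (c : ℕ → ℂ) (u : ℝ) : ℂ :=
  ∑ n ∈ S, (Set.Ioc (Real.log n - h) (Real.log n)).indicator (fun _ => c n) u

lemma win_memLp (h : ℝ) (S : Finset ℕ) (c : ℕ → ℂ) (a b : ℝ) :
    MemLp (win h S c) 2 (volume.restrict (Set.Ioc a b)) := by
  unfold win
  have : (fun u => ∑ n ∈ S, (Set.Ioc (Real.log n - h) (Real.log n)).indicator (fun _ => c n) u)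
    = ∑ n ∈ S, (fun u => (Set.Ioc (Real.log n - h) (Real.log n)).indicator (fun _ => c n) u) := by
    funext u; simp
  rw [this]
  apply memLp_finsetSum'
  intro n _
  apply memLp_indicator_const _ measurableSet_Ioc
  right
  exact (measure_lt_top _ _).ne

lemma ind_int {E : Type*} [NormedAddCommGroup E] [NormedSpace ℝ E]
    {a b p q : ℝ} (f : ℝ → E) (hap : a ≤ p) (hpq : p ≤ q) (hqb : q ≤ b) :
    ∫ u in a..b, (Set.Ioc p q).indicator f u = ∫ u in p..q, f u := by
  rw [intervalIntegral.integral_of_le (by linarith), intervalIntegral.integral_of_le hpq,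
    setIntegral_indicator measurableSet_Ioc]
  congr 2
  rw [Set.inter_eq_right]
  exact Set.Ioc_subset_Ioc hap hqb

lemma coeffOn {L h : ℝ} (hL : 0 < L) (hh : 0 < h) (hhL : h ≤ L/2) (S : Finset ℕ) (c : ℕ → ℂ)
    (hS : ∀ n ∈ S, 1 ≤ n ∧ Real.log n ≤ L/2) (hab : -h < L - h) (k : ℤ) :
    fourierCoeffOn hab (win h S c) (-k)
      = (1/L : ℝ) • ((∑ n ∈ S, c n * tw (fr L k) n) *
        ∫ v in (-h)..0, Complex.exp (Complex.I * ((fr L k * v : ℝ) : ℂ))) := by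
  rw [fourierCoeffOn_eq_integral, show 1 / (L - h - -h) = 1 / L by congr 1; ring]
  congr 1
  have e : ∀ u : ℝ, (fourier (- -k)) (u : AddCircle (L - h - -h)) • win h S c u
      = ∑ n ∈ S, (Set.Ioc (Real.log n - h) (Real.log n)).indicator
        (fun u => c n * Complex.exp (Complex.I * ((fr L k * u : ℝ) : ℂ))) u := by
    intro u
    rw [fourier_coe_apply, neg_neg, show L - h - -h = L by ring, win, smul_eq_mul, Finset.mul_sum]
    refine Finset.sum_congr rfl fun n _ => ?_
    by_cases hu : u ∈ Set.Ioc (Real.log n - h) (Real.log n)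
    · simp only [Set.indicator_of_mem hu]
      rw [mul_comm]
      congr 2
      unfold fr
      push_cast
      ring
    · simp only [Set.indicator_of_notMem hu, mul_zero]
  simp_rw [e]
  rw [intervalIntegral.integral_finsetSum, Finset.sum_mul]
  · refine Finset.sum_congr rfl fun n hn => ?_
    obtain ⟨h1, h2⟩ := hS n hn
    have h3 : 0 ≤ Real.log n := Real.log_natCast_nonneg n
    rw [ind_int _ (by linarith) (by linarith) (by linarith), intervalIntegral.integral_const_mul,
      int_window]
    ring
  · intro n _
    rw [intervalIntegrable_iff]
    apply IntegrableOn.indicator _ measurableSet_Ioc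
    rw [← intervalIntegrable_iff]
    apply Continuous.intervalIntegrable
    fun_prop

lemma bessel {L h : ℝ} (hL : 0 < L) (hh : 0 < h) (hhL : h ≤ L/2) (S : Finset ℕ) (c : ℕ → ℂ)
    (hS : ∀ n ∈ S, 1 ≤ n ∧ Real.log n ≤ L/2) (K : ℕ) (hK : 2 * π * K / L * h ≤ 2) :
    ∑ k ∈ Finset.Icc (-(K:ℤ)) K, ‖∑ n ∈ S, c n * tw (fr L k) n‖^2
      ≤ 36/25 * (L / h^2) * ∫ u in (-h)..(L-h), ‖win h S c u‖^2 := by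
  have hab : -h < L - h := by linarith
  have H := hasSum_sq_fourierCoeffOn hab (win_memLp h S c (-h) (L-h))
  have H1 := sum_le_hasSum (Finset.Icc (-(K:ℤ)) K) (fun i _ => by positivity) H
  rw [show L - h - -h = L by ring] at H1
  have H2 : ∑ k ∈ Finset.Icc (-(K:ℤ)) K, ‖fourierCoeffOn hab (win h S c) k‖^2
      = ∑ k ∈ Finset.Icc (-(K:ℤ)) K, ‖fourierCoeffOn hab (win h S c) (-k)‖^2 := by
    refine Finset.sum_nbij' (fun k => -k) (fun k => -k) ?_ ?_ ?_ ?_ ?_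
    · intro k hk; simp only [Finset.mem_Icc] at *; omega
    · intro k hk; simp only [Finset.mem_Icc] at *; omega
    · simp
    · simp
    · simp
  rw [H2] at H1
  have H3 : ∑ k ∈ Finset.Icc (-(K:ℤ)) K, (5/6*h/L)^2 * ‖∑ n ∈ S, c n * tw (fr L k) n‖^2
      ≤ ∑ k ∈ Finset.Icc (-(K:ℤ)) K, ‖fourierCoeffOn hab (win h S c) (-k)‖^2 := by
    refine Finset.sum_le_sum fun k hk => ?_
    rw [coeffOn hL hh hhL S c hS hab k, norm_smul, norm_mul, ← mul_pow, Real.norm_of_nonneg (by positivity)]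
    have hkk : |fr L k| * h ≤ 2 := by
      refine le_trans ?_ hK
      unfold fr
      rw [abs_div, abs_mul, abs_of_pos hL, abs_of_pos (by positivity : (0:ℝ) < 2*π)]
      gcongr
      simp only [Finset.mem_Icc] at hk
      have : |k| ≤ (K:ℤ) := abs_le.2 hk
      exact_mod_cast this
    have hm := mult_lower hh hkk
    gcongr ?_^2
    calc 5/6*h/L * ‖∑ n ∈ S, c n * tw (fr L k) n‖
        = 1/L * (‖∑ n ∈ S, c n * tw (fr L k) n‖ * (5/6*h)) := by ring
      _ ≤ _ := by gcongr
  rw [← Finset.mul_sum] at H3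
  have H4 := H3.trans H1
  rw [smul_eq_mul] at H4
  calc _ = 36/25 * (L^2 / h^2) * ((5/6*h/L)^2 * ∑ k ∈ Finset.Icc (-(K:ℤ)) K, ‖∑ n ∈ S, c n * tw (fr L k) n‖^2) := by
        field_simp; ring
    _ ≤ 36/25 * (L^2 / h^2) * (L⁻¹ * ∫ u in (-h)..(L-h), ‖win h S c u‖^2) := by gcongr
    _ = _ := by field_simp

/-- abstract family of characters satisfying a large sieve inequality -/
structure Fam (ι : Type) where
  s : Finset ι
  w : ι → ℝ
  χ : ι → ℕ → ℂ
  Z : ℝ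
  P : ℝ
  W : ℝ
  hw : ∀ i ∈ s, 0 ≤ w i
  hZ : 1 ≤ Z
  hmul : ∀ i ∈ s, ∀ m n, χ i (m * n) = χ i m * χ i n
  hle : ∀ i ∈ s, ∀ n, ‖χ i n‖ ≤ 1
  LS : ∀ (a : ℕ → ℂ) (S : Finset ℕ) (M N : ℕ), S ⊆ Finset.Ico M (M + N) →
    ∑ i ∈ s, w i * ‖∑ n ∈ S, a n * χ i n‖^2 ≤ (N + Z) * ∑ n ∈ S, ‖a n‖^2
  PV : ∀ i ∈ s, ∀ z : ℕ, ‖∑ n ∈ Finset.Icc 1 z, χ i n‖ ≤ P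
  hW : ∑ i ∈ s, w i ≤ W

namespace Fam
variable {ι : Type} (F : Fam ι)

/-- twisted Dirichlet polynomial -/
noncomputable def A (S : Finset ℕ) (a : ℕ → ℂ) (t : ℝ) (i : ι) : ℂ :=
  ∑ n ∈ S, a n * F.χ i n * tw t n

/-- l2 norm squared -/
noncomputable def _root_.BV.nn (S : Finset ℕ) (a : ℕ → ℂ) : ℝ := ∑ n ∈ S, ‖a n‖^2

lemma _root_.BV.nn_nonneg (S : Finset ℕ) (a : ℕ → ℂ) : 0 ≤ nn S a :=
  Finset.sum_nonneg fun _ _ => by positivity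

lemma LSt (S : Finset ℕ) (a : ℕ → ℂ) (N : ℕ) (hS : S ⊆ Finset.Icc 1 N) (t : ℝ) :
    ∑ i ∈ F.s, F.w i * ‖F.A S a t i‖^2 ≤ (N + F.Z) * nn S a := by
  have h := F.LS (fun n => a n * tw t n) S 1 N (hS.trans (by
    intro n; simp only [Finset.mem_Icc, Finset.mem_Ico]; omega))
  simp only [norm_mul, tw_norm, mul_one] at h
  refine le_trans (le_of_eq ?_) h
  refine Finset.sum_congr rfl fun i _ => ?_
  unfold A
  congr 3
  exact Finset.sum_congr rfl fun n _ => by ring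

lemma win_eq (h : ℝ) (S : Finset ℕ) (c : ℕ → ℂ) (u : ℝ) :
    win h S c u = ∑ n ∈ S.filter (fun n : ℕ => u ∈ Set.Ioc (Real.log n - h) (Real.log n)), c n := by
  unfold win
  rw [Finset.sum_filter]
  refine Finset.sum_congr rfl fun n _ => ?_
  simp only [Set.indicator]

lemma LSwin {h : ℝ} (hh : 0 < h) (S : Finset ℕ) (a : ℕ → ℂ) (N : ℕ) (hS : S ⊆ Finset.Icc 1 N) (u : ℝ) :
    ∑ i ∈ F.s, F.w i * ‖win h S (fun n => a n * F.χ i n) u‖^2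
      ≤ (N * h + 1 + F.Z) *
        ∑ n ∈ S, (Set.Ioc (Real.log n - h) (Real.log n)).indicator (fun _ => ‖a n‖^2) u := by
  simp only [win_eq]
  set T := S.filter (fun n : ℕ => u ∈ Set.Ioc (Real.log n - h) (Real.log n)) with hT
  have e : ∑ n ∈ S, (Set.Ioc (Real.log n - h) (Real.log n)).indicator (fun _ => ‖a n‖^2) u
      = ∑ n ∈ T, ‖a n‖^2 := by
    rw [hT, Finset.sum_filter]
    refine Finset.sum_congr rfl fun n _ => ?_
    simp only [Set.indicator]
  rw [e]
  rcases T.eq_empty_or_nonempty with h0 | h0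
  · simp [h0]
  set M := T.min' h0
  have hsub : T ⊆ Finset.Ico M (M + (⌊N*h⌋₊ + 1)) := by
    intro n hn
    have h1 : M ≤ n := Finset.min'_le _ _ hn
    have hM : M ∈ T := Finset.min'_mem _ _
    rw [hT, Finset.mem_filter] at hn hM
    obtain ⟨hn1, hn2⟩ := hn
    obtain ⟨hM1, hM2⟩ := hM
    have hn3 := Finset.mem_Icc.1 (hS hn1)
    have hM3 := Finset.mem_Icc.1 (hS hM1)
    have hMp : (0:ℝ) < M := by exact_mod_cast hM3.1
    have hnp : (0:ℝ) < n := by exact_mod_cast hn3.1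
    have h2 : Real.log n - Real.log M < h := by
      have := hn2.1; have := hM2.2; linarith
    have h4 := Real.one_sub_inv_le_log_of_pos (x := n/M) (by positivity)
    rw [Real.log_div hnp.ne' hMp.ne', inv_div] at h4
    have h5 : 1 - (M:ℝ)/n < h := by linarith
    have h6 : (n:ℝ) - M < n * h := by
      have := mul_lt_mul_of_pos_left h5 hnp
      rw [mul_sub, mul_div_cancel₀ _ hnp.ne'] at this
      linarith
    have h7 : ((n - M : ℕ) : ℝ) ≤ N * h := by
      rw [Nat.cast_sub h1]
      refine h6.le.trans ?_
      gcongr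
      exact hn3.2
    have h8 := Nat.le_floor h7
    rw [Finset.mem_Ico]
    omega
  refine (F.LS a T M _ hsub).trans ?_
  have : (0:ℝ) ≤ N*h := by positivity
  have h9 := Nat.floor_le this
  push_cast
  gcongr

/-- hybrid large sieve -/
lemma hyb {L : ℝ} (hL : 0 < L) (S : Finset ℕ) (a : ℕ → ℂ) (N : ℕ) (hS : S ⊆ Finset.Icc 1 N)
    (hN : Real.log N ≤ L/2) (K : ℕ) (hK : 1 ≤ K) :
    ∑ k ∈ Finset.Icc (-(K:ℤ)) K, ∑ i ∈ F.s, F.w i * ‖F.A S a (fr L k) i‖^2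
      ≤ 36/25 * (L * N + π * K * (F.Z + 1)) * nn S a := by
  have hKp : (0:ℝ) < K := by exact_mod_cast hK
  have hK1 : (1:ℝ) ≤ K := by exact_mod_cast hK
  have hpi := Real.pi_pos
  set h := L / (π * K) with hh
  have hhp : 0 < h := by positivity
  have hhL : h ≤ L/2 := by
    rw [hh]; apply div_le_div_of_nonneg_left hL.le (by norm_num)
    nlinarith [Real.pi_gt_three]
  have hK2 : 2 * π * K / L * h ≤ 2 := by
    rw [hh]; apply le_of_eq; field_simp
  have hS' : ∀ n ∈ S, 1 ≤ n ∧ Real.log n ≤ L/2 := by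
    intro n hn
    have := Finset.mem_Icc.1 (hS hn)
    refine ⟨this.1, le_trans ?_ hN⟩
    apply Real.log_le_log (by exact_mod_cast this.1)
    exact_mod_cast this.2
  have hsqint : ∀ c : ℕ → ℂ, IntervalIntegrable (fun u => ‖win h S c u‖^2) volume (-h) (L-h) := by
    intro c
    rw [intervalIntegrable_iff_integrableOn_Ioc_of_le (by linarith)]
    exact (win_memLp h S c (-h) (L-h)).integrable_norm_pow (by norm_num)
  rw [Finset.sum_comm]
  calc _ ≤ ∑ i ∈ F.s, F.w i * (36/25 * (L / h^2) *
        ∫ u in (-h)..(L-h), ‖win h S (fun n => a n * F.χ i n) u‖^2) := by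
        refine Finset.sum_le_sum fun i hi => ?_
        rw [← Finset.mul_sum]
        apply mul_le_mul_of_nonneg_left _ (F.hw i hi)
        exact bessel hL hhp hhL S (fun n => a n * F.χ i n) hS' K hK2
    _ = 36/25 * (L / h^2) * ∫ u in (-h)..(L-h), ∑ i ∈ F.s, F.w i * ‖win h S (fun n => a n * F.χ i n) u‖^2 := by
        rw [intervalIntegral.integral_finsetSum, Finset.mul_sum]
        · refine Finset.sum_congr rfl fun i _ => ?_
          rw [intervalIntegral.integral_const_mul]
          ring
        · intro i _
          exact (hsqint _).const_mul _
    _ ≤ 36/25 * (L / h^2) * ∫ u in (-h)..(L-h), (N * h + 1 + F.Z) *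
        ∑ n ∈ S, (Set.Ioc (Real.log n - h) (Real.log n)).indicator (fun _ => ‖a n‖^2) u := by
        apply mul_le_mul_of_nonneg_left _ (by positivity)
        apply intervalIntegral.integral_mono_on (by linarith)
        · have := IntervalIntegrable.sum (s := F.s) (f := fun i u => F.w i * ‖win h S (fun n => a n * F.χ i n) u‖^2)
            (μ := volume) (a := -h) (b := L-h) (fun i _ => (hsqint _).const_mul _)
          refine cast ?_ this
          congr 1
          funext u; simp
        · apply IntervalIntegrable.const_mul
          have := IntervalIntegrable.sum (s := S) (f := fun n u => (Set.Ioc (Real.log n - h) (Real.log n)).indicator (fun _ => ‖a n‖^2) u)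
            (μ := volume) (a := -h) (b := L-h) (fun n _ => by
              rw [intervalIntegrable_iff]
              apply IntegrableOn.indicator _ measurableSet_Ioc
              rw [← intervalIntegrable_iff]
              simp)
          refine cast ?_ this
          congr 1
          funext u; simp
        · intro u _
          exact F.LSwin hhp S a N hS u
    _ = 36/25 * (L / h^2) * ((N * h + 1 + F.Z) * (h * nn S a)) := by
        rw [intervalIntegral.integral_const_mul, intervalIntegral.integral_finsetSum]
        · congr 2
          unfold nn
          rw [Finset.mul_sum]
          refine Finset.sum_congr rfl fun n hn => ?_
          obtain ⟨h1, h2⟩ := hS' n hn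
          have h3 : 0 ≤ Real.log n := Real.log_natCast_nonneg n
          rw [ind_int _ (by linarith) (by linarith) (by linarith)]
          simp
        · intro n _
          rw [intervalIntegrable_iff]
          apply IntegrableOn.indicator _ measurableSet_Ioc
          rw [← intervalIntegrable_iff]
          simp
    _ = _ := by
        rw [hh]; field_simp; ring

end Fam
end BV

namespace BV

lemma ioc_ico (n : ℕ) : Finset.Ioc 0 n = Finset.Ico 1 (n+1) := by ext; simp; omega

lemma gam_nat {δ : ℝ} {n : ℕ} (hn : 1 ≤ n) :
    gam δ n = min (1 / (π * n)) (1 / (π^2 * δ * (n:ℝ)^2)) := by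
  unfold gam
  rw [if_neg (by exact_mod_cast (by omega : n ≠ 0))]
  simp

lemma gam_anti {δ : ℝ} (hδ : 0 < δ) {n : ℕ} (hn : 1 ≤ n) : gam δ ((n+1 : ℕ):ℤ) ≤ gam δ (n:ℤ) := by
  rw [gam_nat hn, gam_nat (by omega)]
  have h : (0:ℝ) < n := by exact_mod_cast hn
  have h2 : (n:ℝ) ≤ ((n+1:ℕ):ℝ) := by push_cast; linarith
  have := Real.pi_pos
  apply min_le_min <;> gcongr

lemma gam_sum {δ : ℝ} (hδ : 0 < δ) (hδ1 : δ ≤ 1/2) (N : ℕ) :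
    ∑ n ∈ Finset.Ioc 0 N, gam δ (n:ℤ) ≤ 1/π * (Real.log (1/δ) + 2) := by
  have hpi := Real.pi_pos
  have hT : 2 ≤ 1/δ := by rw [le_div_iff₀ hδ]; linarith
  set m := ⌊1/δ⌋₊ with hm
  have hm1 : 1 ≤ m := Nat.le_floor (by push_cast; linarith)
  have hmT : (m:ℝ) ≤ 1/δ := Nat.floor_le (by positivity)
  have hmT2 : 1/δ < m + 1 := Nat.lt_floor_add_one _
  have hmp : (0:ℝ) < m := by exact_mod_cast hm1
  have first : ∀ k : ℕ, k ≤ m → ∑ n ∈ Finset.Ioc 0 k, gam δ (n:ℤ) ≤ 1/π * (1 + Real.log (1/δ)) := by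
    intro k hk
    have h1 : ∑ n ∈ Finset.Ioc 0 k, gam δ (n:ℤ) ≤ ∑ n ∈ Finset.Ioc 0 k, 1/π * ((n:ℝ))⁻¹ := by
      refine Finset.sum_le_sum fun n hn => ?_
      have hn1 : 1 ≤ n := by simp at hn; omega
      rw [gam_nat hn1]
      refine (min_le_left _ _).trans (le_of_eq ?_)
      field_simp
    refine h1.trans ?_
    rw [← Finset.mul_sum]
    gcongr
    have h2 := harmonic_le_one_add_log k
    rw [harmonic_eq_sum_Icc] at h2
    push_cast at h2
    have h3 : Finset.Ioc 0 k = Finset.Icc 1 k := by ext; simp; omega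
    rw [h3]
    refine h2.trans ?_
    rcases Nat.eq_zero_or_pos k with h0 | h0
    · subst h0; simp; exact Real.log_nonpos hδ.le (by linarith)
    · gcongr
      exact (by exact_mod_cast hk : (k:ℝ) ≤ m).trans hmT
  rcases le_total N m with h | h
  · refine (first N h).trans ?_
    gcongr 1/π * ?_
    linarith
  · have second : ∀ k : ℕ, ∑ n ∈ Finset.Ioc 0 (m+k), gam δ (n:ℤ) ≤
        1/π * (1 + Real.log (1/δ)) + 1/(π^2*δ) * (1/m - 1/((m+k:ℕ):ℝ)) := by
      intro k
      induction k with
      | zero => simpa using first m le_rfl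
      | succ k ih =>
        rw [← Nat.add_assoc, Finset.sum_Ioc_succ_top (by omega)]
        have h1 : gam δ ((m+k+1:ℕ):ℤ) ≤ 1/(π^2*δ) * (1/((m+k:ℕ):ℝ) - 1/((m+k+1:ℕ):ℝ)) := by
          rw [gam_nat (by omega)]
          refine (min_le_right _ _).trans ?_
          rw [show 1/(π^2*δ*((m+k+1:ℕ):ℝ)^2) = 1/(π^2*δ) * (1/((m+k+1:ℕ):ℝ)^2) by field_simp]
          gcongr
          have : (0:ℝ) < ((m+k:ℕ):ℝ) := by exact_mod_cast (by omega : 0 < m + k)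
          push_cast at this ⊢
          rw [div_sub_div _ _ (by positivity) (by positivity), div_le_div_iff₀ (by positivity) (by positivity)]
          nlinarith
        calc _ ≤ (1/π * (1 + Real.log (1/δ)) + 1/(π^2*δ) * (1/m - 1/((m+k:ℕ):ℝ)))
              + 1/(π^2*δ) * (1/((m+k:ℕ):ℝ) - 1/((m+k+1:ℕ):ℝ)) := add_le_add ih h1
          _ = _ := by ring
    have h2 := second (N - m)
    rw [Nat.add_sub_cancel' h] at h2
    refine h2.trans ?_
    have h3 : 1/(π^2*δ) * (1/m - 1/(N:ℝ)) ≤ 1/π := by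
      calc 1/(π^2*δ) * (1/m - 1/(N:ℝ)) ≤ 1/(π^2*δ) * (1/m) := by
            gcongr
            have : (0:ℝ) ≤ 1/N := by positivity
            linarith
        _ ≤ 1/π := by
            rw [div_mul_div_comm, div_le_div_iff₀ (by positivity) (by positivity)]
            have : 1 ≤ δ * (m+1) := by
              have := mul_le_mul_of_nonneg_left hmT2.le hδ.le
              rwa [mul_one_div_cancel hδ.ne'] at this
            have h4 : (1:ℝ) ≤ m := by exact_mod_cast hm1
            have h5 : 1 ≤ π * (δ * m) := by
              have := Real.pi_gt_three
              nlinarith [mul_pos hδ hmp]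
            nlinarith
    have : 1/π * (Real.log (1/δ) + 2) = 1/π * (1 + Real.log (1/δ)) + 1/π := by ring
    linarith

lemma abel {f g : ℕ → ℝ} {a b : ℝ} (hf : ∀ n, 0 ≤ f n) (hg : ∀ n, 0 ≤ g n)
    (hga : ∀ n, 1 ≤ n → g (n+1) ≤ g n) (K N : ℕ) (hKN : K < N)
    (hD : ∀ n, 1 ≤ n → ∑ j ∈ Finset.Ioc 0 n, f j ≤ a + b * n) :
    ∑ n ∈ Finset.Ioc K N, g n * f n ≤ g (K+1) * (a + b * K) + b * ∑ n ∈ Finset.Ioc K N, g n := by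
  have main : ∀ j : ℕ, ∑ n ∈ Finset.Ioc K (K+1+j), g n * f n ≤
      g (K+1) * (a + b * K) + b * ∑ n ∈ Finset.Ioc K (K+1+j), g n
      - g (K+1+j) * (a + b * ((K+1+j:ℕ):ℝ) - ∑ i ∈ Finset.Ioc 0 (K+1+j), f i) := by
    intro j
    induction j with
    | zero =>
      simp only [Nat.add_zero]
      rw [Finset.sum_Ioc_succ_top (by omega), Finset.sum_Ioc_succ_top (by omega), Finset.sum_Ioc_succ_top (by omega)]
      simp only [Finset.Ioc_self, Finset.sum_empty, zero_add]
      have h1 : 0 ≤ ∑ i ∈ Finset.Ioc 0 K, f i := Finset.sum_nonneg fun i _ => hf i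
      have h2 := mul_nonneg (hg (K+1)) h1
      push_cast
      nlinarith
    | succ j ih =>
      rw [← Nat.add_assoc, Finset.sum_Ioc_succ_top (by omega), Finset.sum_Ioc_succ_top (a := K) (b := K+1+j) (by omega), Finset.sum_Ioc_succ_top (a := 0) (b := K+1+j) (by omega)]
      have h1 := hD (K+1+j) (by omega)
      have h2 := hga (K+1+j) (by omega)
      have h3 := mul_le_mul_of_nonneg_right h2 (sub_nonneg.2 h1)
      push_cast at *
      nlinarith
  have h := main (N - (K+1))
  rw [show K + 1 + (N - (K+1)) = N by omega] at h
  have h1 := mul_nonneg (hg N) (sub_nonneg.2 (hD N (by omega)))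
  linarith

noncomputable def Lx (x : ℝ) : ℝ := 2 * Real.log (4 * x)
noncomputable def dx (x : ℝ) : ℝ := 1 / (2 * x * Lx x)
noncomputable def lam (x : ℝ) : ℝ := Real.log (2 * x * Lx x) + 3
noncomputable def ep (x : ℝ) (K : ℕ) : ℝ := 36/25 * Lx x / (π * (K+1))
noncomputable def c1 (x : ℝ) : ℝ := 1 + 36/25 * Lx x / π
noncomputable def kp (x : ℝ) : ℝ := 36/25 * lam x
noncomputable def c2 (x : ℝ) : ℝ := 1 + kp x

lemma Lx_gt {x : ℝ} (hx : 1 ≤ x) : 2 < Lx x := by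
  unfold Lx
  have h1 : Real.log 4 ≤ Real.log (4*x) := Real.log_le_log (by norm_num) (by linarith)
  have h2 : Real.log 4 = 2 * Real.log 2 := by
    rw [show (4:ℝ) = 2^2 by norm_num, Real.log_pow]; norm_num
  have := Real.log_two_gt_d9
  linarith

lemma dx_pos {x : ℝ} (hx : 1 ≤ x) : 0 < dx x := by
  have := Lx_gt hx
  unfold dx; positivity

lemma dx_le {x : ℝ} (hx : 1 ≤ x) : dx x ≤ 1/2 := by
  have := Lx_gt hx
  unfold dx
  apply div_le_div_of_nonneg_left (by norm_num) (by norm_num)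
  nlinarith

lemma lam_ge {x : ℝ} (hx : 1 ≤ x) : 3 ≤ lam x := by
  have := Lx_gt hx
  unfold lam
  have : 0 ≤ Real.log (2 * x * Lx x) := Real.log_nonneg (by nlinarith)
  linarith

lemma ep_nonneg {x : ℝ} (hx : 1 ≤ x) (K : ℕ) : 0 ≤ ep x K := by
  have := Lx_gt hx
  unfold ep; positivity

lemma kp_nonneg {x : ℝ} (hx : 1 ≤ x) : 0 ≤ kp x := by
  have := lam_ge hx
  unfold kp; positivity

lemma c1_ge {x : ℝ} (hx : 1 ≤ x) : 1 ≤ c1 x := by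
  have := Lx_gt hx
  unfold c1
  have : 0 ≤ 36/25 * Lx x / π := by positivity
  linarith

lemma c2_ge {x : ℝ} (hx : 1 ≤ x) : 1 ≤ c2 x := by
  have := kp_nonneg hx
  unfold c2
  linarith

namespace Fam
variable {ι : Type} (F : Fam ι)

/-- energy at frequency k -/
noncomputable def En (x : ℝ) (S : Finset ℕ) (a : ℕ → ℂ) (k : ℤ) : ℝ :=
  ∑ i ∈ F.s, F.w i * ‖F.A S a (fr (Lx x) k) i‖^2

lemma En_nonneg (x : ℝ) (S : Finset ℕ) (a : ℕ → ℂ) (k : ℤ) : 0 ≤ F.En x S a k :=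
  Finset.sum_nonneg fun i hi => mul_nonneg (F.hw i hi) (by positivity)

lemma En_high {x : ℝ} (hx : 1 ≤ x) (S : Finset ℕ) (a : ℕ → ℂ) (M : ℕ) (hS : S ⊆ Finset.Icc 1 M)
    (hM : (M:ℝ) ≤ 4 * x) (K N : ℕ) :
    ∑ n ∈ Finset.Ioc K N, gam (dx x) n * (F.En x S a n + F.En x S a (-n))
      ≤ (ep x K * M + kp x * (F.Z + 1)) * nn S a := by
  have hL := Lx_gt hx
  have hd := dx_pos hx
  have hpi := Real.pi_pos
  have hnn := nn_nonneg S a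
  have hZ := F.hZ
  rcases le_or_gt N K with h | h
  · rw [Finset.Ioc_eq_empty (by omega), Finset.sum_empty]
    have := ep_nonneg hx K
    have := kp_nonneg hx
    positivity
  have hMl : Real.log M ≤ Lx x / 2 := by
    unfold Lx
    rcases Nat.eq_zero_or_pos M with h0 | h0
    · subst h0; simp; apply Real.log_nonneg; linarith
    · rw [mul_div_cancel_left₀ _ (by norm_num)]
      exact Real.log_le_log (by exact_mod_cast h0) hM
  have hab := abel (f := fun n : ℕ => F.En x S a n + F.En x S a (-n)) (g := fun n : ℕ => gam (dx x) n)
    (a := 36/25 * (Lx x * M) * nn S a) (b := 36/25 * (π * (F.Z + 1)) * nn S a)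
    (fun n => add_nonneg (F.En_nonneg ..) (F.En_nonneg ..)) (fun n => gam_nonneg hd.le _)
    (fun n hn => gam_anti hd hn) K N h (by
      intro n hn
      have h1 := F.hyb (by linarith : 0 < Lx x) S a M hS hMl n hn
      rw [sum_symm] at h1
      have h2 : ∑ j ∈ Finset.Ioc 0 n, (F.En x S a (j:ℤ) + F.En x S a (-(j:ℤ)))
        = ∑ j ∈ Finset.range n, (F.En x S a ((j:ℤ)+1) + F.En x S a (-((j:ℤ)+1))) := by
        rw [ioc_ico, Finset.sum_Ico_eq_sum_range]
        refine Finset.sum_congr (by simp) fun j _ => ?_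
        push_cast
        rw [add_comm (1:ℤ)]
      rw [h2]
      have h3 := F.En_nonneg x S a 0
      unfold En at h3 ⊢
      calc _ ≤ _ := le_trans (le_add_of_nonneg_left h3) h1
        _ = _ := by ring)
  refine hab.trans ?_
  have hg1 : gam (dx x) ((K+1:ℕ):ℤ) ≤ 1/(π*(K+1)) := by
    rw [gam_nat (by omega)]
    refine (min_le_left _ _).trans ?_
    push_cast; rfl
  have hg2 : ∑ n ∈ Finset.Ioc K N, gam (dx x) (n:ℤ) ≤ 1/π * (lam x - 1) := by
    refine le_trans ?_ ((gam_sum hd (dx_le hx) N).trans (le_of_eq ?_))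
    · apply Finset.sum_le_sum_of_subset_of_nonneg
      · exact Finset.Ioc_subset_Ioc_left (by omega)
      · intro i _ _; exact gam_nonneg hd.le _
    · unfold lam dx; rw [one_div_one_div]; ring
  calc _ ≤ 1/(π*(K+1)) * (36/25 * (Lx x * M) * nn S a + 36/25 * (π * (F.Z + 1)) * nn S a * K)
        + 36/25 * (π * (F.Z + 1)) * nn S a * (1/π * (lam x - 1)) := by
        gcongr
    _ = (ep x K * M + (36/25 * (K/(K+1)) + 36/25 * (lam x - 1)) * (F.Z+1)) * nn S a := by
        unfold ep; field_simp; ring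
    _ ≤ _ := by
        gcongr
        unfold kp
        have : (K:ℝ)/(K+1) ≤ 1 := by rw [div_le_one (by positivity)]; linarith
        linarith

lemma sum_gam_symm (δ : ℝ) (f : ℤ → ℝ) (N : ℕ) :
    ∑ k ∈ Finset.Icc (-(N:ℤ)) N, gam δ k * f k
      = f 0 + ∑ n ∈ Finset.Ioc 0 N, gam δ n * (f n + f (-n)) := by
  rw [sum_symm, gam_zero, one_mul]
  congr 1
  rw [ioc_ico, Finset.sum_Ico_eq_sum_range]
  refine Finset.sum_congr (by simp) fun j _ => ?_
  rw [gam_neg]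
  push_cast
  rw [add_comm (1:ℤ)]
  simp
  ring

lemma En_all {x : ℝ} (hx : 1 ≤ x) (S : Finset ℕ) (a : ℕ → ℂ) (M : ℕ) (hS : S ⊆ Finset.Icc 1 M)
    (hM : (M:ℝ) ≤ 4 * x) (N : ℕ) :
    ∑ k ∈ Finset.Icc (-(N:ℤ)) N, gam (dx x) k * F.En x S a k
      ≤ (c1 x * M + c2 x * (F.Z + 1)) * nn S a := by
  rw [sum_gam_symm]
  have h1 := F.En_high hx S a M hS hM 0 N
  have h2 : F.En x S a 0 ≤ _ := F.LSt S a M hS (fr (Lx x) 0)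
  have hnn := nn_nonneg S a
  have h3 : ep x 0 = c1 x - 1 := by unfold ep c1; simp
  rw [h3] at h1
  unfold c2
  nlinarith

/-- separation of variables for the family -/
lemma sepsum {κ : Type} {x : ℝ} (hx : 1 ≤ x) (J : Finset κ) (m : κ → ℕ) (c : ι → κ → ℂ)
    (hm : ∀ j ∈ J, 1 ≤ m j ∧ (m j : ℝ) ≤ 4 * x) (Y : ι → ℕ) (hY : ∀ i ∈ F.s, (Y i : ℝ) ≤ x) (B : ℝ)
    (hB : ∀ N : ℕ, ∑ k ∈ Finset.Icc (-(N:ℤ)) N, gam (dx x) k *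
      ∑ i ∈ F.s, F.w i * ‖∑ j ∈ J, c i j * tw (fr (Lx x) k) (m j)‖ ≤ B) :
    ∑ i ∈ F.s, F.w i * ‖∑ j ∈ J with m j ≤ Y i, c i j‖ ≤ B := by
  have hL := Lx_gt hx
  have hd := dx_pos hx
  have hsep : ∀ i ∈ F.s, ∃ d : ℤ → ℂ, (∀ k, ‖d k‖ ≤ gam (dx x) k) ∧
      Filter.Tendsto (fun N : ℕ => ∑ k ∈ Finset.Icc (-(N:ℤ)) N, d k * ∑ j ∈ J, c i j * tw (fr (Lx x) k) (m j))
      Filter.atTop (nhds (∑ j ∈ J with m j ≤ Y i, c i j)) := by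
    intro i hi
    rcases Nat.eq_zero_or_pos (Y i) with h0 | h0
    · refine ⟨0, fun k => by simpa using gam_nonneg hd.le k, ?_⟩
      have : J.filter (fun j => m j ≤ Y i) = ∅ := by
        rw [Finset.filter_eq_empty_iff]
        intro j hj
        have := (hm j hj).1
        omega
      rw [this]
      simp
    · have hYx := hY i hi
      obtain ⟨d, hd1, hd2⟩ := sep_nat (L := Lx x) (by linarith) hd (dx_le hx) (Y := Y i) h0 (by
        unfold Lx
        rw [mul_div_cancel_left₀ _ (by norm_num)]
        exact Real.log_le_log (by exact_mod_cast h0) (by linarith)) (by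
        unfold dx
        rw [div_mul_eq_mul_div, div_mul_eq_mul_div, div_le_one (by positivity)]
        nlinarith)
      refine ⟨d, hd1, ?_⟩
      have h1 : Filter.Tendsto (fun N : ℕ => ∑ j ∈ J, c i j * ∑ k ∈ Finset.Icc (-(N:ℤ)) N, d k * tw (fr (Lx x) k) (m j))
          Filter.atTop (nhds (∑ j ∈ J, c i j * (if m j ≤ Y i then 1 else 0))) := by
        apply tendsto_finsetSum
        intro j hj
        apply Filter.Tendsto.const_mul
        apply hd2 _ (hm j hj).1
        unfold Lx
        rw [mul_div_cancel_left₀ _ (by norm_num)]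
        exact Real.log_le_log (by exact_mod_cast (hm j hj).1) (hm j hj).2
      convert h1 using 1
      · funext N
        simp_rw [Finset.mul_sum]
        rw [Finset.sum_comm]
        refine Finset.sum_congr rfl fun j _ => Finset.sum_congr rfl fun k _ => by ring
      · rw [Finset.sum_filter]
        simp
  choose! d hd1 hd2 using hsep
  have hlim : Filter.Tendsto (fun N : ℕ => ∑ i ∈ F.s, F.w i * ‖∑ k ∈ Finset.Icc (-(N:ℤ)) N, d i k * ∑ j ∈ J, c i j * tw (fr (Lx x) k) (m j)‖)
      Filter.atTop (nhds (∑ i ∈ F.s, F.w i * ‖∑ j ∈ J with m j ≤ Y i, c i j‖)) := by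
    apply tendsto_finsetSum
    intro i hi
    exact ((hd2 i hi).norm).const_mul _
  refine le_of_tendsto' hlim fun N => ?_
  refine le_trans ?_ (hB N)
  simp_rw [Finset.mul_sum]
  rw [Finset.sum_comm (s := Finset.Icc (-(N:ℤ)) N)]
  refine Finset.sum_le_sum fun i hi => ?_
  simp_rw [← Finset.mul_sum]
  calc F.w i * ‖∑ k ∈ Finset.Icc (-(N:ℤ)) N, d i k * ∑ j ∈ J, c i j * tw (fr (Lx x) k) (m j)‖
      ≤ F.w i * ∑ k ∈ Finset.Icc (-(N:ℤ)) N, gam (dx x) k * ‖∑ j ∈ J, c i j * tw (fr (Lx x) k) (m j)‖ := by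
        apply mul_le_mul_of_nonneg_left _ (F.hw i hi)
        refine (norm_sum_le _ _).trans (Finset.sum_le_sum fun k _ => ?_)
        rw [norm_mul]
        gcongr
        exact hd1 i hi k
    _ = _ := by
        rw [Finset.mul_sum]
        refine Finset.sum_congr rfl fun k _ => by ring

lemma prod_poly {i : ι} (hi : i ∈ F.s) (S T : Finset ℕ) (hS : ∀ m ∈ S, m ≠ 0) (hT : ∀ m ∈ T, m ≠ 0) (a b : ℕ → ℂ) (t : ℝ) :
    ∑ p ∈ S ×ˢ T, a p.1 * b p.2 * F.χ i (p.1 * p.2) * tw t (p.1 * p.2) = F.A S a t i * F.A T b t i := by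
  unfold A
  rw [Finset.sum_mul_sum, Finset.sum_product]
  refine Finset.sum_congr rfl fun m hm => Finset.sum_congr rfl fun n hn => ?_
  rw [tw_mul _ (hS m hm) (hT n hn), F.hmul i hi]
  ring

/-- Cauchy-Schwarz for weighted double sums -/
lemma cs_gam (x : ℝ) (hx : 1 ≤ x) (S T : Finset ℕ) (a b : ℕ → ℂ) (s : Finset ℤ) {U V : ℝ}
    (hU : ∑ k ∈ s, gam (dx x) k * F.En x S a k ≤ U)
    (hV : ∑ k ∈ s, gam (dx x) k * F.En x T b k ≤ V) :
    ∑ k ∈ s, gam (dx x) k * ∑ i ∈ F.s, F.w i * (‖F.A S a (fr (Lx x) k) i‖ * ‖F.A T b (fr (Lx x) k) i‖)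
      ≤ Real.sqrt U * Real.sqrt V := by
  have hd := dx_pos hx
  simp only [En, Finset.mul_sum] at hU hV ⊢
  rw [← Finset.sum_product'] at hU hV ⊢
  have hg : ∀ p ∈ s ×ˢ F.s, 0 ≤ gam (dx x) p.1 * F.w p.2 := fun p hp =>
    mul_nonneg (gam_nonneg hd.le _) (F.hw _ (Finset.mem_product.1 hp).2)
  have := Real.sum_sqrt_mul_sqrt_le (s ×ˢ F.s)
    (f := fun p => gam (dx x) p.1 * (F.w p.2 * ‖F.A S a (fr (Lx x) p.1) p.2‖^2) ⊔ 0)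
    (g := fun p => gam (dx x) p.1 * (F.w p.2 * ‖F.A T b (fr (Lx x) p.1) p.2‖^2) ⊔ 0)
    (fun p => le_max_right _ _) (fun p => le_max_right _ _)
  refine le_trans (le_trans (le_of_eq ?_) this) ?_
  · refine Finset.sum_congr rfl fun p hp => ?_
    have h1 := hg p hp
    have h2 : 0 ≤ gam (dx x) p.1 * (F.w p.2 * ‖F.A S a (fr (Lx x) p.1) p.2‖^2) := by
      rw [← mul_assoc]; positivity
    have h3 : 0 ≤ gam (dx x) p.1 * (F.w p.2 * ‖F.A T b (fr (Lx x) p.1) p.2‖^2) := by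
      rw [← mul_assoc]; positivity
    rw [max_eq_left h2, max_eq_left h3, ← Real.sqrt_mul h2]
    rw [show gam (dx x) p.1 * (F.w p.2 * ‖F.A S a (fr (Lx x) p.1) p.2‖^2) * (gam (dx x) p.1 * (F.w p.2 * ‖F.A T b (fr (Lx x) p.1) p.2‖^2))
      = (gam (dx x) p.1 * F.w p.2 * (‖F.A S a (fr (Lx x) p.1) p.2‖ * ‖F.A T b (fr (Lx x) p.1) p.2‖))^2 by ring]
    rw [Real.sqrt_sq (mul_nonneg h1 (by positivity))]
    ring
  · apply mul_le_mul _ _ (Real.sqrt_nonneg _) (Real.sqrt_nonneg _)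
    · apply Real.sqrt_le_sqrt
      refine le_trans (le_of_eq ?_) hU
      refine Finset.sum_congr rfl fun p hp => max_eq_left ?_
      have h1 := hg p hp
      rw [← mul_assoc]; positivity
    · apply Real.sqrt_le_sqrt
      refine le_trans (le_of_eq ?_) hV
      refine Finset.sum_congr rfl fun p hp => max_eq_left ?_
      have h1 := hg p hp
      rw [← mul_assoc]; positivity

/-- bilinear estimate -/
lemma T2 {x : ℝ} (hx : 1 ≤ x) (S T : Finset ℕ) (a b : ℕ → ℂ) (M N : ℕ) (hS : S ⊆ Finset.Icc 1 M)
    (hT : T ⊆ Finset.Icc 1 N) (hM : 1 ≤ M) (hN : 1 ≤ N) (hMN : (M:ℝ) * N ≤ 4 * x) (Y : ι → ℕ)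
    (hY : ∀ i ∈ F.s, (Y i : ℝ) ≤ x) :
    ∑ i ∈ F.s, F.w i * ‖∑ p ∈ (S ×ˢ T).filter (fun p => p.1 * p.2 ≤ Y i), a p.1 * b p.2 * F.χ i (p.1 * p.2)‖
      ≤ Real.sqrt ((c1 x * M + c2 x * (F.Z + 1)) * nn S a) *
        Real.sqrt ((c1 x * N + c2 x * (F.Z + 1)) * nn T b) := by
  have hM' : (1:ℝ) ≤ M := by exact_mod_cast hM
  have hN' : (1:ℝ) ≤ N := by exact_mod_cast hN
  have hS0 : ∀ m ∈ S, m ≠ 0 := fun m hm => by have := Finset.mem_Icc.1 (hS hm); omega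
  have hT0 : ∀ m ∈ T, m ≠ 0 := fun m hm => by have := Finset.mem_Icc.1 (hT hm); omega
  refine F.sepsum hx (S ×ˢ T) (fun p => p.1 * p.2) (fun i p => a p.1 * b p.2 * F.χ i (p.1 * p.2)) ?_ Y hY _ ?_
  · intro p hp
    obtain ⟨h1, h2⟩ := Finset.mem_product.1 hp
    have h3 := Finset.mem_Icc.1 (hS h1)
    have h4 := Finset.mem_Icc.1 (hT h2)
    refine ⟨Nat.mul_pos h3.1 h4.1, le_trans ?_ hMN⟩
    exact_mod_cast Nat.mul_le_mul h3.2 h4.2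
  · intro K
    refine le_trans (le_of_eq ?_) (F.cs_gam x hx S T a b (Finset.Icc (-(K:ℤ)) K)
      (F.En_all hx S a M hS (by nlinarith) K) (F.En_all hx T b N hT (by nlinarith) K))
    refine Finset.sum_congr rfl fun k _ => ?_
    congr 1
    refine Finset.sum_congr rfl fun i hi => ?_
    rw [F.prod_poly hi S T hS0 hT0, norm_mul]

end Fam
end BV

namespace BV

/-- additive character e(x) -/
noncomputable def ee (x : ℝ) : ℂ := Complex.exp (((2 * π * x : ℝ) : ℂ) * Complex.I)

lemma ee_norm (x : ℝ) : ‖ee x‖ = 1 := Complex.norm_exp_ofReal_mul_I _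
lemma ee_add (x y : ℝ) : ee (x + y) = ee x * ee y := by
  unfold ee; rw [← Complex.exp_add]; congr 1; push_cast; ring
lemma ee_int (k : ℤ) : ee k = 1 := by
  unfold ee
  rw [Complex.exp_eq_one_iff]
  exact ⟨k, by push_cast; ring⟩
lemma ee_zero : ee 0 = 1 := by simpa using ee_int 0
lemma ee_conj (x : ℝ) : (starRingEnd ℂ) (ee x) = ee (-x) := by
  unfold ee
  rw [← Complex.exp_conj]
  congr 1
  rw [map_mul, Complex.conj_ofReal, Complex.conj_I]
  push_cast; ring

/-- distance to the nearest integer -/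
noncomputable def di (x : ℝ) : ℝ := |x - round x|

lemma di_nonneg (x : ℝ) : 0 ≤ di x := abs_nonneg _
lemma di_half (x : ℝ) : di x ≤ 1/2 := abs_sub_round x

lemma ee_sub_one (x : ℝ) : 4 * di x ≤ ‖ee x - 1‖ := by
  have h1 : ee x = ee (x - round x) := by
    conv_lhs => rw [show x = (x - round x) + ((round x : ℤ) : ℝ) by ring, ee_add, ee_int, mul_one]
  rw [h1]
  unfold di
  have hy := di_half x
  unfold di at hy
  set y := x - round x
  unfold ee
  rw [mul_comm (((2*π*y:ℝ)):ℂ) Complex.I, Complex.norm_exp_I_mul_ofReal_sub_one, norm_mul, Real.norm_eq_abs, Real.norm_eq_abs,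
    show 2 * π * y / 2 = π * y by ring]
  have hpi := Real.pi_pos
  have h2 : |Real.sin (π * y)| = Real.sin (π * |y|) := by
    rcases abs_choice y with h | h
    · rw [h, abs_of_nonneg]
      rw [← h]
      apply Real.sin_nonneg_of_nonneg_of_le_pi (by positivity)
      nlinarith
    · rw [show π * y = -(π * |y|) by rw [h]; ring, Real.sin_neg, abs_neg, abs_of_nonneg]
      apply Real.sin_nonneg_of_nonneg_of_le_pi (by positivity)
      nlinarith
  rw [h2]
  have h3 := Real.mul_le_sin (x := π * |y|) (by positivity) (by nlinarith)
  have h4 : 2 / π * (π * |y|) = 2 * |y| := by field_simp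
  rw [h4] at h3
  norm_num
  linarith

lemma geom_bound (β : ℝ) (hβ : 0 < di β) (M N : ℕ) :
    ‖∑ u ∈ Finset.Ico M N, ee (u * β)‖ ≤ 1 / (2 * di β) := by
  rcases le_or_gt N M with h | h
  · rw [Finset.Ico_eq_empty (by omega)]; simp; positivity
  have e : ∀ u : ℕ, ee (u * β) = (ee β)^u := by
    intro u
    induction u with
    | zero => simp [ee_zero]
    | succ u ih => rw [pow_succ, ← ih, ← ee_add]; congr 1; push_cast; ring
  simp_rw [e]
  have h1 := ee_sub_one β
  have hne : ee β ≠ 1 := by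
    intro h; rw [h] at h1; simp at h1; linarith
  rw [geom_sum_Ico hne h.le, norm_div]
  rw [div_le_div_iff₀ (by linarith) (by positivity)]
  have h2 : ‖ee β ^ N - ee β ^ M‖ ≤ 2 := by
    refine (norm_sub_le _ _).trans ?_
    simp [ee_norm]; norm_num
  nlinarith [norm_nonneg (ee β ^ N - ee β ^ M)]

lemma geom_bound_neg (β : ℝ) (hβ : 0 < di β) (M N : ℕ) :
    ‖∑ u ∈ Finset.Ico M N, ee (-(u * β))‖ ≤ 1 / (2 * di β) := by
  have := geom_bound β hβ M N
  rw [← RCLike.norm_conj, map_sum] at this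
  simpa only [ee_conj] using this

/-- spacing sum -/
lemma spacing {κ : Type*} [DecidableEq κ] (I : Finset κ) (α : κ → ℝ) {δ : ℝ} (hδ : 0 < δ)
    (hsp : ∀ i ∈ I, ∀ j ∈ I, i ≠ j → ∀ k : ℤ, δ ≤ |α i - α j - k|) (i : κ) (hi : i ∈ I) :
    ∑ j ∈ I.erase i, 1 / (di (α i - α j))^2 ≤ π^2 / 3 / δ^2 := by
  set s : κ → ℝ := fun j => (α i - α j) - round (α i - α j) with hs
  have hs1 : ∀ j ∈ I.erase i, δ ≤ |s j| := by
    intro j hj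
    rw [Finset.mem_erase] at hj
    exact hsp i hi j hj.2 hj.1.symm _
  set f : κ → ℤ := fun j => if 0 ≤ s j then ⌊s j / δ⌋ else -⌊-s j / δ⌋ with hf
  have hf1 : ∀ j ∈ I.erase i, (1:ℤ) ≤ |f j| ∧ |(f j:ℝ)| * δ ≤ |s j| := by
    intro j hj
    have h1 := hs1 j hj
    have key : ∀ y : ℝ, δ ≤ y → 1 ≤ ⌊y/δ⌋ ∧ (⌊y/δ⌋:ℝ) * δ ≤ y := by
      intro y hy
      refine ⟨Int.le_floor.2 (by push_cast; rw [le_div_iff₀ hδ]; linarith), ?_⟩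
      rw [← le_div_iff₀ hδ]; exact Int.floor_le _
    by_cases h0 : 0 ≤ s j
    · rw [abs_of_nonneg h0] at h1
      obtain ⟨k1, k2⟩ := key _ h1
      simp only [hf, if_pos h0]
      rw [abs_of_nonneg (by linarith), abs_of_nonneg (by exact_mod_cast (by linarith : 0 ≤ ⌊s j/δ⌋)), abs_of_nonneg h0]
      exact ⟨k1, k2⟩
    · rw [abs_of_neg (by linarith)] at h1
      obtain ⟨k1, k2⟩ := key _ h1
      simp only [hf, if_neg h0]
      rw [abs_neg, Int.cast_neg, abs_neg, abs_of_nonneg (by linarith), abs_of_nonneg (by exact_mod_cast (by linarith : 0 ≤ ⌊-s j/δ⌋)), abs_of_neg (by linarith : s j < 0)]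
      exact ⟨k1, k2⟩
  have hinj : Set.InjOn f (I.erase i : Finset κ) := by
    intro j hj k hk hjk
    have hj' := Finset.mem_coe.1 hj
    have hk' := Finset.mem_coe.1 hk
    by_contra hne
    have hjI := (Finset.mem_erase.1 hj').2
    have hkI := (Finset.mem_erase.1 hk').2
    have h1 := hsp k hkI j hjI (Ne.symm hne) (round (α i - α j) - round (α i - α k))
    have h2 : α k - α j - ((round (α i - α j) - round (α i - α k) : ℤ):ℝ) = s j - s k := by
      simp only [hs]; push_cast; ring
    rw [h2] at h1
    have hlt : |s j - s k| < δ := by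
      obtain ⟨a1, a2⟩ := hf1 j hj'
      obtain ⟨b1, b2⟩ := hf1 k hk'
      have fl : ∀ y : ℝ, (⌊y/δ⌋:ℝ) * δ ≤ y ∧ y < ((⌊y/δ⌋:ℝ) + 1) * δ := by
        intro y
        refine ⟨?_, ?_⟩
        · rw [← le_div_iff₀ hδ]; exact Int.floor_le _
        · rw [← div_lt_iff₀ hδ]; exact Int.lt_floor_add_one _
      have pos : ∀ y : ℝ, 0 < y → 0 ≤ ⌊y/δ⌋ := fun y hy => Int.floor_nonneg.2 (by positivity)
      by_cases p : 0 ≤ s j <;> by_cases q : 0 ≤ s k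
      · simp only [hf, if_pos p, if_pos q] at hjk
        have u := fl (s j); have v := fl (s k)
        rw [hjk] at u
        rw [abs_lt]; constructor <;> nlinarith
      · exfalso
        simp only [hf, if_pos p, if_neg q] at hjk a1 b1
        have u := Int.floor_nonneg.2 (by positivity : 0 ≤ s j / δ)
        have v := pos (-s k) (by linarith)
        have : ⌊s j/δ⌋ = 0 := by omega
        rw [this] at a1; simp at a1
      · exfalso
        simp only [hf, if_neg p, if_pos q] at hjk a1 b1
        have u := Int.floor_nonneg.2 (by positivity : 0 ≤ s k / δ)
        have v := pos (-s j) (by linarith)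
        have : ⌊s k/δ⌋ = 0 := by omega
        rw [this] at b1; simp at b1
      · simp only [hf, if_neg p, if_neg q, neg_inj] at hjk
        have u := fl (-s j); have v := fl (-s k)
        rw [hjk] at u
        rw [abs_lt]; constructor <;> nlinarith
    linarith
  have hsum : HasSum (fun n : ℤ => 1 / (n:ℝ)^2) (π^2/6 + π^2/6) := by
    have h1 : HasSum (fun n : ℕ => 1 / (((n:ℤ):ℝ))^2) (π^2/6) := by
      simpa using hasSum_zeta_two
    have h2 : HasSum (fun n : ℕ => 1 / (((-(n:ℤ) : ℤ):ℝ))^2) (π^2/6) := by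
      simpa using hasSum_zeta_two
    have := HasSum.of_nat_of_neg_add_one (f := fun n : ℤ => 1 / (n:ℝ)^2) (m := π^2/6) (m' := π^2/6) h1 (by
      have h3 := (hasSum_nat_add_iff' (f := fun n : ℕ => 1/((n:ℝ))^2) 1).2 hasSum_zeta_two
      simp only [Finset.range_one, Finset.sum_singleton] at h3
      norm_num at h3
      have e : (fun n:ℕ => 1/(((-((n:ℤ)+1):ℤ)):ℝ)^2) = fun n:ℕ => (((n:ℝ)+1)^2)⁻¹ := by
        funext n; push_cast; rw [one_div]; congr 1; ring
      rw [e]; exact h3)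
    exact this
  have hle : ∑ n ∈ (I.erase i).image f, 1 / (n:ℝ)^2 ≤ π^2/6 + π^2/6 :=
    sum_le_hasSum _ (fun n _ => by positivity) hsum
  rw [Finset.sum_image hinj] at hle
  calc ∑ j ∈ I.erase i, 1 / (di (α i - α j))^2 ≤ ∑ j ∈ I.erase i, 1/δ^2 * (1 / (f j:ℝ)^2) := by
        refine Finset.sum_le_sum fun j hj => ?_
        obtain ⟨a1, a2⟩ := hf1 j hj
        have a3 : (1:ℝ) ≤ |(f j:ℝ)| := by exact_mod_cast a1
        rw [← sq_abs (f j : ℝ), one_div_mul_one_div, ← mul_pow]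
        apply one_div_le_one_div_of_le
        · positivity
        · gcongr
          rw [mul_comm]; exact a2
    _ = 1/δ^2 * ∑ j ∈ I.erase i, 1 / (f j:ℝ)^2 := by rw [Finset.mul_sum]
    _ ≤ 1/δ^2 * (π^2/6 + π^2/6) := by gcongr
    _ = _ := by ring

end BV

namespace BV

lemma di_neg (x : ℝ) : di (-x) = di x := by
  have key : ∀ y : ℝ, di (-y) ≤ di y := by
    intro y
    unfold di
    have := round_le (-y) (-(round y))
    refine this.trans (le_of_eq ?_)
    push_cast
    rw [← abs_neg]; congr 1; ring
  apply le_antisymm (key x)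
  simpa using key (-x)

lemma normsq_sum {κ : Type*} (I : Finset κ) (z : κ → ℂ) :
    ((‖∑ i ∈ I, z i‖^2 : ℝ) : ℂ) = ∑ i ∈ I, ∑ j ∈ I, z i * (starRingEnd ℂ) (z j) := by
  have := Complex.mul_conj' (∑ i ∈ I, z i)
  push_cast
  rw [← this, map_sum, Finset.sum_mul_sum]

set_option maxHeartbeats 1000000 in
/-- additive dual large sieve -/
lemma dualLS {κ : Type*} [DecidableEq κ] (I : Finset κ) (α : κ → ℝ) (H : ℕ) (hH : 1 ≤ H)
    (hsp : ∀ i ∈ I, ∀ j ∈ I, i ≠ j → ∀ k : ℤ, 1/(H:ℝ) ≤ |α i - α j - k|)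
    (c : κ → ℂ) (M N : ℕ) :
    ∑ n ∈ Finset.Ico M (M+N), ‖∑ i ∈ I, c i * ee (n * α i)‖^2
      ≤ (N + (H - 1) + π^2/12 * H) * ∑ i ∈ I, ‖c i‖^2 := by
  have hH0 : (0:ℝ) < H := by exact_mod_cast hH
  set d : κ → ℂ := fun i => c i * ee (M * α i) with hd
  have hdn : ∀ i, ‖d i‖ = ‖c i‖ := fun i => by simp [hd, ee_norm]
  set T : ℝ → ℂ := fun t => ∑ i ∈ I, d i * ee (t * α i) with hT
  have e1 : ∑ n ∈ Finset.Ico M (M+N), ‖∑ i ∈ I, c i * ee (n * α i)‖^2 = ∑ n ∈ Finset.range N, ‖T n‖^2 := by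
    rw [Finset.sum_Ico_eq_sum_range]
    rw [show M + N - M = N by omega]
    refine Finset.sum_congr rfl fun n _ => ?_
    congr 2
    simp only [hT, hd]
    refine Finset.sum_congr rfl fun i _ => ?_
    rw [mul_assoc, ← ee_add]; congr 2; push_cast; ring
  rw [e1]
  have e2 : ∀ v ∈ Finset.range H, ∑ n ∈ Finset.range N, ‖T n‖^2 ≤
      ∑ u ∈ Finset.range (N+H-1), ‖T ((u:ℝ) - v)‖^2 := by
    intro v hv
    rw [Finset.mem_range] at hv
    have : ∑ n ∈ Finset.range N, ‖T n‖^2 = ∑ u ∈ (Finset.range N).image (fun n => n + v), ‖T ((u:ℝ) - v)‖^2 := by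
      rw [Finset.sum_image (by intro a _ b _ h; simpa using h)]
      refine Finset.sum_congr rfl fun n _ => ?_
      push_cast; simp
    rw [this]
    apply Finset.sum_le_sum_of_subset_of_nonneg
    · intro u hu
      rw [Finset.mem_image] at hu
      obtain ⟨n, hn, rfl⟩ := hu
      rw [Finset.mem_range] at *
      omega
    · intros; positivity
  have e3 := Finset.sum_le_sum e2
  rw [Finset.sum_const, Finset.card_range, nsmul_eq_mul] at e3
  set Y : κ → κ → ℂ := fun i j => (∑ u ∈ Finset.range (N+H-1), ee (u * (α i - α j))) *
      (∑ v ∈ Finset.range H, ee (-(v * (α i - α j)))) with hY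
  have e4 : ((∑ v ∈ Finset.range H, ∑ u ∈ Finset.range (N+H-1), ‖T ((u:ℝ) - v)‖^2 : ℝ) : ℂ)
      = ∑ i ∈ I, ∑ j ∈ I, d i * (starRingEnd ℂ) (d j) * Y i j := by
    rw [Complex.ofReal_sum]
    simp_rw [Complex.ofReal_sum, hT, normsq_sum]
    calc ∑ v ∈ Finset.range H, ∑ u ∈ Finset.range (N+H-1), ∑ i ∈ I, ∑ j ∈ I,
          d i * ee (((u:ℝ) - v) * α i) * (starRingEnd ℂ) (d j * ee (((u:ℝ)-v) * α j))
        = ∑ v ∈ Finset.range H, ∑ i ∈ I, ∑ j ∈ I, ∑ u ∈ Finset.range (N+H-1),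
          d i * ee (((u:ℝ) - v) * α i) * (starRingEnd ℂ) (d j * ee (((u:ℝ)-v) * α j)) := by
          refine Finset.sum_congr rfl fun v _ => ?_
          rw [Finset.sum_comm]
          refine Finset.sum_congr rfl fun i _ => ?_
          rw [Finset.sum_comm]
      _ = ∑ i ∈ I, ∑ j ∈ I, ∑ v ∈ Finset.range H, ∑ u ∈ Finset.range (N+H-1),
          d i * ee (((u:ℝ) - v) * α i) * (starRingEnd ℂ) (d j * ee (((u:ℝ)-v) * α j)) := by
          rw [Finset.sum_comm]
          refine Finset.sum_congr rfl fun i _ => ?_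
          rw [Finset.sum_comm]
      _ = _ := by
          refine Finset.sum_congr rfl fun i _ => Finset.sum_congr rfl fun j _ => ?_
          simp only [hY]
          rw [mul_comm (∑ u ∈ Finset.range (N+H-1), _) _, Finset.sum_mul_sum, Finset.mul_sum]
          refine Finset.sum_congr rfl fun v _ => ?_
          rw [Finset.mul_sum]
          refine Finset.sum_congr rfl fun u _ => ?_
          rw [map_mul, ee_conj]
          have : ee (-(v * (α i - α j))) * ee (u * (α i - α j)) = ee (((u:ℝ) - v) * α i) * ee (-(((u:ℝ)-v) * α j)) := by
            rw [← ee_add, ← ee_add]; congr 1; ring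
          rw [this]; ring
  have hdi : ∀ i ∈ I, ∀ j ∈ I, i ≠ j → 0 < di (α i - α j) := by
    intro i hi j hj hij
    have := hsp i hi j hj hij (round (α i - α j))
    unfold di
    exact lt_of_lt_of_le (by positivity) this
  have hYo : ∀ i ∈ I, ∀ j ∈ I, i ≠ j → ‖Y i j‖ ≤ 1/(4 * (di (α i - α j))^2) := by
    intro i hi j hj hij
    have h0 := hdi i hi j hj hij
    have h1 := geom_bound _ h0 0 (N+H-1)
    have h2 := geom_bound_neg _ h0 0 H
    rw [← Finset.range_eq_Ico] at h1 h2
    simp only [hY, norm_mul]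
    calc _ ≤ 1 / (2 * di (α i - α j)) * (1 / (2 * di (α i - α j))) := by gcongr
      _ = _ := by field_simp; ring
  have hYd : ∀ i, ‖Y i i‖ ≤ ((N:ℝ)+(H-1)) * H := by
    intro i
    simp only [hY, sub_self, mul_zero, neg_zero, ee_zero]
    simp only [Finset.sum_const, Finset.card_range, nsmul_eq_mul, mul_one, norm_mul, Complex.norm_natCast]
    rw [Nat.add_sub_assoc hH]; push_cast [hH]; rfl
  have e5 : ∑ v ∈ Finset.range H, ∑ u ∈ Finset.range (N+H-1), ‖T ((u:ℝ) - v)‖^2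
      ≤ ∑ i ∈ I, (((N:ℝ)+(H-1)) * H * ‖c i‖^2 + ∑ j ∈ I.erase i, (‖c i‖^2+‖c j‖^2)/2 * (1/(4 * (di (α i - α j))^2))) := by
    have h1 : ∑ v ∈ Finset.range H, ∑ u ∈ Finset.range (N+H-1), ‖T ((u:ℝ) - v)‖^2
      = ‖∑ i ∈ I, ∑ j ∈ I, d i * (starRingEnd ℂ) (d j) * Y i j‖ := by
      rw [← e4, Complex.norm_real, Real.norm_eq_abs, abs_of_nonneg]
      exact Finset.sum_nonneg fun v _ => Finset.sum_nonneg fun u _ => sq_nonneg _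
    rw [h1]
    refine (norm_sum_le _ _).trans (Finset.sum_le_sum fun i hi => ?_)
    rw [← Finset.add_sum_erase _ _ hi]
    refine (norm_add_le _ _).trans (add_le_add ?_ ((norm_sum_le _ _).trans (Finset.sum_le_sum fun j hj => ?_)))
    · rw [norm_mul, norm_mul, RCLike.norm_conj, hdn]
      have := hYd i
      nlinarith [sq_nonneg ‖c i‖]
    · rw [norm_mul, norm_mul, RCLike.norm_conj, hdn, hdn]
      have hj' := Finset.mem_erase.1 hj
      have := hYo i hi j hj'.2 hj'.1.symm
      have h2 : ‖c i‖ * ‖c j‖ ≤ (‖c i‖^2+‖c j‖^2)/2 := by nlinarith [sq_nonneg (‖c i‖ - ‖c j‖)]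
      gcongr
  have e6 : ∑ i ∈ I, ∑ j ∈ I.erase i, (‖c i‖^2+‖c j‖^2)/2 * (1/(4 * (di (α i - α j))^2))
      = ∑ i ∈ I, ‖c i‖^2/4 * ∑ j ∈ I.erase i, 1/(di (α i - α j))^2 := by
    have s1 : ∑ i ∈ I, ∑ j ∈ I.erase i, ‖c j‖^2/2 * (1/(4 * (di (α i - α j))^2))
       = ∑ i ∈ I, ∑ j ∈ I.erase i, ‖c i‖^2/2 * (1/(4 * (di (α i - α j))^2)) := by
      rw [Finset.sum_comm' (t' := I) (s' := fun j => I.erase j) (by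
        intro a b; simp only [Finset.mem_erase]; tauto)]
      refine Finset.sum_congr rfl fun i _ => Finset.sum_congr rfl fun j _ => ?_
      rw [← di_neg, neg_sub]
    simp_rw [add_div, add_mul, Finset.sum_add_distrib]
    rw [s1, ← Finset.sum_add_distrib]
    refine Finset.sum_congr rfl fun i _ => ?_
    rw [← Finset.sum_add_distrib, Finset.mul_sum]
    refine Finset.sum_congr rfl fun j _ => ?_
    rw [mul_comm (4:ℝ), ← div_div]; ring
  have e7 : ∑ i ∈ I, ‖c i‖^2/4 * ∑ j ∈ I.erase i, 1/(di (α i - α j))^2 ≤ ∑ i ∈ I, ‖c i‖^2/4 * (π^2/3*H^2) := by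
    refine Finset.sum_le_sum fun i hi => ?_
    have := spacing I α (δ := 1/(H:ℝ)) (by positivity) hsp i hi
    have h2 : π^2/3/(1/(H:ℝ))^2 = π^2/3*H^2 := by field_simp
    rw [h2] at this
    gcongr
  rw [Finset.sum_add_distrib, e6, ← Finset.mul_sum] at e5
  rw [← Finset.sum_mul, ← Finset.sum_div] at e7
  have e8 : (H:ℝ) * ∑ n ∈ Finset.range N, ‖T n‖^2 ≤ H * ((N + (H - 1) + π^2/12 * H) * ∑ i ∈ I, ‖c i‖^2) := by
    calc _ ≤ _ := e3
      _ ≤ _ := e5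
      _ ≤ _ := by
        have : (H:ℝ) * ((N + (H - 1) + π^2/12 * H) * ∑ i ∈ I, ‖c i‖^2) =
          (N + (H-1)) * H * ∑ i ∈ I, ‖c i‖^2 + (∑ i ∈ I, ‖c i‖^2)/4 * (π^2/3*H^2) := by ring
        rw [this]; linarith
  exact le_of_mul_le_mul_left e8 hH0

/-- additive large sieve -/
lemma addLS {κ : Type*} [DecidableEq κ] (I : Finset κ) (α : κ → ℝ) (H : ℕ) (hH : 1 ≤ H)
    (hsp : ∀ i ∈ I, ∀ j ∈ I, i ≠ j → ∀ k : ℤ, 1/(H:ℝ) ≤ |α i - α j - k|)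
    (a : ℕ → ℂ) (S : Finset ℕ) (M N : ℕ) (hS : S ⊆ Finset.Ico M (M+N)) :
    ∑ i ∈ I, ‖∑ n ∈ S, a n * ee (n * α i)‖^2
      ≤ (N + (H - 1) + π^2/12 * H) * ∑ n ∈ S, ‖a n‖^2 := by
  have hH0 : (1:ℝ) ≤ H := by exact_mod_cast hH
  set D : ℝ := (N + (H - 1) + π^2/12 * H) with hD
  have hD0 : 0 ≤ D := by
    have : 0 ≤ π^2/12 * H := by positivity
    have : (0:ℝ) ≤ N := by positivity
    rw [hD]; linarith
  set s : κ → ℂ := fun i => ∑ n ∈ S, a n * ee (n * α i) with hs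
  set X := ∑ i ∈ I, ‖s i‖^2 with hX
  have hX0 : 0 ≤ X := by positivity
  have h1 : (X:ℂ) = ∑ n ∈ S, a n * ∑ i ∈ I, (starRingEnd ℂ) (s i) * ee (n * α i) := by
    simp_rw [Finset.mul_sum]
    rw [Finset.sum_comm, hX, Complex.ofReal_sum]
    refine Finset.sum_congr rfl fun i _ => ?_
    push_cast
    rw [← Complex.mul_conj' (s i)]
    conv_lhs => rw [hs]
    simp only
    rw [Finset.sum_mul]
    refine Finset.sum_congr rfl fun n _ => ?_
    ring
  have h2 : X ≤ ∑ n ∈ S, ‖a n‖ * ‖∑ i ∈ I, (starRingEnd ℂ) (s i) * ee (n * α i)‖ := by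
    calc X = ‖(X:ℂ)‖ := by rw [Complex.norm_real, Real.norm_of_nonneg hX0]
      _ ≤ _ := by
        rw [h1]
        refine (norm_sum_le _ _).trans (le_of_eq ?_)
        simp_rw [norm_mul]
  have h3 : X^2 ≤ (∑ n ∈ S, ‖a n‖^2) * (D * X) := by
    calc X^2 ≤ (∑ n ∈ S, ‖a n‖ * ‖∑ i ∈ I, (starRingEnd ℂ) (s i) * ee (n * α i)‖)^2 := by gcongr
      _ ≤ (∑ n ∈ S, ‖a n‖^2) * ∑ n ∈ S, ‖∑ i ∈ I, (starRingEnd ℂ) (s i) * ee (n * α i)‖^2 :=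
        Finset.sum_mul_sq_le_sq_mul_sq _ _ _
      _ ≤ _ := by
        gcongr
        refine (Finset.sum_le_sum_of_subset_of_nonneg hS (by intros; positivity)).trans ?_
        have := dualLS I α H hH hsp (fun i => (starRingEnd ℂ) (s i)) M N
        simpa only [RCLike.norm_conj] using this
  rcases hX0.eq_or_lt with h | h
  · rw [← h]; positivity
  · have : X * X ≤ X * (D * ∑ n ∈ S, ‖a n‖^2) := by nlinarith
    exact le_of_mul_le_mul_left this h

end BV

namespace BV

section chars
variable {r : ℕ} [NeZero r]

lemma conj_char (χ : DirichletCharacter ℂ r) (a : ZMod r) : (starRingEnd ℂ) (χ a) = χ⁻¹ a :=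
  MulChar.star_apply' χ a

lemma orth_pair (a b : ZMod r) :
    ∑ χ : DirichletCharacter ℂ r, χ a * (starRingEnd ℂ) (χ b)
      = if IsUnit b ∧ b = a then (r.totient : ℂ) else 0 := by
  by_cases hb : IsUnit b
  · have h1 := DirichletCharacter.sum_char_inv_mul_char_eq ℂ hb a
    simp only [hb, true_and]
    rw [← h1]
    refine Finset.sum_congr rfl fun χ _ => ?_
    rw [conj_char, MulChar.inv_apply_eq_inv', mul_comm]
    congr 1
    have : χ b * χ b⁻¹ = 1 := by rw [← map_mul, ZMod.mul_inv_of_unit b hb, map_one]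
    exact inv_eq_of_mul_eq_one_right this
  · simp only [hb, false_and, if_false]
    apply Finset.sum_eq_zero
    intro χ _
    rw [MulChar.map_nonunit χ hb]; simp

lemma orth_sq (g : ZMod r → ℂ) :
    ∑ χ : DirichletCharacter ℂ r, ‖∑ b, χ b * g b‖^2
      = r.totient * ∑ b with IsUnit b, ‖g b‖^2 := by
  have h : ((∑ χ : DirichletCharacter ℂ r, ‖∑ b, χ b * g b‖^2 : ℝ) : ℂ)
      = ((r.totient * ∑ b with IsUnit b, ‖g b‖^2 : ℝ) : ℂ) := by
    rw [Complex.ofReal_sum]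
    simp_rw [normsq_sum]
    rw [Finset.sum_comm]
    push_cast
    rw [Finset.mul_sum, Finset.sum_filter]
    refine Finset.sum_congr rfl fun a _ => ?_
    rw [Finset.sum_comm]
    have : ∀ b : ZMod r, ∑ χ : DirichletCharacter ℂ r, χ a * g a * (starRingEnd ℂ) (χ b * g b)
        = if IsUnit b ∧ b = a then (r.totient : ℂ) * (g a * (starRingEnd ℂ) (g b)) else 0 := by
      intro b
      have h2 := orth_pair a b
      have : ∑ χ : DirichletCharacter ℂ r, χ a * g a * (starRingEnd ℂ) (χ b * g b)
        = (∑ χ : DirichletCharacter ℂ r, χ a * (starRingEnd ℂ) (χ b)) * (g a * (starRingEnd ℂ) (g b)) := by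
        rw [Finset.sum_mul]
        refine Finset.sum_congr rfl fun χ _ => ?_
        rw [map_mul]; ring
      rw [this, h2]
      split_ifs <;> simp
    simp_rw [this]
    rw [Finset.sum_eq_single a]
    · simp only [and_true]
      rw [Complex.mul_conj']
    · intro b _ hb; rw [if_neg]; tauto
    · simp
  exact_mod_cast h

lemma sum_unit_one : (∑ b : ZMod r with IsUnit b, (1:ℝ)) = r.totient := by
  have h := ZMod.card_units_eq_totient r
  rw [← h, Finset.sum_const, nsmul_eq_mul, mul_one]
  norm_cast
  symm
  apply Finset.card_bij (fun (u : (ZMod r)ˣ) _ => (u : ZMod r))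
  · intro u _; simp
  · intro u _ v _ h; exact Units.ext h
  · intro b hb
    rw [Finset.mem_filter] at hb
    exact ⟨hb.2.unit, Finset.mem_univ _, rfl⟩

lemma norm_char_unit (χ : DirichletCharacter ℂ r) {b : ZMod r} (hb : IsUnit b) : ‖χ b‖ = 1 := by
  have := DirichletCharacter.unit_norm_eq_one χ hb.unit
  simpa using this

lemma sum_add_char (t : ZMod r) : ∑ n : ZMod r, (ZMod.stdAddChar (n * t) : ℂ) = if t = 0 then (r:ℂ) else 0 := by
  have := AddChar.sum_mulShift (R := ZMod r) t (ZMod.isPrimitive_stdAddChar r)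
  rw [this]
  simp [ZMod.card]

lemma gauss_norm (χ : DirichletCharacter ℂ r) (hχ : χ.IsPrimitive) :
    ‖gaussSum χ (ZMod.stdAddChar (N := r))‖^2 = r := by
  have h1 : ∀ n : ZMod r, ‖gaussSum χ ((ZMod.stdAddChar (N := r)).mulShift n)‖^2
      = (if IsUnit n then ‖gaussSum χ (ZMod.stdAddChar (N := r))‖^2 else 0) := by
    intro n
    rw [gaussSum_mulShift_of_isPrimitive _ hχ, norm_mul, mul_pow]
    by_cases hn : IsUnit n
    · rw [norm_char_unit _ hn]; simp [hn]
    · rw [MulChar.map_nonunit _ hn]; simp [hn]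
  have h2 : ∑ n : ZMod r, ‖gaussSum χ ((ZMod.stdAddChar (N := r)).mulShift n)‖^2
      = r.totient * ‖gaussSum χ (ZMod.stdAddChar (N := r))‖^2 := by
    simp_rw [h1]
    rw [← Finset.sum_filter, Finset.sum_const, nsmul_eq_mul]
    congr 1
    have := sum_unit_one (r := r)
    rw [Finset.sum_const, nsmul_eq_mul, mul_one] at this
    exact this
  have h3 : ((∑ n : ZMod r, ‖gaussSum χ ((ZMod.stdAddChar (N := r)).mulShift n)‖^2 : ℝ) : ℂ)
      = ((r.totient * r : ℝ) : ℂ) := by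
    rw [Complex.ofReal_sum]
    unfold gaussSum
    simp_rw [normsq_sum]
    rw [Finset.sum_comm]
    have key : ∀ a : ZMod r, ∑ n : ZMod r, ∑ b : ZMod r, χ a * (ZMod.stdAddChar (N := r)).mulShift n a *
        (starRingEnd ℂ) (χ b * (ZMod.stdAddChar (N := r)).mulShift n b) = if IsUnit a then (r:ℂ) else 0 := by
      intro a
      rw [Finset.sum_comm]
      have : ∀ b : ZMod r, ∑ n : ZMod r, χ a * (ZMod.stdAddChar (N := r)).mulShift n a *
        (starRingEnd ℂ) (χ b * (ZMod.stdAddChar (N := r)).mulShift n b) = χ a * (starRingEnd ℂ) (χ b) *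
          (if a - b = 0 then (r:ℂ) else 0) := by
        intro b
        rw [← sum_add_char, Finset.mul_sum]
        refine Finset.sum_congr rfl fun n _ => ?_
        rw [AddChar.mulShift_apply, AddChar.mulShift_apply, map_mul (starRingEnd ℂ), ← AddChar.map_neg_eq_conj, mul_sub, sub_eq_add_neg (n*a),
          AddChar.map_add_eq_mul]
        ring
      simp_rw [this]
      rw [Finset.sum_eq_single a]
      · rw [Complex.mul_conj']
        by_cases ha : IsUnit a
        · rw [norm_char_unit _ ha]; simp [ha]
        · rw [MulChar.map_nonunit _ ha]; simp [ha]
      · intro b _ hb; rw [if_neg (sub_ne_zero.2 hb.symm), mul_zero]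
      · simp
    simp_rw [key]
    rw [← Finset.sum_filter, Finset.sum_const, nsmul_eq_mul]
    have := sum_unit_one (r := r)
    rw [Finset.sum_const, nsmul_eq_mul, mul_one] at this
    push_cast
    congr 1
    exact_mod_cast this
  have h4 : (r.totient : ℝ) * ‖gaussSum χ (ZMod.stdAddChar (N := r))‖^2 = r.totient * r := by
    rw [← h2]; exact_mod_cast h3
  have h5 : (0:ℝ) < r.totient := by
    exact_mod_cast Nat.totient_pos.2 (Nat.pos_of_ne_zero (NeZero.ne r))
  exact mul_left_cancel₀ h5.ne' h4

lemma std_ee (n b : ℕ) : (ZMod.stdAddChar ((n : ZMod r) * (b : ZMod r)) : ℂ) = ee (n * ((b:ℝ)/r)) := by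
  have := ZMod.stdAddChar_coe (N := r) ((n:ℤ) * b)
  push_cast at this
  rw [this]
  unfold ee
  congr 1
  push_cast
  ring

lemma sum_zmod {M : Type*} [AddCommMonoid M] (f : ZMod r → M) : ∑ b : ZMod r, f b = ∑ k ∈ Finset.range r, f k := by
  apply Finset.sum_nbij' (i := ZMod.val) (j := fun k => (k : ZMod r))
  · intro b _; exact Finset.mem_range.2 (ZMod.val_lt b)
  · intros; simp
  · intro b _; simp
  · intro k hk; exact ZMod.val_cast_of_lt (Finset.mem_range.1 hk)
  · intro b _; simp

lemma prim_poly (χ : DirichletCharacter ℂ r) (hχ : χ.IsPrimitive) (a : ℕ → ℂ) (S : Finset ℕ) :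
    (r:ℝ) * ‖∑ n ∈ S, a n * χ n‖^2
      = ‖∑ b : ZMod r, χ b * ∑ n ∈ S, (starRingEnd ℂ) (a n) * ZMod.stdAddChar ((n:ZMod r) * b)‖^2 := by
  have : ∑ b : ZMod r, χ b * ∑ n ∈ S, (starRingEnd ℂ) (a n) * ZMod.stdAddChar ((n:ZMod r) * b)
      = gaussSum χ (ZMod.stdAddChar (N := r)) * (starRingEnd ℂ) (∑ n ∈ S, a n * χ n) := by
    rw [map_sum, Finset.mul_sum]
    simp_rw [Finset.mul_sum]
    rw [Finset.sum_comm]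
    refine Finset.sum_congr rfl fun n _ => ?_
    rw [map_mul, conj_char, mul_left_comm, mul_comm (gaussSum _ _), ← gaussSum_mulShift_of_isPrimitive _ hχ]
    unfold gaussSum
    rw [Finset.mul_sum]
    refine Finset.sum_congr rfl fun b _ => ?_
    rw [AddChar.mulShift_apply]; ring
  rw [this, norm_mul, mul_pow, gauss_norm χ hχ, RCLike.norm_conj]

open Classical in
lemma mulLS1 (a : ℕ → ℂ) (S : Finset ℕ) :
    ∑ χ : DirichletCharacter ℂ r with χ.IsPrimitive, (r:ℝ)/r.totient * ‖∑ n ∈ S, a n * χ n‖^2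
      ≤ ∑ b ∈ (Finset.range r).filter (fun b => b.Coprime r), ‖∑ n ∈ S, (starRingEnd ℂ) (a n) * ee (n * ((b:ℝ)/r))‖^2 := by
  have h5 : (0:ℝ) < r.totient := by
    exact_mod_cast Nat.totient_pos.2 (Nat.pos_of_ne_zero (NeZero.ne r))
  have h1 : ∑ χ : DirichletCharacter ℂ r with χ.IsPrimitive, (r:ℝ) * ‖∑ n ∈ S, a n * χ n‖^2
      ≤ r.totient * ∑ b ∈ (Finset.range r).filter (fun b => b.Coprime r), ‖∑ n ∈ S, (starRingEnd ℂ) (a n) * ee (n * ((b:ℝ)/r))‖^2 := by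
    calc _ = ∑ χ : DirichletCharacter ℂ r with χ.IsPrimitive, ‖∑ b : ZMod r, χ b * ∑ n ∈ S, (starRingEnd ℂ) (a n) * ZMod.stdAddChar ((n:ZMod r) * b)‖^2 := by
            refine Finset.sum_congr rfl fun χ hχ => ?_
            exact prim_poly χ (Finset.mem_filter.1 hχ).2 a S
      _ ≤ ∑ χ : DirichletCharacter ℂ r, ‖∑ b : ZMod r, χ b * ∑ n ∈ S, (starRingEnd ℂ) (a n) * ZMod.stdAddChar ((n:ZMod r) * b)‖^2 :=
            Finset.sum_le_sum_of_subset_of_nonneg (Finset.filter_subset _ _) (by intros; positivity)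
      _ = _ := by
            rw [orth_sq, Finset.sum_filter, sum_zmod, Finset.sum_filter]
            congr 1
            refine Finset.sum_congr rfl fun b _ => ?_
            simp_rw [std_ee, ZMod.isUnit_iff_coprime]
  have e : ∑ χ : DirichletCharacter ℂ r with χ.IsPrimitive, (r:ℝ)/r.totient * ‖∑ n ∈ S, a n * χ n‖^2
      = (∑ χ : DirichletCharacter ℂ r with χ.IsPrimitive, (r:ℝ) * ‖∑ n ∈ S, a n * χ n‖^2) / r.totient := by
    rw [Finset.sum_div]
    refine Finset.sum_congr rfl fun χ _ => ?_
    ring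
  rw [e, div_le_iff₀ h5, mul_comm]
  exact h1

lemma di_lower (b : ℕ) (hb : 0 < b) (hbr : b < r) : 0 < di ((b:ℝ)/r) ∧
    1 / (2 * di ((b:ℝ)/r)) ≤ r/2 * (1/b + 1/((r:ℝ)-b)) := by
  have hr : (0:ℝ) < r := by exact_mod_cast (hb.trans hbr)
  have hb0 : (0:ℝ) < b := by exact_mod_cast hb
  have hbr' : (0:ℝ) < (r:ℝ) - b := by rw [sub_pos]; exact_mod_cast hbr
  have h1 : (b:ℝ)/r ≤ di ((b:ℝ)/r) ∨ ((r:ℝ)-b)/r ≤ di ((b:ℝ)/r) := by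
    unfold di
    rcases le_or_gt (round ((b:ℝ)/r)) 0 with h | h
    · left
      have : ((round ((b:ℝ)/r) : ℤ):ℝ) ≤ 0 := by exact_mod_cast h
      refine le_trans ?_ (le_abs_self _); linarith
    · right
      have : (1:ℝ) ≤ ((round ((b:ℝ)/r) : ℤ):ℝ) := by exact_mod_cast h
      refine le_trans ?_ (neg_le_abs _)
      rw [sub_div, div_self hr.ne']; linarith
  rcases h1 with h1 | h1
  · have h2 : 0 < (b:ℝ)/r := by positivity
    refine ⟨by linarith, ?_⟩
    calc 1 / (2 * di ((b:ℝ)/r)) ≤ 1 / (2 * ((b:ℝ)/r)) := by gcongr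
      _ = r/2 * (1/b) := by field_simp
      _ ≤ _ := by
        have : 0 ≤ 1/((r:ℝ)-b) := by positivity
        gcongr; linarith
  · have h2 : 0 < ((r:ℝ)-b)/r := by positivity
    refine ⟨by linarith, ?_⟩
    calc 1 / (2 * di ((b:ℝ)/r)) ≤ 1 / (2 * (((r:ℝ)-b)/r)) := by gcongr
      _ = r/2 * (1/((r:ℝ)-b)) := by field_simp
      _ ≤ _ := by
        have : 0 ≤ 1/(b:ℝ) := by positivity
        gcongr; linarith

lemma polya (hr : 2 ≤ r) (χ : DirichletCharacter ℂ r) (hχ : χ.IsPrimitive) (z : ℕ) :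
    ‖∑ n ∈ Finset.Icc 1 z, χ n‖ ≤ Real.sqrt r * (1 + Real.log r) := by
  have hr0 : (0:ℝ) < r := by positivity
  have h1 := prim_poly χ hχ (fun _ => 1) (Finset.Icc 1 z)
  simp only [one_mul, map_one] at h1
  have h2 : ‖∑ b : ZMod r, χ b * ∑ n ∈ Finset.Icc 1 z, (ZMod.stdAddChar ((n:ZMod r) * b) : ℂ)‖ ≤ r * (1 + Real.log r) := by
    rw [sum_zmod]
    simp_rw [std_ee]
    refine (norm_sum_le _ _).trans ?_
    obtain ⟨m, rfl⟩ : ∃ m, r = m + 1 := ⟨r - 1, by omega⟩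
    rw [Finset.sum_range_succ']
    have hz : χ (((0:ℕ)) : ZMod (m+1)) = 0 := by
      apply MulChar.map_nonunit
      rw [ZMod.isUnit_iff_coprime]; simp
      try omega
    rw [hz, zero_mul, norm_zero, add_zero]
    calc _ ≤ ∑ k ∈ Finset.range m, ((m+1:ℕ):ℝ)/2 * (1/((k+1:ℕ):ℝ) + 1/(((m+1:ℕ):ℝ)-((k+1:ℕ):ℝ))) := by
            refine Finset.sum_le_sum fun k hk => ?_
            rw [Finset.mem_range] at hk
            obtain ⟨d1, d2⟩ := di_lower (r := m+1) (k+1) (by omega) (by omega)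
            rw [norm_mul]
            have h3 := geom_bound _ d1 1 (z+1)
            have h4 : ‖χ ((k+1:ℕ) : ZMod (m+1))‖ ≤ 1 := DirichletCharacter.norm_le_one χ _
            have h5 : Finset.Icc 1 z = Finset.Ico 1 (z+1) := by
              ext; simp only [Finset.mem_Icc, Finset.mem_Ico]; omega
            rw [h5]
            calc _ ≤ 1 * (1 / (2 * di (((k+1:ℕ):ℝ)/((m+1:ℕ):ℝ)))) := by gcongr
              _ ≤ _ := by rw [one_mul]; exact d2
      _ = ((m+1:ℕ):ℝ)/2 * (∑ k ∈ Finset.range m, 1/((k+1:ℕ):ℝ) + ∑ k ∈ Finset.range m, 1/(((m+1:ℕ):ℝ)-((k+1:ℕ):ℝ))) := by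
            rw [← Finset.mul_sum, Finset.sum_add_distrib]
      _ = ((m+1:ℕ):ℝ) * ∑ k ∈ Finset.range m, 1/((k+1:ℕ):ℝ) := by
            have : ∑ k ∈ Finset.range m, 1/(((m+1:ℕ):ℝ)-((k+1:ℕ):ℝ)) = ∑ k ∈ Finset.range m, 1/((k+1:ℕ):ℝ) := by
              rw [← Finset.sum_range_reflect]
              refine Finset.sum_congr rfl fun k hk => ?_
              rw [Finset.mem_range] at hk
              congr 1
              rw [show m - 1 - k + 1 = m - k by omega, Nat.cast_sub hk.le]; push_cast; ring
            rw [this]; ring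
      _ ≤ _ := by
            gcongr
            have h6 := harmonic_le_one_add_log m
            unfold harmonic at h6
            push_cast at h6
            simp only [one_div]
            push_cast
            refine h6.trans ?_
            rcases Nat.eq_zero_or_pos m with h | h
            · omega
            · gcongr; linarith
  have h3 : 0 ≤ Real.log r := Real.log_natCast_nonneg r
  have h4 : (r:ℝ) * ‖∑ n ∈ Finset.Icc 1 z, χ n‖^2 ≤ r * (Real.sqrt r * (1 + Real.log r))^2 := by
    rw [h1, mul_pow, Real.sq_sqrt hr0.le, ← mul_assoc, ← sq, ← mul_pow]
    gcongr
  have h5 := le_of_mul_le_mul_left h4 hr0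
  exact abs_le_of_sq_le_sq' h5 (by positivity) |>.2
end chars

lemma frac_sp {r a r' a' : ℕ} (ha : a < r) (ha' : a' < r') (hc : a.Coprime r) (hc' : a'.Coprime r')
    (hne : (r, a) ≠ (r', a')) (k : ℤ) : 1/((r:ℝ)*r') ≤ |(a:ℝ)/r - (a':ℝ)/r' - k| := by
  have hr : (0:ℝ) < r := by exact_mod_cast (by omega : 0 < r)
  have hr' : (0:ℝ) < r' := by exact_mod_cast (by omega : 0 < r')
  have e : (a:ℝ)/r - (a':ℝ)/r' - k = (((a:ℤ)*r' - a'*r - k*(r*r') : ℤ):ℝ)/((r:ℝ)*r') := by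
    push_cast; field_simp
  have hnz : ((a:ℤ)*r' - a'*r - k*(r*r')) ≠ 0 := by
    intro h0
    apply hne
    have d1 : (r:ℤ) ∣ a * r' := ⟨a' + k*r', by linarith⟩
    have d2 : (r':ℤ) ∣ a' * r := ⟨a - k*r, by linarith⟩
    have d1' : r ∣ a * r' := by exact_mod_cast d1
    have d2' : r' ∣ a' * r := by exact_mod_cast d2
    have e1 : r ∣ r' := hc.symm.dvd_of_dvd_mul_left d1'
    have e2 : r' ∣ r := hc'.symm.dvd_of_dvd_mul_left d2'
    have e3 : r = r' := Nat.dvd_antisymm e1 e2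
    subst e3
    have h1 : (r:ℤ) * (a - a' - k*r) = 0 := by linarith
    have h2 : (a:ℤ) - a' - k*r = 0 := by
      rcases mul_eq_zero.1 h1 with h | h
      · exfalso; omega
      · exact h
    have hk : k = 0 := by
      rcases lt_trichotomy k 0 with h | h | h
      · exfalso; nlinarith
      · exact h
      · exfalso; nlinarith
    subst hk
    simp only [Prod.mk.injEq, true_and]
    omega
  rw [e, abs_div, abs_of_pos (by positivity : (0:ℝ) < (r:ℝ)*r')]
  gcongr
  exact_mod_cast Int.one_le_abs hnz

abbrev Ch := Σ r : ℕ, DirichletCharacter ℂ r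

open Classical in
noncomputable def primSet (r : ℕ) : Finset (DirichletCharacter ℂ r) :=
  if h : r = 0 then ∅ else
    haveI : NeZero r := ⟨h⟩
    Finset.univ.filter (fun χ => χ.IsPrimitive)

open Classical in
lemma primSet_eq (r : ℕ) [NeZero r] : primSet r = Finset.univ.filter (fun χ : DirichletCharacter ℂ r => χ.IsPrimitive) := by
  unfold primSet; rw [dif_neg (NeZero.ne r)]

lemma primSet_card (r : ℕ) : (primSet r).card ≤ r.totient := by
  classical
  rcases Nat.eq_zero_or_pos r with rfl | h
  · simp [primSet]
  · haveI : NeZero r := ⟨h.ne'⟩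
    rw [primSet_eq]
    refine (Finset.card_filter_le _ _).trans (le_of_eq ?_)
    have := DirichletCharacter.card_eq_totient_of_hasEnoughRootsOfUnity ℂ r
    rw [Nat.card_eq_fintype_card] at this
    rw [Finset.card_univ]; exact this

lemma mulLS (R : ℝ) (hR : 1 ≤ R) (a : ℕ → ℂ) (S : Finset ℕ) (M N : ℕ) (hS : S ⊆ Finset.Ico M (M + N)) :
    ∑ i ∈ (Finset.Ioc ⌊R⌋₊ ⌊2*R⌋₊).sigma primSet, ((i.1:ℝ)/i.1.totient) * ‖∑ n ∈ S, a n * i.2 (n : ZMod i.1)‖^2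
      ≤ (N + (7.29 * R^2 - 1)) * ∑ n ∈ S, ‖a n‖^2 := by
  classical
  rw [Finset.sum_sigma]
  set I : Finset (Σ _ : ℕ, ℕ) := (Finset.Ioc ⌊R⌋₊ ⌊2*R⌋₊).sigma (fun r => (Finset.range r).filter (fun b => b.Coprime r)) with hI
  set H := ⌊2*R⌋₊^2 with hH
  have hfl : 1 ≤ ⌊2*R⌋₊ := Nat.le_floor (by push_cast; linarith)
  have hfl2 : (⌊2*R⌋₊:ℝ) ≤ 2*R := Nat.floor_le (by linarith)
  have hH1 : 1 ≤ H := Nat.one_le_pow _ _ hfl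
  have hH2 : (H:ℝ) ≤ 4*R^2 := by
    rw [hH]; push_cast; nlinarith [(by positivity : (0:ℝ) ≤ ⌊2*R⌋₊)]
  have h1 : ∑ r ∈ Finset.Ioc ⌊R⌋₊ ⌊2*R⌋₊, ∑ χ ∈ primSet r, ((r:ℝ)/r.totient) * ‖∑ n ∈ S, a n * χ (n : ZMod r)‖^2
      ≤ ∑ r ∈ Finset.Ioc ⌊R⌋₊ ⌊2*R⌋₊, ∑ b ∈ (Finset.range r).filter (fun b => b.Coprime r), ‖∑ n ∈ S, (starRingEnd ℂ) (a n) * ee (n * ((b:ℝ)/r))‖^2 := by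
    refine Finset.sum_le_sum fun r hr => ?_
    rw [Finset.mem_Ioc] at hr
    haveI : NeZero r := ⟨by omega⟩
    rw [primSet_eq]
    exact mulLS1 a S
  refine h1.trans ?_
  have h2 := addLS I (fun i => (i.2:ℝ)/i.1) H hH1 (by
    rintro ⟨r, b⟩ hi ⟨r', b'⟩ hj hij k
    simp only [hI, Finset.mem_sigma, Finset.mem_Ioc, Finset.mem_filter, Finset.mem_range] at hi hj
    refine le_trans ?_ (frac_sp hi.2.1 hj.2.1 hi.2.2 hj.2.2 (by
      intro h; apply hij; simp only [Prod.mk.injEq] at h; obtain ⟨rfl, rfl⟩ := h; rfl) k)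
    have p1 : (0:ℝ) < r := by exact_mod_cast (by omega : 0 < r)
    have p2 : (0:ℝ) < r' := by exact_mod_cast (by omega : 0 < r')
    apply one_div_le_one_div_of_le (by positivity)
    have : r * r' ≤ H := by rw [hH, sq]; exact Nat.mul_le_mul hi.1.2 hj.1.2
    exact_mod_cast this) (fun n => (starRingEnd ℂ) (a n)) S M N hS
  rw [hI, Finset.sum_sigma] at h2
  refine h2.trans ?_
  simp only [RCLike.norm_conj]
  have hpi : π^2/12 ≤ 0.8225 := by nlinarith [Real.pi_lt_d6, Real.pi_pos]
  have : π^2/12 * H ≤ 0.8225 * H := by gcongr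
  apply mul_le_mul_of_nonneg_right _ (by positivity)
  linarith

/-- The family of primitive characters with conductor in (R, 2R]. -/
noncomputable def FF (R : ℝ) (hR : 1 ≤ R) : Fam Ch where
  s := (Finset.Ioc ⌊R⌋₊ ⌊2*R⌋₊).sigma primSet
  w := fun i => (i.1:ℝ)/i.1.totient
  χ := fun i n => i.2 (n : ZMod i.1)
  Z := 7.29 * R^2 - 1
  P := Real.sqrt (2*R) * (1 + Real.log (2*R))
  W := 2*R*(R+1)
  hw := fun i _ => by positivity
  hZ := by nlinarith
  hmul := fun i _ m n => by push_cast; rw [map_mul]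
  hle := fun i _ n => DirichletCharacter.norm_le_one _ _
  LS := fun a S M N hS => mulLS R hR a S M N hS
  PV := by
    rintro ⟨r, χ⟩ hi z
    rw [Finset.mem_sigma, Finset.mem_Ioc] at hi
    have h1 : 1 ≤ ⌊R⌋₊ := Nat.le_floor (by push_cast; linarith)
    simp only at hi
    have hr2 : 2 ≤ r := by omega
    haveI : NeZero r := ⟨by omega⟩
    have hχ : χ.IsPrimitive := by
      have := hi.2
      classical
      rw [primSet_eq, Finset.mem_filter] at this
      exact this.2
    refine (polya hr2 χ hχ z).trans ?_
    have hr0 : (2:ℝ) ≤ r := by exact_mod_cast hr2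
    have hr : (r:ℝ) ≤ 2*R := (Nat.le_floor_iff (by linarith)).1 hi.1.2
    have := Real.log_nonneg (by linarith : (1:ℝ) ≤ r)
    gcongr
  hW := by
    rw [Finset.sum_sigma]
    calc _ ≤ ∑ r ∈ Finset.Ioc ⌊R⌋₊ ⌊2*R⌋₊, 2*R := by
          refine Finset.sum_le_sum fun r hr => ?_
          rw [Finset.mem_Ioc] at hr
          simp only [Finset.sum_const, nsmul_eq_mul]
          have h1 : (0:ℝ) < r.totient := by
            exact_mod_cast Nat.totient_pos.2 (by omega : 0 < r)
          have h2 : ((primSet r).card:ℝ) ≤ r.totient := by exact_mod_cast primSet_card r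
          have hr : (r:ℝ) ≤ 2*R := (Nat.le_floor_iff (by linarith)).1 hr.2
          calc ((primSet r).card:ℝ) * (r/r.totient) ≤ r.totient * (r/r.totient) := by gcongr
            _ = r := by field_simp
            _ ≤ _ := hr
      _ = (⌊2*R⌋₊ - ⌊R⌋₊ : ℕ) * (2*R) := by simp
      _ ≤ (R+1)*(2*R) := by
          gcongr
          have h1 : ⌊R⌋₊ ≤ ⌊2*R⌋₊ := Nat.floor_mono (by linarith)
          rw [Nat.cast_sub h1]
          have := Nat.floor_le (by linarith : 0 ≤ 2*R)
          have := Nat.lt_floor_add_one R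
          linarith
      _ = _ := by ring

end BV

namespace BV

noncomputable def e0 (K : ℕ) : ℝ := 1 + 2/π * (1 + Real.log K)
noncomputable def E1 (x : ℝ) : ℝ := e0 ⌈Lx x⌉₊ + ep x ⌈Lx x⌉₊
noncomputable def E2 (x : ℝ) : ℝ := e0 ⌈Lx x⌉₊ + kp x

lemma harm_Ioc (K : ℕ) : ∑ n ∈ Finset.Ioc 0 K, 1/(n:ℝ) ≤ 1 + Real.log K := by
  have := harmonic_le_one_add_log K
  rw [harmonic_eq_sum_Icc] at this
  push_cast at this
  refine le_trans (le_of_eq ?_) this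
  refine Finset.sum_congr ?_ fun n _ => by rw [one_div]
  ext; simp only [Finset.mem_Icc, Finset.mem_Ioc]; omega

lemma gam_sum_low {x : ℝ} (hx : 1 ≤ x) (K : ℕ) :
    ∑ n ∈ Finset.Ioc 0 K, gam (dx x) (n:ℤ) ≤ 1/π * (1 + Real.log K) := by
  refine le_trans ?_ (mul_le_mul_of_nonneg_left (harm_Ioc K) (by positivity))
  rw [Finset.mul_sum]
  refine Finset.sum_le_sum fun n hn => ?_
  rw [gam_nat (by have := Finset.mem_Ioc.1 hn; omega)]
  refine (min_le_left _ _).trans (le_of_eq ?_)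
  have : (n:ℝ) ≠ 0 := by
    have := (Finset.mem_Ioc.1 hn).1
    exact_mod_cast this.ne'
  field_simp

lemma e0_ge (K : ℕ) : 1 ≤ e0 K := by
  unfold e0
  have : 0 ≤ Real.log K := Real.log_natCast_nonneg K
  have : 0 ≤ 2/π * (1 + Real.log K) := by positivity
  linarith

namespace Fam
variable {ι : Type} (F : Fam ι)

lemma En_all2 {x : ℝ} (hx : 1 ≤ x) (S : Finset ℕ) (a : ℕ → ℂ) (M : ℕ) (hS : S ⊆ Finset.Icc 1 M)
    (hM : (M:ℝ) ≤ 4 * x) (N K : ℕ) :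
    ∑ k ∈ Finset.Icc (-(N:ℤ)) N, gam (dx x) k * F.En x S a k
      ≤ ((e0 K + ep x K) * M + (e0 K + kp x) * (F.Z + 1)) * nn S a := by
  rw [sum_gam_symm]
  have h1 := F.En_high hx S a M hS hM K N
  have hl : ∀ k : ℤ, F.En x S a k ≤ (M + F.Z) * nn S a := fun k => F.LSt S a M hS (fr (Lx x) k)
  have hnn := nn_nonneg S a
  have hg0 : ∀ k, 0 ≤ gam (dx x) k := fun k => gam_nonneg (dx_pos hx).le k
  have h3 : ∑ n ∈ Finset.Ioc 0 N, gam (dx x) n * (F.En x S a n + F.En x S a (-n))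
      ≤ ∑ n ∈ Finset.Ioc 0 K, gam (dx x) n * (F.En x S a n + F.En x S a (-n))
       + ∑ n ∈ Finset.Ioc K N, gam (dx x) n * (F.En x S a n + F.En x S a (-n)) := by
    rw [← Finset.sum_union (by
      rw [Finset.disjoint_left]; intro n; simp only [Finset.mem_Ioc]; omega)]
    apply Finset.sum_le_sum_of_subset_of_nonneg
    · intro n; simp only [Finset.mem_union, Finset.mem_Ioc]; omega
    · intro n _ _
      exact mul_nonneg (hg0 _) (add_nonneg (F.En_nonneg _ _ _ _) (F.En_nonneg _ _ _ _))
  have hZ := F.hZ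
  have h4 : ∑ n ∈ Finset.Ioc 0 K, gam (dx x) n * (F.En x S a n + F.En x S a (-n))
      ≤ 1/π * (1 + Real.log K) * (2 * ((M + F.Z) * nn S a)) := by
    refine le_trans ?_ (mul_le_mul_of_nonneg_right (gam_sum_low hx K) (by positivity))
    rw [Finset.sum_mul]
    refine Finset.sum_le_sum fun n _ => mul_le_mul_of_nonneg_left ?_ (hg0 _)
    linarith [hl n, hl (-n)]
  have h5 := hl 0
  have h6 := e0_ge K
  have h7 : F.En x S a 0 + 1/π * (1 + Real.log K) * (2 * ((M + F.Z) * nn S a)) ≤ e0 K * (M + (F.Z+1)) * nn S a := by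
    have h8 : e0 K * (M + (F.Z+1)) * nn S a = ((M + F.Z) * nn S a) + 1/π * (1 + Real.log K) * (2 * ((M + F.Z) * nn S a)) + e0 K * nn S a := by
      unfold e0; ring
    have : 0 ≤ e0 K * nn S a := by positivity
    linarith
  calc _ ≤ e0 K * (M + (F.Z+1)) * nn S a + (ep x K * M + kp x * (F.Z+1)) * nn S a := by linarith
    _ = _ := by ring

lemma T2e {x : ℝ} (hx : 1 ≤ x) (S T : Finset ℕ) (a b : ℕ → ℂ) (M N : ℕ) (hS : S ⊆ Finset.Icc 1 M)
    (hT : T ⊆ Finset.Icc 1 N) (hM : 1 ≤ M) (hN : 1 ≤ N) (hMN : (M:ℝ) * N ≤ 4 * x) (Y : ι → ℕ)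
    (hY : ∀ i ∈ F.s, (Y i : ℝ) ≤ x) :
    ∑ i ∈ F.s, F.w i * ‖∑ p ∈ (S ×ˢ T).filter (fun p => p.1 * p.2 ≤ Y i), a p.1 * b p.2 * F.χ i (p.1 * p.2)‖
      ≤ Real.sqrt ((E1 x * M + E2 x * (F.Z + 1)) * nn S a) *
        Real.sqrt ((E1 x * N + E2 x * (F.Z + 1)) * nn T b) := by
  have hM' : (1:ℝ) ≤ M := by exact_mod_cast hM
  have hN' : (1:ℝ) ≤ N := by exact_mod_cast hN
  have hS0 : ∀ m ∈ S, m ≠ 0 := fun m hm => by have := Finset.mem_Icc.1 (hS hm); omega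
  have hT0 : ∀ m ∈ T, m ≠ 0 := fun m hm => by have := Finset.mem_Icc.1 (hT hm); omega
  refine F.sepsum hx (S ×ˢ T) (fun p => p.1 * p.2) (fun i p => a p.1 * b p.2 * F.χ i (p.1 * p.2)) ?_ Y hY _ ?_
  · intro p hp
    obtain ⟨h1, h2⟩ := Finset.mem_product.1 hp
    have h3 := Finset.mem_Icc.1 (hS h1)
    have h4 := Finset.mem_Icc.1 (hT h2)
    refine ⟨Nat.mul_pos h3.1 h4.1, le_trans ?_ hMN⟩
    exact_mod_cast Nat.mul_le_mul h3.2 h4.2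
  · intro K
    refine le_trans (le_of_eq ?_) (F.cs_gam x hx S T a b (Finset.Icc (-(K:ℤ)) K)
      (F.En_all2 hx S a M hS (by nlinarith) K ⌈Lx x⌉₊) (F.En_all2 hx T b N hT (by nlinarith) K ⌈Lx x⌉₊))
    refine Finset.sum_congr rfl fun k _ => ?_
    congr 1
    refine Finset.sum_congr rfl fun i hi => ?_
    rw [F.prod_poly hi S T hS0 hT0, norm_mul]


lemma sqrt_add_le' {A B : ℝ} (hA : 0 ≤ A) (hB : 0 ≤ B) : √(A+B) ≤ √A + √B := by
  rw [Real.sqrt_le_left (by positivity)]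
  have := Real.sq_sqrt hA
  have := Real.sq_sqrt hB
  have : 0 ≤ √A * √B := by positivity
  nlinarith

lemma sqrt4 {A B C D : ℝ} (hA : 0 ≤ A) (hB : 0 ≤ B) (hC : 0 ≤ C) (hD : 0 ≤ D) :
    √(A+B) * √(C+D) ≤ √A*√C + √A*√D + √B*√C + √B*√D := by
  have h1 : √(A+B) ≤ √A + √B := sqrt_add_le' hA hB
  have h2 : √(C+D) ≤ √C + √D := sqrt_add_le' hC hD
  calc _ ≤ (√A+√B)*(√C+√D) := by gcongr
    _ = _ := by ring

lemma E1_ge {x : ℝ} (hx : 1 ≤ x) : 1 ≤ E1 x := by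
  unfold E1; have := ep_nonneg hx ⌈Lx x⌉₊; have := e0_ge ⌈Lx x⌉₊; linarith
lemma E2_ge {x : ℝ} (hx : 1 ≤ x) : 1 ≤ E2 x := by
  unfold E2; have := kp_nonneg hx; have := e0_ge ⌈Lx x⌉₊; linarith

/-- one dyadic piece -/
lemma dy1 {x : ℝ} (hx : 1 ≤ x) (a b : ℕ → ℂ) (M : ℕ) (hM : 1 ≤ M) (hMx : (M:ℝ) ≤ x) (Ca Cb : ℝ) (hCa0 : 0 ≤ Ca) (hCb0 : 0 ≤ Cb)
    (hCa : nn (Finset.Ioc M (2*M)) a ≤ Ca * M) (hCb : ∀ K : ℕ, nn (Finset.Icc 1 K) b ≤ Cb * K)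
    (Y : ι → ℕ) (hY : ∀ i ∈ F.s, (Y i : ℝ) ≤ x) :
    ∑ i ∈ F.s, F.w i * ‖∑ p ∈ (Finset.Ioc M (2*M) ×ˢ Finset.Icc 1 ⌊x/M⌋₊).filter (fun p => p.1 * p.2 ≤ Y i), a p.1 * b p.2 * F.χ i (p.1 * p.2)‖
      ≤ √(Ca * Cb * x) * (√2 * E1 x * √x + √(E1 x * E2 x * (F.Z+1)) * (√(2*M) + √(x/M)) + E2 x * (F.Z+1)) := by
  have hM0 : (0:ℝ) < M := by exact_mod_cast hM
  have hN0 : (0:ℝ) ≤ x/M := by positivity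
  have hN1 : 1 ≤ ⌊x/M⌋₊ := by
    rw [Nat.one_le_floor_iff, le_div_iff₀ hM0]; linarith
  have hNle : (⌊x/M⌋₊:ℝ) ≤ x/M := Nat.floor_le hN0
  have hZ := F.hZ
  have h1 := E1_ge hx
  have h2 := E2_ge hx
  have := F.T2e hx (Finset.Ioc M (2*M)) (Finset.Icc 1 ⌊x/M⌋₊) a b (2*M) ⌊x/M⌋₊ (by
    intro m; simp only [Finset.mem_Ioc, Finset.mem_Icc]; omega) (le_refl _) (by omega) hN1 (by
    push_cast
    have : 2 * (M:ℝ) * ⌊x/M⌋₊ ≤ 2 * M * (x/M) := by gcongr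
    have e : 2 * (M:ℝ) * (x/M) = 2*x := by field_simp
    linarith) Y hY
  refine this.trans ?_
  set Z := F.Z + 1 with hZd
  have hZ0 : 0 ≤ Z := by linarith
  calc √((E1 x * ↑(2 * M) + E2 x * Z) * nn (Finset.Ioc M (2 * M)) a) * √((E1 x * ↑⌊x / ↑M⌋₊ + E2 x * Z) * nn (Finset.Icc 1 ⌊x / ↑M⌋₊) b)
      ≤ √((E1 x * (2*M) + E2 x * Z) * (Ca * M)) * √((E1 x * (x/M) + E2 x * Z) * (Cb * (x/M))) := by
        have hb : nn (Finset.Icc 1 ⌊x / ↑M⌋₊) b ≤ Cb * (x/M) := (hCb _).trans (by gcongr)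
        have := nn_nonneg (Finset.Icc 1 ⌊x / ↑M⌋₊) b
        push_cast
        gcongr
    _ = √(Ca*Cb*x) * (√(E1 x * (2*M) + E2 x * Z) * √(E1 x * (x/M) + E2 x * Z)) := by
        rw [← Real.sqrt_mul (by positivity), ← Real.sqrt_mul (by positivity), ← Real.sqrt_mul (by positivity)]
        congr 1; field_simp
    _ ≤ √(Ca*Cb*x) * (√(E1 x * (2*M)) * √(E1 x * (x/M)) + √(E1 x * (2*M)) * √(E2 x * Z) + √(E2 x * Z) * √(E1 x * (x/M)) + √(E2 x * Z) * √(E2 x * Z)) := by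
        apply mul_le_mul_of_nonneg_left _ (Real.sqrt_nonneg _)
        apply sqrt4 <;> positivity
    _ = _ := by
        congr 1
        have e1 : √(E1 x * (2*M)) * √(E1 x * (x/M)) = √2 * E1 x * √x := by
          rw [← Real.sqrt_mul (by positivity), show E1 x * (2*M) * (E1 x * (x/M)) = (E1 x)^2 * (2*x) by field_simp,
            Real.sqrt_mul (by positivity), Real.sqrt_sq (by linarith), Real.sqrt_mul (by norm_num)]; ring
        have e2 : √(E1 x * (2*M)) * √(E2 x * Z) = √(E1 x * E2 x * Z) * √(2*M) := by
          rw [← Real.sqrt_mul (by positivity), ← Real.sqrt_mul (by positivity)]; congr 1; ring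
        have e3 : √(E2 x * Z) * √(E1 x * (x/M)) = √(E1 x * E2 x * Z) * √(x/M) := by
          rw [← Real.sqrt_mul (by positivity), ← Real.sqrt_mul (by positivity)]; congr 1; ring
        have e4 : √(E2 x * Z) * √(E2 x * Z) = E2 x * Z := Real.mul_self_sqrt (by positivity)
        rw [e1, e2, e3, e4]; ring

lemma geo_up (J : ℕ) : ∑ j ∈ Finset.range J, (√2)^j ≤ (√2 + 1) * (√2)^J := by
  have h := Real.sq_sqrt (show (0:ℝ) ≤ 2 by norm_num)
  induction J with
  | zero => simp; positivity
  | succ n ih =>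
    rw [Finset.sum_range_succ, pow_succ]
    have : 0 ≤ (√2)^n := by positivity
    nlinarith

lemma geo_dn (J : ℕ) : ∑ j ∈ Finset.range J, ((√2)⁻¹)^j ≤ 2 + √2 := by
  have h := Real.sq_sqrt (show (0:ℝ) ≤ 2 by norm_num)
  have h2 : 1.414 < √2 := by apply Real.lt_sqrt_of_sq_lt; norm_num
  have hi : (√2)⁻¹ = √2/2 := by field_simp; linarith
  have h0 : √2 < 1.415 := by rw [Real.sqrt_lt' (by norm_num)]; norm_num
  rw [hi]
  have hg := geom_sum_eq (x := √2/2) (by linarith) J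
  rw [hg, ← neg_div_neg_eq, div_le_iff₀ (by linarith)]
  have : 0 ≤ (√2/2)^J := by positivity
  nlinarith

lemma dyad {x : ℝ} (hx : 1 ≤ x) (a b : ℕ → ℂ) (U V : ℕ) (hU : 4 ≤ U) (hV : (V:ℝ) ≤ 4 * x / U)
    (Ca Cb : ℝ) (hCa0 : 0 ≤ Ca) (hCb0 : 0 ≤ Cb)
    (hsupp : ∀ m, a m ≠ 0 → U < m ∧ m ≤ V)
    (hCa : ∀ M : ℕ, U ≤ M → (M:ℝ) ≤ x → nn (Finset.Ioc M (2*M)) a ≤ Ca * M) (hCb : ∀ K : ℕ, nn (Finset.Icc 1 K) b ≤ Cb * K)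
    (Y : ι → ℕ) (hY : ∀ i ∈ F.s, (Y i : ℝ) ≤ x) :
    ∑ i ∈ F.s, F.w i * ‖∑ p ∈ (Finset.Icc 1 (Y i) ×ˢ Finset.Icc 1 (Y i)).filter (fun p => p.1 * p.2 ≤ Y i), a p.1 * b p.2 * F.χ i (p.1 * p.2)‖
      ≤ √(Ca * Cb * x) * ((1 + Real.log x / Real.log 2) * (√2 * E1 x * √x + E2 x * (F.Z+1)) + 13.1 * √(E1 x * E2 x * (F.Z+1)) * √(x/U)) := by
  have hU0 : (0:ℝ) < U := by positivity
  have hU4 : (4:ℝ) ≤ U := by exact_mod_cast hU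
  have hZ := F.hZ
  have h1 := E1_ge hx
  have h2 := E2_ge hx
  -- choose J
  obtain ⟨J, hJ1, hJ2⟩ : ∃ J : ℕ, V ≤ 2^J * U ∧ ∀ j < J, 2^j * U < V := by
    have hex : ∃ J : ℕ, V ≤ 2^J * U := ⟨V, by
      have := @Nat.lt_two_pow_self V
      nlinarith⟩
    refine ⟨Nat.find hex, Nat.find_spec hex, fun j hj => ?_⟩
    have := Nat.find_min hex hj
    omega
  have hJx : ∀ j < J, ((2^j * U : ℕ):ℝ) ≤ 4 * x/U := fun j hj =>
    le_trans (by exact_mod_cast (hJ2 j hj).le) hV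
  have hVx : 4 * x/U ≤ x := by rw [div_le_iff₀ hU0]; nlinarith
  have hJlog : (J:ℝ) ≤ 1 + Real.log x / Real.log 2 := by
    have hl2 : 0 < Real.log 2 := Real.log_pos (by norm_num)
    rcases Nat.eq_zero_or_pos J with h0 | h0
    · rw [h0]; have := Real.log_nonneg hx; push_cast; positivity
    · have h3 := (hJx (J-1) (by omega)).trans hVx
      push_cast at h3
      have h4 : (2:ℝ)^(J-1) ≤ x := by
        have : (0:ℝ) < 2^(J-1) := by positivity
        nlinarith
      have h5 := Real.log_le_log (by positivity) h4
      rw [Real.log_pow, ← le_div_iff₀ hl2] at h5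
      push_cast [Nat.cast_sub h0] at h5
      linarith
  -- decompose
  have hdec : ∀ i ∈ F.s, ∑ p ∈ (Finset.Icc 1 (Y i) ×ˢ Finset.Icc 1 (Y i)).filter (fun p => p.1 * p.2 ≤ Y i), a p.1 * b p.2 * F.χ i (p.1 * p.2)
      = ∑ j ∈ Finset.range J, ∑ p ∈ (Finset.Ioc (2^j*U) (2*(2^j*U)) ×ˢ Finset.Icc 1 ⌊x/((2^j*U : ℕ):ℝ)⌋₊).filter (fun p => p.1 * p.2 ≤ Y i), a p.1 * b p.2 * F.χ i (p.1 * p.2) := by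
    intro i hi
    have hYx := hY i hi
    rw [← Finset.sum_biUnion]
    · symm
      apply Finset.sum_subset
      · intro p hp
        simp only [Finset.mem_biUnion, Finset.mem_filter, Finset.mem_product, Finset.mem_Ioc, Finset.mem_Icc, Finset.mem_range] at hp ⊢
        obtain ⟨j, hj, ⟨⟨h1, h2⟩, h3, h4⟩, h5⟩ := hp
        have : 0 < p.1 := by omega
        refine ⟨⟨⟨by omega, ?_⟩, h3, ?_⟩, h5⟩ <;> nlinarith
      · intro p hp hnp
        simp only [Finset.mem_biUnion, Finset.mem_filter, Finset.mem_product, Finset.mem_Ioc, Finset.mem_Icc, Finset.mem_range] at hp hnp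
        by_cases ha : a p.1 = 0
        · rw [ha]; ring
        · exfalso
          obtain ⟨hs1, hs2⟩ := hsupp _ ha
          obtain ⟨j, hj, hj1, hj2⟩ : ∃ j < J, 2^j*U < p.1 ∧ p.1 ≤ 2^(j+1)*U := by
            have hex : ∃ j : ℕ, p.1 ≤ 2^j * U := ⟨J, hs2.trans hJ1⟩
            have h0 : Nat.find hex ≠ 0 := by
              intro h0
              have := Nat.find_spec hex
              rw [h0] at this; omega
            refine ⟨Nat.find hex - 1, ?_, ?_, ?_⟩
            · have := Nat.find_min' hex (hs2.trans hJ1); omega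
            · have := Nat.find_min hex (m := Nat.find hex - 1) (by omega); omega
            · rw [Nat.sub_add_cancel (by omega)]; exact Nat.find_spec hex
          apply hnp
          refine ⟨j, hj, ⟨⟨hj1, ?_⟩, hp.1.2.1, ?_⟩, hp.2⟩
          · rw [pow_succ] at hj2; linarith
          · apply Nat.le_floor
            have hpos : (0:ℝ) < ((2^j*U:ℕ):ℝ) := by
              have : 0 < 2^j*U := by positivity
              exact_mod_cast this
            rw [le_div_iff₀ hpos]
            have h6 : p.2 * (2^j*U) ≤ Y i := by nlinarith [hp.2]
            calc (p.2:ℝ) * ((2^j*U:ℕ):ℝ) ≤ (Y i:ℝ) := by exact_mod_cast h6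
              _ ≤ x := hYx
    · intro j _ j' _ hjj
      rw [Function.onFun, Finset.disjoint_left]
      intro p hp hp'
      simp only [Finset.mem_filter, Finset.mem_product, Finset.mem_Ioc] at hp hp'
      have key : ∀ j j' : ℕ, j < j' → 2^j*U < p.1 ∧ p.1 ≤ 2*(2^j*U) → 2^j'*U < p.1 ∧ p.1 ≤ 2*(2^j'*U) → False := by
        intro j j' hlt h h'
        have : 2^(j+1) ≤ 2^j' := Nat.pow_le_pow_right (by norm_num) hlt
        have : 2^(j+1) * U ≤ 2^j' * U := Nat.mul_le_mul_right _ this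
        have e : 2^(j+1) * U = 2*(2^j*U) := by ring
        rw [e] at this
        have h2 := h.2
        have h3 := h'.1
        exact absurd (lt_of_lt_of_le h3 h2) (by exact not_lt.2 this)
      rcases lt_or_gt_of_ne hjj with h | h
      · exact key j j' h hp.1.1 hp'.1.1
      · exact key j' j h hp'.1.1 hp.1.1
  calc _ = ∑ i ∈ F.s, F.w i * ‖∑ j ∈ Finset.range J, ∑ p ∈ (Finset.Ioc (2^j*U) (2*(2^j*U)) ×ˢ Finset.Icc 1 ⌊x/((2^j*U : ℕ):ℝ)⌋₊).filter (fun p => p.1 * p.2 ≤ Y i), a p.1 * b p.2 * F.χ i (p.1 * p.2)‖ := by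
        refine Finset.sum_congr rfl fun i hi => by rw [hdec i hi]
    _ ≤ ∑ i ∈ F.s, ∑ j ∈ Finset.range J, F.w i * ‖∑ p ∈ (Finset.Ioc (2^j*U) (2*(2^j*U)) ×ˢ Finset.Icc 1 ⌊x/((2^j*U : ℕ):ℝ)⌋₊).filter (fun p => p.1 * p.2 ≤ Y i), a p.1 * b p.2 * F.χ i (p.1 * p.2)‖ := by
        refine Finset.sum_le_sum fun i hi => ?_
        rw [← Finset.mul_sum]
        exact mul_le_mul_of_nonneg_left (norm_sum_le _ _) (F.hw i hi)
    _ = ∑ j ∈ Finset.range J, ∑ i ∈ F.s, F.w i * ‖∑ p ∈ (Finset.Ioc (2^j*U) (2*(2^j*U)) ×ˢ Finset.Icc 1 ⌊x/((2^j*U : ℕ):ℝ)⌋₊).filter (fun p => p.1 * p.2 ≤ Y i), a p.1 * b p.2 * F.χ i (p.1 * p.2)‖ := Finset.sum_comm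
    _ ≤ ∑ j ∈ Finset.range J, √(Ca * Cb * x) * (√2 * E1 x * √x + √(E1 x * E2 x * (F.Z+1)) * (√(2*((2^j*U:ℕ):ℝ)) + √(x/((2^j*U:ℕ):ℝ))) + E2 x * (F.Z+1)) := by
        refine Finset.sum_le_sum fun j hj => ?_
        have hj := Finset.mem_range.1 hj
        have hUj : U ≤ 2^j*U := Nat.le_mul_of_pos_left _ (by positivity)
        exact F.dy1 hx a b (2^j*U) (by omega) ((hJx j hj).trans hVx) Ca Cb hCa0 hCb0
          (hCa _ hUj ((hJx j hj).trans hVx)) hCb Y hY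
    _ = √(Ca * Cb * x) * (J * (√2 * E1 x * √x + E2 x * (F.Z+1)) + √(E1 x * E2 x * (F.Z+1)) * (∑ j ∈ Finset.range J, √(2*((2^j*U:ℕ):ℝ)) + ∑ j ∈ Finset.range J, √(x/((2^j*U:ℕ):ℝ)))) := by
        rw [← Finset.mul_sum, ← Finset.sum_add_distrib, Finset.sum_add_distrib, Finset.sum_add_distrib, ← Finset.mul_sum (f := fun j => √(2*((2^j*U:ℕ):ℝ)) + √(x/((2^j*U:ℕ):ℝ)))]
        simp only [Finset.sum_const, Finset.card_range, nsmul_eq_mul]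
        ring
    _ ≤ _ := by
        have hs2 := Real.sq_sqrt (show (0:ℝ) ≤ 2 by norm_num)
        have hs3 : √2 < 1.4143 := by rw [Real.sqrt_lt' (by norm_num)]; norm_num
        have hup : ∑ j ∈ Finset.range J, √(2*((2^j*U:ℕ):ℝ)) ≤ (√2+1) * 4 * √(x/U) := by
          have e : ∀ j ∈ Finset.range J, √(2*((2^j*U:ℕ):ℝ)) = √(2*U) * (√2)^j := by
            intro j _
            push_cast
            rw [show (2:ℝ)*(2^j*U) = 2*U*(2^j) by ring, Real.sqrt_mul (by positivity)]
            congr 1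
            rw [Real.sqrt_eq_iff_mul_self_eq (by positivity) (by positivity), ← pow_add, ← two_mul, pow_mul, hs2]
          rw [Finset.sum_congr rfl e, ← Finset.mul_sum]
          rcases Nat.eq_zero_or_pos J with h0 | h0
          · rw [h0]; simp; positivity
          · have h3 := hJx (J-1) (by omega)
            have h4 : √(2*U) * (√2)^J ≤ 4 * √(x/U) := by
              apply le_of_sq_le_sq _ (by positivity)
              rw [mul_pow, mul_pow, Real.sq_sqrt (by positivity), Real.sq_sqrt (by positivity), ← pow_mul, mul_comm J 2, pow_mul, hs2]
              push_cast at h3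
              have : (2:ℝ)^J = 2 * 2^(J-1) := by rw [← pow_succ', Nat.sub_add_cancel h0]
              rw [this]
              rw [le_div_iff₀ hU0] at h3
              rw [mul_div_assoc', le_div_iff₀ hU0]
              nlinarith
            have h5 := geo_up J
            calc _ ≤ √(2*U) * ((√2 + 1) * (√2)^J) := by gcongr
              _ = (√2+1) * (√(2*U) * (√2)^J) := by ring
              _ ≤ (√2+1) * (4 * √(x/U)) := by gcongr
              _ = _ := by ring
        have hdn : ∑ j ∈ Finset.range J, √(x/((2^j*U:ℕ):ℝ)) ≤ (2+√2) * √(x/U) := by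
          have e : ∀ j ∈ Finset.range J, √(x/((2^j*U:ℕ):ℝ)) = √(x/U) * ((√2)⁻¹)^j := by
            intro j _
            push_cast
            rw [show x/(2^j*U) = x/U*((2^j)⁻¹) by field_simp, Real.sqrt_mul (by positivity)]
            congr 1
            rw [Real.sqrt_eq_iff_mul_self_eq (by positivity) (by positivity), ← pow_add, ← two_mul, pow_mul, inv_pow, hs2, inv_pow]
          rw [Finset.sum_congr rfl e, ← Finset.mul_sum, mul_comm]
          gcongr
          exact geo_dn J
        have hZ0 : 0 ≤ F.Z + 1 := by linarith
        have hxU : 0 ≤ √(x/U) := Real.sqrt_nonneg _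
        have hsum : ∑ j ∈ Finset.range J, √(2*((2^j*U:ℕ):ℝ)) + ∑ j ∈ Finset.range J, √(x/((2^j*U:ℕ):ℝ)) ≤ 13.1 * √(x/U) := by
          nlinarith
        apply mul_le_mul_of_nonneg_left _ (Real.sqrt_nonneg _)
        apply add_le_add
        · apply mul_le_mul_of_nonneg_right hJlog; positivity
        · exact (mul_le_mul_of_nonneg_left hsum (Real.sqrt_nonneg _)).trans (le_of_eq (by ring))

end Fam
end BV

namespace BV

/-- pairs with product at most Y -/
def prs (Y : ℕ) : Finset (ℕ × ℕ) := (Finset.Icc 1 Y ×ˢ Finset.Icc 1 Y).filter (fun p => p.1 * p.2 ≤ Y)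

lemma mem_prs {Y : ℕ} {p : ℕ × ℕ} : p ∈ prs Y ↔ 1 ≤ p.1 ∧ 1 ≤ p.2 ∧ p.1 * p.2 ≤ Y := by
  unfold prs
  simp only [Finset.mem_filter, Finset.mem_product, Finset.mem_Icc]
  constructor
  · rintro ⟨⟨⟨h1, h2⟩, h3, h4⟩, h5⟩; exact ⟨h1, h3, h5⟩
  · rintro ⟨h1, h3, h5⟩
    refine ⟨⟨⟨h1, ?_⟩, h3, ?_⟩, h5⟩ <;> nlinarith

lemma conv_sum (f g : ArithmeticFunction ℝ) (h : ℕ → ℂ) (Y : ℕ) :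
    ∑ n ∈ Finset.Icc 1 Y, (((f * g) n : ℝ) : ℂ) * h n = ∑ p ∈ prs Y, (f p.1 : ℂ) * (g p.2 : ℂ) * h (p.1 * p.2) := by
  have e : ∀ n ∈ Finset.Icc 1 Y, (((f * g) n : ℝ) : ℂ) * h n = ∑ p ∈ (prs Y).filter (fun p => p.1 * p.2 = n), (f p.1 : ℂ) * (g p.2 : ℂ) * h (p.1 * p.2) := by
    intro n hn
    rw [Finset.mem_Icc] at hn
    rw [ArithmeticFunction.mul_apply]
    push_cast
    rw [Finset.sum_mul]
    have : n.divisorsAntidiagonal = (prs Y).filter (fun p => p.1 * p.2 = n) := by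
      ext p
      simp only [Nat.mem_divisorsAntidiagonal, Finset.mem_filter, mem_prs]
      constructor
      · rintro ⟨h1, h2⟩
        have : p.1 * p.2 ≠ 0 := by omega
        have h3 := Nat.pos_of_ne_zero (left_ne_zero_of_mul this)
        have h4 := Nat.pos_of_ne_zero (right_ne_zero_of_mul this)
        exact ⟨⟨h3, h4, by omega⟩, h1⟩
      · rintro ⟨_, h1⟩; exact ⟨h1, by omega⟩
    rw [this]
    refine Finset.sum_congr rfl fun p hp => ?_
    rw [(Finset.mem_filter.1 hp).2]
  rw [Finset.sum_congr rfl e]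
  apply Finset.sum_fiberwise_of_maps_to
  intro p hp
  have := mem_prs.1 hp
  exact Finset.mem_Icc.2 ⟨Nat.mul_pos this.1 this.2.1, this.2.2⟩

lemma prs_iter (f : ℕ × ℕ → ℂ) (Y : ℕ) :
    ∑ p ∈ prs Y, f p = ∑ a ∈ Finset.Icc 1 Y, ∑ m ∈ Finset.Icc 1 (Y/a), f (a, m) := by
  unfold prs
  rw [Finset.sum_filter, Finset.sum_product]
  refine Finset.sum_congr rfl fun a ha => ?_
  have ha := Finset.mem_Icc.1 ha
  rw [← Finset.sum_filter]
  refine Finset.sum_congr ?_ fun _ _ => rfl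
  ext m
  simp only [Finset.mem_filter, Finset.mem_Icc]
  rw [Nat.le_div_iff_mul_le (by omega), mul_comm m]
  constructor
  · rintro ⟨⟨h1, h2⟩, h3⟩; exact ⟨h1, h3⟩
  · rintro ⟨h1, h3⟩
    refine ⟨⟨h1, ?_⟩, h3⟩; nlinarith

/-- truncations -/
noncomputable def lo (U : ℕ) (f : ArithmeticFunction ℝ) : ArithmeticFunction ℝ := ⟨fun n => if n ≤ U then f n else 0, by simp⟩
noncomputable def hi (U : ℕ) (f : ArithmeticFunction ℝ) : ArithmeticFunction ℝ := ⟨fun n => if n ≤ U then 0 else f n, by simp⟩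
lemma lo_apply (U : ℕ) (f : ArithmeticFunction ℝ) (n : ℕ) : lo U f n = if n ≤ U then f n else 0 := rfl
lemma hi_apply (U : ℕ) (f : ArithmeticFunction ℝ) (n : ℕ) : hi U f n = if n ≤ U then 0 else f n := rfl
lemma lo_add_hi (U : ℕ) (f : ArithmeticFunction ℝ) : lo U f + hi U f = f := by
  ext n
  rw [ArithmeticFunction.add_apply, lo_apply, hi_apply]
  split_ifs <;> simp

noncomputable def mu : ArithmeticFunction ℝ := ((moebius : ArithmeticFunction ℤ) : ArithmeticFunction ℝ)
noncomputable def ze : ArithmeticFunction ℝ := ((zeta : ArithmeticFunction ℕ) : ArithmeticFunction ℝ)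
lemma mu_ze : mu * ze = 1 := coe_moebius_mul_coe_zeta
lemma ze_apply {n : ℕ} (hn : n ≠ 0) : ze n = 1 := by unfold ze; simp [natCoe_apply, zeta_apply, hn]
lemma mu_abs (n : ℕ) : |mu n| ≤ 1 := by
  unfold mu; rw [intCoe_apply]; exact_mod_cast abs_moebius_le_one

noncomputable def bU (U : ℕ) : ArithmeticFunction ℝ := hi U mu * ze

lemma vaughan (U : ℕ) : (Λ : ArithmeticFunction ℝ) = lo U Λ + lo U mu * ArithmeticFunction.log
    - lo U mu * lo U Λ * ze + hi U Λ * bU U := by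
  have h1 : (Λ : ArithmeticFunction ℝ) * ze = ArithmeticFunction.log := vonMangoldt_mul_zeta
  have h2 := mu_ze
  have h3 := lo_add_hi U (Λ : ArithmeticFunction ℝ)
  have h4 := lo_add_hi U mu
  unfold bU
  set a := lo U (Λ : ArithmeticFunction ℝ)
  set b := hi U (Λ : ArithmeticFunction ℝ)
  set c := lo U mu
  set d := hi U mu
  rw [← h1, ← h3]
  rw [← h4] at h2
  linear_combination (-b) * h2

namespace Fam
variable {ι : Type} (F : Fam ι)

lemma P_nonneg {i : ι} (hi : i ∈ F.s) : 0 ≤ F.P := (norm_nonneg _).trans (F.PV i hi 0)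

lemma psum {i : ι} (hi : i ∈ F.s) (f : ℕ → ℂ) (V : ℕ → ℝ) (hV1 : V 1 = 0)
    (hV : ∀ m, 1 ≤ m → ‖f (m+1) - f m‖ ≤ V (m+1) - V m) (N : ℕ) (hN : 1 ≤ N) :
    ‖∑ m ∈ Finset.Icc 1 N, f m * F.χ i m‖ ≤ F.P * (‖f N‖ + V N) := by
  have key : ‖∑ m ∈ Finset.Icc 1 N, f m * F.χ i m - f N * ∑ m ∈ Finset.Icc 1 N, F.χ i m‖ ≤ F.P * V N := by
    induction N, hN using Nat.le_induction with
    | base => simp [hV1]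
    | succ n hn ih =>
      rw [Finset.sum_Icc_succ_top (by omega), Finset.sum_Icc_succ_top (by omega)]
      have h1 := F.PV i hi n
      have h2 := hV n hn
      calc _ = ‖(∑ m ∈ Finset.Icc 1 n, f m * F.χ i m - f n * ∑ m ∈ Finset.Icc 1 n, F.χ i m) - (f (n+1) - f n) * ∑ m ∈ Finset.Icc 1 n, F.χ i m‖ := by
            congr 1; ring
        _ ≤ F.P * V n + (V (n+1) - V n) * F.P := by
            refine (norm_sub_le _ _).trans (add_le_add ih ?_)
            rw [norm_mul]
            exact mul_le_mul h2 h1 (norm_nonneg _) ((norm_nonneg _).trans h2)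
        _ = _ := by ring
  calc _ = ‖(∑ m ∈ Finset.Icc 1 N, f m * F.χ i m - f N * ∑ m ∈ Finset.Icc 1 N, F.χ i m) + f N * ∑ m ∈ Finset.Icc 1 N, F.χ i m‖ := by
        congr 1; ring
    _ ≤ F.P * V N + ‖f N‖ * F.P := by
        refine (norm_add_le _ _).trans (add_le_add key ?_)
        rw [norm_mul]
        exact mul_le_mul_of_nonneg_left (F.PV i hi N) (norm_nonneg _)
    _ = _ := by ring

lemma log_psum {i : ι} (hi : i ∈ F.s) (N : ℕ) :
    ‖∑ m ∈ Finset.Icc 1 N, (Real.log m : ℂ) * F.χ i m‖ ≤ 2 * F.P * Real.log N := by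
  rcases Nat.eq_zero_or_pos N with rfl | hN
  · simp
  refine (F.psum hi (fun m => ((Real.log m : ℝ):ℂ)) (fun m => Real.log m) (by simp) ?_ N hN).trans (le_of_eq ?_)
  · intro m hm
    rw [← Complex.ofReal_sub, Complex.norm_real, Real.norm_eq_abs, abs_of_nonneg]
    have : (0:ℝ) < m := by exact_mod_cast hm
    rw [sub_nonneg]
    apply Real.log_le_log this; push_cast; linarith
  · rw [Complex.norm_real, Real.norm_eq_abs, abs_of_nonneg (Real.log_natCast_nonneg N)]; ring

lemma tw_psum {i : ι} (hi : i ∈ F.s) (t : ℝ) (N : ℕ) (hN : 1 ≤ N) :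
    ‖∑ m ∈ Finset.Icc 1 N, F.χ i m * tw t m‖ ≤ F.P * (1 + |t| * Real.log N) := by
  have := F.psum hi (fun m => tw t m) (fun m => |t| * Real.log m) (by simp) ?_ N hN
  · rw [tw_norm] at this
    refine le_trans (le_of_eq ?_) this
    congr 1
    exact Finset.sum_congr rfl fun m _ => mul_comm _ _
  · intro m hm
    have h0 : (0:ℝ) < m := by exact_mod_cast hm
    have h1 : Real.log m ≤ Real.log ((m+1:ℕ):ℝ) := by
      apply Real.log_le_log h0; push_cast; linarith
    unfold tw
    have e : Complex.exp (Complex.I * ((t * Real.log ((m+1:ℕ):ℝ) : ℝ):ℂ)) - Complex.exp (Complex.I * ((t * Real.log (m:ℝ) : ℝ):ℂ))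
      = Complex.exp (Complex.I * ((t * Real.log (m:ℝ) : ℝ):ℂ)) * (Complex.exp (Complex.I * ((t * (Real.log ((m+1:ℕ):ℝ) - Real.log m) : ℝ):ℂ)) - 1) := by
      rw [mul_sub, mul_one, ← Complex.exp_add]
      congr 2
      push_cast; ring
    rw [e, norm_mul, Complex.norm_exp_I_mul_ofReal, one_mul]
    refine (Real.norm_exp_I_mul_ofReal_sub_one_le).trans ?_
    rw [Real.norm_eq_abs, abs_mul, abs_of_nonneg (sub_nonneg.2 h1)]
    apply le_of_eq; ring

/-- first sum -/
lemma S1 (U : ℕ) (Y : ι → ℕ) :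
    ∑ i ∈ F.s, F.w i * ‖∑ n ∈ Finset.Icc 1 (Y i), ((lo U Λ n : ℝ) : ℂ) * F.χ i n‖ ≤ F.W * ∑ n ∈ Finset.Icc 1 U, Λ n := by
  have h0 : 0 ≤ ∑ n ∈ Finset.Icc 1 U, Λ n := Finset.sum_nonneg fun _ _ => vonMangoldt_nonneg
  refine le_trans ?_ (mul_le_mul_of_nonneg_right F.hW h0)
  rw [Finset.sum_mul]
  refine Finset.sum_le_sum fun i hi => mul_le_mul_of_nonneg_left ?_ (F.hw i hi)
  refine (norm_sum_le _ _).trans ?_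
  calc ∑ n ∈ Finset.Icc 1 (Y i), ‖((lo U Λ n : ℝ) : ℂ) * F.χ i n‖
      ≤ ∑ n ∈ Finset.Icc 1 (Y i), if n ≤ U then Λ n else 0 := by
        refine Finset.sum_le_sum fun n _ => ?_
        rw [norm_mul, Complex.norm_real, lo_apply]
        have := F.hle i hi n
        split_ifs
        · rw [Real.norm_of_nonneg vonMangoldt_nonneg]
          exact mul_le_of_le_one_right vonMangoldt_nonneg this
        · simp
    _ = ∑ n ∈ (Finset.Icc 1 (Y i)).filter (fun n => n ≤ U), Λ n := (Finset.sum_filter _ _).symm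
    _ ≤ _ := by
        apply Finset.sum_le_sum_of_subset_of_nonneg
        · intro n; simp only [Finset.mem_filter, Finset.mem_Icc]; omega
        · intro n _ _; exact vonMangoldt_nonneg

lemma norm_prs_le {i : ι} (hi : i ∈ F.s) (f : ℕ → ℂ) (g : ℕ → ℂ) (Y : ℕ) :
    ‖∑ p ∈ prs Y, f p.1 * g p.2 * F.χ i (p.1 * p.2)‖ ≤ ∑ a ∈ Finset.Icc 1 Y, ‖f a‖ * ‖∑ m ∈ Finset.Icc 1 (Y/a), g m * F.χ i m‖ := by
  rw [prs_iter]
  refine (norm_sum_le _ _).trans (Finset.sum_le_sum fun a _ => ?_)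
  have : ∑ m ∈ Finset.Icc 1 (Y/a), f a * g m * F.χ i (a * m) = f a * F.χ i a * ∑ m ∈ Finset.Icc 1 (Y/a), g m * F.χ i m := by
    rw [Finset.mul_sum]
    refine Finset.sum_congr rfl fun m _ => ?_
    rw [F.hmul i hi]; ring
  rw [this, norm_mul, norm_mul]
  apply mul_le_mul_of_nonneg_right _ (norm_nonneg _)
  exact mul_le_of_le_one_right (norm_nonneg _) (F.hle i hi a)

/-- second sum -/
lemma S2 (U : ℕ) (hP : 0 ≤ F.P) {x : ℝ} (hx : 1 ≤ x) (Y : ι → ℕ) (hY : ∀ i ∈ F.s, (Y i : ℝ) ≤ x) :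
    ∑ i ∈ F.s, F.w i * ‖∑ p ∈ prs (Y i), ((lo U mu p.1 : ℝ) : ℂ) * ((ArithmeticFunction.log p.2 : ℝ):ℂ) * F.χ i (p.1 * p.2)‖ ≤ F.W * (U * (2 * F.P * Real.log x)) := by
  have hl := Real.log_nonneg hx
  refine le_trans ?_ (mul_le_mul_of_nonneg_right F.hW (by positivity))
  rw [Finset.sum_mul]
  refine Finset.sum_le_sum fun i hi => mul_le_mul_of_nonneg_left ?_ (F.hw i hi)
  refine (F.norm_prs_le hi (fun n => ((lo U mu n : ℝ):ℂ)) (fun n => ((ArithmeticFunction.log n : ℝ):ℂ)) (Y i)).trans ?_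
  calc _ ≤ ∑ a ∈ Finset.Icc 1 (Y i), (if a ≤ U then 1 else 0) * (2 * F.P * Real.log x) := by
        refine Finset.sum_le_sum fun a ha => ?_
        have ha := Finset.mem_Icc.1 ha
        apply mul_le_mul _ _ (norm_nonneg _) (by split_ifs <;> norm_num)
        · rw [Complex.norm_real, lo_apply]
          split_ifs
          · exact mu_abs a
          · simp
        · simp only [ArithmeticFunction.log_apply]
          refine (F.log_psum hi _).trans ?_
          apply mul_le_mul_of_nonneg_left _ (by positivity)
          rcases Nat.eq_zero_or_pos (Y i / a) with h | h
          · rw [h]; simpa using hl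
          · apply Real.log_le_log (by exact_mod_cast h)
            refine le_trans ?_ (hY i hi)
            exact_mod_cast Nat.div_le_self _ _
    _ ≤ _ := by
        rw [← Finset.sum_mul]
        apply mul_le_mul_of_nonneg_right _ (by positivity)
        rw [← Finset.sum_filter, Finset.sum_const, nsmul_eq_mul, mul_one]
        have : ((Finset.Icc 1 (Y i)).filter (fun a => a ≤ U)).card ≤ (Finset.Icc 1 U).card := by
          apply Finset.card_le_card
          intro n; simp only [Finset.mem_filter, Finset.mem_Icc]; omega
        simp only [Nat.card_Icc, Nat.add_sub_cancel] at this
        exact_mod_cast this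

/-- third sum, small part -/
lemma S3A (U : ℕ) (g : ℕ → ℝ) (hP : 0 ≤ F.P) (hg : ∀ m, |g m| ≤ if m ≤ U then Real.log m else 0) (Y : ι → ℕ) :
    ∑ i ∈ F.s, F.w i * ‖∑ p ∈ prs (Y i), (g p.1 : ℂ) * 1 * F.χ i (p.1 * p.2)‖ ≤ F.W * (U * Real.log U * F.P) := by
  have hl := Real.log_natCast_nonneg U
  refine le_trans ?_ (mul_le_mul_of_nonneg_right F.hW (by positivity))
  rw [Finset.sum_mul]
  refine Finset.sum_le_sum fun i hi => mul_le_mul_of_nonneg_left ?_ (F.hw i hi)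
  refine (F.norm_prs_le hi (fun n => (g n:ℂ)) (fun n => 1) (Y i)).trans ?_
  calc _ ≤ ∑ a ∈ Finset.Icc 1 (Y i), (if a ≤ U then Real.log U else 0) * F.P := by
        refine Finset.sum_le_sum fun a ha => ?_
        have ha := Finset.mem_Icc.1 ha
        apply mul_le_mul _ _ (norm_nonneg _) (by split_ifs; exact hl; rfl)
        · rw [Complex.norm_real, Real.norm_eq_abs]
          refine (hg a).trans ?_
          split_ifs with h
          · apply Real.log_le_log (by exact_mod_cast ha.1)
            exact_mod_cast h
          · rfl
        · simp only [one_mul]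
          exact F.PV i hi _
    _ ≤ _ := by
        rw [← Finset.sum_mul]
        apply mul_le_mul_of_nonneg_right _ hP
        rw [← Finset.sum_filter, Finset.sum_const, nsmul_eq_mul]
        apply mul_le_mul_of_nonneg_right _ hl
        have : ((Finset.Icc 1 (Y i)).filter (fun a => a ≤ U)).card ≤ (Finset.Icc 1 U).card := by
          apply Finset.card_le_card
          intro n; simp only [Finset.mem_filter, Finset.mem_Icc]; omega
        simp only [Nat.card_Icc, Nat.add_sub_cancel] at this
        exact_mod_cast this

end Fam
end BV

namespace BV

noncomputable def cf (q : ℕ × ℕ) : ℝ := mu q.1 * Λ q.2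
def Qs (U : ℕ) : Finset (ℕ × ℕ) := Finset.Icc 1 U ×ˢ Finset.Icc 1 U
/-- the size condition -/
def sm (x : ℝ) (U : ℕ) (q : ℕ × ℕ) : Prop := ((2^(Nat.log 2 q.1 + Nat.log 2 q.2) : ℕ):ℝ) ≤ x / U

noncomputable instance smdec (x : ℝ) (U : ℕ) : DecidablePred (sm x U) := Classical.decPred _

lemma g_eq (U m : ℕ) (hm : 1 ≤ m) : (lo U mu * lo U Λ) m = ∑ q ∈ (Qs U).filter (fun q => q.1 * q.2 = m), cf q := by
  rw [ArithmeticFunction.mul_apply]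
  symm
  apply Finset.sum_subset_zero_on_sdiff
  · intro q hq
    simp only [Finset.mem_filter] at hq
    rw [Nat.mem_divisorsAntidiagonal]
    exact ⟨hq.2, by omega⟩
  · intro q hq
    simp only [Finset.mem_sdiff, Nat.mem_divisorsAntidiagonal, Finset.mem_filter, Qs, Finset.mem_product, Finset.mem_Icc] at hq
    obtain ⟨⟨h1, h2⟩, h3⟩ := hq
    rw [lo_apply, lo_apply]
    have h4 : q.1 ≠ 0 := by rintro h; rw [h] at h1; omega
    have h5 : q.2 ≠ 0 := by rintro h; rw [h] at h1; omega
    by_cases h6 : q.1 ≤ U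
    · by_cases h7 : q.2 ≤ U
      · exact absurd ⟨⟨⟨by omega, h6⟩, by omega, h7⟩, h1⟩ h3
      · rw [if_neg h7]; ring
    · rw [if_neg h6]; ring
  · intro q hq
    simp only [Finset.mem_filter, Qs, Finset.mem_product, Finset.mem_Icc] at hq
    rw [lo_apply, lo_apply, if_pos hq.1.1.2, if_pos hq.1.2.2]; rfl

lemma g_bound (Q : Finset (ℕ × ℕ)) (m : ℕ) (hm : 1 ≤ m) :
    |∑ q ∈ Q.filter (fun q => q.1 * q.2 = m), cf q| ≤ Real.log m := by
  refine (Finset.abs_sum_le_sum_abs _ _).trans ?_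
  calc _ ≤ ∑ q ∈ Q.filter (fun q => q.1 * q.2 = m), Λ q.2 := by
        refine Finset.sum_le_sum fun q _ => ?_
        unfold cf
        rw [abs_mul, abs_of_nonneg (vonMangoldt_nonneg (n := q.2))]
        exact mul_le_of_le_one_left vonMangoldt_nonneg (mu_abs _)
    _ ≤ ∑ q ∈ m.divisorsAntidiagonal, Λ q.2 := by
        apply Finset.sum_le_sum_of_subset_of_nonneg
        · intro q hq
          rw [Nat.mem_divisorsAntidiagonal]
          exact ⟨(Finset.mem_filter.1 hq).2, by omega⟩
        · intro _ _ _; exact vonMangoldt_nonneg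
    _ = _ := by
        rw [Nat.sum_divisorsAntidiagonal' (f := fun _ b => Λ b)]
        exact vonMangoldt_sum

/-- boxes -/
def Sb (U i : ℕ) : Finset ℕ := (Finset.Icc 1 U).filter (fun b => Nat.log 2 b = i)
noncomputable def boxes (x : ℝ) (U : ℕ) : Finset (ℕ × ℕ) :=
  open Classical in (Finset.range (Nat.log 2 U + 1) ×ˢ Finset.range (Nat.log 2 U + 1)).filter (fun p => ¬ ((2^(p.1+p.2) : ℕ):ℝ) ≤ x / U)
noncomputable def Nb (x : ℝ) (p : ℕ × ℕ) : ℕ := ⌊x / ((2^(p.1+p.2) : ℕ):ℝ)⌋₊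
noncomputable def tri (x : ℝ) (U : ℕ) (p : ℕ × ℕ) : Finset ((ℕ × ℕ) × ℕ) := (Sb U p.1 ×ˢ Sb U p.2) ×ˢ Finset.Icc 1 (Nb x p)

lemma Sb_mem {U i b : ℕ} (hb : b ∈ Sb U i) : 1 ≤ b ∧ b ≤ U ∧ 2^i ≤ b ∧ b < 2^(i+1) := by
  simp only [Sb, Finset.mem_filter, Finset.mem_Icc] at hb
  obtain ⟨⟨h1, h2⟩, h3⟩ := hb
  refine ⟨h1, h2, ?_, ?_⟩
  · rw [← h3]; exact Nat.pow_log_le_self 2 (by omega)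
  · rw [← h3]; exact Nat.lt_pow_succ_log_self (by norm_num) b

lemma boxsplit (x : ℝ) (U Y : ℕ) (hY : (Y:ℝ) ≤ x) (h : ℕ → ℂ) :
    ∑ p ∈ prs Y, (((∑ q ∈ ((Qs U).filter (fun q => ¬ sm x U q)).filter (fun q => q.1 * q.2 = p.1), cf q : ℝ)) : ℂ) * h (p.1 * p.2)
     = ∑ r ∈ boxes x U, ∑ t ∈ (tri x U r).filter (fun t => t.1.1 * t.1.2 * t.2 ≤ Y), (cf t.1 : ℂ) * h (t.1.1 * t.1.2 * t.2) := by
  classical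
  set QC := (Qs U).filter (fun q => ¬ sm x U q) with hQC
  have hQ1 : ∀ q ∈ QC, 1 ≤ q.1 ∧ q.1 ≤ U ∧ 1 ≤ q.2 ∧ q.2 ≤ U := by
    intro q hq
    simp only [hQC, Finset.mem_filter, Qs, Finset.mem_product, Finset.mem_Icc] at hq
    tauto
  have e1 : ∑ p ∈ prs Y, (((∑ q ∈ QC.filter (fun q => q.1 * q.2 = p.1), cf q : ℝ)) : ℂ) * h (p.1 * p.2)
      = ∑ q ∈ QC, ∑ n ∈ (Finset.Icc 1 Y).filter (fun n => q.1 * q.2 * n ≤ Y), (cf q : ℂ) * h (q.1 * q.2 * n) := by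
    push_cast
    simp_rw [Finset.sum_mul]
    rw [Finset.sum_comm' (t' := QC) (s' := fun q => (prs Y).filter (fun p => q.1 * q.2 = p.1))]
    · refine Finset.sum_congr rfl fun q hq => ?_
      obtain ⟨h1, h2, h3, h4⟩ := hQ1 q hq
      have hpos : 0 < q.1 * q.2 := Nat.mul_pos h1 h3
      refine Finset.sum_nbij' (fun p => p.2) (fun n => (q.1*q.2, n)) ?_ ?_ ?_ ?_ ?_
      · intro p hp
        simp only [Finset.mem_filter, mem_prs] at hp
        simp only [Finset.mem_filter, Finset.mem_Icc]
        rw [hp.2]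
        refine ⟨⟨hp.1.2.1, ?_⟩, hp.1.2.2⟩
        nlinarith [hp.1.1, hp.1.2.1, hp.1.2.2]
      · intro n hn
        simp only [Finset.mem_filter, Finset.mem_Icc] at hn
        simp only [Finset.mem_filter, mem_prs]
        exact ⟨⟨hpos, hn.1.1, hn.2⟩, trivial⟩
      · intro p hp
        simp only [Finset.mem_filter, mem_prs] at hp
        ext <;> simp [hp.2]
      · intro n _; rfl
      · intro p hp
        simp only [Finset.mem_filter, mem_prs] at hp
        rw [hp.2]
    · intro p q
      simp only [Finset.mem_filter]
      tauto
  rw [e1]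
  have e2 : ∀ r ∈ boxes x U, ∑ t ∈ (tri x U r).filter (fun t => t.1.1 * t.1.2 * t.2 ≤ Y), (cf t.1 : ℂ) * h (t.1.1 * t.1.2 * t.2)
      = ∑ q ∈ QC.filter (fun q => (Nat.log 2 q.1, Nat.log 2 q.2) = r), ∑ n ∈ (Finset.Icc 1 Y).filter (fun n => q.1 * q.2 * n ≤ Y), (cf q : ℂ) * h (q.1 * q.2 * n) := by
    intro r hr
    rw [Finset.sum_filter]
    unfold tri
    rw [Finset.sum_product]
    have : QC.filter (fun q => (Nat.log 2 q.1, Nat.log 2 q.2) = r) = Sb U r.1 ×ˢ Sb U r.2 := by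
      ext q
      simp only [hQC, Finset.mem_filter, Qs, Sb, Finset.mem_product, Prod.ext_iff]
      simp only [boxes, Finset.mem_filter] at hr
      constructor
      · tauto
      · rintro ⟨⟨h1, h2⟩, h3, h4⟩
        refine ⟨⟨⟨h1, h3⟩, ?_⟩, h2, h4⟩
        unfold sm; rw [h2, h4]; exact hr.2
    rw [this]
    refine Finset.sum_congr rfl fun q hq => ?_
    rw [← Finset.sum_filter]
    refine Finset.sum_congr ?_ fun _ _ => rfl
    rw [Finset.mem_product] at hq
    have hb := Sb_mem hq.1
    have hc := Sb_mem hq.2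
    have hpos : 0 < q.1 * q.2 := Nat.mul_pos hb.1 hc.1
    ext n
    simp only [Finset.mem_filter, Finset.mem_Icc]
    constructor
    · rintro ⟨⟨h1, h2⟩, h3⟩
      refine ⟨⟨h1, ?_⟩, h3⟩; nlinarith
    · rintro ⟨⟨h1, h2⟩, h3⟩
      refine ⟨⟨h1, ?_⟩, h3⟩
      unfold Nb
      apply Nat.le_floor
      rw [le_div_iff₀ (by positivity)]
      refine le_trans ?_ hY
      have : n * 2^(r.1+r.2) ≤ Y := by
        refine le_trans ?_ h3
        rw [mul_comm, pow_add]
        exact Nat.mul_le_mul_right _ (Nat.mul_le_mul hb.2.2.1 hc.2.2.1)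
      exact_mod_cast this
  rw [Finset.sum_congr rfl e2]
  symm
  apply Finset.sum_fiberwise_of_maps_to
  intro q hq
  obtain ⟨h1, h2, h3, h4⟩ := hQ1 q hq
  rw [hQC, Finset.mem_filter] at hq
  simp only [boxes, Finset.mem_filter, Finset.mem_product, Finset.mem_range]
  refine ⟨⟨?_, ?_⟩, hq.2⟩
  · exact Nat.lt_succ_of_le (Nat.log_mono_right h2)
  · exact Nat.lt_succ_of_le (Nat.log_mono_right h4)

namespace Fam
variable {ι : Type} (F : Fam ι)

/-- box sum -/
noncomputable def box (x : ℝ) (U : ℕ) (Y : ι → ℕ) (r : ℕ × ℕ) : ℝ :=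
  ∑ i ∈ F.s, F.w i * ‖∑ t ∈ (tri x U r).filter (fun t => t.1.1 * t.1.2 * t.2 ≤ Y i), (cf t.1 : ℂ) * F.χ i (t.1.1 * t.1.2 * t.2)‖

noncomputable def dyB (x : ℝ) (U : ℕ) : ℝ := (1 + Real.log x / Real.log 2) * (√2 * E1 x * √x + E2 x * (F.Z+1)) + 13.1 * √(E1 x * E2 x * (F.Z+1)) * √(x/U)

lemma S3 {x : ℝ} (hx : 1 ≤ x) (U : ℕ) (hU : 4 ≤ U) (hUx : (U:ℝ)^2 ≤ x) (hP : 0 ≤ F.P) (Y : ι → ℕ) (hY : ∀ i ∈ F.s, (Y i : ℝ) ≤ x) :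
    ∑ i ∈ F.s, F.w i * ‖∑ p ∈ prs (Y i), (((lo U mu * lo U Λ) p.1 : ℝ) : ℂ) * ((ze p.2 : ℝ):ℂ) * F.χ i (p.1 * p.2)‖
     ≤ F.W * (U * Real.log U * F.P) + √(Real.log x^2 * 1 * x) * F.dyB x U + ∑ r ∈ boxes x U, F.box x U Y r := by
  classical
  have hU0 : (0:ℝ) < U := by positivity
  have hU4 : (4:ℝ) ≤ U := by exact_mod_cast hU
  have hUxU : (U:ℝ) ≤ x/U := by rw [le_div_iff₀ hU0]; nlinarith
  set gA : ℕ → ℝ := fun m => if 1 ≤ m ∧ m ≤ U then ∑ q ∈ (Qs U).filter (fun q => q.1 * q.2 = m), cf q else 0 with hgA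
  set gB : ℕ → ℝ := fun m => if m ≤ U then 0 else ∑ q ∈ ((Qs U).filter (fun q => sm x U q)).filter (fun q => q.1 * q.2 = m), cf q with hgB
  set gC : ℕ → ℝ := fun m => ∑ q ∈ ((Qs U).filter (fun q => ¬ sm x U q)).filter (fun q => q.1 * q.2 = m), cf q with hgC
  have hle : ∀ q : ℕ × ℕ, 1 ≤ q.1 → 1 ≤ q.2 → 2^(Nat.log 2 q.1 + Nat.log 2 q.2) ≤ q.1 * q.2 := by
    intro q h1 h2
    rw [pow_add]
    exact Nat.mul_le_mul (Nat.pow_log_le_self 2 (by omega)) (Nat.pow_log_le_self 2 (by omega))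
  have hsplit : ∀ m, 1 ≤ m → (lo U mu * lo U Λ) m = gA m + gB m + gC m := by
    intro m hm
    rw [g_eq U m hm]
    simp only [hgA, hgB, hgC]
    by_cases h : m ≤ U
    · rw [if_pos ⟨hm, h⟩, if_pos h]
      have : ((Qs U).filter (fun q => ¬ sm x U q)).filter (fun q => q.1 * q.2 = m) = ∅ := by
        rw [Finset.filter_eq_empty_iff]
        intro q hq hqm
        simp only [Finset.mem_filter, Qs, Finset.mem_product, Finset.mem_Icc] at hq
        apply hq.2
        unfold sm
        refine le_trans ?_ hUxU
        have := hle q hq.1.1.1 hq.1.2.1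
        exact_mod_cast (this.trans (hqm ▸ h))
      rw [this]; simp
    · rw [if_neg (fun hh => h hh.2), if_neg h, zero_add]
      rw [← Finset.sum_union]
      · refine Finset.sum_congr ?_ fun _ _ => rfl
        ext q
        simp only [Finset.mem_union, Finset.mem_filter]
        tauto
      · rw [Finset.disjoint_left]
        intro q; simp only [Finset.mem_filter]; tauto
  have hA := F.S3A U gA hP (by
    intro m
    simp only [hgA]
    split_ifs with h1 h2 h2
    · exact g_bound _ m h1.1
    · exact absurd h1.2 h2
    · simp; exact Real.log_natCast_nonneg m
    · simp) Y
  have hxl := Real.log_nonneg hx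
  have hgBs : ∀ m : ℕ, gB m ≠ 0 → U < m ∧ m ≤ ⌊4*x/U⌋₊ := by
    intro m hm
    simp only [hgB] at hm
    by_cases h : m ≤ U
    · rw [if_pos h] at hm; exact absurd rfl hm
    · rw [if_neg h] at hm
      obtain ⟨q, hq, _⟩ := Finset.exists_ne_zero_of_sum_ne_zero hm
      rw [Finset.mem_filter, Finset.mem_filter] at hq
      have hqs : ((2^(Nat.log 2 q.1 + Nat.log 2 q.2) : ℕ):ℝ) ≤ x / U := hq.1.2
      refine ⟨by omega, Nat.le_floor ?_⟩
      have h1 := Nat.lt_pow_succ_log_self (b := 2) (by norm_num) q.1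
      have h2 := Nat.lt_pow_succ_log_self (b := 2) (by norm_num) q.2
      have h3 : m ≤ 4 * 2^(Nat.log 2 q.1 + Nat.log 2 q.2) := by
        rw [← hq.2]
        calc q.1 * q.2 ≤ 2^(Nat.log 2 q.1).succ * 2^(Nat.log 2 q.2).succ := Nat.mul_le_mul h1.le h2.le
          _ = _ := by rw [Nat.succ_eq_add_one, Nat.succ_eq_add_one]; ring
      calc (m:ℝ) ≤ 4 * ((2^(Nat.log 2 q.1 + Nat.log 2 q.2):ℕ):ℝ) := by exact_mod_cast h3
        _ ≤ 4 * (x/U) := by linarith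
        _ = _ := by ring
  have hVx : 4 * x/U ≤ x := by rw [div_le_iff₀ hU0]; nlinarith
  have hB := F.dyad hx (fun m => (gB m : ℂ)) (fun _ => 1) U ⌊4*x/U⌋₊ hU (Nat.floor_le (by positivity)) (Real.log x^2) 1 (sq_nonneg _) (by norm_num)
    (by intro m hm; exact hgBs m (by simpa using hm)) (by
      intro M hM hMx
      unfold nn
      calc _ ≤ ∑ n ∈ Finset.Ioc M (2*M), Real.log x^2 := by
            refine Finset.sum_le_sum fun n hn => ?_
            rw [Complex.norm_real, Real.norm_eq_abs, sq_abs]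
            by_cases h0 : gB n = 0
            · rw [h0]; simpa using sq_nonneg (Real.log x)
            · obtain ⟨h1, h2⟩ := hgBs n h0
              have hn1 : 1 ≤ n := by omega
              have h3 : |gB n| ≤ Real.log n := by
                simp only [hgB]
                rw [if_neg (by omega)]
                exact g_bound _ n hn1
              have h4 : Real.log n ≤ Real.log x := by
                apply Real.log_le_log (by exact_mod_cast hn1)
                refine le_trans ?_ hVx
                exact (Nat.cast_le.2 h2).trans (Nat.floor_le (by positivity))
              rw [← sq_abs]
              exact pow_le_pow_left₀ (abs_nonneg _) (h3.trans h4) 2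
        _ = _ := by
            rw [Finset.sum_const, nsmul_eq_mul, Nat.card_Ioc, show 2*M - M = M by omega]; ring) (by
      intro K; unfold nn; simp) Y hY
  have hC : ∀ i ∈ F.s, ‖∑ p ∈ prs (Y i), (gC p.1 : ℂ) * 1 * F.χ i (p.1 * p.2)‖ ≤
      ∑ r ∈ boxes x U, ‖∑ t ∈ (tri x U r).filter (fun t => t.1.1 * t.1.2 * t.2 ≤ Y i), (cf t.1 : ℂ) * F.χ i (t.1.1 * t.1.2 * t.2)‖ := by
    intro i hi
    simp only [mul_one]
    simp only [hgC]
    rw [boxsplit x U (Y i) (hY i hi) (F.χ i)]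
    exact norm_sum_le _ _
  calc _ ≤ ∑ i ∈ F.s, (F.w i * ‖∑ p ∈ prs (Y i), (gA p.1 : ℂ) * 1 * F.χ i (p.1 * p.2)‖ + F.w i * ‖∑ p ∈ prs (Y i), (gB p.1 : ℂ) * 1 * F.χ i (p.1 * p.2)‖
        + ∑ r ∈ boxes x U, F.w i * ‖∑ t ∈ (tri x U r).filter (fun t => t.1.1 * t.1.2 * t.2 ≤ Y i), (cf t.1 : ℂ) * F.χ i (t.1.1 * t.1.2 * t.2)‖) := by
        refine Finset.sum_le_sum fun i hi => ?_
        rw [← Finset.mul_sum, ← mul_add, ← mul_add]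
        apply mul_le_mul_of_nonneg_left _ (F.hw i hi)
        have e : ∑ p ∈ prs (Y i), (((lo U mu * lo U Λ) p.1 : ℝ) : ℂ) * ((ze p.2 : ℝ):ℂ) * F.χ i (p.1 * p.2)
          = ∑ p ∈ prs (Y i), (gA p.1 : ℂ) * 1 * F.χ i (p.1 * p.2) + ∑ p ∈ prs (Y i), (gB p.1 : ℂ) * 1 * F.χ i (p.1 * p.2)
            + ∑ p ∈ prs (Y i), (gC p.1 : ℂ) * 1 * F.χ i (p.1 * p.2) := by
          rw [← Finset.sum_add_distrib, ← Finset.sum_add_distrib]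
          refine Finset.sum_congr rfl fun p hp => ?_
          have := mem_prs.1 hp
          rw [hsplit _ this.1, ze_apply (by omega)]
          push_cast; ring
        rw [e]
        refine (norm_add₃_le).trans ?_
        gcongr
        exact hC i hi
    _ ≤ _ := by
        rw [Finset.sum_add_distrib, Finset.sum_add_distrib]
        refine add_le_add (add_le_add hA hB) ?_
        rw [Finset.sum_comm]
        rfl

end Fam
end BV

namespace BV

lemma inv_Ioc (a b : ℕ) (hab : a + 1 ≤ b) : ∑ n ∈ Finset.Ioc a b, (1:ℝ)/n ≤ 1/((a:ℝ)+1) + Real.log (b/((a:ℝ)+1)) := by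
  induction b, hab using Nat.le_induction with
  | base =>
    rw [Finset.sum_Ioc_succ_top (by omega)]
    simp
  | succ n hn ih =>
    rw [Finset.sum_Ioc_succ_top (by omega)]
    have hn0 : (0:ℝ) < n := by exact_mod_cast (show 0 < n by omega)
    have ha0 : (0:ℝ) < (a:ℝ)+1 := by positivity
    have h1 : (1:ℝ)/((n+1:ℕ):ℝ) ≤ Real.log (((n+1:ℕ):ℝ)/n) := by
      have := Real.one_sub_inv_le_log_of_pos (x := ((n+1:ℕ):ℝ)/n) (by positivity)
      refine le_trans (le_of_eq ?_) this
      push_cast; field_simp; ring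
    have h2 : Real.log (((n+1:ℕ):ℝ)/((a:ℝ)+1)) = Real.log ((n:ℝ)/((a:ℝ)+1)) + Real.log (((n+1:ℕ):ℝ)/n) := by
      rw [← Real.log_mul (by positivity) (by positivity)]
      congr 1; field_simp
    rw [h2]; linarith

lemma inv_window (T : Finset ℕ) (A B : ℝ) (hA : 0 < A) (hAB : A ≤ B) (hT : ∀ n ∈ T, 1 ≤ n ∧ A < n ∧ (n:ℝ) ≤ B) :
    ∑ n ∈ T, (1:ℝ)/n ≤ 1 + Real.log (B/A) := by
  have hB : 0 < B := lt_of_lt_of_le hA hAB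
  have hsub : T ⊆ Finset.Ioc ⌊A⌋₊ ⌊B⌋₊ := by
    intro n hn
    obtain ⟨h1, h2, h3⟩ := hT n hn
    rw [Finset.mem_Ioc]
    exact ⟨(Nat.floor_lt hA.le).2 h2, Nat.le_floor h3⟩
  have h1 : ∑ n ∈ T, (1:ℝ)/n ≤ ∑ n ∈ Finset.Ioc ⌊A⌋₊ ⌊B⌋₊, (1:ℝ)/n :=
    Finset.sum_le_sum_of_subset_of_nonneg hsub (fun _ _ _ => by positivity)
  refine h1.trans ?_
  have hl : 0 ≤ Real.log (B/A) := Real.log_nonneg ((one_le_div hA).2 hAB)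
  by_cases h : ⌊A⌋₊ + 1 ≤ ⌊B⌋₊
  · refine (inv_Ioc _ _ h).trans ?_
    have h2 : A < (⌊A⌋₊:ℝ) + 1 := Nat.lt_floor_add_one A
    have h3 : (⌊B⌋₊:ℝ) ≤ B := Nat.floor_le hB.le
    have h4 : (0:ℝ) < ⌊B⌋₊ := by exact_mod_cast (show 0 < ⌊B⌋₊ by omega)
    apply add_le_add
    · rw [div_le_one (by positivity)]; linarith [Nat.cast_nonneg (α := ℝ) ⌊A⌋₊]
    · apply Real.log_le_log (by positivity)
      apply div_le_div₀ hB.le h3 hA h2.le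
  · rw [Finset.Ioc_eq_empty_of_le (by omega)]
    simp; linarith

lemma gcd_sum (d e V : ℕ) (hd : 1 ≤ d) (hdV : d ≤ V) :
    (Nat.gcd d e : ℝ) = ∑ g ∈ Finset.Icc 1 V, if g ∣ d ∧ g ∣ e then (Nat.totient g : ℝ) else 0 := by
  rw [← Finset.sum_filter]
  have := Nat.sum_totient (Nat.gcd d e)
  conv_lhs => rw [← this]
  push_cast
  refine Finset.sum_congr ?_ fun _ _ => rfl
  ext g
  simp only [Nat.mem_divisors, Finset.mem_filter, Finset.mem_Icc, Nat.dvd_gcd_iff]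
  constructor
  · rintro ⟨⟨h1, h2⟩, h3⟩
    exact ⟨⟨Nat.pos_of_dvd_of_pos h1 hd, (Nat.le_of_dvd hd h1).trans hdV⟩, h1, h2⟩
  · rintro ⟨_, h1, h2⟩
    exact ⟨⟨h1, h2⟩, fun h => by rw [Nat.gcd_eq_zero_iff] at h; omega⟩

/-- mean square of a divisor count -/
lemma dcount (D : Finset ℕ) (V K p : ℕ) (hp : 1 ≤ p) (hD : ∀ d ∈ D, 1 ≤ d ∧ d ≤ V ∧ Nat.Coprime p d) :
    ∑ k ∈ (Finset.Icc 1 K).filter (fun k => p ∣ k), ((D.filter (fun d => d ∣ k)).card : ℝ)^2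
      ≤ (K:ℝ)/p * ∑ g ∈ Finset.Icc 1 V, (Nat.totient g : ℝ) * (∑ d ∈ D.filter (fun d => g ∣ d), (1:ℝ)/d)^2 := by
  have hp0 : (0:ℝ) < p := by exact_mod_cast hp
  have e1 : ∀ k : ℕ, ((D.filter (fun d => d ∣ k)).card : ℝ)^2 = ∑ d ∈ D, ∑ e ∈ D, if d ∣ k ∧ e ∣ k then (1:ℝ) else 0 := by
    intro k
    rw [Finset.card_filter]
    push_cast
    rw [sq, Finset.sum_mul_sum]
    refine Finset.sum_congr rfl fun d _ => Finset.sum_congr rfl fun e _ => ?_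
    by_cases h1 : d ∣ k <;> by_cases h2 : e ∣ k <;> simp [h1, h2]
  simp_rw [e1]
  rw [Finset.sum_comm]
  have e2 : ∀ d ∈ D, ∑ k ∈ (Finset.Icc 1 K).filter (fun k => p ∣ k), ∑ e ∈ D, (if d ∣ k ∧ e ∣ k then (1:ℝ) else 0)
      ≤ ∑ e ∈ D, (K:ℝ)/p * ((Nat.gcd d e : ℝ) * (1/d * (1/e))) := by
    intro d hd
    rw [Finset.sum_comm]
    refine Finset.sum_le_sum fun e he => ?_
    obtain ⟨hd1, _, hdc⟩ := hD d hd
    obtain ⟨he1, _, hec⟩ := hD e he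
    rw [← Finset.sum_filter, Finset.sum_const, nsmul_eq_mul, mul_one, Finset.filter_filter]
    have hc : ((Finset.Icc 1 K).filter (fun k => p ∣ k ∧ d ∣ k ∧ e ∣ k)) ⊆ (Finset.Ioc 0 K).filter (fun k => p * Nat.lcm d e ∣ k) := by
      intro k hk
      rw [Finset.mem_filter, Finset.mem_Icc] at hk
      rw [Finset.mem_filter, Finset.mem_Ioc]
      refine ⟨⟨by omega, hk.1.2⟩, ?_⟩
      apply Nat.Coprime.mul_dvd_of_dvd_of_dvd _ hk.2.1 (Nat.lcm_dvd hk.2.2.1 hk.2.2.2)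
      exact Nat.Coprime.coprime_dvd_right (Nat.lcm_dvd_mul d e) (Nat.Coprime.mul_right hdc hec)
    have hc2 := Finset.card_le_card hc
    rw [Nat.Ioc_filter_dvd_card_eq_div] at hc2
    have hc3 : (((Finset.Icc 1 K).filter (fun k => p ∣ k ∧ d ∣ k ∧ e ∣ k)).card : ℝ) ≤ (K:ℝ) / ((p * Nat.lcm d e : ℕ):ℝ) :=
      le_trans (by exact_mod_cast hc2) Nat.cast_div_le
    refine hc3.trans (le_of_eq ?_)
    have hg : (Nat.gcd d e : ℝ) * (Nat.lcm d e : ℝ) = d * e := by exact_mod_cast Nat.gcd_mul_lcm d e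
    have hd0 : (0:ℝ) < d := by exact_mod_cast hd1
    have he0 : (0:ℝ) < e := by exact_mod_cast he1
    have hl0 : (0:ℝ) < (Nat.lcm d e : ℝ) := by exact_mod_cast Nat.lcm_pos hd1 he1
    push_cast
    field_simp
    linear_combination (-(K:ℝ)) * hg
  refine (Finset.sum_le_sum e2).trans ?_
  simp_rw [← Finset.mul_sum]
  apply mul_le_mul_of_nonneg_left _ (by positivity)
  apply le_of_eq
  have e3 : ∀ d ∈ D, ∑ e ∈ D, ((Nat.gcd d e : ℝ) * (1/d * (1/e))) = ∑ g ∈ Finset.Icc 1 V, (Nat.totient g : ℝ) * ((if g ∣ d then (1:ℝ)/d else 0) * ∑ e ∈ D, (if g ∣ e then (1:ℝ)/e else 0)) := by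
    intro d hd
    obtain ⟨hd1, hd2, hdc⟩ := hD d hd
    simp_rw [gcd_sum d _ V hd1 hd2, Finset.sum_mul]
    rw [Finset.sum_comm]
    refine Finset.sum_congr rfl fun g _ => ?_
    rw [Finset.mul_sum, Finset.mul_sum]
    refine Finset.sum_congr rfl fun e _ => ?_
    by_cases h1 : g ∣ d <;> by_cases h2 : g ∣ e <;> simp [h1, h2]
  rw [Finset.sum_congr rfl e3, Finset.sum_comm]
  refine Finset.sum_congr rfl fun g _ => ?_
  rw [← Finset.mul_sum, ← Finset.sum_mul, Finset.sum_filter, sq]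

def rough (p d : ℕ) : Prop := ∀ q : ℕ, q.Prime → q ∣ d → p < q

lemma rough_cop {p s m : ℕ} (hs : 1 ≤ s) (hsp : s ≤ p) (hm : rough p m) : Nat.Coprime s m := by
  rw [Nat.coprime_iff_gcd_eq_one]
  by_contra h
  obtain ⟨q, hq, hqd⟩ := Nat.exists_prime_and_dvd h
  have h1 := Nat.le_of_dvd hs (hqd.trans (Nat.gcd_dvd_left _ _))
  have h2 := hm q hq (hqd.trans (Nat.gcd_dvd_right _ _))
  omega

noncomputable def Hm (n : ℕ) : ℝ := ∑ s ∈ Finset.Icc 1 n, (1:ℝ)/s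

lemma Hm_eq (n : ℕ) : Hm n = (harmonic n : ℝ) := by
  unfold Hm
  rw [harmonic_eq_sum_Icc]
  push_cast
  simp [one_div]

lemma Hm_ge {n : ℕ} (hn : 1 ≤ n) : 1/2 + Real.log n ≤ Hm n := by
  have h1 := Real.eulerMascheroniConstant_lt_eulerMascheroniSeq' n
  have h2 := Real.one_half_lt_eulerMascheroniConstant
  unfold Real.eulerMascheroniSeq' at h1
  rw [if_neg (by omega)] at h1
  rw [Hm_eq]; linarith

lemma Hm_le (n : ℕ) : Hm n ≤ 1 + Real.log n := by
  rw [Hm_eq]; exact harmonic_le_one_add_log n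

lemma Hm_pos {n : ℕ} (hn : 1 ≤ n) : 1 ≤ Hm n := by
  unfold Hm
  have := Finset.single_le_sum (f := fun s : ℕ => (1:ℝ)/s) (s := Finset.Icc 1 n) (fun _ _ => by positivity) (Finset.mem_Icc.2 ⟨le_refl 1, hn⟩)
  simpa using this

lemma rough_window (p : ℕ) (hp : 1 ≤ p) (D : Finset ℕ) (A B : ℝ) (hA : 0 < A) (hAB : A ≤ B) 
    (hD : ∀ d ∈ D, 1 ≤ d ∧ A < d ∧ (d:ℝ) ≤ B ∧ rough p d) :
    ∑ d ∈ D, (1:ℝ)/d ≤ (1 + Real.log (p * B / A)) / Hm p := by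
  have hH := Hm_pos hp
  have hp1 : (1:ℝ) ≤ p := by exact_mod_cast hp
  rw [le_div_iff₀ (by linarith)]
  have hinj : Set.InjOn (fun z : ℕ × ℕ => z.1 * z.2) (D ×ˢ Finset.Icc 1 p : Finset (ℕ × ℕ)) := by
    rintro ⟨m, s⟩ h1 ⟨m', s'⟩ h2 h3
    simp only [Finset.coe_product, Set.mem_prod, Finset.mem_coe, Finset.mem_Icc] at h1 h2 h3
    have c1 := rough_cop h1.2.1 h1.2.2 (hD m' h2.1).2.2.2
    have c2 := rough_cop h2.2.1 h2.2.2 (hD m h1.1).2.2.2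
    have d1 : s ∣ s' := c1.dvd_of_dvd_mul_left (by rw [← h3]; exact dvd_mul_left _ _)
    have d2 : s' ∣ s := c2.dvd_of_dvd_mul_left (by rw [h3]; exact dvd_mul_left _ _)
    have : s = s' := Nat.dvd_antisymm d1 d2
    subst this
    have := Nat.eq_of_mul_eq_mul_right (by omega) h3
    rw [this]
  have h1 : (∑ d ∈ D, (1:ℝ)/d) * Hm p = ∑ n ∈ (D ×ˢ Finset.Icc 1 p).image (fun z : ℕ × ℕ => z.1 * z.2), (1:ℝ)/n := by
    rw [Finset.sum_image hinj, Finset.sum_product, Hm, Finset.sum_mul_sum]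
    refine Finset.sum_congr rfl fun d _ => Finset.sum_congr rfl fun s _ => ?_
    push_cast
    rw [div_mul_div_comm, one_mul]
  rw [h1]
  apply inv_window _ A (p*B) hA (by nlinarith)
  intro n hn
  rw [Finset.mem_image] at hn
  obtain ⟨z, hz, rfl⟩ := hn
  rw [Finset.mem_product, Finset.mem_Icc] at hz
  obtain ⟨d1, d2, d3, _⟩ := hD z.1 hz.1
  have s1 : (1:ℝ) ≤ z.2 := by exact_mod_cast hz.2.1
  have s2 : (z.2:ℝ) ≤ p := by exact_mod_cast hz.2.2
  have d1' : (1:ℝ) ≤ z.1 := by exact_mod_cast d1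
  refine ⟨Nat.mul_pos d1 hz.2.1, ?_, ?_⟩
  · push_cast; nlinarith
  · push_cast; nlinarith

/-- the window set -/
noncomputable def Dp (V p : ℕ) : Finset ℕ := by
  classical
  exact (Finset.Icc 1 V).filter (fun d => V < p * d ∧ rough p d)

lemma mem_Dp {V p d : ℕ} : d ∈ Dp V p ↔ (1 ≤ d ∧ d ≤ V) ∧ V < p * d ∧ rough p d := by
  unfold Dp; simp only [Finset.mem_filter, Finset.mem_Icc]

lemma Dp_cop {V p d : ℕ} (hp : 1 ≤ p) (hd : d ∈ Dp V p) : Nat.Coprime p d :=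
  rough_cop hp le_rfl (mem_Dp.1 hd).2.2

lemma Dp_sum (V p : ℕ) (hp : 2 ≤ p) (hpV : p ≤ V) :
    ∑ g ∈ Finset.Icc 1 V, (Nat.totient g : ℝ) * (∑ d ∈ (Dp V p).filter (fun d => g ∣ d), (1:ℝ)/d)^2
      ≤ 4 * (1 + 2 * Real.log V) / Hm p := by
  classical
  have hH := Hm_pos (n := p) (by omega)
  have hp0 : (0:ℝ) < p := by exact_mod_cast (show 0 < p by omega)
  have hp1 : (1:ℝ) ≤ p := by exact_mod_cast (show 1 ≤ p by omega)
  have hpV' : (p:ℝ) ≤ V := by exact_mod_cast hpV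
  have hV0 : (0:ℝ) < V := by linarith
  have hlp : 0 ≤ Real.log p := Real.log_nonneg hp1
  -- each window at most 2/g
  have hw : ∀ g ∈ Finset.Icc 1 V, ∑ d ∈ (Dp V p).filter (fun d => g ∣ d), (1:ℝ)/d ≤ 2 / g := by
    intro g hg
    have hg := (Finset.mem_Icc.1 hg).1
    have hg0 : (0:ℝ) < g := by exact_mod_cast hg
    have e : ∑ d ∈ (Dp V p).filter (fun d => g ∣ d), (1:ℝ)/d = 1/g * ∑ m ∈ ((Dp V p).filter (fun d => g ∣ d)).image (fun d => d / g), (1:ℝ)/m := by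
      rw [Finset.sum_image, Finset.mul_sum]
      · refine Finset.sum_congr rfl fun d hd => ?_
        obtain ⟨m, rfl⟩ := (Finset.mem_filter.1 hd).2
        rw [Nat.mul_div_cancel_left _ hg]
        push_cast; rw [div_mul_div_comm, one_mul]
      · intro d hd d' hd' h
        rw [Finset.mem_coe, Finset.mem_filter] at hd hd'
        obtain ⟨m, rfl⟩ := hd.2
        obtain ⟨m', rfl⟩ := hd'.2
        simp only [Nat.mul_div_cancel_left _ hg] at h
        rw [h]
    rw [e, div_mul_eq_mul_div, one_mul]
    apply div_le_div_of_nonneg_right _ hg0.le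
    refine (rough_window p (by omega) _ (V/(p*g)) (V/g) (by positivity) ?_ ?_).trans ?_
    · apply div_le_div_of_nonneg_left hV0.le hg0; nlinarith
    · intro m hm
      rw [Finset.mem_image] at hm
      obtain ⟨d, hd, rfl⟩ := hm
      obtain ⟨hd, m, rfl⟩ := Finset.mem_filter.1 hd
      rw [mem_Dp] at hd
      rw [Nat.mul_div_cancel_left _ hg]
      refine ⟨?_, ?_, ?_, ?_⟩
      · rcases Nat.eq_zero_or_pos m with h | h
        · rw [h] at hd; simp at hd
        · exact h
      · rw [div_lt_iff₀ (by positivity)]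
        have : ((V:ℕ):ℝ) < ((p * (g * m) : ℕ):ℝ) := by exact_mod_cast hd.2.1
        push_cast at this; nlinarith
      · rw [le_div_iff₀ hg0]
        have : ((g * m : ℕ):ℝ) ≤ V := by exact_mod_cast hd.1.2
        push_cast at this; linarith
      · intro q hq hqm
        exact hd.2.2 q hq (hqm.trans (dvd_mul_left _ _))
    · rw [show (p:ℝ) * (V/g) / (V/(p*g)) = p^2 by field_simp, Real.log_pow, div_le_iff₀ (by linarith)]
      have := Hm_ge (n := p) (by omega)
      push_cast; linarith
  have h0 : ∀ g ∈ Finset.Icc 1 V, ¬ rough p g → ∑ d ∈ (Dp V p).filter (fun d => g ∣ d), (1:ℝ)/d = 0 := by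
    intro g hg hr
    rw [Finset.filter_eq_empty_iff.2, Finset.sum_empty]
    intro d hd hgd
    apply hr
    intro q hq hqg
    exact (mem_Dp.1 hd).2.2 q hq (hqg.trans hgd)
  calc _ ≤ ∑ g ∈ Finset.Icc 1 V, (if rough p g then 4 * ((1:ℝ)/g) else 0) := by
        refine Finset.sum_le_sum fun g hg => ?_
        have hg0 : (0:ℝ) < g := by exact_mod_cast (Finset.mem_Icc.1 hg).1
        split_ifs with h
        · have h1 : (0:ℝ) ≤ ∑ d ∈ (Dp V p).filter (fun d => g ∣ d), (1:ℝ)/d := Finset.sum_nonneg fun _ _ => by positivity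
          have h2 : (∑ d ∈ (Dp V p).filter (fun d => g ∣ d), (1:ℝ)/d)^2 ≤ (2/g)^2 := pow_le_pow_left₀ h1 (hw g hg) 2
          have h3 : (Nat.totient g : ℝ) ≤ g := by exact_mod_cast Nat.totient_le g
          calc _ ≤ (g:ℝ) * (2/g)^2 := mul_le_mul h3 h2 (sq_nonneg _) hg0.le
            _ = _ := by field_simp; norm_num
        · rw [h0 g hg h]; simp
    _ = 4 * ∑ g ∈ (Finset.Icc 1 V).filter (fun g => rough p g), (1:ℝ)/g := by
        rw [← Finset.sum_filter, Finset.mul_sum]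
    _ ≤ 4 * ((1 + 2 * Real.log V)/Hm p) := by
        apply mul_le_mul_of_nonneg_left _ (by norm_num)
        have hb : ∀ A : ℝ, 0 < A → A < 1 → ∑ g ∈ (Finset.Icc 1 V).filter (fun g => rough p g), (1:ℝ)/g ≤ (1 + Real.log (p * V / A)) / Hm p := by
          intro A hA hA1
          apply rough_window p (by omega) _ A V hA (by linarith)
          intro d hd
          rw [Finset.mem_filter, Finset.mem_Icc] at hd
          have : (1:ℝ) ≤ d := by exact_mod_cast hd.1.1
          exact ⟨hd.1.1, by linarith, by exact_mod_cast hd.1.2, hd.2⟩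
        -- limit avoided : use strict slack through continuity
        have hlim : Filter.Tendsto (fun A : ℝ => (1 + Real.log (p * V / A)) / Hm p) (nhdsWithin 1 (Set.Iio 1)) (nhds ((1 + Real.log (p * V / 1)) / Hm p)) := by
          apply Filter.Tendsto.mono_left _ nhdsWithin_le_nhds
          apply ContinuousAt.tendsto
          have : (p * V / 1 : ℝ) ≠ 0 := by positivity
          fun_prop (disch := first | assumption | norm_num)
        have h1 : ∑ g ∈ (Finset.Icc 1 V).filter (fun g => rough p g), (1:ℝ)/g ≤ (1 + Real.log (p * V / 1)) / Hm p := by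
          apply ge_of_tendsto hlim
          have : Set.Ioo (0:ℝ) 1 ∈ nhdsWithin (1:ℝ) (Set.Iio 1) := Ioo_mem_nhdsLT (by norm_num)
          filter_upwards [this] with A hA
          exact hb A hA.1 hA.2
        refine h1.trans ?_
        apply div_le_div_of_nonneg_right _ (by linarith)
        rw [div_one, Real.log_mul (by positivity) (by positivity)]
        have := Real.log_le_log hp0 hpV'
        linarith
    _ = _ := by ring

lemma bU_apply (U k : ℕ) (hk : 1 ≤ k) : bU U k = ∑ d ∈ k.divisors, hi U mu d := by
  unfold bU ze
  rw [coe_mul_zeta_apply]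

lemma mu_pmul {p e : ℕ} (hp : p.Prime) (h : ¬ p ∣ e) : mu (p * e) = - mu e := by
  unfold mu
  have hc : Nat.Coprime p e := (Nat.Prime.coprime_iff_not_dvd hp).2 h
  simp only [ArithmeticFunction.intCoe_apply]
  rw [isMultiplicative_moebius.map_mul_of_coprime hc, moebius_apply_prime hp]
  push_cast; ring

lemma bU_le (U k : ℕ) (hk : 2 ≤ k) : |bU U k| ≤ (((Dp U k.minFac).filter (fun d => d ∣ k)).card : ℝ) := by
  classical
  set p := k.minFac with hp
  have hpp : p.Prime := Nat.minFac_prime (by omega)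
  rw [bU_apply U k (by omega)]
  set s := k.divisors.filter (fun d => ¬ p ∣ d) with hs
  have e1 : ∑ d ∈ k.divisors.filter (fun d => p ∣ d), hi U mu d = ∑ e ∈ s, hi U mu (p * e) := by
    symm
    rw [← Finset.sum_image (f := fun d => hi U mu d) (g := fun e => p * e)]
    · apply Finset.sum_subset
      · intro d hd
        rw [Finset.mem_image] at hd
        obtain ⟨e, he, rfl⟩ := hd
        rw [hs, Finset.mem_filter, Nat.mem_divisors] at he
        rw [Finset.mem_filter, Nat.mem_divisors]
        refine ⟨⟨?_, he.1.2⟩, dvd_mul_right _ _⟩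
        exact Nat.Coprime.mul_dvd_of_dvd_of_dvd ((Nat.Prime.coprime_iff_not_dvd hpp).2 he.2) (Nat.minFac_dvd k) he.1.1
      · intro d hd hd2
        rw [Finset.mem_filter, Nat.mem_divisors] at hd
        obtain ⟨⟨h1, h2⟩, e, rfl⟩ := hd
        rw [hi_apply]
        split_ifs with h
        · rfl
        · have hpe : p ∣ e := by
            by_contra hpe
            apply hd2
            rw [Finset.mem_image]
            refine ⟨e, ?_, rfl⟩
            rw [hs, Finset.mem_filter, Nat.mem_divisors]
            exact ⟨⟨(dvd_mul_left _ _).trans h1, h2⟩, hpe⟩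
          unfold mu
          simp only [ArithmeticFunction.intCoe_apply]
          rw [moebius_eq_zero_of_not_squarefree]
          · simp
          · intro hsq
            obtain ⟨f, rfl⟩ := hpe
            have := hsq p ⟨f, by ring⟩
            exact hpp.one_lt.ne' (Nat.isUnit_iff.1 this)
    · intro e _ e' _ h
      exact Nat.eq_of_mul_eq_mul_left hpp.pos h
  rw [← Finset.sum_filter_add_sum_filter_not k.divisors (fun d => p ∣ d), e1, ← Finset.sum_add_distrib]
  refine (Finset.abs_sum_le_sum_abs _ _).trans ?_
  have e2 : ∀ e ∈ s, |hi U mu (p * e) + hi U mu e| ≤ if e ∈ Dp U p then (1:ℝ) else 0 := by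
    intro e he
    rw [hs, Finset.mem_filter, Nat.mem_divisors] at he
    have he0 : 1 ≤ e := Nat.pos_of_ne_zero (fun h => by rw [h] at he; simp at he)
    have hpe : e ≤ p * e := Nat.le_mul_of_pos_left _ hpp.pos
    rw [hi_apply, hi_apply, mu_pmul hpp he.2]
    by_cases h1 : p * e ≤ U
    · rw [if_pos h1, if_pos (hpe.trans h1)]; simp; split_ifs <;> norm_num
    · rw [if_neg h1]
      by_cases h2 : e ≤ U
      · rw [if_pos h2, add_zero, abs_neg]
        rw [if_pos]
        · exact mu_abs e
        · rw [mem_Dp]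
          refine ⟨⟨he0, h2⟩, by omega, ?_⟩
          intro q hq hqe
          have h3 : p ≤ q := Nat.minFac_le_of_dvd hq.two_le (hqe.trans he.1.1)
          rcases h3.lt_or_eq with h4 | h4
          · exact h4
          · exact absurd (h4 ▸ hqe) he.2
      · rw [if_neg h2]; simp; split_ifs <;> norm_num
  refine (Finset.sum_le_sum e2).trans ?_
  rw [← Finset.sum_filter, Finset.sum_const, nsmul_eq_mul, mul_one]
  norm_cast
  apply Finset.card_le_card
  intro d hd
  rw [hs, Finset.mem_filter, Finset.mem_filter, Nat.mem_divisors] at hd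
  rw [Finset.mem_filter]
  exact ⟨hd.2, hd.1.1.1⟩

lemma Dp_big {U p : ℕ} (h : U < p) (k : ℕ) : ((Dp U p).filter (fun d => d ∣ k)).card ≤ 1 := by
  rw [Finset.card_le_one]
  have : ∀ d ∈ (Dp U p).filter (fun d => d ∣ k), d = 1 := by
    intro d hd
    have hd := mem_Dp.1 (Finset.mem_filter.1 hd).1
    by_contra h1
    obtain ⟨q, hq, hqd⟩ := Nat.exists_prime_and_dvd h1
    have h2 := hd.2.2 q hq hqd
    have h3 := Nat.le_of_dvd hd.1.1 hqd
    omega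
  intro a ha b hb
  rw [this a ha, this b hb]

lemma Hm_tel (V : ℕ) (hV : 1 ≤ V) : ∑ p ∈ Finset.Icc 2 V, (1:ℝ)/(p * Hm p) ≤ Real.log (Hm V) := by
  induction V, hV using Nat.le_induction with
  | base => simp [Hm]
  | succ n hn ih =>
    rw [← Finset.insert_Icc_right_eq_Icc_add_one (by omega), Finset.sum_insert (by simp)]
    have h1 := Hm_pos hn
    have e : Hm (n+1) = Hm n + 1/((n+1:ℕ):ℝ) := by
      unfold Hm
      rw [Finset.sum_Icc_succ_top (by omega)]
    have hn1 : (0:ℝ) < ((n+1:ℕ):ℝ) := by positivity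
    have h2 : Hm n < Hm (n+1) := by rw [e]; have : 0 < 1/((n+1:ℕ):ℝ) := by positivity
                                    linarith
    have h3 := Real.one_sub_inv_le_log_of_pos (x := Hm (n+1) / Hm n) (by apply div_pos <;> linarith)
    rw [Real.log_div (by linarith) (by linarith)] at h3
    have h4 : 1 - (Hm (n+1) / Hm n)⁻¹ = 1/(((n+1:ℕ):ℝ) * Hm (n+1)) := by
      rw [inv_div]
      have : Hm (n+1) ≠ 0 := by linarith
      field_simp
      rw [e]; field_simp; ring
    rw [h4] at h3
    linarith

lemma bU_ms (U K : ℕ) (hU : 1 ≤ U) :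
    nn (Finset.Icc 1 K) (fun k => ((bU U k : ℝ):ℂ)) ≤ (1 + 4 * (1 + 2 * Real.log U) * Real.log (1 + Real.log U)) * K := by
  classical
  have hU1 : (1:ℝ) ≤ U := by exact_mod_cast hU
  have hlU : 0 ≤ Real.log U := Real.log_nonneg hU1
  set c : ℕ → ℝ := fun k => (((Dp U k.minFac).filter (fun d => d ∣ k)).card : ℝ) with hc
  have h1 : ∀ k ∈ Finset.Icc 1 K, ‖((bU U k : ℝ):ℂ)‖^2 ≤ (1:ℝ) + (if 2 ≤ k ∧ k.minFac ≤ U then c k^2 else 0) := by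
    intro k hk
    have hk := (Finset.mem_Icc.1 hk).1
    rw [Complex.norm_real, Real.norm_eq_abs]
    rcases hk.lt_or_eq with h2 | h2
    · have h3 := bU_le U k h2
      by_cases h4 : k.minFac ≤ U
      · rw [if_pos ⟨h2, h4⟩]
        have : |bU U k|^2 ≤ c k^2 := pow_le_pow_left₀ (abs_nonneg _) h3 2
        linarith
      · rw [if_neg (fun h => h4 h.2)]
        have h5 := Dp_big (not_le.1 h4) k
        have h6 : |bU U k| ≤ 1 := h3.trans (by exact_mod_cast h5)
        have := pow_le_pow_left₀ (abs_nonneg _) h6 2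
        linarith
    · rw [← h2, bU_apply U 1 le_rfl]
      simp [hi_apply, hU]
  unfold nn
  refine (Finset.sum_le_sum h1).trans ?_
  rw [Finset.sum_add_distrib]
  have hA : ∑ k ∈ Finset.Icc 1 K, (1:ℝ) = K := by simp
  rw [hA, ← Finset.sum_filter]
  have hB : ∑ k ∈ (Finset.Icc 1 K).filter (fun k => 2 ≤ k ∧ k.minFac ≤ U), c k^2
      ≤ ∑ p ∈ Finset.Icc 2 U, (K:ℝ) * (4 * (1 + 2 * Real.log U)) * (1/(p * Hm p)) := by
    rw [← Finset.sum_fiberwise_of_maps_to (t := Finset.Icc 2 U) (g := fun k : ℕ => k.minFac)]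
    · refine Finset.sum_le_sum fun p hp => ?_
      rw [Finset.mem_Icc] at hp
      calc _ ≤ ∑ k ∈ (Finset.Icc 1 K).filter (fun k => p ∣ k), (((Dp U p).filter (fun d => d ∣ k)).card : ℝ)^2 := by
            rw [Finset.filter_filter]
            calc _ = ∑ k ∈ (Finset.Icc 1 K).filter (fun k => (2 ≤ k ∧ k.minFac ≤ U) ∧ k.minFac = p), (((Dp U p).filter (fun d => d ∣ k)).card : ℝ)^2 := by
                  refine Finset.sum_congr rfl fun k hk => ?_
                  rw [hc]; simp only
                  rw [(Finset.mem_filter.1 hk).2.2]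
              _ ≤ _ := by
                  apply Finset.sum_le_sum_of_subset_of_nonneg
                  · intro k hk
                    rw [Finset.mem_filter] at hk ⊢
                    exact ⟨hk.1, hk.2.2 ▸ Nat.minFac_dvd k⟩
                  · intros; positivity
        _ ≤ _ := dcount (Dp U p) U K p (by omega) (fun d hd => ⟨(mem_Dp.1 hd).1.1, (mem_Dp.1 hd).1.2, Dp_cop (by omega) hd⟩)
        _ ≤ (K:ℝ)/p * (4 * (1 + 2 * Real.log U) / Hm p) := mul_le_mul_of_nonneg_left (Dp_sum U p hp.1 hp.2) (by positivity)
        _ = _ := by rw [div_mul_div_comm, mul_one_div]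
    · intro k hk
      rw [Finset.mem_filter] at hk
      rw [Finset.mem_Icc]
      exact ⟨(Nat.minFac_prime (by omega)).two_le, hk.2.2⟩
  rw [← Finset.mul_sum] at hB
  have hC : ∑ p ∈ Finset.Icc 2 U, (1:ℝ)/(p * Hm p) ≤ Real.log (1 + Real.log U) := by
    refine (Hm_tel U hU).trans ?_
    exact Real.log_le_log (by linarith [Hm_pos hU]) (Hm_le U)
  have hD := mul_le_mul_of_nonneg_left hC (show 0 ≤ (K:ℝ) * (4 * (1 + 2 * Real.log U)) by positivity)
  nlinarith

end BV

namespace BV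

lemma log_lin {w : ℝ} (hw : 0 < w) : Real.log w ≤ w/100 + 4 := by
  have h1 := Real.log_le_sub_one_of_pos (x := w/100) (by positivity)
  rw [Real.log_div (by positivity) (by norm_num)] at h1
  have h2 : Real.log 100 ≤ 5 := by
    have : Real.log 100 ≤ Real.log ((2:ℝ)^7) := Real.log_le_log (by norm_num) (by norm_num)
    rw [Real.log_pow] at this
    have h3 := Real.log_two_lt_d9
    push_cast at this; linarith
  linarith

lemma cheb3 (M : ℕ) (hM : 262144 ≤ M) : ∑ n ∈ Finset.Ioc M (2*M), Λ n ≤ 3 * M := by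
  have hM' : (262144:ℝ) ≤ M := by exact_mod_cast hM
  have h1 := Chebyshev.psi_le (x := ((2*M:ℕ):ℝ)) (by push_cast; linarith)
  rw [Chebyshev.psi_eq_sum_Icc, Nat.floor_natCast] at h1
  have h2 : ∑ n ∈ Finset.Ioc M (2*M), Λ n ≤ ∑ n ∈ Finset.Icc 0 (2*M), Λ n := by
    apply Finset.sum_le_sum_of_subset_of_nonneg
    · intro n hn; rw [Finset.mem_Ioc] at hn; rw [Finset.mem_Icc]; omega
    · intros; exact vonMangoldt_nonneg
  refine h2.trans (h1.trans ?_)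
  push_cast
  set w := √(2 * (M:ℝ)) with hw
  have hww : w^2 = 2 * M := Real.sq_sqrt (by positivity)
  have hw1 : 700 ≤ w := by
    rw [hw]; apply Real.le_sqrt_of_sq_le; linarith
  have hl : Real.log (2 * (M:ℝ)) ≤ w/50 + 8 := by
    rw [← hww, Real.log_pow]
    have := log_lin (w := w) (by linarith)
    push_cast; linarith
  have h4 : Real.log 4 ≤ 1.3863 := by
    rw [show (4:ℝ) = 2^2 by norm_num, Real.log_pow]
    have h3 := Real.log_two_lt_d9
    push_cast; linarith
  have h5 : 2 * w * Real.log (2 * (M:ℝ)) ≤ 2 * w * (w/50 + 8) := mul_le_mul_of_nonneg_left hl (by positivity)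
  rw [show (3:ℝ) * M = 3/2 * w^2 by rw [hww]; ring]
  rw [← hww] at h5 ⊢
  nlinarith

lemma bU_zero (U k : ℕ) (hk : k ≤ U) : bU U k = 0 := by
  rcases Nat.eq_zero_or_pos k with rfl | h
  · simp
  · rw [bU_apply U k h]
    apply Finset.sum_eq_zero
    intro d hd
    rw [hi_apply, if_pos ((Nat.divisor_le hd).trans hk)]

noncomputable def Cb (U : ℕ) : ℝ := 1 + 4 * (1 + 2 * Real.log U) * Real.log (1 + Real.log U)
lemma Cb_ge {U : ℕ} (hU : 1 ≤ U) : 1 ≤ Cb U := by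
  unfold Cb
  have hU1 : (1:ℝ) ≤ U := by exact_mod_cast hU
  have hlU : 0 ≤ Real.log U := Real.log_nonneg hU1
  have : 0 ≤ Real.log (1 + Real.log U) := Real.log_nonneg (by linarith)
  have : 0 ≤ 4 * (1 + 2 * Real.log U) * Real.log (1 + Real.log U) := by positivity
  linarith

namespace Fam
variable {ι : Type} (F : Fam ι)

lemma S4 {x : ℝ} (hx : 1 ≤ x) (U : ℕ) (hU : 262144 ≤ U) (Y : ι → ℕ) (hY : ∀ i ∈ F.s, (Y i : ℝ) ≤ x) :
    ∑ i ∈ F.s, F.w i * ‖∑ p ∈ prs (Y i), ((hi U Λ p.1 : ℝ) : ℂ) * ((bU U p.2 : ℝ):ℂ) * F.χ i (p.1 * p.2)‖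
      ≤ √(3 * Real.log x * Cb U * x) * F.dyB x U := by
  have hU0 : (0:ℝ) < U := by exact_mod_cast (show 0 < U by omega)
  have hlx : 0 ≤ Real.log x := Real.log_nonneg hx
  set V := ⌊x / U⌋₊ with hV
  have hVx : (V:ℝ) ≤ x / U := Nat.floor_le (by positivity)
  set a : ℕ → ℂ := fun m => if m ≤ V then ((hi U Λ m : ℝ):ℂ) else 0 with ha
  have key := F.dyad hx a (fun k => ((bU U k : ℝ):ℂ)) U V (by omega) (hVx.trans (by
      apply div_le_div_of_nonneg_right _ hU0.le; linarith)) (3 * Real.log x) (Cb U) (by positivity) (by linarith [Cb_ge (U := U) (by omega)])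
      (by
        intro m hm
        rw [ha] at hm
        simp only [ne_eq, ite_eq_right_iff, hi_apply, not_forall] at hm
        obtain ⟨h1, h2⟩ := hm
        refine ⟨?_, h1⟩
        by_contra h3
        rw [if_pos (by omega)] at h2
        simp at h2)
      (by
        intro M hM hMx
        calc nn (Finset.Ioc M (2*M)) a ≤ ∑ n ∈ Finset.Ioc M (2*M), Real.log x * Λ n := by
              unfold nn
              refine Finset.sum_le_sum fun n hn => ?_
              rw [Finset.mem_Ioc] at hn
              have hL := vonMangoldt_nonneg (n := n)
              rw [ha]; simp only
              split_ifs with h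
              · rw [hi_apply, if_neg (by omega), Complex.norm_real, Real.norm_eq_abs, sq_abs, sq]
                apply mul_le_mul_of_nonneg_right _ hL
                refine vonMangoldt_le_log.trans ?_
                apply Real.log_le_log (by exact_mod_cast (show 0 < n by omega))
                have : (n:ℝ) ≤ V := by exact_mod_cast h
                refine this.trans (hVx.trans ?_)
                apply div_le_self (by linarith)
                exact_mod_cast (show 1 ≤ U by omega)
              · simp; positivity
          _ ≤ _ := by
              rw [← Finset.mul_sum]
              have := mul_le_mul_of_nonneg_left (cheb3 M (by omega)) hlx
              linarith)
      (fun K => bU_ms U K (by omega)) Y hY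
  refine le_trans (le_of_eq ?_) key
  refine Finset.sum_congr rfl fun i hi' => ?_
  congr 2
  refine Finset.sum_congr rfl fun p hp => ?_
  have hp := mem_prs.1 hp
  rw [ha]; simp only
  split_ifs with h
  · rfl
  · have : bU U p.2 = 0 := by
      apply bU_zero
      by_contra h3
      apply h
      rw [hV]
      apply Nat.le_floor
      rw [le_div_iff₀ hU0]
      refine le_trans ?_ (hY i hi')
      have : p.1 * U ≤ Y i := le_trans (Nat.mul_le_mul_left _ (by omega)) hp.2.2
      exact_mod_cast this
    rw [this]; simp

end Fam
end BV

namespace BV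

/-- high frequencies -/
noncomputable def hs (K N : ℕ) : Finset ℤ := (Finset.Icc (-(N:ℤ)) N).filter (fun k => (K:ℤ) < |k|)

namespace Fam
variable {ι : Type} (F : Fam ι)

lemma hs_sum (δ : ℝ) (f : ℤ → ℝ) (K N : ℕ) :
    ∑ k ∈ hs K N, gam δ k * f k = ∑ n ∈ Finset.Ioc K N, gam δ n * (f n + f (-n)) := by
  unfold hs
  rw [Finset.sum_filter]
  have := sum_gam_symm δ (fun k => if (K:ℤ) < |k| then f k else 0) N
  simp only [abs_zero, abs_neg, Nat.abs_cast, Nat.cast_lt] at this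
  rw [if_neg (by omega), zero_add] at this
  refine Eq.trans ?_ (this.trans ?_)
  · refine Finset.sum_congr rfl fun k _ => ?_
    split_ifs <;> simp
  · have e : Finset.Ioc K N = (Finset.Ioc 0 N).filter (fun n => K < n) := by
      ext n; simp only [Finset.mem_Ioc, Finset.mem_filter]; omega
    rw [e, Finset.sum_filter]
    refine Finset.sum_congr rfl fun n _ => ?_
    split_ifs <;> simp

lemma ls_sum (δ : ℝ) (f : ℤ → ℝ) (K N : ℕ) (hf : ∀ k, 0 ≤ f k) (hδ : 0 ≤ δ) :
    ∑ k ∈ Finset.Icc (-(N:ℤ)) N, gam δ k * f k ≤ f 0 + ∑ n ∈ Finset.Ioc 0 K, gam δ n * (f n + f (-n)) + ∑ k ∈ hs K N, gam δ k * f k := by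
  rw [hs_sum, sum_gam_symm, add_assoc]
  apply add_le_add le_rfl
  have hnn : ∀ n : ℕ, 0 ≤ gam δ n * (f n + f (-n)) := fun n => mul_nonneg (gam_nonneg hδ _) (add_nonneg (hf _) (hf _))
  rw [← Finset.sum_union]
  · apply Finset.sum_le_sum_of_subset_of_nonneg
    · intro n hn
      simp only [Finset.mem_union, Finset.mem_Ioc] at hn ⊢; omega
    · intro n _ _; exact hnn n
  · rw [Finset.disjoint_left]
    intro n h1 h2
    simp only [Finset.mem_Ioc] at h1 h2; omega

lemma hs_En {x : ℝ} (hx : 1 ≤ x) (S : Finset ℕ) (a : ℕ → ℂ) (M : ℕ) (hS : S ⊆ Finset.Icc 1 M)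
    (hM : (M:ℝ) ≤ 4 * x) (K N : ℕ) :
    ∑ k ∈ hs K N, gam (dx x) k * F.En x S a k ≤ (ep x K * M + kp x * (F.Z + 1)) * nn S a := by
  rw [hs_sum]; exact F.En_high hx S a M hS hM K N

/-- grouping of two polynomials -/
lemma group {i : ι} (hi : i ∈ F.s) (S T : Finset ℕ) (M1 M2 : ℕ) (hS : S ⊆ Finset.Icc 1 M1) (hT : T ⊆ Finset.Icc 1 M2)
    (a b : ℕ → ℂ) (t : ℝ) :
    F.A S a t i * F.A T b t i = F.A (Finset.Icc 1 (M1 * M2)) (fun m => ∑ p ∈ (S ×ˢ T).filter (fun p => p.1 * p.2 = m), a p.1 * b p.2) t i := by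
  have hS0 : ∀ m ∈ S, m ≠ 0 := fun m hm => by have := Finset.mem_Icc.1 (hS hm); omega
  have hT0 : ∀ m ∈ T, m ≠ 0 := fun m hm => by have := Finset.mem_Icc.1 (hT hm); omega
  rw [← F.prod_poly hi S T hS0 hT0 a b t]
  unfold A
  rw [← Finset.sum_fiberwise_of_maps_to (t := Finset.Icc 1 (M1*M2)) (g := fun p : ℕ × ℕ => p.1 * p.2)]
  · refine Finset.sum_congr rfl fun m _ => ?_
    rw [Finset.sum_mul, Finset.sum_mul]
    refine Finset.sum_congr rfl fun p hp => ?_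
    rw [(Finset.mem_filter.1 hp).2]
  · intro p hp
    have h1 := Finset.mem_Icc.1 (hS (Finset.mem_product.1 hp).1)
    have h2 := Finset.mem_Icc.1 (hT (Finset.mem_product.1 hp).2)
    rw [Finset.mem_Icc]
    exact ⟨Nat.mul_pos h1.1 h2.1, Nat.mul_le_mul h1.2 h2.2⟩

lemma tri_poly {i : ι} (hi : i ∈ F.s) (S T R : Finset ℕ) (hS : ∀ m ∈ S, m ≠ 0) (hT : ∀ m ∈ T, m ≠ 0) (hR : ∀ m ∈ R, m ≠ 0) (a b : ℕ → ℂ) (t : ℝ) :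
    ∑ p ∈ (S ×ˢ T) ×ˢ R, a p.1.1 * b p.1.2 * F.χ i (p.1.1 * p.1.2 * p.2) * tw t (p.1.1 * p.1.2 * p.2)
      = F.A S a t i * F.A T b t i * F.A R (fun _ => 1) t i := by
  rw [← F.prod_poly hi S T hS hT a b t]
  unfold A
  rw [Finset.sum_mul_sum, Finset.sum_product]
  refine Finset.sum_congr rfl fun m hm => Finset.sum_congr rfl fun n hn => ?_
  have hm' := Finset.mem_product.1 hm
  rw [tw_mul _ (Nat.mul_ne_zero (hS _ hm'.1) (hT _ hm'.2)) (hR n hn), F.hmul i hi]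
  ring

lemma cs_w (S T : Finset ℕ) (a b : ℕ → ℂ) (M1 M2 : ℕ) (hS : S ⊆ Finset.Icc 1 M1) (hT : T ⊆ Finset.Icc 1 M2) (t : ℝ) :
    ∑ i ∈ F.s, F.w i * (‖F.A S a t i‖ * ‖F.A T b t i‖) ≤ √((M1 + F.Z) * nn S a) * √((M2 + F.Z) * nn T b) := by
  have h1 := F.LSt S a M1 hS t
  have h2 := F.LSt T b M2 hT t
  have h3 := Finset.sum_mul_sq_le_sq_mul_sq F.s (fun i => √(F.w i) * ‖F.A S a t i‖) (fun i => √(F.w i) * ‖F.A T b t i‖)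
  have e1 : ∑ i ∈ F.s, F.w i * (‖F.A S a t i‖ * ‖F.A T b t i‖) = ∑ i ∈ F.s, (√(F.w i) * ‖F.A S a t i‖) * (√(F.w i) * ‖F.A T b t i‖) := by
    refine Finset.sum_congr rfl fun i hi => ?_
    have := Real.mul_self_sqrt (F.hw i hi)
    linear_combination (-(‖F.A S a t i‖ * ‖F.A T b t i‖)) * this
  have e2 : ∀ (S : Finset ℕ) (a : ℕ → ℂ), ∑ i ∈ F.s, (√(F.w i) * ‖F.A S a t i‖)^2 = ∑ i ∈ F.s, F.w i * ‖F.A S a t i‖^2 := by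
    intro S a
    refine Finset.sum_congr rfl fun i hi => ?_
    rw [mul_pow, Real.sq_sqrt (F.hw i hi)]
  rw [e2, e2] at h3
  have hp : 0 ≤ ∑ i ∈ F.s, F.w i * ‖F.A S a t i‖^2 := Finset.sum_nonneg fun i hi => mul_nonneg (F.hw i hi) (sq_nonneg _)
  have hq : 0 ≤ ∑ i ∈ F.s, F.w i * ‖F.A T b t i‖^2 := Finset.sum_nonneg fun i hi => mul_nonneg (F.hw i hi) (sq_nonneg _)
  rw [e1, ← Real.sqrt_mul (hp.trans h1)]
  apply Real.le_sqrt_of_sq_le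
  exact h3.trans (mul_le_mul h1 h2 hq (hp.trans h1))

/-- trilinear separation with low frequencies treated by Polya-Vinogradov -/
lemma trilin {x : ℝ} (hx : 1 ≤ x) (hP : 0 ≤ F.P) (S T : Finset ℕ) (a b : ℕ → ℂ) (M1 M2 N : ℕ) (hS : S ⊆ Finset.Icc 1 M1)
    (hT : T ⊆ Finset.Icc 1 M2) (hN : 1 ≤ N) (hx4 : (M1:ℝ) * M2 * N ≤ 4 * x) (K : ℕ) (Y : ι → ℕ) (hY : ∀ i ∈ F.s, (Y i : ℝ) ≤ x) (H : ℝ)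
    (hH : ∀ N' : ℕ, ∑ k ∈ hs K N', gam (dx x) k * ∑ i ∈ F.s, F.w i *
      (‖F.A S a (fr (Lx x) k) i‖ * ‖F.A T b (fr (Lx x) k) i‖ * ‖F.A (Finset.Icc 1 N) (fun _ => 1) (fr (Lx x) k) i‖) ≤ H) :
    ∑ i ∈ F.s, F.w i * ‖∑ p ∈ ((S ×ˢ T) ×ˢ Finset.Icc 1 N).filter (fun p => p.1.1 * p.1.2 * p.2 ≤ Y i), a p.1.1 * b p.1.2 * F.χ i (p.1.1 * p.1.2 * p.2)‖
      ≤ F.P * (e0 K + 4 * K * Real.log N / Lx x) * (√((M1 + F.Z) * nn S a) * √((M2 + F.Z) * nn T b)) + H := by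
  have hL := Lx_gt hx
  have hd := dx_pos hx
  have hpi := Real.pi_pos
  have hS0 : ∀ m ∈ S, m ≠ 0 := fun m hm => by have := Finset.mem_Icc.1 (hS hm); omega
  have hT0 : ∀ m ∈ T, m ≠ 0 := fun m hm => by have := Finset.mem_Icc.1 (hT hm); omega
  have hR0 : ∀ m ∈ Finset.Icc 1 N, m ≠ 0 := fun m hm => by have := Finset.mem_Icc.1 hm; omega
  have hlN : 0 ≤ Real.log N := Real.log_natCast_nonneg N
  set G := √((M1 + F.Z) * nn S a) * √((M2 + F.Z) * nn T b) with hG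
  have hG0 : 0 ≤ G := by positivity
  refine F.sepsum hx ((S ×ˢ T) ×ˢ Finset.Icc 1 N) (fun p => p.1.1 * p.1.2 * p.2) (fun i p => a p.1.1 * b p.1.2 * F.χ i (p.1.1 * p.1.2 * p.2)) ?_ Y hY _ ?_
  · intro p hp
    rw [Finset.mem_product, Finset.mem_product] at hp
    have h1 := Finset.mem_Icc.1 (hS hp.1.1)
    have h2 := Finset.mem_Icc.1 (hT hp.1.2)
    have h3 := Finset.mem_Icc.1 hp.2
    refine ⟨Nat.mul_pos (Nat.mul_pos h1.1 h2.1) h3.1, ?_⟩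
    have : p.1.1 * p.1.2 * p.2 ≤ M1 * M2 * N := Nat.mul_le_mul (Nat.mul_le_mul h1.2 h2.2) h3.2
    refine le_trans ?_ hx4
    exact_mod_cast this
  · intro N'
    set f : ℤ → ℝ := fun k => ∑ i ∈ F.s, F.w i *
      (‖F.A S a (fr (Lx x) k) i‖ * ‖F.A T b (fr (Lx x) k) i‖ * ‖F.A (Finset.Icc 1 N) (fun _ => 1) (fr (Lx x) k) i‖) with hf
    have e : ∑ k ∈ Finset.Icc (-(N':ℤ)) N', gam (dx x) k * ∑ i ∈ F.s, F.w i * ‖∑ p ∈ (S ×ˢ T) ×ˢ Finset.Icc 1 N, a p.1.1 * b p.1.2 * F.χ i (p.1.1 * p.1.2 * p.2) * tw (fr (Lx x) k) (p.1.1 * p.1.2 * p.2)‖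
        = ∑ k ∈ Finset.Icc (-(N':ℤ)) N', gam (dx x) k * f k := by
      refine Finset.sum_congr rfl fun k _ => ?_
      congr 1
      refine Finset.sum_congr rfl fun i hi => ?_
      rw [F.tri_poly hi S T _ hS0 hT0 hR0, norm_mul, norm_mul]
    rw [e]
    have hf0 : ∀ k, 0 ≤ f k := fun k => Finset.sum_nonneg fun i hi => mul_nonneg (F.hw i hi) (by positivity)
    have hfb : ∀ k : ℤ, f k ≤ F.P * (1 + |fr (Lx x) k| * Real.log N) * G := by
      intro k
      refine le_trans ?_ (mul_le_mul_of_nonneg_left (F.cs_w S T a b M1 M2 hS hT (fr (Lx x) k)) (by positivity))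
      rw [Finset.mul_sum, hf]
      refine Finset.sum_le_sum fun i hi => ?_
      have h1 : ‖F.A (Finset.Icc 1 N) (fun _ => 1) (fr (Lx x) k) i‖ ≤ F.P * (1 + |fr (Lx x) k| * Real.log N) := by
        have := F.tw_psum hi (fr (Lx x) k) N hN
        unfold A
        simpa only [one_mul] using this
      have h2 : 0 ≤ F.w i * (‖F.A S a (fr (Lx x) k) i‖ * ‖F.A T b (fr (Lx x) k) i‖) := mul_nonneg (F.hw i hi) (by positivity)
      have := mul_le_mul_of_nonneg_left h1 h2
      calc _ = F.w i * (‖F.A S a (fr (Lx x) k) i‖ * ‖F.A T b (fr (Lx x) k) i‖) * ‖F.A (Finset.Icc 1 N) (fun _ => 1) (fr (Lx x) k) i‖ := by ring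
        _ ≤ _ := this
        _ = _ := by ring
    refine (ls_sum (dx x) f K N' hf0 hd.le).trans ?_
    apply add_le_add _ (hH N')
    have hfr : ∀ k : ℤ, |fr (Lx x) k| = 2 * π * |(k:ℝ)| / Lx x := by
      intro k
      unfold fr
      rw [abs_div, abs_mul, abs_mul, abs_of_pos hpi, abs_of_pos (show 0 < Lx x by linarith)]
      norm_num
    have h0 : f 0 ≤ F.P * G := by
      refine (hfb 0).trans (le_of_eq ?_)
      rw [hfr]; simp
    have h1 : ∑ n ∈ Finset.Ioc 0 K, gam (dx x) (n:ℤ) * (f n + f (-n)) ≤ ∑ n ∈ Finset.Ioc 0 K, (F.P * G) * (2/π * (1/(n:ℝ)) + 4 * Real.log N / Lx x) := by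
      refine Finset.sum_le_sum fun n hn => ?_
      have hn1 : 1 ≤ n := by have := Finset.mem_Ioc.1 hn; omega
      have hn0 : (0:ℝ) < n := by exact_mod_cast hn1
      have hg : gam (dx x) (n:ℤ) ≤ 1/(π * n) := by rw [gam_nat hn1]; exact min_le_left _ _
      have h2 : f n + f (-n) ≤ 2 * (F.P * (1 + (2 * π * n / Lx x) * Real.log N) * G) := by
        have ha := hfb n
        have hb := hfb (-n)
        rw [hfr] at ha hb
        simp only [Int.cast_natCast, Int.cast_neg, abs_neg, Nat.abs_cast] at ha hb
        linarith
      calc _ ≤ 1/(π * n) * (2 * (F.P * (1 + (2 * π * n / Lx x) * Real.log N) * G)) := mul_le_mul hg h2 (add_nonneg (hf0 _) (hf0 _)) (by positivity)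
        _ = _ := by field_simp; ring
    rw [← Finset.mul_sum, Finset.sum_add_distrib, ← Finset.mul_sum] at h1
    have h2 := harm_Ioc K
    have h3 : 2/π * ∑ n ∈ Finset.Ioc 0 K, 1/(n:ℝ) ≤ 2/π * (1 + Real.log K) := mul_le_mul_of_nonneg_left h2 (by positivity)
    simp only [Finset.sum_const, Nat.card_Ioc, nsmul_eq_mul, Nat.sub_zero] at h1
    have h4 : (F.P * G) * (2/π * ∑ n ∈ Finset.Ioc 0 K, 1/(n:ℝ) + K * (4 * Real.log N / Lx x)) ≤ (F.P * G) * (2/π * (1 + Real.log K) + K * (4 * Real.log N / Lx x)) :=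
      mul_le_mul_of_nonneg_left (by linarith) (by positivity)
    unfold e0
    calc _ ≤ F.P * G + (F.P * G) * (2/π * (1 + Real.log K) + K * (4 * Real.log N / Lx x)) := add_le_add h0 (h1.trans h4)
      _ = _ := by ring

/-- high part with the pair (T, Icc) grouped -/
lemma high_pair {x : ℝ} (hx : 1 ≤ x) (S T : Finset ℕ) (a b : ℕ → ℂ) (M1 M2 N : ℕ) (hS : S ⊆ Finset.Icc 1 M1)
    (hT : T ⊆ Finset.Icc 1 M2) (hM1 : (M1:ℝ) ≤ 4*x) (hM2 : ((M2 * N : ℕ):ℝ) ≤ 4*x) (K N' : ℕ) (n1 n2 : ℝ) (hn1 : nn S a ≤ n1)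
    (hn2 : nn (Finset.Icc 1 (M2*N)) (fun m => ∑ p ∈ (T ×ˢ Finset.Icc 1 N).filter (fun p => p.1 * p.2 = m), b p.1 * 1) ≤ n2) :
    ∑ k ∈ hs K N', gam (dx x) k * ∑ i ∈ F.s, F.w i *
      (‖F.A S a (fr (Lx x) k) i‖ * ‖F.A T b (fr (Lx x) k) i‖ * ‖F.A (Finset.Icc 1 N) (fun _ => 1) (fr (Lx x) k) i‖) 
      ≤ √((ep x K * M1 + kp x * (F.Z+1)) * n1) * √((ep x K * ((M2 * N : ℕ):ℝ) + kp x * (F.Z+1)) * n2) := by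
  have hZ := F.hZ
  have h1 := F.hs_En hx S a M1 hS hM1 K N'
  have h2 := F.hs_En hx (Finset.Icc 1 (M2*N)) (fun m => ∑ p ∈ (T ×ˢ Finset.Icc 1 N).filter (fun p => p.1 * p.2 = m), b p.1 * 1) (M2*N) (le_refl _) hM2 K N'
  have he := ep_nonneg hx K
  have hk := kp_nonneg hx
  have h1' := h1.trans (mul_le_mul_of_nonneg_left hn1 (by positivity))
  have h2' := h2.trans (mul_le_mul_of_nonneg_left hn2 (by positivity))
  refine le_trans (le_of_eq ?_) (F.cs_gam x hx S _ a _ (hs K N') h1' h2')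
  refine Finset.sum_congr rfl fun k _ => ?_
  congr 1
  refine Finset.sum_congr rfl fun i hi => ?_
  have hg := F.group hi T (Finset.Icc 1 N) M2 N hT (le_refl _) b (fun _ => 1) (fr (Lx x) k)
  beta_reduce at hg
  rw [← hg, norm_mul]
  ring

end Fam
end BV

namespace BV

lemma log_div_sqrt {y : ℝ} (hy : 0 < y) : 2 * √y * Real.log y ≤ 1.4720 * y := by
  set w := √y with hw
  have hw0 : 0 < w := Real.sqrt_pos.2 hy
  have hww : w^2 = y := Real.sq_sqrt hy.le
  rw [← hww, Real.log_pow]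
  have h1 := Real.log_le_sub_one_of_pos (x := w / Real.exp 1) (by positivity)
  rw [Real.log_div (by positivity) (by positivity), Real.log_exp] at h1
  have he : 2.7182818283 < Real.exp 1 := Real.exp_one_gt_d9
  have h2 : w / Real.exp 1 ≤ w * 0.36788 := by
    rw [div_le_iff₀ (by positivity)]; nlinarith
  have h3 : Real.log w ≤ 0.36788 * w := by linarith
  have := mul_le_mul_of_nonneg_left h3 (show 0 ≤ 4 * w by positivity)
  push_cast
  nlinarith

lemma psi_286 {y : ℝ} (hy : 0 ≤ y) : Chebyshev.psi y ≤ 2.86 * y := by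
  rcases lt_or_ge y 1 with h | h
  · have : Chebyshev.psi y = 0 := by
      rw [Chebyshev.psi_eq_sum_Icc, Nat.floor_eq_zero.2 h]; simp
    rw [this]; positivity
  · have h1 := Chebyshev.psi_le h
    have h2 := log_div_sqrt (y := y) (by linarith)
    have h4 : Real.log 4 ≤ 1.3863 := by
      rw [show (4:ℝ) = 2^2 by norm_num, Real.log_pow]
      have h3 := Real.log_two_lt_d9
      push_cast; linarith
    nlinarith

lemma lam_sum (M : ℕ) : ∑ n ∈ Finset.Icc 1 M, Λ n ≤ 2.86 * M := by
  have h := psi_286 (y := (M:ℝ)) (by positivity)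
  rw [Chebyshev.psi_eq_sum_Icc, Nat.floor_natCast] at h
  refine le_trans ?_ h
  apply Finset.sum_le_sum_of_subset_of_nonneg
  · intro n hn; rw [Finset.mem_Icc] at hn ⊢; omega
  · intros; exact vonMangoldt_nonneg

lemma Sb_sub (U i : ℕ) : Sb U i ⊆ Finset.Icc 1 (2^(i+1)) := by
  intro b hb
  have := Sb_mem hb
  rw [Finset.mem_Icc]; omega

lemma Sb_card (U i : ℕ) : (Sb U i).card ≤ 2^i := by
  have : Sb U i ⊆ Finset.Ico (2^i) (2^(i+1)) := by
    intro b hb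
    have := Sb_mem hb
    rw [Finset.mem_Ico]; omega
  refine (Finset.card_le_card this).trans ?_
  rw [Nat.card_Ico, pow_succ]; omega

lemma nn_mu (U i : ℕ) : nn (Sb U i) (fun b => ((mu b : ℝ):ℂ)) ≤ 2^i := by
  unfold nn
  calc _ ≤ ∑ b ∈ Sb U i, (1:ℝ) := by
        refine Finset.sum_le_sum fun b _ => ?_
        rw [Complex.norm_real, Real.norm_eq_abs]
        have := pow_le_pow_left₀ (abs_nonneg _) (mu_abs b) 2
        linarith
    _ ≤ _ := by
        rw [Finset.sum_const, nsmul_eq_mul, mul_one]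
        exact_mod_cast Sb_card U i

lemma nn_lam (U j : ℕ) : nn (Sb U j) (fun b => ((Λ b : ℝ):ℂ)) ≤ 5.72 * Real.log U * 2^j := by
  unfold nn
  calc _ ≤ ∑ b ∈ Sb U j, Real.log U * Λ b := by
        refine Finset.sum_le_sum fun b hb => ?_
        have hb := Sb_mem hb
        rw [Complex.norm_real, Real.norm_eq_abs, sq_abs, sq]
        apply mul_le_mul_of_nonneg_right _ vonMangoldt_nonneg
        refine vonMangoldt_le_log.trans (Real.log_le_log (by exact_mod_cast hb.1) (by exact_mod_cast hb.2.1))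
    _ ≤ Real.log U * (2.86 * ((2^(j+1):ℕ):ℝ)) := by
        rw [← Finset.mul_sum]
        apply mul_le_mul_of_nonneg_left _ (Real.log_natCast_nonneg U)
        refine le_trans ?_ (lam_sum _)
        apply Finset.sum_le_sum_of_subset_of_nonneg (Sb_sub U j)
        intros; exact vonMangoldt_nonneg
    _ = _ := by push_cast; ring

lemma nn_lamN (U j N : ℕ) : nn (Finset.Icc 1 (2^(j+1)*N)) (fun m => ∑ p ∈ (Sb U j ×ˢ Finset.Icc 1 N).filter (fun p => p.1 * p.2 = m), ((Λ p.1 : ℝ):ℂ) * 1)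
    ≤ ((2^(j+1)*N : ℕ):ℝ) * (Real.log ((2^(j+1)*N : ℕ):ℝ))^2 := by
  unfold nn
  calc _ ≤ ∑ m ∈ Finset.Icc 1 (2^(j+1)*N), (Real.log ((2^(j+1)*N : ℕ):ℝ))^2 := by
        refine Finset.sum_le_sum fun m hm => ?_
        rw [Finset.mem_Icc] at hm
        apply pow_le_pow_left₀ (norm_nonneg _)
        calc _ = ‖((∑ p ∈ (Sb U j ×ˢ Finset.Icc 1 N).filter (fun p => p.1 * p.2 = m), Λ p.1 : ℝ):ℂ)‖ := by
              push_cast; simp only [mul_one]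
          _ = ∑ p ∈ (Sb U j ×ˢ Finset.Icc 1 N).filter (fun p => p.1 * p.2 = m), Λ p.1 := by
              rw [Complex.norm_real, Real.norm_eq_abs, abs_of_nonneg]
              exact Finset.sum_nonneg fun _ _ => vonMangoldt_nonneg
          _ ≤ ∑ p ∈ m.divisorsAntidiagonal, Λ p.1 := by
              apply Finset.sum_le_sum_of_subset_of_nonneg
              · intro p hp
                rw [Finset.mem_filter] at hp
                rw [Nat.mem_divisorsAntidiagonal]
                exact ⟨hp.2, by omega⟩
              · intros; exact vonMangoldt_nonneg
          _ = Real.log m := by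
              rw [Nat.sum_divisorsAntidiagonal (fun a _ => Λ a), vonMangoldt_sum]
          _ ≤ _ := Real.log_le_log (by exact_mod_cast hm.1) (by exact_mod_cast hm.2)
    _ = _ := by simp

lemma Sb_window (U i g : ℕ) (hg : 1 ≤ g) : ∑ d ∈ (Sb U i).filter (fun d => g ∣ d), (1:ℝ)/d ≤ 1.6932/g := by
  have hg0 : (0:ℝ) < g := by exact_mod_cast hg
  have e : ∑ d ∈ (Sb U i).filter (fun d => g ∣ d), (1:ℝ)/d = 1/g * ∑ m ∈ ((Sb U i).filter (fun d => g ∣ d)).image (fun d => d / g), (1:ℝ)/m := by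
    rw [Finset.sum_image, Finset.mul_sum]
    · refine Finset.sum_congr rfl fun d hd => ?_
      obtain ⟨m, rfl⟩ := (Finset.mem_filter.1 hd).2
      rw [Nat.mul_div_cancel_left _ hg]
      push_cast; rw [div_mul_div_comm, one_mul]
    · intro d hd d' hd' h
      rw [Finset.mem_coe, Finset.mem_filter] at hd hd'
      obtain ⟨m, rfl⟩ := hd.2
      obtain ⟨m', rfl⟩ := hd'.2
      simp only [Nat.mul_div_cancel_left _ hg] at h
      rw [h]
  rw [e, div_mul_eq_mul_div, one_mul]
  apply div_le_div_of_nonneg_right _ hg0.le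
  set A : ℝ := 2^i/g with hA
  have hA0 : 0 < A := by positivity
  -- compare with a slightly smaller left end point
  have hle : ∀ δ : ℝ, 0 < δ → δ < 1 → ∑ m ∈ ((Sb U i).filter (fun d => g ∣ d)).image (fun d => d / g), (1:ℝ)/m ≤ 1 + Real.log (2*A/(A*δ)) := by
    intro δ h0 h1
    apply inv_window _ (A*δ) (2*A) (by positivity) (by nlinarith)
    intro m hm
    rw [Finset.mem_image] at hm
    obtain ⟨d, hd, rfl⟩ := hm
    obtain ⟨hd, m, rfl⟩ := Finset.mem_filter.1 hd
    have hd := Sb_mem hd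
    rw [Nat.mul_div_cancel_left _ hg]
    have h3 : (2:ℝ)^i ≤ g * m := by exact_mod_cast hd.2.2.1
    have h4 : (g:ℝ) * m ≤ 2^(i+1) := by exact_mod_cast hd.2.2.2.le
    have h5 : A ≤ m := by rw [hA, div_le_iff₀ hg0]; linarith
    refine ⟨?_, by nlinarith, ?_⟩
    · rcases Nat.eq_zero_or_pos m with h | h
      · rw [h] at hd; simp at hd
      · exact h
    · rw [hA, ← mul_div_assoc, le_div_iff₀ hg0]
      rw [pow_succ] at h4; linarith
  have h := hle 0.99999 (by norm_num) (by norm_num)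
  refine h.trans ?_
  rw [show 2*A/(A*0.99999) = 2 * (100000/99999) by field_simp; norm_num, Real.log_mul (by norm_num) (by norm_num)]
  have h1 := Real.log_two_lt_d9
  have h2 := Real.log_le_sub_one_of_pos (x := (100000/99999:ℝ)) (by norm_num)
  norm_num at h1 h2 ⊢
  linarith

lemma nn_muN (U i N : ℕ) : nn (Finset.Icc 1 (2^(i+1)*N)) (fun m => ∑ p ∈ (Sb U i ×ˢ Finset.Icc 1 N).filter (fun p => p.1 * p.2 = m), ((mu p.1 : ℝ):ℂ) * 1)
    ≤ ((2^(i+1)*N : ℕ):ℝ) * (2.867 * (1 + Real.log ((2^(i+1) : ℕ):ℝ))) := by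
  have h1 := dcount (Sb U i) (2^(i+1)) (2^(i+1)*N) 1 le_rfl (fun d hd => by
    have := Finset.mem_Icc.1 (Sb_sub U i hd)
    exact ⟨this.1, this.2, Nat.coprime_one_left d⟩)
  have e : (Finset.Icc 1 (2^(i+1)*N)).filter (fun k => 1 ∣ k) = Finset.Icc 1 (2^(i+1)*N) := by
    apply Finset.filter_true_of_mem; intro k _; exact one_dvd k
  rw [e, Nat.cast_one, div_one] at h1
  unfold nn
  refine le_trans (Finset.sum_le_sum fun m hm => ?_) (h1.trans ?_)
  · rw [Finset.mem_Icc] at hm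
    apply pow_le_pow_left₀ (norm_nonneg _)
    refine (norm_sum_le _ _).trans ?_
    calc _ ≤ ∑ p ∈ (Sb U i ×ˢ Finset.Icc 1 N).filter (fun p => p.1 * p.2 = m), (1:ℝ) := by
          refine Finset.sum_le_sum fun p _ => ?_
          rw [mul_one, Complex.norm_real, Real.norm_eq_abs]
          exact mu_abs _
      _ ≤ _ := by
          rw [Finset.sum_const, nsmul_eq_mul, mul_one]
          norm_cast
          apply Finset.card_le_card_of_injOn (fun p => p.1)
          · intro p hp
            rw [Finset.mem_coe, Finset.mem_filter, Finset.mem_product] at hp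
            rw [Finset.mem_coe, Finset.mem_filter]
            exact ⟨hp.1.1, ⟨p.2, hp.2.symm⟩⟩
          · intro p hp p' hp' h
            rw [Finset.mem_coe, Finset.mem_filter, Finset.mem_product] at hp hp'
            have h0 := Sb_mem hp.1.1
            have h : p.1 = p'.1 := h
            ext
            · exact h
            · apply Nat.eq_of_mul_eq_mul_left h0.1
              rw [hp.2, h, hp'.2]
  · apply mul_le_mul_of_nonneg_left _ (by positivity)
    calc _ ≤ ∑ g ∈ Finset.Icc (1:ℕ) (2^(i+1)), 2.867 * ((1:ℝ)/(g:ℝ)) := by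
          refine Finset.sum_le_sum fun g hg => ?_
          have hg1 := (Finset.mem_Icc.1 hg).1
          have hg0 : (0:ℝ) < g := by exact_mod_cast hg1
          have h1 : (0:ℝ) ≤ ∑ d ∈ (Sb U i).filter (fun d => g ∣ d), (1:ℝ)/d := Finset.sum_nonneg fun _ _ => by positivity
          have h2 := pow_le_pow_left₀ h1 (Sb_window U i g hg1) 2
          have h3 : (Nat.totient g : ℝ) ≤ g := by exact_mod_cast Nat.totient_le g
          calc _ ≤ (g:ℝ) * (1.6932/g)^2 := mul_le_mul h3 h2 (sq_nonneg _) hg0.le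
            _ = 1.6932^2 * (1/g) := by field_simp
            _ ≤ _ := by
              apply mul_le_mul_of_nonneg_right _ (by positivity); norm_num
      _ ≤ _ := by
          rw [← Finset.mul_sum]
          apply mul_le_mul_of_nonneg_left _ (by norm_num)
          exact Hm_le _

end BV

namespace BV

lemma hp_num {ε k B D x c d h : ℝ} (hε : 0 ≤ ε) (hk : 0 ≤ k) (hB : 0 < B) (hD : 0 ≤ D) (hx : 0 ≤ x) (hc : 0 ≤ c) (hd : 0 ≤ d) (hh : 0 ≤ h)
    (hBD : B * D ≤ x) (hB2 : B^2 ≤ x) (hcd : 2 * (c * d) ≤ h^2) :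
    √((ε*(2*B)+k)*(c*B)) * √((ε*(2*D)+k)*(d*(2*D))) ≤ h * √x * (2*ε*√x + 2*√(ε*k)*√(x/B) + k) := by
  have hBx : B ≤ x / B := by rw [le_div_iff₀ hB]; nlinarith
  have hDx : D ≤ x / B := by rw [le_div_iff₀ hB]; nlinarith
  set X := x / B with hX
  have hX0 : 0 ≤ X := by positivity
  rw [← Real.sqrt_mul (by positivity)]
  apply Real.sqrt_le_iff.2
  refine ⟨by positivity, ?_⟩
  have e1 : (h * √x * (2*ε*√x + 2*√(ε*k)*√X + k))^2 = h^2 * (√x)^2 * (2*ε*√x + 2*√(ε*k)*√X + k)^2 := by ring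
  rw [e1, Real.sq_sqrt hx]
  have e2 : (ε*(2*B)+k)*(c*B) * ((ε*(2*D)+k)*(d*(2*D))) = (2*(c*d)) * (B*D) * (4*ε^2*(B*D) + 2*ε*k*(B+D) + k^2) := by ring
  rw [e2]
  have e3 : 4*ε^2*(B*D) + 2*ε*k*(B+D) + k^2 ≤ (2*ε*√x + 2*√(ε*k)*√X + k)^2 := by
    have s1 := Real.sq_sqrt hx
    have s2 := Real.sq_sqrt hX0
    have s3 := Real.sq_sqrt (mul_nonneg hε hk)
    have a1 : 4*ε^2*(B*D) ≤ (2*ε*√x)^2 := by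
      rw [mul_pow, s1]; nlinarith [mul_le_mul_of_nonneg_left hBD (sq_nonneg ε)]
    have a2 : 2*ε*k*(B+D) ≤ (2*√(ε*k)*√X)^2 := by
      rw [mul_pow, mul_pow, s2, s3]; nlinarith [mul_le_mul_of_nonneg_left (add_le_add hBx hDx) (mul_nonneg hε hk)]
    have p1 : 0 ≤ 2*ε*√x := by positivity
    have p2 : 0 ≤ 2*√(ε*k)*√X := by positivity
    nlinarith [mul_nonneg p1 p2, mul_nonneg p1 hk, mul_nonneg p2 hk]
  exact mul_le_mul (mul_le_mul hcd hBD (by positivity) (by positivity)) e3 (by positivity) (by positivity)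

lemma e0_lin {K : ℕ} (hK : 1 ≤ K) : e0 K ≤ 1.637 * K := by
  unfold e0
  have hK' : (1:ℝ) ≤ K := by exact_mod_cast hK
  have h1 : Real.log K ≤ K - 1 := Real.log_le_sub_one_of_pos (by linarith)
  have h2 : 2/π ≤ 0.637 := by
    rw [div_le_iff₀ Real.pi_pos]; have := Real.pi_gt_d2; norm_num at this ⊢; linarith
  have h3 : 0 ≤ Real.log K := Real.log_natCast_nonneg K
  nlinarith [mul_le_mul h2 (show 1 + Real.log K ≤ K by linarith) (by linarith) (by norm_num : (0:ℝ) ≤ 0.637)]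

lemma kl_aux {K l n L : ℝ} (hK : 0 ≤ K) (hl : 0 < l) (hn : n ≤ 4/9 * l) (hL : 2 * l ≤ L) : 4 * K * n / L ≤ 0.889 * K := by
  rw [div_le_iff₀ (by linarith)]
  nlinarith [mul_le_mul_of_nonneg_left hn hK, mul_le_mul_of_nonneg_left hL hK, mul_nonneg hK hl.le]

namespace Fam
variable {ι : Type} (F : Fam ι)

set_option maxHeartbeats 3000000 in
lemma box_bound {x : ℝ} (hx : 1 ≤ x) (hl : 75 ≤ Real.log x) (hP : 0 ≤ F.P) (U : ℕ) (hU : 4 ≤ U) (hUx : (U:ℝ)^2 ≤ x)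
    (hUl : Real.log U ≤ 4/9 * Real.log x) (i j : ℕ) (hr : (i,j) ∈ boxes x U) (K : ℕ) (hK : 1 ≤ K)
    (Y : ι → ℕ) (hY : ∀ i ∈ F.s, (Y i : ℝ) ≤ x) :
    F.box x U Y (i,j) ≤ 2.53 * K * F.P * (√((2*2^i + F.Z) * 2^i) * √((2*2^j + F.Z) * (2.543 * Real.log x * 2^j)))
      + 2.61 * Real.log x * √x * (2 * ep x K * √x + 2 * √(ep x K * (kp x * (F.Z+1))) * √(x / max (2^i) (2^j)) + kp x * (F.Z+1)) := by
  classical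
  set l := Real.log x with hldef
  have hZ := F.hZ
  have hU0 : (0:ℝ) < U := by positivity
  have hU4 : (4:ℝ) ≤ U := by exact_mod_cast hU
  have hx0 : 0 < x := by linarith
  have hUxU : (U:ℝ) ≤ x/U := by rw [le_div_iff₀ hU0]; nlinarith
  unfold boxes at hr
  rw [Finset.mem_filter, Finset.mem_product, Finset.mem_range, Finset.mem_range] at hr
  obtain ⟨⟨hi, hj⟩, hbig⟩ := hr
  simp only at hi hj hbig
  push Not at hbig
  have hpow : ∀ m, m < Nat.log 2 U + 1 → (2:ℝ)^m ≤ U := by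
    intro m hm
    have h1 : 2^m ≤ 2^(Nat.log 2 U) := Nat.pow_le_pow_right (by norm_num) (by omega)
    have h2 : 2^(Nat.log 2 U) ≤ U := Nat.pow_log_le_self 2 (by omega)
    exact_mod_cast h1.trans h2
  have hBU := hpow i hi
  have hCU := hpow j hj
  have ebc : ((2^(i+j) : ℕ):ℝ) = 2^i * 2^j := by push_cast; ring
  rw [ebc] at hbig
  set B : ℝ := 2^i with hB
  set C : ℝ := 2^j with hC
  have hB1 : 1 ≤ B := one_le_pow₀ (by norm_num)
  have hC1 : 1 ≤ C := one_le_pow₀ (by norm_num)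
  have hB0 : 0 < B := by linarith
  have hC0 : 0 < C := by linarith
  have hBCx : B * C ≤ x := by nlinarith
  set N := Nb x (i,j) with hN
  have hNe : N = ⌊x / (B*C)⌋₊ := by rw [hN]; unfold Nb; simp only; rw [ebc]
  have hNle : (N:ℝ) ≤ x / (B*C) := by rw [hNe]; exact Nat.floor_le (by positivity)
  have hN1 : 1 ≤ N := by
    rw [hNe]; apply Nat.le_floor
    rw [le_div_iff₀ (by positivity)]; push_cast; linarith
  have hNU : (N:ℝ) ≤ U := by
    refine hNle.trans ?_
    rw [div_le_iff₀ (by positivity)]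
    rw [div_lt_iff₀ hU0] at hbig; linarith
  have hN1' : (1:ℝ) ≤ N := by exact_mod_cast hN1
  have hNx : N * (B*C) ≤ x := by rwa [le_div_iff₀ (by positivity)] at hNle
  have hlogN : Real.log N ≤ 4/9 * l := (Real.log_le_log (by linarith) hNU).trans hUl
  have hB2 : B^2 ≤ x := by nlinarith
  have hC2 : C^2 ≤ x := by nlinarith
  have ei : ((2^(i+1) : ℕ):ℝ) = 2 * B := by push_cast; rw [pow_succ]; ring
  have ej : ((2^(j+1) : ℕ):ℝ) = 2 * C := by push_cast; rw [pow_succ]; ring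
  have hε := ep_nonneg hx K
  have hκ := kp_nonneg hx
  have hk : 0 ≤ kp x * (F.Z+1) := by positivity
  have hx4 : 4 ≤ x := by nlinarith
  have hBC4 : 4 < B * C := by linarith
  have hbx : 2 * B ≤ 4 * x := by nlinarith
  have hcx : 2 * C ≤ 4 * x := by nlinarith
  have hCN : C * N ≤ x := by nlinarith [mul_nonneg (by linarith : 0 ≤ B - 1) (by positivity : 0 ≤ (N:ℝ)*C)]
  have hBN : B * N ≤ x := by nlinarith [mul_nonneg (by linarith : 0 ≤ C - 1) (by positivity : 0 ≤ (N:ℝ)*B)]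
  have n1 := nn_mu U i
  have n2 : nn (Sb U j) (fun b => ((Λ b : ℝ):ℂ)) ≤ 2.543 * l * C := by
    refine (nn_lam U j).trans ?_
    nlinarith [mul_le_mul_of_nonneg_right hUl hC0.le]
  have key := F.trilin hx hP (Sb U i) (Sb U j) (fun b => ((mu b : ℝ):ℂ)) (fun b => ((Λ b : ℝ):ℂ)) (2^(i+1)) (2^(j+1)) N (Sb_sub U i) (Sb_sub U j) hN1
    (by rw [ei, ej]; nlinarith) K Y hY
    (2.61 * l * √x * (2 * ep x K * √x + 2 * √(ep x K * (kp x * (F.Z+1))) * √(x / max B C) + kp x * (F.Z+1))) (by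
      intro N'
      rcases le_total C B with hcb | hcb
      · rw [max_eq_left hcb]
        have hB2' : 2 ≤ B := by nlinarith
        have hlog : Real.log ((2^(j+1)*N : ℕ):ℝ) ≤ l := by
          apply Real.log_le_log (by positivity)
          rw [Nat.cast_mul, ej]
          nlinarith [mul_nonneg (by linarith : 0 ≤ B - 2) (by positivity : 0 ≤ (N:ℝ)*C)]
        have hlog0 : 0 ≤ Real.log ((2^(j+1)*N : ℕ):ℝ) := Real.log_natCast_nonneg _
        have q := F.high_pair hx (Sb U i) (Sb U j) (fun b => ((mu b : ℝ):ℂ)) (fun b => ((Λ b : ℝ):ℂ)) (2^(i+1)) (2^(j+1)) N (Sb_sub U i) (Sb_sub U j)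
          (by rw [ei]; exact hbx) (by rw [Nat.cast_mul, ej]; nlinarith) K N' (1 * B) (l^2 * (2 * (C * N))) (by rw [one_mul]; exact n1) (by
            refine (nn_lamN U j N).trans ?_
            rw [show l^2 * (2 * (C*N)) = (2*C*N) * l^2 by ring]
            have : ((2^(j+1)*N : ℕ):ℝ) = 2*C*N := by rw [Nat.cast_mul, ej]
            rw [this] at hlog hlog0 ⊢
            exact mul_le_mul_of_nonneg_left (pow_le_pow_left₀ hlog0 hlog 2) (by positivity))
        refine q.trans ?_
        rw [Nat.cast_mul, ei, ej, show 2 * C * (N:ℝ) = 2 * (C*N) by ring]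
        exact hp_num hε hk hB0 (by positivity) hx0.le (by norm_num) (by positivity) (by linarith) (by linarith) hB2 (by nlinarith [sq_nonneg l])
      · rw [max_eq_right hcb]
        have hlog : 1 + Real.log ((2^(i+1) : ℕ):ℝ) ≤ 0.4671 * l := by
          rw [ei, Real.log_mul (by norm_num) hB0.ne']
          have := Real.log_two_lt_d9
          have := Real.log_le_log hB0 hBU
          linarith
        have q := F.high_pair hx (Sb U j) (Sb U i) (fun b => ((Λ b : ℝ):ℂ)) (fun b => ((mu b : ℝ):ℂ)) (2^(j+1)) (2^(i+1)) N (Sb_sub U j) (Sb_sub U i)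
          (by rw [ej]; exact hcx) (by rw [Nat.cast_mul, ei]; nlinarith) K N' (2.543 * l * C) ((2.867 * (0.4671 * l)) * (2 * (B * N))) n2 (by
            refine (nn_muN U i N).trans ?_
            rw [Nat.cast_mul, ei]
            rw [ei] at hlog
            nlinarith [mul_le_mul_of_nonneg_left hlog (by positivity : 0 ≤ 2*B*(N:ℝ))])
        refine le_trans (le_of_eq ?_) (q.trans ?_)
        · refine Finset.sum_congr rfl fun k _ => ?_
          congr 1
          refine Finset.sum_congr rfl fun m _ => ?_
          ring
        rw [Nat.cast_mul, ei, ej, show 2 * B * (N:ℝ) = 2 * (B*N) by ring]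
        exact hp_num hε hk hC0 (by positivity) hx0.le (by linarith) (by linarith) (by linarith) (by linarith) hC2 (by nlinarith [sq_nonneg l]))
  refine le_trans (le_of_eq ?_) (key.trans ?_)
  · unfold box
    refine Finset.sum_congr rfl fun m _ => ?_
    congr 2
    refine Finset.sum_congr rfl fun t _ => ?_
    unfold cf; push_cast; ring
  · gcongr ?_ + _
    rw [ei, ej]
    have hc : e0 K + 4 * K * Real.log N / Lx x ≤ 2.53 * K := by
      have h1 := e0_lin hK
      have hL : 2 * l ≤ Lx x := by
        unfold Lx; rw [Real.log_mul (by norm_num) hx0.ne']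
        have : 0 ≤ Real.log 4 := Real.log_nonneg (by norm_num)
        linarith
      have h2 : 4 * K * Real.log N / Lx x ≤ 0.889 * K := by
        exact kl_aux (by positivity) (by linarith) hlogN hL
      linarith
    have hs : √((2*B + F.Z) * nn (Sb U i) (fun b => ((mu b : ℝ):ℂ))) * √((2*C + F.Z) * nn (Sb U j) (fun b => ((Λ b : ℝ):ℂ)))
      ≤ √((2*B + F.Z) * B) * √((2*C + F.Z) * (2.543 * l * C)) := by
      have hb : 0 ≤ 2*B + F.Z := by linarith
      have hc' : 0 ≤ 2*C + F.Z := by linarith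
      exact mul_le_mul (Real.sqrt_le_sqrt (mul_le_mul_of_nonneg_left n1 hb)) (Real.sqrt_le_sqrt (mul_le_mul_of_nonneg_left n2 hc')) (by positivity) (by positivity)
    have h0 : F.P * (e0 K + 4 * K * Real.log N / Lx x) ≤ 2.53 * K * F.P := by
      rw [mul_comm (2.53 * (K:ℝ))]; exact mul_le_mul_of_nonneg_left hc hP
    exact mul_le_mul h0 hs (by positivity) (by positivity)
end Fam
end BV

namespace BV

lemma log_le_e {w : ℝ} (hw : 0 < w) : Real.log w ≤ 0.3679 * w := by
  have h := Real.log_le_sub_one_of_pos (show 0 < w / Real.exp 1 by positivity)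
  rw [Real.log_div hw.ne' (Real.exp_pos 1).ne', Real.log_exp] at h
  have h2 : w / Real.exp 1 ≤ 0.3679 * w := by
    rw [div_le_iff₀ (Real.exp_pos 1)]
    have := Real.exp_one_gt_d9
    nlinarith
  linarith

lemma w_le {x w : ℝ} (hw : 2.94 ≤ w) (hwl : w^4 = Real.log x) (h75 : 75 ≤ Real.log x) (hx0 : 0 < x)
    : w ≤ 0.0394 * Real.log x := by
  rw [← hwl]
  have h2 : 8.64 ≤ w^2 := by nlinarith
  have : 25.4 ≤ w^3 := by nlinarith
  nlinarith

lemma loglog_le {x w : ℝ} (hw : 2.94 ≤ w) (hwl : w^4 = Real.log x) (h75 : 75 ≤ Real.log x) (hx0 : 0 < x)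
    : Real.log (Real.log x) ≤ 1.4716 * w := by
  rw [← hwl, Real.log_pow]; have := log_le_e (show 0 < w by linarith); push_cast; linarith

lemma Lx_le {x w : ℝ} (hw : 2.94 ≤ w) (hwl : w^4 = Real.log x) (h75 : 75 ≤ Real.log x) (hx0 : 0 < x)
    : Lx x ≤ 2.037 * Real.log x := by
  unfold Lx
  rw [Real.log_mul (by norm_num) hx0.ne', show (4:ℝ) = 2^2 by norm_num, Real.log_pow]
  have := Real.log_two_lt_d9
  push_cast; linarith

lemma Lx_le2 {x w : ℝ} (hw : 2.94 ≤ w) (hwl : w^4 = Real.log x) (h75 : 75 ≤ Real.log x) (hx0 : 0 < x)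
    : 2 * Real.log x ≤ Lx x := by
  unfold Lx
  rw [Real.log_mul (by norm_num) hx0.ne']
  have : 0 ≤ Real.log 4 := Real.log_nonneg (by norm_num)
  linarith

lemma kp_le {x w : ℝ} (hw : 2.94 ≤ w) (hwl : w^4 = Real.log x) (h75 : 75 ≤ Real.log x) (hx0 : 0 < x)
    : kp x ≤ 1.61 * Real.log x := by
  have h1 := Lx_le hw hwl h75 hx0
  have h1' := Lx_le2 hw hwl h75 hx0
  have h2 := loglog_le hw hwl h75 hx0
  have h3 := w_le hw hwl h75 hx0
  unfold kp lam
  have hL : 0 < Lx x := by linarith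
  rw [Real.log_mul (by positivity) hL.ne', Real.log_mul (by norm_num) hx0.ne']
  have h4 : Real.log (Lx x) ≤ Real.log 2.037 + Real.log (Real.log x) := by
    rw [← Real.log_mul (by norm_num) (by linarith)]
    exact Real.log_le_log hL h1
  have h5 : Real.log 2.037 ≤ 0.7120 := by
    have : (2.037:ℝ) = 2 * 1.0185 := by norm_num
    rw [this, Real.log_mul (by norm_num) (by norm_num)]
    have := Real.log_two_lt_d9
    have := Real.log_le_sub_one_of_pos (show (0:ℝ) < 1.0185 by norm_num)
    linarith
  have := Real.log_two_lt_d9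
  linarith

lemma ep_le {x w : ℝ} (hw : 2.94 ≤ w) (hwl : w^4 = Real.log x) (h75 : 75 ≤ Real.log x) (hx0 : 0 < x)
    (K : ℕ) {s u : ℝ} (hu : 0 < u) (hs : 0 < s) (hK : u / s ≤ K) : ep x K ≤ 0.934 * Real.log x * (s / u) := by
  have h1 := Lx_le hw hwl h75 hx0
  have h1' := Lx_le2 hw hwl h75 hx0
  unfold ep
  rw [div_le_iff₀ (by positivity)]
  have hpi := Real.pi_gt_d4
  have h2 : 1 ≤ (s/u) * ((K:ℝ)+1) := by
    have : 1 = (s/u) * (u/s) := by field_simp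
    calc (1:ℝ) = (s/u) * (u/s) := this
      _ ≤ _ := mul_le_mul_of_nonneg_left (by linarith) (by positivity)
  have h3 : 36/25 * Lx x ≤ 0.934 * Real.log x * π := by nlinarith
  have h4 : 0 ≤ 0.934 * Real.log x * π := by nlinarith
  calc 36/25 * Lx x ≤ 0.934 * Real.log x * π * 1 := by linarith
    _ ≤ 0.934 * Real.log x * π * ((s/u) * ((K:ℝ)+1)) := mul_le_mul_of_nonneg_left h2 h4
    _ = _ := by ring

lemma e0_le {x w : ℝ} (hw : 2.94 ≤ w) (hwl : w^4 = Real.log x) (h75 : 75 ≤ Real.log x) (hx0 : 0 < x)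
    : e0 ⌈Lx x⌉₊ ≤ 2.094 + 0.9371 * w := by
  have h1 := Lx_le hw hwl h75 hx0
  have h1' := Lx_le2 hw hwl h75 hx0
  have h2 := loglog_le hw hwl h75 hx0
  unfold e0
  have hc := Nat.ceil_lt_add_one (show 0 ≤ Lx x by linarith)
  have hc0 : 0 < (⌈Lx x⌉₊:ℝ) := by exact_mod_cast Nat.ceil_pos.2 (by linarith)
  have h3 : Real.log ⌈Lx x⌉₊ ≤ 0.7184 + Real.log (Real.log x) := by
    have h5 : Real.log 2.0504 ≤ 0.7184 := by
      have : (2.0504:ℝ) = 2 * 1.0252 := by norm_num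
      rw [this, Real.log_mul (by norm_num) (by norm_num)]
      have := Real.log_two_lt_d9
      have := Real.log_le_sub_one_of_pos (show (0:ℝ) < 1.0252 by norm_num)
      linarith
    have : Real.log ⌈Lx x⌉₊ ≤ Real.log 2.0504 + Real.log (Real.log x) := by
      rw [← Real.log_mul (by norm_num) (by linarith)]
      exact Real.log_le_log hc0 (by linarith)
    linarith
  have h6 : 2/π ≤ 0.63665 := by
    rw [div_le_iff₀ Real.pi_pos]; have := Real.pi_gt_d4; norm_num at this ⊢; linarith
  have h7 : 0 ≤ 1 + Real.log ⌈Lx x⌉₊ := by linarith [Real.log_natCast_nonneg ⌈Lx x⌉₊]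
  have := mul_le_mul_of_nonneg_right h6 h7
  linarith

lemma E1_le {x w : ℝ} (hw : 2.94 ≤ w) (hwl : w^4 = Real.log x) (h75 : 75 ≤ Real.log x) (hx0 : 0 < x)
    : E1 x ≤ 1.81 * w := by
  have h := e0_le hw hwl h75 hx0
  have h1' := Lx_le2 hw hwl h75 hx0
  unfold E1
  have : ep x ⌈Lx x⌉₊ ≤ 0.4585 := by
    unfold ep
    rw [div_le_iff₀ (by positivity)]
    have hpi := Real.pi_gt_d4
    have hc := Nat.le_ceil (Lx x)
    have : Lx x * 3.1415 ≤ (⌈Lx x⌉₊ + 1) * π := by nlinarith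
    nlinarith
  linarith

lemma E2_le {x w : ℝ} (hw : 2.94 ≤ w) (hwl : w^4 = Real.log x) (h75 : 75 ≤ Real.log x) (hx0 : 0 < x)
    : E2 x ≤ 1.68 * Real.log x := by
  have h := e0_le hw hwl h75 hx0
  have h1 := kp_le hw hwl h75 hx0
  have h3 := w_le hw hwl h75 hx0
  unfold E2; linarith

lemma Cb_le {x w : ℝ} (hw : 2.94 ≤ w) (hwl : w^4 = Real.log x) (h75 : 75 ≤ Real.log x) (hx0 : 0 < x)
    (U : ℕ) (hU1 : 1 ≤ U) (hU : Real.log U ≤ 4/9 * Real.log x) : Cb U ≤ 5.32 * w^5 := by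
  have h2 := loglog_le hw hwl h75 hx0
  unfold Cb
  have h0 : 0 ≤ Real.log U := Real.log_natCast_nonneg U
  have h3 : Real.log (1 + Real.log U) ≤ 1.4716 * w :=
    le_trans (Real.log_le_log (by linarith) (by linarith)) h2
  have h3' : 0 ≤ Real.log (1 + Real.log U) := Real.log_nonneg (by linarith)
  have h4 : 1 + 2 * Real.log U ≤ 0.9023 * Real.log x := by linarith
  have h5 := mul_le_mul h4 h3 h3' (by linarith)
  have h6 : w^5 = Real.log x * w := by rw [← hwl]; ring
  rw [h6]
  have h7 : 200 ≤ Real.log x * w := by nlinarith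
  linarith

set_option maxHeartbeats 1000000 in
lemma Fam.box_one {ι : Type} (F : Fam ι) {x w T R ρ : ℝ} (hw : 2.94 ≤ w) (hwl : w^4 = Real.log x) (h75 : 75 ≤ Real.log x) (hx : 1 ≤ x)
    (hT : x = T^6) (hT0 : 0 < T) (hρ : ρ^2 = R) (hρ0 : 0 < ρ) (hZ : F.Z + 1 = 7.29 * R^2) (hP0 : 0 ≤ F.P) (hP : F.P ≤ 0.5036 * w^4 * ρ)
    (U : ℕ) (hU : 4 ≤ U) (hUx : (U:ℝ)^2 ≤ x) (hUl : Real.log U ≤ 4/9 * Real.log x) (hU1 : (U:ℝ) ≤ R^2) (hU2 : U * R ≤ T^4)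
    (i j : ℕ) (hr : (i,j) ∈ boxes x U) (Y : ι → ℕ) (hY : ∀ i ∈ F.s, (Y i : ℝ) ≤ x) :
    F.box x U Y (i,j) ≤ 38 * w^6 * (T^4*R*ρ) + 4.88 * w^8 * (T^2*R) * √(2^(i+j)) + 17.3 * w^8 * (T^4*R*ρ) * √(√(2^(i+j)) / max (2^i) (2^j))
      + 30.7 * w^8 * (T^3*R^2) := by
  classical
  have hx0 : 0 < x := by linarith
  have hR0 : 0 < R := by rw [← hρ]; positivity
  have hw0 : 0 < w := by linarith
  set s := √((2:ℝ)^(i+j)) with hs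
  have hs0 : 0 < s := Real.sqrt_pos.2 (by positivity)
  have hss : s^2 = 2^i * 2^j := by rw [hs, Real.sq_sqrt (by positivity), pow_add]
  set u := T^4 / R with hu
  have hu0 : 0 < u := by positivity
  have hr' := hr
  unfold boxes at hr'
  rw [Finset.mem_filter, Finset.mem_product, Finset.mem_range, Finset.mem_range] at hr'
  obtain ⟨⟨hi, hj⟩, -⟩ := hr'
  simp only at hi hj
  have hpow : ∀ m, m < Nat.log 2 U + 1 → (2:ℝ)^m ≤ U := by
    intro m hm
    have h1 : 2^m ≤ 2^(Nat.log 2 U) := Nat.pow_le_pow_right (by norm_num) (by omega)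
    have h2 : 2^(Nat.log 2 U) ≤ U := Nat.pow_log_le_self 2 (by omega)
    exact_mod_cast h1.trans h2
  have hBU := hpow i hi
  have hCU := hpow j hj
  have hU0 : (0:ℝ) < U := by positivity
  have hUu : (U:ℝ) ≤ u := by rw [hu, le_div_iff₀ hR0]; exact hU2
  have hsu : s ≤ u := by
    refine le_trans ?_ hUu
    have : s^2 ≤ (U:ℝ)^2 := by
      rw [hss, sq]; exact mul_le_mul hBU hCU (by positivity) (by positivity)
    exact le_of_sq_le_sq this hU0.le
  have hus : 1 ≤ u / s := by rw [le_div_iff₀ hs0]; linarith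
  set K := ⌈u / s⌉₊ with hK
  have hK1 : 1 ≤ K := Nat.ceil_pos.2 (by linarith)
  have hKle := Nat.le_ceil (u / s)
  have hKu : (K:ℝ) ≤ 2 * (u / s) := by have := Nat.ceil_lt_add_one (show 0 ≤ u/s by linarith); linarith
  have key := F.box_bound hx h75 hP0 U hU hUx hUl i j hr K hK1 Y hY
  have hep := ep_le hw hwl h75 hx0 K hu0 hs0 hKle
  have hep0 := ep_nonneg hx K
  have hkp := kp_le hw hwl h75 hx0
  have hkp0 := kp_nonneg hx
  rw [← hwl] at hep hkp key
  set ε := ep x K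
  set κ := kp x
  have hsx : √x = T^3 := by rw [hT, show T^6 = (T^3)^2 by ring]; exact Real.sqrt_sq (by positivity)
  rw [hZ, hsx] at key
  refine key.trans ?_
  clear key
  set B : ℝ := 2^i with hB
  set C : ℝ := 2^j with hC
  have hB0 : 0 < B := by positivity
  have hC0 : 0 < C := by positivity
  -- low
  have low : 2.53 * K * F.P * (√((2*B + F.Z) * B) * √((2*C + F.Z) * (2.543 * w^4 * C))) ≤ 38 * w^6 * (T^4*R*ρ) := by
    have a1 : √((2*B + F.Z) * B) * √((2*C + F.Z) * (2.543 * w^4 * C)) ≤ 9.29 * R^2 * (1.595 * w^2) * s := by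
      rw [← Real.sqrt_mul (mul_nonneg (by linarith [F.hZ]) hB0.le)]
      apply Real.sqrt_le_iff.2
      refine ⟨by positivity, ?_⟩
      have b1 : 2*B + F.Z ≤ 9.29 * R^2 := by linarith
      have b2 : 2*C + F.Z ≤ 9.29 * R^2 := by linarith
      have b3 := mul_le_mul b1 b2 (by linarith [F.hZ]) (by positivity)
      have b4 : (9.29 * R^2 * (1.595 * w^2) * s)^2 = (9.29 * R^2 * (9.29 * R^2)) * (1.595^2 * w^4 * (B * C)) := by
        rw [← hss]; ring
      rw [b4]
      calc _ = ((2*B+F.Z) * (2*C+F.Z)) * (2.543 * w^4 * (B*C)) := by ring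
        _ ≤ (9.29 * R^2 * (9.29 * R^2)) * (1.595^2 * w^4 * (B * C)) :=
          mul_le_mul b3 (by
            have : 0 ≤ w^4 * (B*C) := by positivity
            nlinarith) (by positivity) (by positivity)
    have a2 : 2.53 * K * F.P ≤ 2.53 * (2 * (u/s)) * (0.5036 * w^4 * ρ) :=
      mul_le_mul (by linarith) hP hP0 (by positivity)
    refine (mul_le_mul a2 a1 (by positivity) (by positivity)).trans ?_
    have e : 2.53 * (2 * (u/s)) * (0.5036 * w^4 * ρ) * (9.29 * R^2 * (1.595 * w^2) * s) = (2.53*2*0.5036*9.29*1.595) * (w^6 * (T^4*R*ρ)) := by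
      rw [hu]; field_simp
    rw [e]
    have : 0 ≤ w^6 * (T^4*R*ρ) := by positivity
    nlinarith
  have hε' : ε ≤ 0.934 * w^4 * (s * R / T^4) := by
    refine hep.trans (le_of_eq ?_); rw [hu]; field_simp
  have t1 : 2.61 * w^4 * T^3 * (2 * ε * T^3) ≤ 4.88 * w^8 * (T^2*R) * s := by
    calc 2.61 * w^4 * T^3 * (2 * ε * T^3) ≤ 2.61 * w^4 * T^3 * (2 * (0.934 * w^4 * (s * R / T^4)) * T^3) := by gcongr
      _ = 4.87548 * (w^8 * (T^2*R) * s) := by field_simp; ring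
      _ ≤ _ := by have : 0 ≤ w^8 * (T^2*R) * s := by positivity
                  nlinarith
  have t3 : 2.61 * w^4 * T^3 * (κ * (7.29 * R^2)) ≤ 30.7 * w^8 * (T^3*R^2) := by
    calc 2.61 * w^4 * T^3 * (κ * (7.29 * R^2)) ≤ 2.61 * w^4 * T^3 * ((1.61 * w^4) * (7.29 * R^2)) := by gcongr
      _ = (2.61*1.61*7.29) * (w^8 * (T^3*R^2)) := by ring
      _ ≤ _ := by have : 0 ≤ w^8 * (T^3*R^2) := by positivity
                  nlinarith
  have t2 : 2.61 * w^4 * T^3 * (2 * √(ε * (κ * (7.29 * R^2))) * √(x / max B C)) ≤ 17.3 * w^8 * (T^4*R*ρ) * √(s / max B C) := by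
    set m := max B C
    have hm0 : 0 < m := lt_max_of_lt_left hB0
    have a : √(ε * (κ * (7.29 * R^2))) * √(x / m) ≤ 3.3111 * w^4 * (T*R*ρ) * √(s/m) := by
      rw [← Real.sqrt_mul (by positivity)]
      apply Real.sqrt_le_iff.2
      refine ⟨by positivity, ?_⟩
      rw [mul_pow, Real.sq_sqrt (by positivity)]
      calc ε * (κ * (7.29 * R^2)) * (x/m) ≤ (0.934 * w^4 * (s * R / T^4)) * ((1.61*w^4) * (7.29 * R^2)) * (x/m) := by gcongr
        _ = (0.934*1.61*7.29) * (w^8 * T^2 * R^3 * (s/m)) := by rw [hT]; field_simp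
        _ ≤ 3.3111^2 * (w^8 * T^2 * R^3 * (s/m)) := by
            apply mul_le_mul_of_nonneg_right (by norm_num) (by positivity)
        _ = _ := by rw [← hρ]; ring
    calc 2.61 * w^4 * T^3 * (2 * √(ε * (κ * (7.29 * R^2))) * √(x / m)) = 5.22 * w^4 * T^3 * (√(ε * (κ * (7.29 * R^2))) * √(x / m)) := by ring
      _ ≤ 5.22 * w^4 * T^3 * (3.3111 * w^4 * (T*R*ρ) * √(s/m)) := by gcongr
      _ = (5.22*3.3111) * (w^8 * (T^4*R*ρ) * √(s/m)) := by ring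
      _ ≤ 17.3 * (w^8 * (T^4*R*ρ) * √(s/m)) := by
            apply mul_le_mul_of_nonneg_right (by norm_num) (by positivity)
      _ = _ := by ring
  linarith
end BV

namespace BV

lemma geo_inj {c : ℝ} (hc : 0 ≤ c) (hc1 : c < 1) (s : Finset ℕ) (f : ℕ → ℕ) (hf : ∀ a ∈ s, ∀ b ∈ s, f a = f b → a = b) :
    ∑ j ∈ s, c^(f j) ≤ (1-c)⁻¹ := by
  rw [← Finset.sum_image (f := fun m : ℕ => c^m) (g := f) (fun a ha b hb h => hf a ha b hb h), ← tsum_geometric_of_lt_one hc hc1]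
  exact (summable_geometric_of_lt_one hc hc1).sum_le_tsum _ (fun _ _ => pow_nonneg hc _)

lemma geo_sq {c : ℝ} (hc : 0 ≤ c) (hc1 : c < 1) (I : ℕ) :
    ∑ p ∈ Finset.range (I+1) ×ˢ Finset.range (I+1), c^((I-p.1)+(I-p.2)) ≤ ((1-c)⁻¹)^2 := by
  rw [Finset.sum_product]
  have h : ∑ j ∈ Finset.range (I+1), c^(I-j) ≤ (1-c)⁻¹ := by
    refine geo_inj hc hc1 _ (fun j => I - j) ?_
    intro a ha b hb h
    rw [Finset.mem_range] at ha hb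
    omega
  have h0 : 0 ≤ ∑ j ∈ Finset.range (I+1), c^(I-j) := Finset.sum_nonneg fun _ _ => pow_nonneg hc _
  calc _ = (∑ j ∈ Finset.range (I+1), c^(I-j)) * (∑ j ∈ Finset.range (I+1), c^(I-j)) := by
        rw [Finset.sum_mul_sum]
        simp only [pow_add]
    _ ≤ _ := by rw [sq]; exact mul_le_mul h h h0 (h0.trans h)

lemma geo_diff {c : ℝ} (hc : 0 ≤ c) (hc1 : c < 1) (I : ℕ) :
    ∑ p ∈ Finset.range (I+1) ×ˢ Finset.range (I+1), c^((p.1-p.2)+(p.2-p.1)) ≤ (I+1) * (2 * (1-c)⁻¹) := by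
  rw [Finset.sum_product]
  have h : ∀ i ∈ Finset.range (I+1), ∑ j ∈ Finset.range (I+1), c^((i-j)+(j-i)) ≤ 2 * (1-c)⁻¹ := by
    intro i hi
    rw [← Finset.sum_filter_add_sum_filter_not _ (fun j => j ≤ i)]
    have a1 : ∑ j ∈ (Finset.range (I+1)).filter (fun j => j ≤ i), c^((i-j)+(j-i)) ≤ (1-c)⁻¹ := by
      refine geo_inj hc hc1 _ (fun j => (i-j)+(j-i)) ?_
      intro a ha b hb h
      rw [Finset.mem_filter] at ha hb
      omega
    have a2 : ∑ j ∈ (Finset.range (I+1)).filter (fun j => ¬ j ≤ i), c^((i-j)+(j-i)) ≤ (1-c)⁻¹ := by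
      refine geo_inj hc hc1 _ (fun j => (i-j)+(j-i)) ?_
      intro a ha b hb h
      rw [Finset.mem_filter] at ha hb
      omega
    linarith
  refine (Finset.sum_le_sum h).trans (le_of_eq ?_)
  rw [Finset.sum_const, Finset.card_range, nsmul_eq_mul]; push_cast; ring

lemma sd_le (i j : ℕ) : √(√((2:ℝ)^(i+j)) / max (2^i) (2^j)) ≤ 0.841^((i-j)+(j-i)) := by
  have main : ∀ a d : ℕ, √(√((2:ℝ)^(a+(a+d))) / 2^(a+d)) ≤ 0.841^d := by
    intro a d
    apply Real.sqrt_le_iff.2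
    refine ⟨by positivity, ?_⟩
    rw [div_le_iff₀ (by positivity)]
    apply Real.sqrt_le_iff.2
    refine ⟨by positivity, ?_⟩
    have e : ((0.841^d)^2 * (2:ℝ)^(a+d))^2 = (0.841^4*2)^d * 2^(a+(a+d)) := by
      rw [mul_pow, mul_pow, ← pow_mul, ← pow_mul, ← pow_mul, ← pow_mul, mul_comm 4 d]
      ring
    rw [e]
    have h1 : (1:ℝ) ≤ (0.841^4*2)^d := one_le_pow₀ (by norm_num)
    nlinarith [pow_pos (show (0:ℝ) < 2 by norm_num) (a+(a+d))]
  rcases le_total i j with h | h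
  · obtain ⟨d, rfl⟩ := Nat.exists_eq_add_of_le h
    rw [max_eq_right (pow_le_pow_right₀ (by norm_num) h)]
    have := main i d
    rwa [show (i - (i+d)) + (i+d-i) = d by omega]
  · obtain ⟨d, rfl⟩ := Nat.exists_eq_add_of_le h
    rw [max_eq_left (pow_le_pow_right₀ (by norm_num) h), show j + d + j = j + (j+d) by ring]
    have := main j d
    rwa [show (j+d-j) + (j-(j+d)) = d by omega]

lemma ss_le (I i j : ℕ) (hi : i ≤ I) (hj : j ≤ I) : √((2:ℝ)^(i+j)) ≤ 2^I * 0.7072^((I-i)+(I-j)) := by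
  apply Real.sqrt_le_iff.2
  refine ⟨by positivity, ?_⟩
  set m := (I-i)+(I-j) with hm
  have h1 : (2:ℝ)^(i+j) * 2^m = (2^I)^2 := by
    rw [← pow_add, ← pow_mul]; congr 1; omega
  rw [mul_pow, ← h1]
  have e : (2:ℝ)^(i+j) * 2^m * (0.7072^m)^2 = 2^(i+j) * (2*0.7072^2)^m := by
    rw [mul_pow, ← pow_mul, ← pow_mul, mul_comm m 2]; ring
  rw [e]
  have h2 : (1:ℝ) ≤ (2*0.7072^2)^m := one_le_pow₀ (by norm_num)
  nlinarith [pow_pos (show (0:ℝ) < 2 by norm_num) (i+j)]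

lemma kr_le {T R ρ : ℝ} (hT0 : 0 < T) (hρ : ρ^2 = R) (hρ0 : 0 < ρ) (U : ℕ) (hU : 1 ≤ U) (hU2 : U * R ≤ T^4) (i j : ℕ)
    (hi : i ≤ Nat.log 2 U) (hj : j ≤ Nat.log 2 U) (hb : T^6 / U < 2^i * 2^j) :
    T^3*R^2 ≤ T^4*R*ρ * 0.891^((Nat.log 2 U-i)+(Nat.log 2 U-j)) := by
  set I := Nat.log 2 U with hI
  set m := (I-i)+(I-j) with hm
  have hU0 : (0:ℝ) < U := by exact_mod_cast hU
  have hR0 : 0 < R := by rw [← hρ]; positivity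
  have h1 : (2:ℝ)^i * 2^j * 2^m = (2^I)^2 := by
    rw [← pow_add, ← pow_add, ← pow_mul]; congr 1; omega
  have h2 : (2:ℝ)^I ≤ U := by exact_mod_cast Nat.pow_log_le_self 2 (by omega : U ≠ 0)
  rw [div_lt_iff₀ hU0] at hb
  have h3 : T^6 * 2^m ≤ U^3 := by
    calc T^6 * 2^m ≤ 2^i * 2^j * U * 2^m := by gcongr
      _ = U * (2^I)^2 := by rw [← h1]; ring
      _ ≤ U * U^2 := by gcongr
      _ = _ := by ring
  have h4 : R^3 * 2^m ≤ T^6 := by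
    have a : U^3 * R^3 ≤ T^6 * T^6 := by
      calc U^3 * R^3 = (U*R)^3 := by ring
        _ ≤ (T^4)^3 := by gcongr
        _ = _ := by ring
    have b : T^6 * (R^3 * 2^m) ≤ T^6 * T^6 := by
      calc T^6 * (R^3 * 2^m) = (T^6 * 2^m) * R^3 := by ring
        _ ≤ U^3 * R^3 := by gcongr
        _ ≤ _ := a
    exact le_of_mul_le_mul_left b (by positivity)
  have h5 : ρ ≤ T * 0.891^m := by
    apply le_of_pow_le_pow_left₀ (n := 6) (by norm_num) (by positivity)
    have a : (T * 0.891^m)^6 * 2^m = T^6 * (0.891^6*2)^m := by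
      rw [mul_pow, mul_pow, ← pow_mul, ← pow_mul, mul_comm m 6]; ring
    have b : (1:ℝ) ≤ (0.891^6*2)^m := one_le_pow₀ (by norm_num)
    have c : ρ^6 = R^3 := by rw [← hρ]; ring
    rw [c]
    have d : R^3 * 2^m ≤ (T * 0.891^m)^6 * 2^m := by
      rw [a]; nlinarith [pow_pos hT0 6]
    exact le_of_mul_le_mul_right d (by positivity)
  calc T^3*R^2 = T^3 * R * ρ * ρ := by rw [← hρ]; ring
    _ ≤ T^3 * R * ρ * (T * 0.891^m) := by gcongr
    _ = _ := by ring

lemma logU_nat {l : ℝ} (h75 : 75 ≤ l) (U : ℕ) (hU : 1 ≤ U) (hUl : Real.log U ≤ 4/9 * l) : ((Nat.log 2 U:ℕ):ℝ) + 1 ≤ 0.6546 * l := by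
  have h1 : (2:ℝ)^(Nat.log 2 U) ≤ U := by exact_mod_cast Nat.pow_log_le_self 2 (by omega : U ≠ 0)
  have h2 := Real.log_le_log (by positivity) h1
  rw [Real.log_pow] at h2
  have := Real.log_two_gt_d9
  nlinarith [(Nat.cast_nonneg (Nat.log 2 U) : (0:ℝ) ≤ _)]

set_option maxHeartbeats 1000000 in
lemma Fam.box_sum {ι : Type} (F : Fam ι) {x w T R ρ : ℝ} (hw : 2.94 ≤ w) (hwl : w^4 = Real.log x) (h75 : 75 ≤ Real.log x) (hx : 1 ≤ x)
    (hT : x = T^6) (hT0 : 0 < T) (hρ : ρ^2 = R) (hρ0 : 0 < ρ) (hZ : F.Z + 1 = 7.29 * R^2) (hP0 : 0 ≤ F.P) (hP : R ≤ T^2 → F.P ≤ 0.5036 * w^4 * ρ)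
    (U : ℕ) (hU : 4 ≤ U) (hUx : (U:ℝ)^2 ≤ x) (hUl : Real.log U ≤ 4/9 * Real.log x) (hU1 : (U:ℝ) ≤ R^2) (hU2 : U * R ≤ T^4)
    (Y : ι → ℕ) (hY : ∀ i ∈ F.s, (Y i : ℝ) ≤ x) :
    ∑ r ∈ boxes x U, F.box x U Y r ≤ 37 * w^14 * (T^4*R*ρ) + 57 * w^8 * T^6 := by
  classical
  have hR0 : 0 < R := by rw [← hρ]; positivity
  have hw0 : 0 < w := by linarith
  have hU0 : (0:ℝ) < U := by positivity
  set I := Nat.log 2 U with hI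
  have hI2 : (2:ℝ)^I ≤ U := by exact_mod_cast Nat.pow_log_le_self 2 (by omega : U ≠ 0)
  have hmem : ∀ p ∈ boxes x U, p.1 ≤ I ∧ p.2 ≤ I ∧ T^6 / U < 2^p.1 * 2^p.2 := by
    intro p hp
    unfold boxes at hp
    rw [Finset.mem_filter, Finset.mem_product, Finset.mem_range, Finset.mem_range] at hp
    obtain ⟨⟨h1, h2⟩, h3⟩ := hp
    push Not at h3
    refine ⟨by omega, by omega, ?_⟩
    rw [← hT]
    refine h3.trans_le (le_of_eq ?_)
    push_cast; ring
  rcases (boxes x U).eq_empty_or_nonempty with he | ⟨p0, hp0⟩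
  · rw [he, Finset.sum_empty]; positivity
  have hRT : R ≤ T^2 := by
    obtain ⟨h1, h2, h3⟩ := hmem p0 hp0
    have a1 : (2:ℝ)^p0.1 ≤ U := (pow_le_pow_right₀ (by norm_num) h1).trans hI2
    have a2 : (2:ℝ)^p0.2 ≤ U := (pow_le_pow_right₀ (by norm_num) h2).trans hI2
    rw [div_lt_iff₀ hU0] at h3
    have a3 : T^6 ≤ U^3 := by
      calc T^6 ≤ 2^p0.1 * 2^p0.2 * U := h3.le
        _ ≤ U * U * U := by gcongr
        _ = _ := by ring
    have a4 : T^2 ≤ U := by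
      apply le_of_pow_le_pow_left₀ (n := 3) (by norm_num) hU0.le
      calc (T^2)^3 = T^6 := by ring
        _ ≤ _ := a3
    have a5 : T^2 * R ≤ T^2 * T^2 := by
      calc T^2 * R ≤ U * R := by gcongr
        _ ≤ T^4 := hU2
        _ = _ := by ring
    exact le_of_mul_le_mul_left a5 (by positivity)
  have hP' := hP hRT
  set G := T^4*R*ρ with hG
  have hG0 : 0 < G := by positivity
  have hsub : boxes x U ⊆ Finset.range (I+1) ×ˢ Finset.range (I+1) := by
    intro p hp
    obtain ⟨h1, h2, h3⟩ := hmem p hp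
    rw [Finset.mem_product, Finset.mem_range, Finset.mem_range]; omega
  set g : ℕ × ℕ → ℝ := fun p => 38 * w^6 * G + 4.88 * w^8 * (T^2*R) * 2^I * 0.7072^((I-p.1)+(I-p.2)) + 17.3 * w^8 * G * 0.841^((p.1-p.2)+(p.2-p.1))
    + 30.7 * w^8 * G * 0.891^((I-p.1)+(I-p.2)) with hg
  have h1 : ∑ r ∈ boxes x U, F.box x U Y r ≤ ∑ p ∈ Finset.range (I+1) ×ˢ Finset.range (I+1), g p := by
    refine le_trans (Finset.sum_le_sum (g := g) ?_) (Finset.sum_le_sum_of_subset_of_nonneg hsub ?_)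
    · rintro ⟨i, j⟩ hp
      obtain ⟨b1, b2, b3⟩ := hmem _ hp
      simp only at b1 b2 b3
      have k := F.box_one hw hwl h75 hx hT hT0 hρ hρ0 hZ hP0 hP' U hU hUx hUl hU1 hU2 i j hp Y hY
      have k1 := ss_le I i j b1 b2
      have k2 := sd_le i j
      have k3 := kr_le hT0 hρ hρ0 U (by omega) hU2 i j b1 b2 b3
      rw [← hI, ← hG] at k3
      have m1 := mul_le_mul_of_nonneg_left k1 (show 0 ≤ 4.88 * w^8 * (T^2*R) by positivity)
      have m2 := mul_le_mul_of_nonneg_left k2 (show 0 ≤ 17.3 * w^8 * G by positivity)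
      have m3 := mul_le_mul_of_nonneg_left k3 (show 0 ≤ 30.7 * w^8 by positivity)
      simp only [hg]
      rw [← hG] at k
      linarith
    · intro p _ _
      simp only [hg]; positivity
  refine h1.trans ?_
  simp only [hg]
  rw [Finset.sum_add_distrib, Finset.sum_add_distrib, Finset.sum_add_distrib, Finset.sum_const,
    Finset.card_product, Finset.card_range, nsmul_eq_mul, ← Finset.mul_sum, ← Finset.mul_sum, ← Finset.mul_sum]
  have s1 := geo_sq (c := 0.7072) (by norm_num) (by norm_num) I
  have s2 := geo_diff (c := 0.841) (by norm_num) (by norm_num) I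
  have s3 := geo_sq (c := 0.891) (by norm_num) (by norm_num) I
  have hIl := logU_nat h75 U (by omega) hUl
  rw [← hI, ← hwl] at hIl
  have q1 : (((I+1)*(I+1) : ℕ):ℝ) * (38 * w^6 * G) ≤ 16.3 * w^14 * G := by
    have : (((I+1)*(I+1) : ℕ):ℝ) ≤ (0.6546 * w^4)^2 := by
      push_cast; rw [← sq]; exact pow_le_pow_left₀ (by positivity) hIl 2
    calc _ ≤ (0.6546 * w^4)^2 * (38 * w^6 * G) := by gcongr
      _ = (0.6546^2*38) * (w^14 * G) := by ring
      _ ≤ 16.3 * (w^14 * G) := mul_le_mul_of_nonneg_right (by norm_num) (by positivity)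
      _ = _ := by ring
  have q2 : 4.88 * w^8 * (T^2*R) * 2^I * ∑ p ∈ Finset.range (I+1) ×ˢ Finset.range (I+1), (0.7072:ℝ)^((I-p.1)+(I-p.2)) ≤ 57 * w^8 * T^6 := by
    calc _ ≤ 4.88 * w^8 * (T^2*R) * 2^I * 11.665 := by
          refine mul_le_mul_of_nonneg_left (s1.trans (by norm_num)) (by positivity)
      _ ≤ 4.88 * w^8 * (T^2*R) * U * 11.665 := by gcongr
      _ = (4.88*11.665) * (w^8 * T^2 * (U*R)) := by ring
      _ ≤ 57 * (w^8 * T^2 * T^4) := by gcongr; norm_num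
      _ = _ := by ring
  have hw2 : 8.64 ≤ w^2 := by nlinarith
  have q3 : 17.3 * w^8 * G * ∑ p ∈ Finset.range (I+1) ×ˢ Finset.range (I+1), (0.841:ℝ)^((p.1-p.2)+(p.2-p.1)) ≤ 16.5 * w^14 * G := by
    calc _ ≤ 17.3 * w^8 * G * ((0.6546 * w^4) * 12.58) := by
          refine mul_le_mul_of_nonneg_left (s2.trans ?_) (by positivity)
          exact mul_le_mul hIl (by norm_num) (by norm_num) (by positivity)
      _ = (17.3*0.6546*12.58) * (w^12 * G) := by ring
      _ ≤ (16.5*8.64) * (w^12 * G) := mul_le_mul_of_nonneg_right (by norm_num) (by positivity)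
      _ ≤ (16.5*w^2) * (w^12 * G) := by gcongr
      _ = _ := by ring
  have q4 : 30.7 * w^8 * G * ∑ p ∈ Finset.range (I+1) ×ˢ Finset.range (I+1), (0.891:ℝ)^((I-p.1)+(I-p.2)) ≤ 4.1 * w^14 * G := by
    calc _ ≤ 30.7 * w^8 * G * 84.17 := by
          refine mul_le_mul_of_nonneg_left (s3.trans (by norm_num)) (by positivity)
      _ = (30.7*84.17) * (w^8 * G) := by ring
      _ ≤ (4.1*8.64^3) * (w^8 * G) := mul_le_mul_of_nonneg_right (by norm_num) (by positivity)
      _ ≤ (4.1*(w^2)^3) * (w^8 * G) := by gcongr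
      _ = _ := by ring
  have : 0 < w^14 * G := by positivity
  linarith
end BV

namespace BV

lemma Fam.total {ι : Type} (F : Fam ι) (U : ℕ) (Y : ι → ℕ) :
    ∑ i ∈ F.s, F.w i * ‖∑ n ∈ Finset.Icc 1 (Y i), ((Λ n : ℝ) : ℂ) * F.χ i n‖ ≤
      ∑ i ∈ F.s, F.w i * ‖∑ n ∈ Finset.Icc 1 (Y i), ((lo U Λ n : ℝ) : ℂ) * F.χ i n‖
      + ∑ i ∈ F.s, F.w i * ‖∑ p ∈ prs (Y i), ((lo U mu p.1 : ℝ) : ℂ) * ((ArithmeticFunction.log p.2 : ℝ):ℂ) * F.χ i (p.1 * p.2)‖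
      + ∑ i ∈ F.s, F.w i * ‖∑ p ∈ prs (Y i), (((lo U mu * lo U Λ) p.1 : ℝ) : ℂ) * ((ze p.2 : ℝ):ℂ) * F.χ i (p.1 * p.2)‖
      + ∑ i ∈ F.s, F.w i * ‖∑ p ∈ prs (Y i), ((hi U Λ p.1 : ℝ) : ℂ) * ((bU U p.2 : ℝ):ℂ) * F.χ i (p.1 * p.2)‖ := by
  rw [← Finset.sum_add_distrib, ← Finset.sum_add_distrib, ← Finset.sum_add_distrib]
  refine Finset.sum_le_sum fun i hi => ?_
  rw [← mul_add, ← mul_add, ← mul_add]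
  refine mul_le_mul_of_nonneg_left ?_ (F.hw i hi)
  rw [← conv_sum _ _ (F.χ i), ← conv_sum _ _ (F.χ i), ← conv_sum _ _ (F.χ i)]
  have e : ∑ n ∈ Finset.Icc 1 (Y i), ((Λ n : ℝ) : ℂ) * F.χ i n = 
      ∑ n ∈ Finset.Icc 1 (Y i), ((lo U Λ n : ℝ) : ℂ) * F.χ i n 
      + ∑ n ∈ Finset.Icc 1 (Y i), (((lo U mu * ArithmeticFunction.log) n : ℝ) : ℂ) * F.χ i n 
      - ∑ n ∈ Finset.Icc 1 (Y i), (((lo U mu * lo U Λ * ze) n : ℝ) : ℂ) * F.χ i n 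
      + ∑ n ∈ Finset.Icc 1 (Y i), ((((BV.hi U Λ) * bU U) n : ℝ) : ℂ) * F.χ i n := by
    rw [← Finset.sum_add_distrib, ← Finset.sum_sub_distrib, ← Finset.sum_add_distrib]
    refine Finset.sum_congr rfl fun n _ => ?_
    have h := congrArg (fun f : ArithmeticFunction ℝ => f n) (vaughan U)
    simp only [ArithmeticFunction.add_apply, sub_eq_add_neg, ArithmeticFunction.neg_apply] at h
    rw [h]; push_cast; ring
  rw [e]
  refine (norm_add_le _ _).trans ?_
  gcongr
  refine (norm_sub_le _ _).trans ?_
  gcongr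
  exact norm_add_le _ _

lemma P_le {x w T R ρ : ℝ} (hw : 2.94 ≤ w) (hwl : w^4 = Real.log x) (h75 : 75 ≤ Real.log x) 
    (hT : x = T^6) (hT0 : 0 < T) (hρ : ρ^2 = R) (hρ0 : 0 < ρ) (hRT : 2 * R ≤ T^3) : √(2*R) * (1 + Real.log (2*R)) ≤ 0.7262 * w^4 * ρ ∧
     (R ≤ T^2 → √(2*R) * (1 + Real.log (2*R)) ≤ 0.5036 * w^4 * ρ) := by
  have hR0 : 0 < R := by rw [← hρ]; positivity
  have hs : √(2*R) ≤ 1.41422 * ρ := by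
    apply Real.sqrt_le_iff.2
    refine ⟨by positivity, ?_⟩
    rw [← hρ]; nlinarith [sq_nonneg ρ]
  have hl : Real.log x = 6 * Real.log T := by rw [hT, Real.log_pow]; push_cast; ring
  rw [hwl]
  constructor
  · have h1 := Real.log_le_log (by positivity) hRT
    rw [Real.log_pow] at h1
    push_cast at h1
    have h2 : 1 + Real.log (2*R) ≤ 0.51334 * Real.log x := by linarith
    calc _ ≤ √(2*R) * (0.51334 * Real.log x) := mul_le_mul_of_nonneg_left h2 (Real.sqrt_nonneg _)
      _ ≤ (1.41422 * ρ) * (0.51334 * Real.log x) := mul_le_mul_of_nonneg_right hs (by linarith)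
      _ = (1.41422*0.51334) * (Real.log x * ρ) := by ring
      _ ≤ 0.7262 * (Real.log x * ρ) := mul_le_mul_of_nonneg_right (by norm_num) (by nlinarith)
      _ = _ := by ring
  · intro hR
    have h1 := Real.log_le_log hR0 hR
    rw [Real.log_pow] at h1
    push_cast at h1
    have h2 : 1 + Real.log (2*R) ≤ 0.35592 * Real.log x := by
      rw [Real.log_mul (by norm_num) hR0.ne']
      have := Real.log_two_lt_d9
      linarith
    calc _ ≤ √(2*R) * (0.35592 * Real.log x) := mul_le_mul_of_nonneg_left h2 (Real.sqrt_nonneg _)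
      _ ≤ (1.41422 * ρ) * (0.35592 * Real.log x) := mul_le_mul_of_nonneg_right hs (by linarith)
      _ = (1.41422*0.35592) * (Real.log x * ρ) := by ring
      _ ≤ 0.5036 * (Real.log x * ρ) := mul_le_mul_of_nonneg_right (by norm_num) (by nlinarith)
      _ = _ := by ring

lemma Fam.dyB_le {ι : Type} (F : Fam ι) {x w T R ρ : ℝ} (hw : 2.94 ≤ w) (hwl : w^4 = Real.log x) (h75 : 75 ≤ Real.log x) (hx : 1 ≤ x)
    (hT : x = T^6) (hT0 : 0 < T) (hρ : ρ^2 = R) (hρ0 : 0 < ρ) (hZ : F.Z + 1 = 7.29 * R^2) 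
    (U : ℕ) (hU0 : (0:ℝ) < U) (hU : R^2 ≤ 1.01 * U ∨ T^4/R ≤ 1.01 * U) :
    F.dyB x U ≤ 1.4561 * w^4 * (2.56 * w * T^3 + 12.25 * w^4 * R^2) + 36.2 * w^3 * (T^3 + T*R*ρ) := by
  have hR0 : 0 < R := by rw [← hρ]; positivity
  have hx0 : 0 < x := by linarith
  have hw0 : 0 < w := by linarith
  unfold dyB
  rw [hZ]
  have hsx : √x = T^3 := by rw [hT, show T^6 = (T^3)^2 by ring]; exact Real.sqrt_sq (by positivity)
  rw [hsx]
  have e1 := E1_le hw hwl h75 hx0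
  have e2 := E2_le hw hwl h75 hx0
  have e1' := E1_ge hx
  have e2' := E2_ge hx
  rw [← hwl] at e2
  have h2 : √2 ≤ 1.41422 := by
    apply Real.sqrt_le_iff.2; norm_num
  have a1 : 1 + Real.log x / Real.log 2 ≤ 1.4561 * w^4 := by
    rw [hwl]
    have : Real.log x / Real.log 2 ≤ 1.4427 * Real.log x := by
      rw [div_le_iff₀ (Real.log_pos (by norm_num))]
      have := Real.log_two_gt_d9
      nlinarith
    linarith
  have a2 : √2 * E1 x * T^3 ≤ 2.56 * w * T^3 := by
    have : √2 * E1 x ≤ 1.41422 * (1.81 * w) := mul_le_mul h2 e1 (by linarith) (by norm_num)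
    exact mul_le_mul_of_nonneg_right (by linarith) (by positivity)
  have a3 : E2 x * (7.29 * R^2) ≤ 12.25 * w^4 * R^2 := by
    have : 0 ≤ w^4 * R^2 := by positivity
    calc _ ≤ 1.68 * w^4 * (7.29 * R^2) := mul_le_mul_of_nonneg_right e2 (by positivity)
      _ = 1.68*7.29 * (w^4 * R^2) := by ring
      _ ≤ _ := by nlinarith
  have a4 : √(E1 x * E2 x * (7.29 * R^2)) ≤ 2.747 * w^3 * R := by
    apply Real.sqrt_le_iff.2
    refine ⟨by positivity, ?_⟩
    calc E1 x * E2 x * (7.29 * R^2) ≤ (1.81 * w) * (1.68 * w^4) * (7.29 * R^2) := by gcongr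
      _ = (1.81*1.68*7.29) * (w^5 * R^2) := by ring
      _ ≤ (7.54*2.94) * (w^5*R^2) := mul_le_mul_of_nonneg_right (by norm_num) (by positivity)
      _ ≤ (7.54*w) * (w^5*R^2) := by gcongr
      _ = 7.54 * (w^6*R^2) := by ring
      _ ≤ 2.747^2 * (w^6*R^2) := mul_le_mul_of_nonneg_right (by norm_num) (by positivity)
      _ = _ := by ring
  have a5 : R * √(x/U) ≤ 1.005 * (T^3 + T*R*ρ) := by
    rcases hU with h | h
    · have : √(x/U) ≤ 1.005 * T^3 / R := by
        apply Real.sqrt_le_iff.2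
        refine ⟨by positivity, ?_⟩
        rw [div_le_iff₀ hU0, hT]
        calc T^6 = T^6 / R^2 * R^2 := by field_simp
          _ ≤ T^6 / R^2 * (1.01 * U) := by gcongr
          _ = 1.01 * (T^6 / R^2 * U) := by ring
          _ ≤ 1.005^2 * (T^6 / R^2 * U) := mul_le_mul_of_nonneg_right (by norm_num) (by positivity)
          _ = _ := by ring
      calc R * √(x/U) ≤ R * (1.005 * T^3 / R) := by gcongr
        _ = 1.005 * T^3 := by field_simp
        _ ≤ _ := by nlinarith [show 0 < T*R*ρ by positivity]
    · have : √(x/U) ≤ 1.005 * (T * ρ) := by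
        apply Real.sqrt_le_iff.2
        refine ⟨by positivity, ?_⟩
        rw [div_le_iff₀ hU0, hT]
        calc T^6 = T^2*R * (T^4/R) := by field_simp
          _ ≤ T^2*R * (1.01 * U) := by gcongr
          _ = 1.01 * (T^2*R * U) := by ring
          _ ≤ 1.005^2 * (T^2*R * U) := mul_le_mul_of_nonneg_right (by norm_num) (by positivity)
          _ = _ := by rw [← hρ]; ring
      calc R * √(x/U) ≤ R * (1.005 * (T * ρ)) := by gcongr
        _ = 1.005 * (T*R*ρ) := by ring
        _ ≤ _ := by nlinarith [show 0 < T^3 by positivity]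
  refine add_le_add (mul_le_mul a1 (add_le_add a2 a3) (by positivity) (by positivity)) ?_
  calc 13.1 * √(E1 x * E2 x * (7.29 * R^2)) * √(x/U) ≤ 13.1 * (2.747 * w^3 * R) * √(x/U) := by gcongr
    _ = 13.1 * 2.747 * w^3 * (R * √(x/U)) := by ring
    _ ≤ 13.1 * 2.747 * w^3 * (1.005 * (T^3 + T*R*ρ)) := by gcongr
    _ = (13.1*2.747*1.005) * (w^3 * (T^3 + T*R*ρ)) := by ring
    _ ≤ 36.2 * (w^3 * (T^3 + T*R*ρ)) := mul_le_mul_of_nonneg_right (by norm_num) (by positivity)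
    _ = _ := by ring

set_option maxHeartbeats 1000000 in
lemma block0 {x w T R ρ : ℝ} (hw : 2.94 ≤ w) (hwl : w^4 = Real.log x) (h75 : 75 ≤ Real.log x) (hx : 1 ≤ x)
    (hT : x = T^6) (hT0 : 0 < T) (hρ : ρ^2 = R) (hρ0 : 0 < ρ) (hR : 1 ≤ R) (hR4 : 10000 ≤ R) (hRT : 2 * R ≤ T^3) 
    (U : ℕ) (hU : 262144 ≤ U) (hUx : (U:ℝ)^2 ≤ x) (hUl : Real.log U ≤ 4/9 * Real.log x) (hU1 : (U:ℝ) ≤ R^2) (hU2 : U * R ≤ T^4)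
    (hU3 : R^2 ≤ 1.01 * U ∨ T^4/R ≤ 1.01 * U)
    (Y : Ch → ℕ) (hY : ∀ i ∈ (FF R hR).s, (Y i : ℝ) ≤ x) :
    ∑ i ∈ (FF R hR).s, (FF R hR).w i * ‖∑ n ∈ Finset.Icc 1 (Y i), ((Λ n : ℝ) : ℂ) * (FF R hR).χ i n‖ ≤
      30 * w^10 * T^6 + 18 * w^14 * (T^3 * R^2) + 40 * w^14 * (T^4*R*ρ) := by
  have hR0 : 0 < R := by linarith
  have hx0 : 0 < x := by linarith
  have hw0 : 0 < w := by linarith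
  have hU0 : (0:ℝ) < U := by exact_mod_cast (by omega : 0 < U)
  have hP := P_le hw hwl h75 hT hT0 hρ hρ0 hRT
  have hZ : (FF R hR).Z + 1 = 7.29 * R^2 := by simp only [FF]; ring
  have hW : (FF R hR).W ≤ 2.001 * R^2 := by simp only [FF]; nlinarith
  have hW0 : 0 ≤ (FF R hR).W := by simp only [FF]; positivity
  have hPd : (FF R hR).P = √(2*R) * (1 + Real.log (2*R)) := rfl
  have hP0 : 0 ≤ (FF R hR).P := by
    rw [hPd]; have := Real.log_nonneg (show 1 ≤ 2*R by linarith); positivity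
  rw [← hPd] at hP
  generalize FF R hR = F at *
  obtain ⟨hP1, hP2⟩ := hP
  have t := F.total U Y
  have s1 := F.S1 U Y
  have s2 := F.S2 U hP0 hx Y hY
  have s3 := F.S3 hx U (by omega) hUx hP0 Y hY
  have s4 := F.S4 hx U hU Y hY
  have bs := F.box_sum hw hwl h75 hx hT hT0 hρ hρ0 hZ hP0 hP2 U (by omega) hUx hUl hU1 hU2 Y hY
  have hd := F.dyB_le hw hwl h75 hx hT hT0 hρ hρ0 hZ U hU0 hU3
  set G := T^4*R*ρ with hG
  have hG0 : 0 < G := by positivity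
  have hsx : √x = T^3 := by rw [hT, show T^6 = (T^3)^2 by ring]; exact Real.sqrt_sq (by positivity)
  have hw2 : 8.64 ≤ w^2 := by nlinarith
  have hw6 : 640 ≤ w^6 := by
    calc (640:ℝ) ≤ 8.64^3 := by norm_num
      _ ≤ (w^2)^3 := by gcongr
      _ = _ := by ring
  have hρ1 : 100 ≤ ρ := by
    by_contra h; push Not at h; nlinarith
  have u1 : F.W * ∑ n ∈ Finset.Icc 1 U, Λ n ≤ 0.1 * w^14 * G := by
    calc _ ≤ 2.001 * R^2 * (2.86 * U) := by
          refine mul_le_mul hW (lam_sum U) (Finset.sum_nonneg fun _ _ => vonMangoldt_nonneg) (by positivity)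
      _ = 2.001*2.86 * R * (U * R) := by ring
      _ ≤ 2.001*2.86 * R * T^4 := by gcongr
      _ ≤ 6 * R * T^4 := by gcongr; norm_num
      _ ≤ (0.1 * w^14 * ρ) * R * T^4 := by
          gcongr
          have : 1 ≤ w^14 := one_le_pow₀ (by linarith)
          nlinarith
      _ = _ := by ring
  have u2 : F.W * (U * (2 * F.P * Real.log x)) ≤ 0.1 * w^14 * G := by
    rw [← hwl]
    calc _ ≤ 2.001 * R^2 * (U * (2 * (0.7262 * w^4 * ρ) * w^4)) := by gcongr
      _ = 2.001*2*0.7262 * w^8 * R * ρ * (U * R) := by ring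
      _ ≤ 2.001*2*0.7262 * w^8 * R * ρ * T^4 := by gcongr
      _ = 2.001*2*0.7262 * (w^8 * G) := by ring
      _ ≤ 0.1 * w^6 * (w^8 * G) := mul_le_mul_of_nonneg_right (by linarith) (by positivity)
      _ = _ := by ring
  have u3 : F.W * (U * Real.log U * F.P) ≤ 0.1 * w^14 * G := by
    rw [← hwl] at hUl
    have := Real.log_natCast_nonneg U
    calc _ ≤ 2.001 * R^2 * (U * (4/9 * w^4) * (0.7262 * w^4 * ρ)) := by gcongr
      _ = 2.001*(4/9)*0.7262 * w^8 * R * ρ * (U * R) := by ring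
      _ ≤ 2.001*(4/9)*0.7262 * w^8 * R * ρ * T^4 := by gcongr
      _ = 2.001*(4/9)*0.7262 * (w^8 * G) := by ring
      _ ≤ 0.1 * w^6 * (w^8 * G) := mul_le_mul_of_nonneg_right (by linarith) (by positivity)
      _ = _ := by ring
  have v1 : √(Real.log x^2 * 1 * x) = w^4 * T^3 := by
    rw [mul_one, Real.sqrt_mul (by positivity), hsx, Real.sqrt_sq (by linarith), hwl]
  have v2 : √(3 * Real.log x * Cb U * x) ≤ 2.331 * w^5 * T^3 := by
    have hc := Cb_le hw hwl h75 hx0 U (by omega) hUl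
    have hc0 := Cb_ge (U := U) (by omega)
    rw [← hwl]
    apply Real.sqrt_le_iff.2
    refine ⟨by positivity, ?_⟩
    rw [hT]
    calc 3 * w^4 * Cb U * T^6 ≤ 3 * w^4 * (5.32 * w^5) * T^6 := by gcongr
      _ = 3*5.32 * (w^9 * T^6) := by ring
      _ ≤ (5.43*2.94) * (w^9 * T^6) := mul_le_mul_of_nonneg_right (by norm_num) (by positivity)
      _ ≤ (5.43*w) * (w^9 * T^6) := by gcongr
      _ = 5.43 * (w^10 * T^6) := by ring
      _ ≤ 2.331^2 * (w^10 * T^6) := mul_le_mul_of_nonneg_right (by norm_num) (by positivity)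
      _ = _ := by ring
  set D := F.dyB x U with hD
  have hD0 : 0 ≤ 1.4561 * w^4 * (2.56 * w * T^3 + 12.25 * w^4 * R^2) + 36.2 * w^3 * (T^3 + T*R*ρ) := by positivity
  have v3 : √(Real.log x^2 * 1 * x) * D + √(3 * Real.log x * Cb U * x) * D ≤ 2.6722 * w^5 * T^3 * (1.4561 * w^4 * (2.56 * w * T^3 + 12.25 * w^4 * R^2) + 36.2 * w^3 * (T^3 + T*R*ρ)) := by
    rw [← add_mul]
    refine mul_le_mul ?_ hd ?_ (by positivity)
    · rw [v1]
      have : w^4 * T^3 ≤ 0.3412 * w^5 * T^3 := by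
        gcongr ?_ * _
        calc w^4 ≤ w^4 * (0.3412 * w) := by
              have : 1 ≤ 0.3412 * w := by linarith
              nlinarith [pow_pos hw0 4]
          _ = _ := by ring
      linarith
    · have := Fam.E1_ge hx
      have := Fam.E2_ge hx
      have := F.hZ
      have := Real.log_pos (show (1:ℝ) < 2 by norm_num)
      rw [hD]; unfold Fam.dyB; positivity
  have z1 : 2.6722 * w^5 * T^3 * (1.4561 * w^4 * (2.56 * w * T^3 + 12.25 * w^4 * R^2) + 36.2 * w^3 * (T^3 + T*R*ρ))
    = 2.6722*1.4561*2.56 * (w^10 * T^6) + 2.6722*1.4561*12.25 * (w^13 * (T^3 * R^2)) + 2.6722*36.2 * (w^8 * T^6) + 2.6722 * 36.2 * (w^8 * G) := by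
    rw [hG]; ring
  have z2 : w^13 * (T^3 * R^2) ≤ w^14 * (T^3 * R^2) / 2.94 := by
    rw [le_div_iff₀ (by norm_num)]
    calc _ ≤ w^13 * (T^3*R^2) * w := by gcongr
      _ = _ := by ring
  have z3 : w^8 * T^6 ≤ w^10 * T^6 / 8.64 := by
    rw [le_div_iff₀ (by norm_num)]
    calc _ ≤ w^8 * T^6 * w^2 := by gcongr
      _ = _ := by ring
  have z4 : w^8 * G ≤ w^14 * G / 640 := by
    rw [le_div_iff₀ (by norm_num)]
    calc _ ≤ w^8 * G * w^6 := by gcongr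
      _ = _ := by ring
  have y1 : 0 < w^10 * T^6 := by positivity
  have y2 : 0 < w^14 * (T^3 * R^2) := by positivity
  have y3 : 0 < w^14 * G := by positivity
  rw [z1] at v3
  have A := t.trans (add_le_add (add_le_add (add_le_add s1 s2) s3) s4)
  refine A.trans ?_
  clear A t s1 s2 s3 s4 z1
  generalize √(Real.log x^2 * 1 * x) * D = a1 at *
  generalize √(3 * Real.log x * Cb U * x) * D = a2 at *
  generalize ∑ r ∈ boxes x U, F.box x U Y r = a3 at *
  generalize F.W * ∑ n ∈ Finset.Icc 1 U, Λ n = a4 at *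
  generalize F.W * (U * (2 * F.P * Real.log x)) = a5 at *
  generalize F.W * (U * Real.log U * F.P) = a6 at *
  have b1 : a3 ≤ 37 * (w^14 * G) + 57 * (w^8 * T^6) := by linarith
  have b2 : a4 ≤ 0.1 * (w^14 * G) := by linarith
  have b3 : a5 ≤ 0.1 * (w^14 * G) := by linarith
  have b4 : a6 ≤ 0.1 * (w^14 * G) := by linarith
  rw [mul_assoc, mul_assoc 18, mul_assoc 40]
  generalize w^14 * G = g1 at *
  generalize w^8 * G = g2 at *
  generalize w^10 * T^6 = g3 at *
  generalize w^8 * T^6 = g4 at *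
  generalize w^13 * (T^3 * R^2) = g5 at *
  generalize w^14 * (T^3 * R^2) = g6 at *
  clear * - b1 b2 b3 b4 v3 z2 z3 z4 y1 y2 y3
  rw [le_div_iff₀ (by norm_num)] at z2 z3 z4
  norm_num at b1 b2 b3 b4 v3 z2 z3 z4
  linarith
end BV

namespace BV

theorem block {x w T R ρ : ℝ} (hw0 : 0 < w) (hwl : w^4 = Real.log x) (h75 : 75 ≤ Real.log x) (hx : 1 ≤ x)
    (hT : x = T^6) (hT0 : 0 < T) (hρ : ρ^2 = R) (hρ0 : 0 < ρ) (hR : 1 ≤ R) (hR4 : 10000 ≤ R) (hRT : 2 * R ≤ T^3) 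
    (Y : Ch → ℕ) (hY : ∀ i ∈ (FF R hR).s, (Y i : ℝ) ≤ x) :
    ∑ i ∈ (FF R hR).s, (FF R hR).w i * ‖∑ n ∈ Finset.Icc 1 (Y i), ((Λ n : ℝ) : ℂ) * (FF R hR).χ i n‖ ≤
      30 * w^10 * T^6 + 18 * w^14 * (T^3 * R^2) + 40 * w^14 * (T^4*R*ρ) := by
  have hR0 : 0 < R := by linarith
  have hw : 2.94 ≤ w := by
    apply le_of_pow_le_pow_left₀ (n := 4) (by norm_num) hw0.le
    rw [hwl]; refine le_trans ?_ h75; norm_num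
  have hl : Real.log x = 6 * Real.log T := by rw [hT, Real.log_pow]; push_cast; ring
  have hTe : 150000 ≤ T := by
    have h1 : Real.exp 12 ≤ T := by
      rw [← Real.le_log_iff_exp_le hT0]; linarith
    have h2 : (150000:ℝ) ≤ Real.exp 12 := by
      have : Real.exp 12 = (Real.exp 1)^12 := by rw [← Real.exp_nat_mul]; norm_num
      rw [this]
      have h3 := Real.exp_one_gt_d9
      calc (150000:ℝ) ≤ 2.7^12 := by norm_num
        _ ≤ _ := pow_le_pow_left₀ (by norm_num) (by linarith) 12
    linarith
  set m := min (R^2) (T^4/R) with hm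
  have hm1 : 270000 ≤ m := by
    apply le_min
    · nlinarith
    · rw [le_div_iff₀ hR0]
      calc 270000 * R ≤ T * 2 * R := by gcongr; linarith
        _ = T * (2 * R) := by ring
        _ ≤ T * T^3 := by gcongr
        _ = _ := by ring
  set U := ⌊m⌋₊ with hU
  have hUm : (U:ℝ) ≤ m := Nat.floor_le (by linarith)
  have hUm' : m < U + 1 := Nat.lt_floor_add_one m
  have hU262 : 262144 ≤ U := by
    apply Nat.le_floor; push_cast; linarith
  have hU1 : (U:ℝ) ≤ R^2 := hUm.trans (min_le_left _ _)
  have hU2 : U * R ≤ T^4 := by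
    have := hUm.trans (min_le_right _ _)
    rwa [le_div_iff₀ hR0] at this
  have hU0 : (0:ℝ) < U := by linarith
  have hU3 : R^2 ≤ 1.01 * U ∨ T^4/R ≤ 1.01 * U := by
    rcases min_choice (R^2) (T^4/R) with h | h
    · left; rw [← h, ← hm]; linarith
    · right; rw [← h, ← hm]; linarith
  have h3 : (U:ℝ)^3 ≤ T^8 := by
    have : (U:ℝ)^3 * R^2 ≤ T^8 * R^2 := by
      calc (U:ℝ)^3 * R^2 = U * (U*R)^2 := by ring
        _ ≤ R^2 * (T^4)^2 := by gcongr
        _ = _ := by ring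
    exact le_of_mul_le_mul_right this (by positivity)
  have hUl : Real.log U ≤ 4/9 * Real.log x := by
    have := Real.log_le_log (by positivity) h3
    rw [Real.log_pow, Real.log_pow] at this
    push_cast at this
    linarith
  have hUx : (U:ℝ)^2 ≤ x := by
    apply le_of_pow_le_pow_left₀ (n := 3) (by norm_num) (by linarith)
    rw [hT]
    calc ((U:ℝ)^2)^3 = (U^3)^2 := by ring
      _ ≤ (T^8)^2 := by gcongr
      _ = T^16 := by ring
      _ ≤ T^18 := pow_le_pow_right₀ (by linarith) (by norm_num)
      _ = _ := by ring
  exact block0 hw hwl h75 hx hT hT0 hρ hρ0 hR hR4 hRT U hU262 hUx hUl hU1 hU2 hU3 Y hY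
end BV

namespace BV

lemma prod_ratio_le (S : Finset ℕ) : (∀ p ∈ S, 2 ≤ p) → ∏ p ∈ S, ((p:ℝ)/((p:ℝ)-1)) ≤ S.card + 1 := by
  induction S using Finset.induction_on_max with
  | empty => simp
  | insert a s ha ih =>
    intro h
    have hna : a ∉ s := fun h' => lt_irrefl _ (ha a h')
    rw [Finset.prod_insert hna, Finset.card_insert_of_notMem hna]
    have ih' := ih (fun p hp => h p (Finset.mem_insert_of_mem hp))
    have ha2 : 2 ≤ a := h a (Finset.mem_insert_self _ _)
    have hsub : s ⊆ Finset.Ico 2 a := by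
      intro p hp
      rw [Finset.mem_Ico]
      exact ⟨h p (Finset.mem_insert_of_mem hp), ha p hp⟩
    have hc := Finset.card_le_card hsub
    rw [Nat.card_Ico] at hc
    have hc' : (s.card:ℝ) + 2 ≤ a := by
      have : s.card + 2 ≤ a := by omega
      exact_mod_cast this
    have hc0 : (0:ℝ) ≤ s.card := by positivity
    have h1 : (a:ℝ)/((a:ℝ)-1) ≤ (s.card+2)/(s.card+1) := by
      rw [div_le_div_iff₀ (by linarith) (by linarith)]
      nlinarith
    calc (a:ℝ)/((a:ℝ)-1) * ∏ p ∈ s, ((p:ℝ)/((p:ℝ)-1)) ≤ (s.card+2)/(s.card+1) * (s.card+1) := by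
          apply mul_le_mul h1 ih' _ (by positivity)
          apply Finset.prod_nonneg
          intro p hp
          have : (2:ℝ) ≤ p := by exact_mod_cast h p (Finset.mem_insert_of_mem hp)
          apply div_nonneg <;> linarith
      _ = _ := by
        push_cast
        field_simp
        ring

lemma tot_prod (q : ℕ) : (q.totient:ℝ) = q * ∏ p ∈ q.primeFactors, (1 - (p:ℝ)⁻¹) := by
  have h := Nat.totient_eq_mul_prod_factors q
  have h2 : ((q.totient:ℚ):ℝ) = ((q * ∏ p ∈ q.primeFactors, (1 - (p:ℚ)⁻¹) : ℚ) : ℝ) := by rw [h]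
  push_cast at h2
  exact h2

lemma omega_le {q : ℕ} (hq : 1 ≤ q) : (q.primeFactors.card:ℝ) * Real.log 2 ≤ Real.log q := by
  have h1 : 2^q.primeFactors.card ≤ ∏ p ∈ q.primeFactors, p :=
    Finset.pow_card_le_prod _ _ _ (fun p hp => (Nat.prime_of_mem_primeFactors hp).two_le)
  have h2 : 2^q.primeFactors.card ≤ q := h1.trans (Nat.le_of_dvd hq (Nat.prod_primeFactors_dvd q))
  have h3 : ((2:ℝ)^q.primeFactors.card) ≤ q := by exact_mod_cast h2
  have := Real.log_le_log (by positivity) h3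
  rwa [Real.log_pow] at this

/-- `q ≤ φ(q) (ω(q)+1)` -/
lemma tot_ge {q : ℕ} (hq : 1 ≤ q) : (q:ℝ) ≤ q.totient * (q.primeFactors.card + 1) := by
  have h1 := prod_ratio_le q.primeFactors (fun p hp => (Nat.prime_of_mem_primeFactors hp).two_le)
  have h2 : (∏ p ∈ q.primeFactors, (1 - (p:ℝ)⁻¹)) * ∏ p ∈ q.primeFactors, ((p:ℝ)/((p:ℝ)-1)) = 1 := by
    rw [← Finset.prod_mul_distrib]
    apply Finset.prod_eq_one
    intro p hp
    have : (2:ℝ) ≤ p := by exact_mod_cast (Nat.prime_of_mem_primeFactors hp).two_le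
    have : (p:ℝ) - 1 ≠ 0 := by intro h; linarith
    field_simp
  have h3 := tot_prod q
  calc (q:ℝ) = q.totient * ∏ p ∈ q.primeFactors, ((p:ℝ)/((p:ℝ)-1)) := by
        rw [h3, mul_assoc, h2, mul_one]
    _ ≤ _ := by gcongr

lemma prod_one_sub_ge (S : Finset ℕ) (f : ℕ → ℝ) : (∀ p ∈ S, 0 ≤ f p ∧ f p ≤ 1) →
    0 ≤ ∏ p ∈ S, (1 - f p) ∧ 1 - ∑ p ∈ S, f p ≤ ∏ p ∈ S, (1 - f p) ∧ ∏ p ∈ S, (1 - f p) ≤ 1 := by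
  classical
  induction S using Finset.induction_on with
  | empty => simp
  | insert a s ha ih =>
    intro h
    obtain ⟨i1, i2, i3⟩ := ih (fun p hp => h p (Finset.mem_insert_of_mem hp))
    obtain ⟨h1, h2⟩ := h a (Finset.mem_insert_self _ _)
    rw [Finset.prod_insert ha, Finset.sum_insert ha]
    refine ⟨mul_nonneg (by linarith) i1, by nlinarith, by nlinarith⟩

/-- rough numbers -/
lemma tot_rough {q : ℕ} (hq : 1 ≤ q) {B : ℝ} (hB : 1 ≤ B) (h : ∀ p ∈ q.primeFactors, B ≤ (p:ℝ)) :
    (q:ℝ) * (1 - q.primeFactors.card / B) ≤ q.totient := by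
  rw [tot_prod]
  have h1 := (prod_one_sub_ge q.primeFactors (fun p => (p:ℝ)⁻¹) (by
    intro p hp
    have : (1:ℝ) ≤ p := hB.trans (h p hp)
    exact ⟨by positivity, inv_le_one_of_one_le₀ this⟩)).2.1
  refine mul_le_mul_of_nonneg_left (le_trans ?_ h1) (by positivity)
  have : ∑ p ∈ q.primeFactors, (p:ℝ)⁻¹ ≤ ∑ p ∈ q.primeFactors, B⁻¹ := by
    apply Finset.sum_le_sum
    intro p hp
    exact inv_anti₀ (by linarith) (h p hp)
  rw [Finset.sum_const, nsmul_eq_mul, ← div_eq_mul_inv] at this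
  linarith

/-- contribution of prime powers not coprime to `q` -/
lemma err_le {q N : ℕ} {l : ℝ} (hq : 1 ≤ q) (hN : 1 ≤ N) (hl : Real.log N ≤ l) :
    ∑ n ∈ (Finset.Icc 1 N).filter (fun n : ℕ => ¬ n.Coprime q), Λ n ≤ q.primeFactors.card * (Nat.log 2 N) * l := by
  classical
  have hl0 : 0 ≤ l := le_trans (Real.log_natCast_nonneg N) hl
  have h1 : ∑ n ∈ (Finset.Icc 1 N).filter (fun n : ℕ => ¬ n.Coprime q), Λ n
      = ∑ n ∈ (Finset.Icc 1 N).filter (fun n : ℕ => ¬ n.Coprime q ∧ IsPrimePow n), Λ n := by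
    symm
    apply Finset.sum_subset
    · intro n hn
      rw [Finset.mem_filter] at hn ⊢
      exact ⟨hn.1, hn.2.1⟩
    · intro n hn hn'
      rw [Finset.mem_filter] at hn hn'
      rw [vonMangoldt_eq_zero_iff]
      intro h
      exact hn' ⟨hn.1, hn.2, h⟩
  rw [h1]
  have h2 : ((Finset.Icc 1 N).filter (fun n : ℕ => ¬ n.Coprime q ∧ IsPrimePow n)).card
      ≤ (q.primeFactors ×ˢ Finset.Icc 1 (Nat.log 2 N)).card := by
    have hsub : (Finset.Icc 1 N).filter (fun n : ℕ => ¬ n.Coprime q ∧ IsPrimePow n) ⊆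
        (q.primeFactors ×ˢ Finset.Icc 1 (Nat.log 2 N)).image (fun u => u.1^u.2) := by
      intro n hn
      rw [Finset.mem_filter, Finset.mem_Icc] at hn
      obtain ⟨⟨h1, h2⟩, h3, h4⟩ := hn
      rw [isPrimePow_nat_iff] at h4
      obtain ⟨p, k, hp, hk, rfl⟩ := h4
      rw [Finset.mem_image]
      refine ⟨(p,k), ?_, rfl⟩
      rw [Finset.mem_product, Finset.mem_Icc, Nat.mem_primeFactors]
      have hpq : p ∣ q := by
        by_contra hc
        exact h3 (((Nat.Prime.coprime_iff_not_dvd hp).2 hc).pow_left k)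
      refine ⟨⟨hp, hpq, by omega⟩, hk, ?_⟩
      apply Nat.le_log_of_pow_le (by norm_num)
      exact (Nat.pow_le_pow_left hp.two_le k).trans h2
    exact (Finset.card_le_card hsub).trans Finset.card_image_le
  calc _ ≤ ∑ n ∈ (Finset.Icc 1 N).filter (fun n : ℕ => ¬ n.Coprime q ∧ IsPrimePow n), l := by
        apply Finset.sum_le_sum
        intro n hn
        rw [Finset.mem_filter, Finset.mem_Icc] at hn
        refine vonMangoldt_le_log.trans (le_trans (Real.log_le_log ?_ ?_) hl)
        · have : 0 < n := by omega
          exact_mod_cast this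
        · exact_mod_cast hn.1.2
    _ ≤ _ := by
        rw [Finset.sum_const, nsmul_eq_mul]
        refine mul_le_mul_of_nonneg_right ?_ hl0
        rw [Finset.card_product, Nat.card_Icc] at h2
        have : ((((Finset.Icc 1 N).filter (fun n : ℕ => ¬ n.Coprime q ∧ IsPrimePow n)).card : ℕ):ℝ) ≤ ((q.primeFactors.card * (Nat.log 2 N + 1 - 1) : ℕ):ℝ) := by
          exact_mod_cast h2
        rw [Nat.add_sub_cancel] at this
        push_cast at this
        exact this

lemma natlog_le {N : ℕ} (hN : 1 ≤ N) : (Nat.log 2 N : ℝ) * Real.log 2 ≤ Real.log N := by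
  have h := Nat.pow_log_le_self 2 (show N ≠ 0 by omega)
  have h3 : ((2:ℝ)^(Nat.log 2 N)) ≤ N := by exact_mod_cast h
  have := Real.log_le_log (by positivity) h3
  rwa [Real.log_pow] at this

end BV

namespace BV

/-- `ψ(N, χ)` -/
noncomputable def psiC (i : Ch) (N : ℕ) : ℂ := ∑ n ∈ Finset.Icc 1 N, ((Λ n : ℝ) : ℂ) * i.2 (n : ZMod i.1)

noncomputable def errq (q N : ℕ) : ℝ := ∑ n ∈ (Finset.Icc 1 N).filter (fun n : ℕ => ¬ n.Coprime q), Λ n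

lemma errq_nonneg (q N : ℕ) : 0 ≤ errq q N := Finset.sum_nonneg fun _ _ => vonMangoldt_nonneg

lemma char_exp {q : ℕ} [NeZero q] (N a : ℕ) (ha : a.Coprime q) :
    (q.totient : ℂ) * ((∑ n ∈ (Finset.Icc 1 N).filter (fun n : ℕ => (n : ZMod q) = (a : ZMod q)), Λ n : ℝ) : ℂ)
      = ∑ χ : DirichletCharacter ℂ q, (starRingEnd ℂ) (χ (a : ZMod q)) * psiC ⟨q, χ⟩ N := by
  have hau : IsUnit (a : ZMod q) := (ZMod.isUnit_iff_coprime a q).2 ha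
  have h1 : ∑ χ : DirichletCharacter ℂ q, (starRingEnd ℂ) (χ (a : ZMod q)) * psiC ⟨q, χ⟩ N
      = ∑ n ∈ Finset.Icc 1 N, ((Λ n : ℝ) : ℂ) *
        ∑ χ : DirichletCharacter ℂ q, χ (n : ZMod q) * (starRingEnd ℂ) (χ (a : ZMod q)) := by
    unfold psiC
    simp_rw [Finset.mul_sum]
    rw [Finset.sum_comm]
    refine Finset.sum_congr rfl fun n _ => Finset.sum_congr rfl fun χ _ => ?_
    ring
  rw [h1]
  simp_rw [orth_pair]
  simp only [hau, true_and]
  rw [Finset.sum_filter]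
  push_cast
  rw [Finset.mul_sum]
  refine Finset.sum_congr rfl fun n _ => ?_
  by_cases h : (n : ZMod q) = (a : ZMod q)
  · rw [if_pos h, if_pos h.symm]; ring
  · rw [if_neg h, if_neg (fun h' => h h'.symm)]; simp

lemma psiC_one {q : ℕ} [NeZero q] (N : ℕ) :
    psiC ⟨q, 1⟩ N = ((∑ n ∈ Finset.Icc 1 N, Λ n - errq q N : ℝ) : ℂ) := by
  unfold psiC errq
  rw [Finset.sum_filter, ← Finset.sum_sub_distrib]
  push_cast
  refine Finset.sum_congr rfl fun n _ => ?_
  by_cases h : n.Coprime q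
  · have hu : IsUnit (n : ZMod q) := (ZMod.isUnit_iff_coprime n q).2 h
    rw [MulChar.one_apply hu]
    simp [h]
  · have hu : ¬ IsUnit (n : ZMod q) := fun hu => h ((ZMod.isUnit_iff_coprime n q).1 hu)
    have := MulChar.map_nonunit (1 : DirichletCharacter ℂ q) hu
    simp only [this]
    simp [h]

lemma diff_le {q : ℕ} [NeZero q] (N a : ℕ) (ha : a.Coprime q) :
    (q.totient:ℝ) * |∑ n ∈ (Finset.Icc 1 N).filter (fun n : ℕ => (n : ZMod q) = (a : ZMod q)), Λ n
        - (∑ n ∈ Finset.Icc 1 N, Λ n) / q.totient|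
      ≤ (∑ χ ∈ Finset.univ.filter (fun χ : DirichletCharacter ℂ q => χ ≠ 1), ‖psiC ⟨q, χ⟩ N‖) + errq q N := by
  classical
  set A := ∑ n ∈ (Finset.Icc 1 N).filter (fun n : ℕ => (n : ZMod q) = (a : ZMod q)), Λ n with hA
  set P := ∑ n ∈ Finset.Icc 1 N, Λ n with hP
  have hau : IsUnit (a : ZMod q) := (ZMod.isUnit_iff_coprime a q).2 ha
  have hphi : (0:ℝ) < q.totient := by exact_mod_cast Nat.totient_pos.2 (Nat.pos_of_ne_zero (NeZero.ne q))
  have h1 := char_exp (q := q) N a ha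
  rw [← hA] at h1
  rw [← Finset.add_sum_erase Finset.univ _ (Finset.mem_univ (1 : DirichletCharacter ℂ q)), psiC_one,
    MulChar.one_apply hau, ← hP] at h1
  have hE := errq_nonneg q N
  have h2 : (((q.totient:ℝ) * A - P : ℝ) : ℂ) = (∑ χ ∈ Finset.univ.erase (1 : DirichletCharacter ℂ q),
      (starRingEnd ℂ) (χ (a : ZMod q)) * psiC ⟨q, χ⟩ N) - ((errq q N : ℝ) : ℂ) := by
    have : (((q.totient:ℝ) * A - P : ℝ) : ℂ) = (q.totient : ℂ) * (A:ℂ) - (P:ℂ) := by push_cast; ring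
    rw [this, h1]
    push_cast
    simp
    ring
  have h3 : (q.totient:ℝ) * |A - P / q.totient| = |(q.totient:ℝ) * A - P| := by
    rw [← abs_of_pos hphi, ← abs_mul, abs_of_pos hphi]
    congr 1
    field_simp
  rw [h3, ← Real.norm_eq_abs, ← Complex.norm_real, h2]
  refine (norm_sub_le _ _).trans ?_
  have h4 : ‖((errq q N : ℝ) : ℂ)‖ = errq q N := by
    rw [Complex.norm_real, Real.norm_of_nonneg hE]
  rw [h4]
  gcongr
  refine (norm_sum_le _ _).trans (le_of_eq ?_)
  refine Finset.sum_congr ?_ fun χ _ => ?_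
  · ext χ; simp
  · rw [norm_mul, RCLike.norm_conj, norm_char_unit _ hau, one_mul]

lemma prim_le {q : ℕ} [NeZero q] (χ : DirichletCharacter ℂ q) (N : ℕ) :
    ‖psiC ⟨q, χ⟩ N‖ ≤ ‖psiC ⟨χ.conductor, χ.primitiveCharacter⟩ N‖ + errq q N := by
  have h1 : psiC ⟨q, χ⟩ N = psiC ⟨χ.conductor, χ.primitiveCharacter⟩ N -
     ∑ n ∈ (Finset.Icc 1 N).filter (fun n : ℕ => ¬ n.Coprime q), ((Λ n : ℝ) : ℂ) * χ.primitiveCharacter (n : ZMod χ.conductor) := by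
    unfold psiC
    rw [Finset.sum_filter, ← Finset.sum_sub_distrib]
    refine Finset.sum_congr rfl fun n _ => ?_
    by_cases h : n.Coprime q
    · have h2 := DirichletCharacter.primitiveCharacter_apply_of_isCoprime (χ := χ) (a := (n:ℤ)) (Nat.isCoprime_iff_coprime.mpr h)
      simp only [Int.cast_natCast] at h2
      simp only [h2]
      simp [h]
    · have hu : ¬ IsUnit (n : ZMod q) := fun hu => h ((ZMod.isUnit_iff_coprime n q).1 hu)
      simp only [MulChar.map_nonunit χ hu]
      simp [h]
  rw [h1]
  refine (norm_sub_le _ _).trans ?_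
  gcongr
  refine (norm_sum_le _ _).trans ?_
  unfold errq
  refine Finset.sum_le_sum fun n _ => ?_
  rw [norm_mul, Complex.norm_real, Real.norm_of_nonneg vonMangoldt_nonneg]
  have := DirichletCharacter.norm_le_one χ.primitiveCharacter (n : ZMod χ.conductor)
  have h0 : 0 ≤ Λ n := vonMangoldt_nonneg
  nlinarith

open Classical in
noncomputable def toCh {q : ℕ} (χ : DirichletCharacter ℂ q) : Ch := ⟨χ.conductor, χ.primitiveCharacter⟩

open Classical in
noncomputable def fromCh (q : ℕ) (i : Ch) : DirichletCharacter ℂ q :=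
  if h : i.1 ∣ q then DirichletCharacter.changeLevel h i.2 else 1

lemma from_to {q : ℕ} (χ : DirichletCharacter ℂ q) : fromCh q (toCh χ) = χ := by
  unfold fromCh toCh
  rw [dif_pos χ.conductor_dvd_level]
  exact χ.changeLevel_primitiveCharacter

lemma sum_toCh_le {q : ℕ} [NeZero q] (B : Ch → ℝ) (hB : ∀ i, 0 ≤ B i) :
    ∑ χ ∈ Finset.univ.filter (fun χ : DirichletCharacter ℂ q => χ ≠ 1), B (toCh χ)
      ≤ ∑ r ∈ q.divisors.filter (fun r => 1 < r), ∑ ψ ∈ primSet r, B ⟨r, ψ⟩ := by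
  classical
  have h1 : ∑ i ∈ (Finset.univ.filter (fun χ : DirichletCharacter ℂ q => χ ≠ 1)).image toCh, B i
      = ∑ χ ∈ Finset.univ.filter (fun χ : DirichletCharacter ℂ q => χ ≠ 1), B (toCh χ) := by
    apply Finset.sum_image
    intro χ _ χ' _ h
    rw [← from_to χ, ← from_to χ', h]
  rw [← h1, ← Finset.sum_sigma (q.divisors.filter (fun r => 1 < r)) primSet B]
  apply Finset.sum_le_sum_of_subset_of_nonneg
  · intro i hi
    rw [Finset.mem_image] at hi
    obtain ⟨χ, hχ, rfl⟩ := hi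
    rw [Finset.mem_filter] at hχ
    rw [Finset.mem_sigma, Finset.mem_filter, Nat.mem_divisors]
    have hc0 : χ.conductor ≠ 0 := DirichletCharacter.conductor_ne_zero χ
    have hc1 : χ.conductor ≠ 1 := fun h => hχ.2 ((DirichletCharacter.eq_one_iff_conductor_eq_one).2 h)
    refine ⟨⟨⟨χ.conductor_dvd_level, NeZero.ne q⟩, ?_⟩, ?_⟩
    · show 1 < χ.conductor
      omega
    · show χ.primitiveCharacter ∈ primSet χ.conductor
      have : NeZero χ.conductor := ⟨hc0⟩
      rw [primSet_eq, Finset.mem_filter]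
      exact ⟨Finset.mem_univ _, χ.primitiveCharacter_isPrimitive⟩
  · intro i _ _; exact hB i

/-- per-modulus bound -/
lemma modulus_le {q : ℕ} (hq : 1 ≤ q) (N X a : ℕ) (hN : N ≤ X) (ha : a.Coprime q) (B : Ch → ℝ)
    (hB : ∀ i, ∀ n ≤ X, ‖psiC i n‖ ≤ B i) :
    |∑ n ∈ (Finset.Icc 1 N).filter (fun n : ℕ => (n : ZMod q) = (a : ZMod q)), Λ n
        - (∑ n ∈ Finset.Icc 1 N, Λ n) / q.totient|
      ≤ (∑ r ∈ q.divisors.filter (fun r => 1 < r), ∑ ψ ∈ primSet r, B ⟨r, ψ⟩) / q.totient + errq q X := by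
  classical
  have : NeZero q := ⟨by omega⟩
  have hphi : (0:ℝ) < q.totient := by exact_mod_cast Nat.totient_pos.2 hq
  have h1 := diff_le (q := q) N a ha
  have hE : errq q N ≤ errq q X := by
    unfold errq
    apply Finset.sum_le_sum_of_subset_of_nonneg
    · intro n hn
      rw [Finset.mem_filter, Finset.mem_Icc] at hn ⊢
      exact ⟨⟨hn.1.1, hn.1.2.trans hN⟩, hn.2⟩
    · intros; exact vonMangoldt_nonneg
  have hE0 := errq_nonneg q N
  have h2 : ∑ χ ∈ Finset.univ.filter (fun χ : DirichletCharacter ℂ q => χ ≠ 1), ‖psiC ⟨q, χ⟩ N‖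
     ≤ ∑ χ ∈ Finset.univ.filter (fun χ : DirichletCharacter ℂ q => χ ≠ 1), (B (toCh χ) + errq q X) := by
    refine Finset.sum_le_sum fun χ _ => ?_
    have := prim_le χ N
    have h3 := hB (toCh χ) N hN
    unfold toCh at h3 ⊢
    linarith
  rw [Finset.sum_add_distrib, Finset.sum_const, nsmul_eq_mul] at h2
  have h3 := sum_toCh_le (q := q) B (fun i => (norm_nonneg _).trans (hB i 0 (Nat.zero_le _)))
  have hcard : ((Finset.univ.filter (fun χ : DirichletCharacter ℂ q => χ ≠ 1)).card : ℝ) + 1 = q.totient := by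
    have h5 := DirichletCharacter.card_eq_totient_of_hasEnoughRootsOfUnity ℂ q
    rw [Nat.card_eq_fintype_card] at h5
    have h6 : (Finset.univ.filter (fun χ : DirichletCharacter ℂ q => χ ≠ 1)) = Finset.univ.erase 1 := by
      ext χ; simp
    rw [h6, ← h5]
    have h7 := Finset.card_erase_add_one (Finset.mem_univ (1 : DirichletCharacter ℂ q))
    rw [Finset.card_univ] at h7
    exact_mod_cast h7
  have h4 : (q.totient:ℝ) * |∑ n ∈ (Finset.Icc 1 N).filter (fun n : ℕ => (n : ZMod q) = (a : ZMod q)), Λ n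
        - (∑ n ∈ Finset.Icc 1 N, Λ n) / q.totient| ≤ 
      (∑ r ∈ q.divisors.filter (fun r => 1 < r), ∑ ψ ∈ primSet r, B ⟨r, ψ⟩) + q.totient * errq q X := by
    have : (q.totient:ℝ) * errq q X = ((Finset.univ.filter (fun χ : DirichletCharacter ℂ q => χ ≠ 1)).card : ℝ) * errq q X + errq q X := by
      rw [← hcard]; ring
    linarith
  rw [div_add' _ _ _ hphi.ne', le_div_iff₀ hphi]
  linarith

end BV

namespace BV

lemma blockS {x w T R ρ : ℝ} (hw0 : 0 < w) (hwl : w^4 = Real.log x) (h75 : 75 ≤ Real.log x) (hx : 1 ≤ x)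
    (hT : x = T^6) (hT0 : 0 < T) (hρ : ρ^2 = R) (hρ0 : 0 < ρ) (hR4 : 10000 ≤ R) (hRT : 2 * R ≤ T^3) 
    (Y : Ch → ℕ) (hY : ∀ i, (Y i : ℝ) ≤ x) :
    ∑ r ∈ Finset.Ioc ⌊R⌋₊ ⌊2*R⌋₊, (∑ ψ ∈ primSet r, ‖psiC ⟨r, ψ⟩ (Y ⟨r, ψ⟩)‖) / r ≤
      30 * w^10 * T^6 / R + 18 * w^14 * T^3 * R + 40 * w^14 * T^4 * ρ := by
  have hR : 1 ≤ R := by linarith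
  have hR0 : 0 < R := by linarith
  have h1 := block hw0 hwl h75 hx hT hT0 hρ hρ0 hR hR4 hRT Y (fun i _ => hY i)
  have h2 : R * ∑ r ∈ Finset.Ioc ⌊R⌋₊ ⌊2*R⌋₊, (∑ ψ ∈ primSet r, ‖psiC ⟨r, ψ⟩ (Y ⟨r, ψ⟩)‖) / r ≤
     ∑ i ∈ (FF R hR).s, (FF R hR).w i * ‖∑ n ∈ Finset.Icc 1 (Y i), ((Λ n : ℝ) : ℂ) * (FF R hR).χ i n‖ := by
    show _ ≤ ∑ i ∈ (Finset.Ioc ⌊R⌋₊ ⌊2*R⌋₊).sigma primSet, ((i.1:ℝ)/i.1.totient) * ‖psiC i (Y i)‖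
    rw [Finset.sum_sigma, Finset.mul_sum]
    refine Finset.sum_le_sum fun r hr => ?_
    rw [Finset.mem_Ioc] at hr
    have hrR : R < r := Nat.lt_of_floor_lt hr.1
    have hr0 : (0:ℝ) < r := by linarith
    have hrn : 0 < r := by exact_mod_cast hr0
    show _ ≤ ∑ ψ ∈ primSet r, (r:ℝ)/r.totient * ‖psiC ⟨r, ψ⟩ (Y ⟨r, ψ⟩)‖
    rw [← Finset.mul_sum, mul_div_assoc', div_le_iff₀ hr0]
    have hs : 0 ≤ ∑ ψ ∈ primSet r, ‖psiC ⟨r, ψ⟩ (Y ⟨r, ψ⟩)‖ := Finset.sum_nonneg fun _ _ => norm_nonneg _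
    have ht : (0:ℝ) < r.totient := by exact_mod_cast Nat.totient_pos.2 hrn
    have h1 : (1:ℝ) ≤ r / r.totient := by
      rw [le_div_iff₀ ht, one_mul]; exact_mod_cast Nat.totient_le r
    calc R * ∑ ψ ∈ primSet r, ‖psiC ⟨r, ψ⟩ (Y ⟨r, ψ⟩)‖ ≤ r * ∑ ψ ∈ primSet r, ‖psiC ⟨r, ψ⟩ (Y ⟨r, ψ⟩)‖ := by gcongr
      _ = 1 * (∑ ψ ∈ primSet r, ‖psiC ⟨r, ψ⟩ (Y ⟨r, ψ⟩)‖) * r := by ring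
      _ ≤ _ := by gcongr
  have h3 : 30 * w^10 * T^6 + 18 * w^14 * (T^3 * R^2) + 40 * w^14 * (T^4*R*ρ)
     = R * (30 * w^10 * T^6 / R + 18 * w^14 * T^3 * R + 40 * w^14 * T^4 * ρ) := by
    field_simp
  rw [h3] at h1
  exact le_of_mul_le_mul_left (h2.trans h1) hR0

lemma dyadic {f : ℕ → ℝ} (hf : ∀ n, 0 ≤ f n) {a b c Q Q₁ : ℝ} (ha : 0 ≤ a) (hb : 0 ≤ b) (hc : 0 ≤ c) (hQ₁ : 0 < Q₁)
    (h : ∀ R : ℝ, Q₁/2 < R → 2*R ≤ Q → ∑ r ∈ Finset.Ioc ⌊R⌋₊ ⌊2*R⌋₊, f r ≤ a / R + b * R + c * Real.sqrt R) (n : ℕ) :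
    ∀ Q' : ℝ, Q' ≤ Q → Q₁/2 < Q' → Q' ≤ 2^n * Q₁ →
    ∑ r ∈ Finset.Ioc ⌊Q₁⌋₊ ⌊Q'⌋₊, f r ≤ a * (4/Q₁ - 2/Q') + b * Q' + 2.4143 * c * Real.sqrt Q' := by
  have hz : ∀ Q' : ℝ, Q₁/2 < Q' → Q' ≤ Q₁ → 
      ∑ r ∈ Finset.Ioc ⌊Q₁⌋₊ ⌊Q'⌋₊, f r ≤ a * (4/Q₁ - 2/Q') + b * Q' + 2.4143 * c * Real.sqrt Q' := by
    intro Q' h2 h1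
    have h0 : 0 < Q' := by linarith
    rw [Finset.Ioc_eq_empty (by have := Nat.floor_mono h1; omega), Finset.sum_empty]
    have : 2/Q' ≤ 4/Q₁ := by
      rw [div_le_div_iff₀ h0 hQ₁]; linarith
    have h3 : 0 ≤ a * (4/Q₁ - 2/Q') := mul_nonneg ha (by linarith)
    positivity
  induction n with
  | zero =>
    intro Q' _ h2 h1
    exact hz Q' h2 (by simpa using h1)
  | succ n ih =>
    intro Q' hQ' h2 h1
    rcases le_or_gt Q' Q₁ with hle | hgt
    · exact hz Q' h2 hle
    · have i1 := ih (Q'/2) (by linarith) (by linarith) (by rw [pow_succ] at h1; linarith)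
      have i2 := h (Q'/2) (by linarith) (by linarith)
      rw [show 2 * (Q'/2) = Q' by ring] at i2
      have hQ0 : 0 < Q' := by linarith
      have hs : Real.sqrt (Q'/2) ≤ 0.70711 * Real.sqrt Q' := by
        apply Real.sqrt_le_iff.2
        refine ⟨by positivity, ?_⟩
        rw [mul_pow, Real.sq_sqrt hQ0.le]
        nlinarith
      have h3 : ∑ r ∈ Finset.Ioc ⌊Q₁⌋₊ ⌊Q'⌋₊, f r ≤ ∑ r ∈ Finset.Ioc ⌊Q₁⌋₊ ⌊Q'/2⌋₊, f r + ∑ r ∈ Finset.Ioc ⌊Q'/2⌋₊ ⌊Q'⌋₊, f r := by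
        rw [← Finset.sum_union (by
          rw [Finset.disjoint_left]; intro r h1 h2; rw [Finset.mem_Ioc] at h1 h2; omega)]
        apply Finset.sum_le_sum_of_subset_of_nonneg
        · intro r hr
          rw [Finset.mem_union]
          rw [Finset.mem_Ioc] at *
          rw [Finset.mem_Ioc]
          omega
        · intros; exact hf _
      have e1 : 2/(Q'/2) = 4/Q' := by field_simp; norm_num
      have e2 : a/(Q'/2) = a*(2/Q') := by field_simp
      rw [e1] at i1
      rw [e2] at i2
      have h4 : c * Real.sqrt (Q'/2) ≤ c * (0.70711 * Real.sqrt Q') := by gcongr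
      have h5 : a * (4/Q') = 2 * (a * (2/Q')) := by ring
      have h6 : 0 ≤ c * Real.sqrt Q' := by positivity
      rw [mul_sub] at i1 ⊢
      norm_num at i1 h4 ⊢
      nlinarith

open Classical in
lemma ksum {S : ℕ → ℝ} (hS : ∀ n, 0 ≤ S n) {D Q Q₁ : ℝ} (hD : 0 ≤ D) (hQ₁ : 1 ≤ Q₁) (hQ : Q₁ ≤ Q)
    (hφ : ∀ q ∈ (Finset.Icc 1 ⌊Q⌋₊).filter (fun q => Q₁ < (q.minFac : ℝ)), (q:ℝ) ≤ D * q.totient) :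
    ∑ q ∈ (Finset.Icc 1 ⌊Q⌋₊).filter (fun q => Q₁ < (q.minFac : ℝ)), (∑ r ∈ q.divisors.filter (fun r => 1 < r), S r) / q.totient
     ≤ D * ∑ k ∈ insert 1 (Finset.Ioc ⌊Q₁⌋₊ ⌊Q⌋₊), (1/(k:ℝ)) * ∑ r ∈ Finset.Ioc ⌊Q₁⌋₊ ⌊Q/k⌋₊, S r / r := by
  set F := (Finset.Icc 1 ⌊Q⌋₊).filter (fun q => Q₁ < (q.minFac : ℝ)) with hF
  have h1 : ∑ q ∈ F, (∑ r ∈ q.divisors.filter (fun r => 1 < r), S r) / q.totient ≤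
      D * ∑ u ∈ F.sigma (fun q => q.divisors.filter (fun r => 1 < r)), S u.2 / (((u.1/u.2 : ℕ):ℝ) * u.2) := by
    rw [Finset.sum_sigma, Finset.mul_sum]
    refine Finset.sum_le_sum fun q hq => ?_
    rw [Finset.sum_div, Finset.mul_sum]
    refine Finset.sum_le_sum fun r hr => ?_
    have hφq := hφ q hq
    rw [hF, Finset.mem_filter, Finset.mem_Icc] at hq
    rw [Finset.mem_filter, Nat.mem_divisors] at hr
    have h1 : (((q/r : ℕ):ℝ) * r) = q := by
      exact_mod_cast Nat.div_mul_cancel hr.1.1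
    show _ ≤ D * (S r / (((q/r : ℕ):ℝ) * r))
    rw [h1, mul_div_assoc', div_le_div_iff₀ (by exact_mod_cast Nat.totient_pos.2 hq.1.1) (by exact_mod_cast hq.1.1)]
    nlinarith [hS r]
  refine h1.trans (mul_le_mul_of_nonneg_left ?_ hD)
  have h2 : ∑ k ∈ insert 1 (Finset.Ioc ⌊Q₁⌋₊ ⌊Q⌋₊), (1/(k:ℝ)) * ∑ r ∈ Finset.Ioc ⌊Q₁⌋₊ ⌊Q/k⌋₊, S r / r
     = ∑ v ∈ (insert 1 (Finset.Ioc ⌊Q₁⌋₊ ⌊Q⌋₊)).sigma (fun k : ℕ => Finset.Ioc ⌊Q₁⌋₊ ⌊Q/k⌋₊), S v.2 / ((v.1:ℝ) * v.2) := by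
    rw [Finset.sum_sigma]
    refine Finset.sum_congr rfl fun k _ => ?_
    rw [Finset.mul_sum]
    refine Finset.sum_congr rfl fun r _ => ?_
    show _ = S r / ((k:ℝ) * r)
    rw [div_mul_div_comm, one_mul]
  rw [h2]
  have h3 : ∑ u ∈ F.sigma (fun q => q.divisors.filter (fun r => 1 < r)), S u.2 / (((u.1/u.2 : ℕ):ℝ) * u.2)
     = ∑ v ∈ (F.sigma (fun q => q.divisors.filter (fun r => 1 < r))).image (fun u : (Σ _ : ℕ, ℕ) => (⟨u.1/u.2, u.2⟩ : Σ _ : ℕ, ℕ)),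
        S v.2 / ((v.1:ℝ) * v.2) := by
    rw [Finset.sum_image]
    rintro ⟨q, r⟩ hu ⟨q', r'⟩ hu' h
    simp only [Finset.mem_coe, Finset.mem_sigma, Finset.mem_filter, Nat.mem_divisors] at hu hu'
    simp only [Sigma.mk.injEq, heq_eq_eq] at h
    obtain ⟨ha, rfl⟩ := h
    have e1 := Nat.div_mul_cancel hu.2.1.1
    have e2 := Nat.div_mul_cancel hu'.2.1.1
    rw [ha, e2] at e1
    rw [e1]
  rw [h3]
  apply Finset.sum_le_sum_of_subset_of_nonneg
  · intro v hv
    rw [Finset.mem_image] at hv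
    obtain ⟨⟨q, r⟩, hu, rfl⟩ := hv
    simp only [Finset.mem_sigma, hF, Finset.mem_filter, Nat.mem_divisors, Finset.mem_Icc] at hu
    obtain ⟨⟨⟨hq1, hq2⟩, hq3⟩, ⟨hrq, _⟩, hr1⟩ := hu
    have hqQ : (q:ℝ) ≤ Q := (Nat.le_floor_iff (by linarith)).1 hq2
    obtain ⟨k, hk⟩ := hrq
    have hr0 : 0 < r := by omega
    have hdiv : q / r = k := by rw [hk]; exact Nat.mul_div_cancel_left k hr0
    have hk0 : 0 < k := Nat.pos_of_ne_zero (by rintro rfl; omega)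
    have hbig : ∀ d : ℕ, d ∣ q → 1 < d → Q₁ < d := by
      intro d hd hd1
      have h1 : q.minFac ≤ d := (Nat.minFac_le_of_dvd hd1 hd)
      have h2 : (q.minFac:ℝ) ≤ d := by exact_mod_cast h1
      linarith
    have hfl : ∀ d : ℕ, Q₁ < d → ⌊Q₁⌋₊ < d := fun d hd => (Nat.floor_lt (by linarith)).2 hd
    rw [Finset.mem_sigma]
    simp only [hdiv]
    have hk0' : (0:ℝ) < k := by exact_mod_cast hk0
    have hkr : (q:ℝ) = r * k := by exact_mod_cast hk
    refine ⟨?_, ?_⟩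
    · rw [Finset.mem_insert, Finset.mem_Ioc]
      rcases Nat.lt_or_ge 1 k with h | h
      · right
        refine ⟨hfl k (hbig k ⟨r, by rw [hk]; ring⟩ h), ?_⟩
        refine le_trans ?_ hq2
        rw [hk]; exact Nat.le_mul_of_pos_left k hr0
      · left; omega
    · rw [Finset.mem_Ioc]
      refine ⟨hfl r (hbig r ⟨k, hk⟩ hr1), ?_⟩
      apply Nat.le_floor
      rw [le_div_iff₀ hk0']
      linarith
  · rintro ⟨k, r⟩ _ _
    have := hS r
    show 0 ≤ S r / ((k:ℝ) * r)
    positivity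

lemma sum_inv_sq (M N : ℕ) (hM : 1 ≤ M) (h : M ≤ N) : ∑ k ∈ Finset.Ioc M N, 1/(k:ℝ)^2 ≤ 1/(M:ℝ) - 1/N := by
  induction N, h using Nat.le_induction with
  | base => simp
  | succ n hn ih =>
    rw [← Finset.insert_Ioc_right_eq_Ioc_add_one hn, Finset.sum_insert (by simp)]
    have hn0 : (0:ℝ) < n := by exact_mod_cast (by omega : 0 < n)
    have : 1/((n+1:ℕ):ℝ)^2 ≤ 1/(n:ℝ) - 1/((n+1:ℕ):ℝ) := by
      push_cast
      rw [div_sub_div _ _ (by positivity) (by positivity), div_le_div_iff₀ (by positivity) (by positivity)]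
      nlinarith
    linarith

lemma sum_inv_32 (M N : ℕ) (hM : 1 ≤ M) (h : M ≤ N) :
    ∑ k ∈ Finset.Ioc M N, 1/((k:ℝ) * Real.sqrt k) ≤ 2/Real.sqrt M - 2/Real.sqrt N := by
  induction N, h using Nat.le_induction with
  | base => simp
  | succ n hn ih =>
    rw [← Finset.insert_Ioc_right_eq_Ioc_add_one hn, Finset.sum_insert (by simp)]
    have hn0 : (0:ℝ) < n := by exact_mod_cast (by omega : 0 < n)
    have : 1/(((n+1:ℕ):ℝ) * Real.sqrt ((n+1:ℕ):ℝ)) ≤ 2/Real.sqrt n - 2/Real.sqrt ((n+1:ℕ):ℝ) := by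
      push_cast
      have ha := Real.sq_sqrt hn0.le
      have hb := Real.sq_sqrt (by linarith : (0:ℝ) ≤ (n:ℝ)+1)
      have ha0 := Real.sqrt_pos.2 hn0
      have hb0 := Real.sqrt_pos.2 (by linarith : (0:ℝ) < (n:ℝ)+1)
      set a := Real.sqrt (n:ℝ)
      set b := Real.sqrt ((n:ℝ)+1)
      have hab : a ≤ b := by
        apply le_of_sq_le_sq _ hb0.le
        rw [ha, hb]; linarith
      have e : (n:ℝ)+1 = b^2 := hb.symm
      rw [e, div_sub_div _ _ ha0.ne' hb0.ne', div_le_div_iff₀ (by positivity) (by positivity)]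
      have e3 : (b-a)*(b+a) = 1 := by nlinarith
      have e4 : 1 ≤ (b-a)*(2*b) := by nlinarith
      have e5 : a * b * 1 ≤ b * b * ((b-a)*(2*b)) := by
        apply mul_le_mul _ e4 (by norm_num) (by positivity)
        nlinarith
      nlinarith
    linarith

end BV

namespace BV

lemma G_all {f : ℕ → ℝ} (hf : ∀ n, 0 ≤ f n) {a b c Q Q₁ : ℝ} (ha : 0 ≤ a) (hb : 0 ≤ b) (hc : 0 ≤ c) (hQ₁ : 0 < Q₁)
    (h : ∀ R : ℝ, Q₁/2 < R → 2*R ≤ Q → ∑ r ∈ Finset.Ioc ⌊R⌋₊ ⌊2*R⌋₊, f r ≤ a / R + b * R + c * Real.sqrt R)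
    (Q' : ℝ) (hQ' : Q' ≤ Q) (hQ0 : 0 < Q') :
    ∑ r ∈ Finset.Ioc ⌊Q₁⌋₊ ⌊Q'⌋₊, f r ≤ a * (4/Q₁) + b * Q' + 2.4143 * c * Real.sqrt Q' := by
  rcases le_or_gt Q' Q₁ with h1 | h1
  · rw [Finset.Ioc_eq_empty (by have := Nat.floor_mono h1; omega), Finset.sum_empty]
    positivity
  · obtain ⟨n, hn⟩ := pow_unbounded_of_one_lt (Q'/Q₁) (by norm_num : (1:ℝ) < 2)
    rw [div_lt_iff₀ hQ₁] at hn
    have := dyadic hf ha hb hc hQ₁ h n Q' hQ' (by linarith) hn.le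
    have h2 : a * (4/Q₁ - 2/Q') ≤ a * (4/Q₁) := by
      apply mul_le_mul_of_nonneg_left _ ha
      have : 0 < 2/Q' := by positivity
      linarith
    linarith

open Classical in
lemma K_sum {f : ℕ → ℝ} {A b c Q Q₁ L : ℝ} (hA : 0 ≤ A) (hb : 0 ≤ b) (hc : 0 ≤ c) (hQ₁ : 10001 ≤ Q₁) (hQ : Q₁ ≤ Q)
    (hL : 1 + Real.log Q ≤ L)
    (h : ∀ Q' : ℝ, Q' ≤ Q → 0 < Q' → ∑ r ∈ Finset.Ioc ⌊Q₁⌋₊ ⌊Q'⌋₊, f r ≤ A + b * Q' + c * Real.sqrt Q') :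
    ∑ k ∈ insert 1 (Finset.Ioc ⌊Q₁⌋₊ ⌊Q⌋₊), (1/(k:ℝ)) * ∑ r ∈ Finset.Ioc ⌊Q₁⌋₊ ⌊Q/k⌋₊, f r
      ≤ A * L + b * Q * 1.0001 + c * Real.sqrt Q * 1.02 := by
  have hQ0 : 0 < Q := by linarith
  have hM : 10000 ≤ ⌊Q₁⌋₊ := Nat.le_floor (by push_cast; linarith)
  have hM' : (10000:ℝ) ≤ (⌊Q₁⌋₊:ℝ) := by exact_mod_cast hM
  have hMN : ⌊Q₁⌋₊ ≤ ⌊Q⌋₊ := Nat.floor_mono hQ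
  set K := insert 1 (Finset.Ioc ⌊Q₁⌋₊ ⌊Q⌋₊) with hK
  have hn : 1 ∉ Finset.Ioc ⌊Q₁⌋₊ ⌊Q⌋₊ := by rw [Finset.mem_Ioc]; omega
  have hk1 : ∀ k ∈ K, 1 ≤ k := by
    intro k hk
    rw [hK, Finset.mem_insert, Finset.mem_Ioc] at hk
    omega
  have h1 : ∑ k ∈ K, (1/(k:ℝ)) * ∑ r ∈ Finset.Ioc ⌊Q₁⌋₊ ⌊Q/k⌋₊, f r ≤
     ∑ k ∈ K, (A * (1/(k:ℝ)) + b * Q * (1/(k:ℝ)^2) + c * Real.sqrt Q * (1/((k:ℝ) * Real.sqrt k))) := by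
    refine Finset.sum_le_sum fun k hk => ?_
    have hk0 : (1:ℝ) ≤ k := by exact_mod_cast hk1 k hk
    have h2 := h (Q/k) (div_le_self hQ0.le hk0) (by positivity)
    have h3 : (1/(k:ℝ)) * (A + b * (Q/k) + c * Real.sqrt (Q/k)) = A * (1/(k:ℝ)) + b * Q * (1/(k:ℝ)^2) + c * Real.sqrt Q * (1/((k:ℝ) * Real.sqrt k)) := by
      rw [Real.sqrt_div hQ0.le]
      field_simp
    rw [← h3]
    gcongr
  refine h1.trans ?_
  rw [Finset.sum_add_distrib, Finset.sum_add_distrib, ← Finset.mul_sum, ← Finset.mul_sum, ← Finset.mul_sum]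
  have s1 : ∑ k ∈ K, 1/(k:ℝ) ≤ L := by
    have hsub : K ⊆ Finset.Icc 1 ⌊Q⌋₊ := by
      intro k hk
      rw [Finset.mem_Icc]
      refine ⟨hk1 k hk, ?_⟩
      rw [hK, Finset.mem_insert, Finset.mem_Ioc] at hk
      omega
    have h2 : ∑ k ∈ K, 1/(k:ℝ) ≤ Hm ⌊Q⌋₊ := Finset.sum_le_sum_of_subset_of_nonneg hsub (by intros; positivity)
    have h3 := Hm_le ⌊Q⌋₊
    have h4 : Real.log ⌊Q⌋₊ ≤ Real.log Q := by
      apply Real.log_le_log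
      · have : 0 < ⌊Q⌋₊ := by omega
        exact_mod_cast this
      · exact Nat.floor_le hQ0.le
    linarith
  have s2 : ∑ k ∈ K, 1/(k:ℝ)^2 ≤ 1.0001 := by
    rw [hK, Finset.sum_insert hn]
    have := sum_inv_sq ⌊Q₁⌋₊ ⌊Q⌋₊ (by omega) hMN
    have h2 : 1/(⌊Q₁⌋₊:ℝ) ≤ 1/10000 := by gcongr
    have h3 : 0 ≤ 1/(⌊Q⌋₊:ℝ) := by positivity
    have h4 : 1/((1:ℕ):ℝ)^2 = 1 := by simp
    have h5 : (1.0001:ℝ) = 1 + 1/10000 := by norm_num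
    rw [h4, h5]
    linarith
  have s3 : ∑ k ∈ K, 1/((k:ℝ) * Real.sqrt k) ≤ 1.02 := by
    rw [hK, Finset.sum_insert hn]
    have := sum_inv_32 ⌊Q₁⌋₊ ⌊Q⌋₊ (by omega) hMN
    have h2 : 2/Real.sqrt (⌊Q₁⌋₊:ℝ) ≤ 2/100 := by
      gcongr
      apply Real.le_sqrt_of_sq_le
      linarith
    have h3 : 0 ≤ 2/Real.sqrt (⌊Q⌋₊:ℝ) := by positivity
    have h4 : 1/(((1:ℕ):ℝ) * Real.sqrt ((1:ℕ):ℝ)) = 1 := by simp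
    have h5 : (1.02:ℝ) = 1 + 2/100 := by norm_num
    rw [h4, h5]
    linarith
  gcongr

lemma num_big {w T l Q Q₁ : ℝ} (hw0 : 0 < w) (hwl : w^4 = l) (h75 : 75 ≤ l) (hQ : 31 * w^6 ≤ Q₁) :
    8.66 ≤ w^2 ∧ 20000 ≤ Q₁ ∧ 268 * l ≤ Q₁ := by
  have h1 : 8.66 ≤ w^2 := by
    apply le_of_sq_le_sq _ (by positivity)
    nlinarith
  have h2 : w^6 = l * w^2 := by rw [← hwl]; ring
  have h3 : 75 * 8.66 ≤ l * w^2 := by gcongr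
  have h4 : l * 8.66 ≤ l * w^2 := by gcongr
  refine ⟨h1, by norm_num at h3 ⊢; linarith, by norm_num at h4 ⊢; linarith⟩

lemma omega_num {q : ℕ} {l : ℝ} (hq : 1 ≤ q) (hl : Real.log q ≤ l/2) : (q.primeFactors.card:ℝ) ≤ 0.7214 * l := by
  have h1 := omega_le hq
  have h2 := Real.log_two_gt_d9
  have h3 : (q.primeFactors.card:ℝ) * 0.6931 ≤ q.primeFactors.card * Real.log 2 := by gcongr; norm_num at h2 ⊢; linarith
  norm_num at h3 ⊢
  have hl0 : 0 ≤ l := by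
    have := Real.log_natCast_nonneg q
    linarith
  linarith

lemma natlog_num {N : ℕ} {l : ℝ} (hN : 1 ≤ N) (hl : Real.log N ≤ l) : (Nat.log 2 N:ℝ) ≤ 1.4428 * l := by
  have h1 := natlog_le hN
  have h2 := Real.log_two_gt_d9
  have h3 : (Nat.log 2 N:ℝ) * 0.69314 ≤ Nat.log 2 N * Real.log 2 := by gcongr; norm_num at h2 ⊢; linarith
  norm_num at h3 ⊢
  have hl0 : 0 ≤ l := by
    have := Real.log_natCast_nonneg N
    linarith
  linarith

set_option maxHeartbeats 1000000 in
theorem main_big {x w T Q Q₁ : ℝ} (hw0 : 0 < w) (hwl : w^4 = Real.log x) (h75 : 75 ≤ Real.log x) (hx : 4 ≤ x)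
    (hT : x = T^6) (hT0 : 0 < T) (hT1 : 1 ≤ T) (hQw : 31 * w^6 ≤ Q₁) (hQ : Q₁ ≤ Q) (hQT : Q ≤ T^3) :
    ∑ q ∈ (Finset.Icc 1 ⌊Q⌋₊).filter (fun q => Q₁ < (q.minFac : ℝ)),
      ⨆ y ∈ Set.Icc (2 : ℝ) x, ⨆ a ∈ {a : ℕ | Nat.Coprime a q},
        |psiMod y q a - psi y / (q.totient : ℝ)| ≤
      64 * w^14 * T^6 / Q₁ + 20 * w^14 * T^3 * Q + 100 * w^14 * T^4 * Real.sqrt Q := by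
  classical
  obtain ⟨hw2, hQ4, hQl⟩ := num_big hw0 hwl h75 hQw (T := T) (Q := Q)
  set l := Real.log x with hl
  set X := ⌊x⌋₊ with hX
  have hXx : (X:ℝ) ≤ x := Nat.floor_le (by linarith)
  have hX1 : 1 ≤ X := Nat.le_floor (by push_cast; linarith)
  have hlogX : Real.log X ≤ l := Real.log_le_log (by exact_mod_cast hX1) hXx
  have hl6 : l = 6 * Real.log T := by rw [hl, hT, Real.log_pow]; norm_num
  have hlQ : Real.log Q ≤ l/2 := by
    have := Real.log_le_log (by linarith) hQT
    rw [Real.log_pow] at this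
    push_cast at this
    linarith
  have hmax : ∀ i : Ch, ∃ N ∈ Finset.range (X+1), ∀ n ∈ Finset.range (X+1), ‖psiC i n‖ ≤ ‖psiC i N‖ :=
    fun i => Finset.exists_max_image _ _ ⟨0, by simp⟩
  choose Y hY1 hY2 using hmax
  have hYx : ∀ i, (Y i:ℝ) ≤ x := by
    intro i
    have h1 := hY1 i
    rw [Finset.mem_range] at h1
    have h2 : (Y i:ℝ) ≤ X := by exact_mod_cast (by omega : Y i ≤ X)
    linarith
  set S : ℕ → ℝ := fun r => ∑ ψ ∈ primSet r, ‖psiC ⟨r, ψ⟩ (Y ⟨r, ψ⟩)‖ with hS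
  have hS0 : ∀ n, 0 ≤ S n := fun n => Finset.sum_nonneg fun _ _ => norm_nonneg _
  set F := (Finset.Icc 1 ⌊Q⌋₊).filter (fun q => Q₁ < (q.minFac : ℝ)) with hF
  have hFq : ∀ q ∈ F, 1 ≤ q ∧ (q:ℝ) ≤ Q ∧ Q₁ < (q.minFac:ℝ) := by
    intro q hq
    rw [hF, Finset.mem_filter, Finset.mem_Icc] at hq
    exact ⟨hq.1.1, (Nat.le_floor_iff (by linarith)).1 hq.1.2, hq.2⟩
  have hom : ∀ q ∈ F, (q.primeFactors.card:ℝ) ≤ 0.7214 * l := by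
    intro q hq
    obtain ⟨h1, h2, _⟩ := hFq q hq
    apply omega_num h1
    refine le_trans (Real.log_le_log (by exact_mod_cast h1) h2) hlQ
  have hφ : ∀ q ∈ F, (q:ℝ) ≤ 1.0031 * q.totient := by
    intro q hq
    obtain ⟨h1, h2, h3⟩ := hFq q hq
    have h4 := tot_rough h1 (by linarith : (1:ℝ) ≤ Q₁) (by
      intro p hp
      have h5 : q.minFac ≤ p := Nat.minFac_le_of_dvd (Nat.prime_of_mem_primeFactors hp).two_le (Nat.dvd_of_mem_primeFactors hp)
      have h6 : (q.minFac:ℝ) ≤ p := by exact_mod_cast h5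
      linarith)
    have h5 : (q.primeFactors.card:ℝ) / Q₁ ≤ 0.003 := by
      rw [div_le_iff₀ (by linarith)]
      have := hom q hq
      norm_num at this ⊢
      linarith
    have h6 : (q:ℝ) * (1 - 0.003) ≤ q * (1 - q.primeFactors.card / Q₁) := by gcongr
    have h7 : (0:ℝ) ≤ q := by positivity
    norm_num at h6 ⊢
    linarith
  have herr : ∀ q ∈ F, errq q X ≤ 1.05 * w^12 := by
    intro q hq
    obtain ⟨h1, h2, h3⟩ := hFq q hq
    have h4 := err_le h1 hX1 hlogX
    have h5 := hom q hq
    have h6 := natlog_num hX1 hlogX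
    have hl0 : 0 ≤ l := by linarith
    refine h4.trans ?_
    calc (q.primeFactors.card:ℝ) * (Nat.log 2 X) * l ≤ (0.7214 * l) * (1.4428 * l) * l := by gcongr
      _ = 0.7214 * 1.4428 * l^3 := by ring
      _ ≤ 1.05 * l^3 := by gcongr; norm_num
      _ = _ := by rw [← hwl]; ring
  have hper : ∀ q ∈ F, (⨆ y ∈ Set.Icc (2 : ℝ) x, ⨆ a ∈ {a : ℕ | Nat.Coprime a q},
        |psiMod y q a - psi y / (q.totient : ℝ)|) ≤
       (∑ r ∈ q.divisors.filter (fun r => 1 < r), S r) / q.totient + 1.05 * w^12 := by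
    intro q hq
    obtain ⟨h1, h2, h3⟩ := hFq q hq
    have h0 : 0 ≤ (∑ r ∈ q.divisors.filter (fun r => 1 < r), S r) / q.totient + 1.05 * w^12 := by
      have : 0 ≤ ∑ r ∈ q.divisors.filter (fun r => 1 < r), S r := Finset.sum_nonneg fun _ _ => hS0 _
      positivity
    refine Real.iSup_le (fun y => Real.iSup_le (fun hy => Real.iSup_le (fun a => Real.iSup_le (fun ha => ?_) h0) h0) h0) h0
    have h4 := modulus_le h1 ⌊y⌋₊ X a (Nat.floor_mono hy.2) ha (fun i => ‖psiC i (Y i)‖) (by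
      intro i n hn
      exact hY2 i n (Finset.mem_range.2 (by omega)))
    have h5 := herr q hq
    unfold psiMod psi
    linarith
  have hG := G_all (f := fun r => S r / r) (fun n => div_nonneg (hS0 n) (by positivity))
    (a := 30 * w^10 * T^6) (b := 18 * w^14 * T^3) (c := 40 * w^14 * T^4) (Q := Q) (Q₁ := Q₁)
    (by positivity) (by positivity) (by positivity) (by linarith) (by
      intro R hR1 hR2
      exact blockS hw0 hwl h75 (by linarith) hT hT0 (Real.sq_sqrt (by linarith)) (Real.sqrt_pos.2 (by linarith)) (by linarith) (by linarith) Y hYx)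
  have hL : 1 + Real.log Q ≤ 0.5134 * l := by norm_num; linarith
  have hK := K_sum (f := fun r => S r / r) (A := 30 * w^10 * T^6 * (4/Q₁)) (b := 18 * w^14 * T^3) (c := 2.4143 * (40 * w^14 * T^4))
    (Q := Q) (Q₁ := Q₁) (L := 0.5134 * l) (by positivity) (by positivity) (by positivity) (by linarith) hQ hL hG
  have hkk := ksum hS0 (D := 1.0031) (by norm_num) (by linarith : (1:ℝ) ≤ Q₁) hQ hφ
  rw [← hF] at hkk
  have hsum : ∑ q ∈ F, (⨆ y ∈ Set.Icc (2 : ℝ) x, ⨆ a ∈ {a : ℕ | Nat.Coprime a q},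
        |psiMod y q a - psi y / (q.totient : ℝ)|) ≤ 
      ∑ q ∈ F, (∑ r ∈ q.divisors.filter (fun r => 1 < r), S r) / q.totient + F.card * (1.05 * w^12) := by
    rw [← nsmul_eq_mul, ← Finset.sum_const, ← Finset.sum_add_distrib]
    exact Finset.sum_le_sum hper
  have hcard : (F.card:ℝ) ≤ Q := by
    have h1 : F.card ≤ (Finset.Icc 1 ⌊Q⌋₊).card := Finset.card_filter_le _ _
    rw [Nat.card_Icc, Nat.add_sub_cancel] at h1
    exact (Nat.le_floor_iff (by linarith)).1 h1
  have hE : F.card * (1.05 * w^12) ≤ 1.05 * (w^14 * T^3 * Q) := by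
    have h1 : F.card * (1.05 * w^12) ≤ Q * (1.05 * w^12) := by gcongr
    have h2 : 1 * 1 ≤ w^2 * T^3 := by
      apply mul_le_mul (by norm_num at hw2; linarith) (one_le_pow₀ hT1) (by norm_num) (by positivity)
    have hQ0 : 0 ≤ Q := by linarith
    have h3 : Q * (1.05 * w^12) * (1*1) ≤ Q * (1.05 * w^12) * (w^2 * T^3) := by gcongr
    calc _ ≤ _ := h1
      _ = Q * (1.05 * w^12) * (1*1) := by ring
      _ ≤ _ := h3
      _ = _ := by ring
  have hfin : 1.0031 * (30 * w^10 * T^6 * (4/Q₁) * (0.5134 * l) + 18 * w^14 * T^3 * Q * 1.0001 + 2.4143 * (40 * w^14 * T^4) * Real.sqrt Q * 1.02)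
     = 61.798985 * 0 + (1.0031 * 30 * 4 * 0.5134) * (w^14 * T^6 / Q₁) + (1.0031 * 18 * 1.0001) * (w^14 * T^3 * Q) + (1.0031 * 2.4143 * 40 * 1.02) * (w^14 * T^4 * Real.sqrt Q) := by
    rw [← hwl]; ring
  have hk2 := hkk.trans (mul_le_mul_of_nonneg_left hK (by norm_num))
  rw [hfin] at hk2
  have p1 : 0 ≤ w^14 * T^6 / Q₁ := by
    have : 0 < Q₁ := by linarith
    positivity
  have p2 : 0 ≤ w^14 * T^3 * Q := by
    have : 0 < Q := by linarith
    positivity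
  have p3 : 0 ≤ w^14 * T^4 * Real.sqrt Q := by positivity
  have e1 : 64 * w^14 * T^6 / Q₁ + 20 * w^14 * T^3 * Q + 100 * w^14 * T^4 * Real.sqrt Q
    = 64 * (w^14 * T^6 / Q₁) + 20 * (w^14 * T^3 * Q) + 100 * (w^14 * T^4 * Real.sqrt Q) := by ring
  rw [e1]
  refine hsum.trans ?_
  clear hfin hsum hK hG hkk e1
  generalize w^14 * T^6 / Q₁ = P1 at *
  generalize w^14 * T^3 * Q = P2 at *
  generalize w^14 * T^4 * Real.sqrt Q = P3 at *
  norm_num at hk2 hE ⊢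
  linarith

end BV

namespace BV

lemma foldr_lcm_dvd (L : ℕ) (l : List ℕ) (h : ∀ a ∈ l, a ∣ L) : l.foldr Nat.lcm 1 ∣ L := by
  induction l with
  | nil => simp
  | cons a l ih =>
    exact Nat.lcm_dvd (h a (by simp)) (ih fun b hb => h b (by simp [hb]))

lemma lcm113 : 10^50 ≤ Nat.lcmUpto 113 := by
  have h : ∀ a ∈ [64, 81, 25, 49, 11, 13, 17, 19, 23, 29, 31, 37, 41, 43, 47, 53, 59, 61, 67, 71, 73, 79, 83, 89, 97, 101, 103, 107, 109, 113], a ∣ Nat.lcmUpto 113 := by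
    intro a ha
    refine Finset.dvd_lcm (f := id) (Finset.mem_Icc.2 ?_)
    simp only [List.mem_cons, List.not_mem_nil, or_false] at ha
    omega
  have h2 := Nat.le_of_dvd (Nat.lcmUpto_pos 113) (foldr_lcm_dvd _ _ h)
  refine le_trans ?_ h2
  norm_num [List.foldr]

lemma A0_ge : 1 ≤ A₀ := by
  unfold A₀
  rw [le_div_iff₀ (by norm_num), one_mul]
  have h1 : psi 113 = Chebyshev.psi ((113:ℕ):ℝ) := by
    unfold psi
    rw [Chebyshev.psi_eq_sum_Icc]
    have : ⌊(113:ℝ)⌋₊ = 113 := by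
      have := Nat.floor_natCast (R := ℝ) 113
      exact_mod_cast this
    have h2 : ⌊((113:ℕ):ℝ)⌋₊ = 113 := Nat.floor_natCast 113
    rw [this, h2]
    apply Finset.sum_subset
    · intro n hn
      rw [Finset.mem_Icc] at *
      omega
    · intro n hn hn'
      rw [Finset.mem_Icc] at *
      have : n = 0 := by omega
      subst this
      simp
  rw [h1, Chebyshev.psi_eq_log_lcmUpto]
  have h2 : ((10:ℝ)^50) ≤ (Nat.lcmUpto 113 : ℝ) := by exact_mod_cast lcm113
  have h3 := Real.log_le_log (by positivity) h2
  rw [Real.log_pow] at h3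
  have h4 : Real.log 10 = 3 * Real.log 2 + Real.log (10/8) := by
    rw [show (10:ℝ) = 2^3 * (10/8) by norm_num, Real.log_mul (by norm_num) (by norm_num), Real.log_pow]
    norm_num
  have h5 := Real.one_sub_inv_le_log_of_pos (show (0:ℝ) < 10/8 by norm_num)
  have h6 := Real.log_two_gt_d9
  generalize Real.log (Nat.lcmUpto 113 : ℝ) = L at *
  norm_num at h3 h5 h6 h4
  linarith

lemma E0_ge : 1.8375 ≤ E₀ := by
  have hs : Summable (fun p : Nat.Primes => 1 / ((p:ℝ) * ((p:ℝ) - 1))) := by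
    have h1 : Summable (fun n : ℕ => 2 * (1/(n:ℝ)^2)) := (Real.summable_one_div_nat_pow.2 (by norm_num)).mul_left 2
    have h2 : Summable (fun p : Nat.Primes => 2 * (1/(((p:ℕ)):ℝ)^2)) := h1.comp_injective Nat.Primes.coe_nat_injective
    refine Summable.of_nonneg_of_le (fun p => ?_) (fun p => ?_) h2
    · have : (2:ℝ) ≤ ((p:ℕ):ℝ) := by exact_mod_cast p.2.two_le
      apply div_nonneg (by norm_num)
      nlinarith
    · have : (2:ℝ) ≤ ((p:ℕ):ℝ) := by exact_mod_cast p.2.two_le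
      rw [mul_one_div, div_le_div_iff₀ (by nlinarith) (by positivity)]
      nlinarith
  have hm := Real.multipliable_one_add_of_summable hs
  have ht : Filter.Tendsto (fun s : Finset Nat.Primes => ∏ p ∈ s, (1 + 1 / ((p:ℝ) * ((p:ℝ) - 1)))) Filter.atTop (nhds E₀) := hm.hasProd
  refine ge_of_tendsto ht ?_
  set f : Nat.Primes → ℝ := fun p => 1 + 1 / ((p:ℝ) * ((p:ℝ) - 1)) with hf
  obtain ⟨a, ha⟩ : ∃ a : Nat.Primes, (a:ℕ) = 2 := ⟨⟨2, by norm_num⟩, rfl⟩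
  obtain ⟨b, hb⟩ : ∃ a : Nat.Primes, (a:ℕ) = 3 := ⟨⟨3, by norm_num⟩, rfl⟩
  obtain ⟨c, hc⟩ : ∃ a : Nat.Primes, (a:ℕ) = 5 := ⟨⟨5, by norm_num⟩, rfl⟩
  have hab : a ≠ b := fun h => by rw [h, hb] at ha; omega
  have hac : a ≠ c := fun h => by rw [h, hc] at ha; omega
  have hbc : b ≠ c := fun h => by rw [h, hc] at hb; omega
  filter_upwards [Filter.eventually_ge_atTop ({a, b, c} : Finset Nat.Primes)] with s hs
  have h1 : ∏ p ∈ ({a, b, c} : Finset Nat.Primes), f p = 1.8375 := by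
    rw [Finset.prod_insert (by simp [hab, hac]), Finset.prod_insert (by simp [hbc]), Finset.prod_singleton]
    simp only [hf, ha, hb, hc]
    norm_num
  rw [← h1, ← Finset.prod_sdiff hs]
  have h3 : 1 ≤ ∏ p ∈ s \ {a, b, c}, f p := by
    have h5 : ∏ p ∈ s \ {a, b, c}, (1:ℝ) ≤ ∏ p ∈ s \ {a, b, c}, f p := by
      apply Finset.prod_le_prod (by intros; norm_num)
      intro p _
      have : (2:ℝ) ≤ ((p:ℕ):ℝ) := by exact_mod_cast p.2.two_le
      have h6 : 0 ≤ 1 / (((p:ℕ):ℝ) * (((p:ℕ):ℝ) - 1)) := by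
        apply div_nonneg (by norm_num)
        nlinarith
      simp only [hf]
      linarith
    simpa using h5
  rw [h1]
  linarith

lemma c0_ge : 3.8 ≤ c₀ := by
  unfold c₀
  have hA := A0_ge
  have h1 : 1.4142 ≤ Real.sqrt (2 * A₀) := by
    apply Real.le_sqrt_of_sq_le
    norm_num; linarith
  have hl1 := Real.log_two_gt_d9
  have hl2 := Real.log_two_lt_d9
  have hpi := Real.pi_lt_d4
  have hpi0 := Real.pi_pos
  have h3 : (3:ℝ)^((3:ℝ)/2) ≤ 5.1962 := by
    have h0 : (0:ℝ) ≤ (3:ℝ)^((3:ℝ)/2) := by positivity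
    apply le_of_sq_le_sq _ (by norm_num)
    rw [← Real.rpow_natCast, ← Real.rpow_mul (by norm_num)]
    norm_num
  have h30 : (0:ℝ) < (3:ℝ)^((3:ℝ)/2) := by positivity
  have h4 : (3:ℝ)^((3:ℝ)/2) * π * Real.log 2^2 ≤ 5.1962 * 3.1416 * 0.69315^2 := by
    have : Real.log 2 ≤ 0.69315 := by norm_num at hl2 ⊢; linarith
    gcongr
  have hd : 0 < (3:ℝ)^((3:ℝ)/2) * π * Real.log 2^2 := by positivity
  have h5 : 5.76 ≤ Real.sqrt (2 * A₀) * 2^5 / ((3:ℝ)^((3:ℝ)/2) * π * Real.log 2^2) := by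
    rw [le_div_iff₀ hd]
    have : 5.76 * ((3:ℝ)^((3:ℝ)/2) * π * Real.log 2^2) ≤ 5.76 * (5.1962 * 3.1416 * 0.69315^2) := by gcongr
    norm_num at this h1 ⊢
    linarith
  have h6 : 2/3 ≤ 2 + Real.log (Real.log 2) / Real.log (4/3) := by
    have hp : 0 < Real.log (4/3) := Real.log_pos (by norm_num)
    have h7 : 4 * Real.log (3/4) ≤ 3 * Real.log (Real.log 2) := by
      have : ((3:ℝ)/4)^4 ≤ (Real.log 2)^3 := by
        have h8 : (0.6931:ℝ)^3 ≤ (Real.log 2)^3 := by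
          gcongr; norm_num at hl1 ⊢; linarith
        refine le_trans ?_ h8
        norm_num
      have := Real.log_le_log (by norm_num) this
      rw [Real.log_pow, Real.log_pow] at this
      exact_mod_cast this
    have h8 : Real.log (3/4) = - Real.log (4/3) := by rw [← Real.log_inv]; norm_num
    have h9 : -(4/3) ≤ Real.log (Real.log 2) / Real.log (4/3) := by
      rw [le_div_iff₀ hp]; linarith
    linarith
  calc (3.8:ℝ) ≤ 5.76 * (2/3) := by norm_num
    _ ≤ _ := by gcongr

lemma c1_nine : 9 ≤ c₁ := by
  unfold c₁
  have h1 := E0_ge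
  have h2 := c0_ge
  have : (1.8375:ℝ) * 3.8 ≤ E₀ * c₀ := by gcongr
  norm_num at this ⊢
  linarith

lemma card_ap {q : ℕ} (hq : 1 ≤ q) (N a : ℕ) :
    ((Finset.Icc 1 N).filter (fun n : ℕ => (n : ZMod q) = (a : ZMod q))).card ≤ N / q + 1 := by
  have h : ((Finset.Icc 1 N).filter (fun n : ℕ => (n : ZMod q) = (a : ZMod q))).card ≤ (Finset.range (N/q+1)).card := by
    apply Finset.card_le_card_of_injOn (fun n => n / q)
    · intro n hn
      rw [Finset.mem_coe, Finset.mem_filter, Finset.mem_Icc] at hn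
      rw [Finset.mem_coe, Finset.mem_range]
      exact Nat.lt_succ_of_le (Nat.div_le_div_right hn.1.2)
    · intro n hn m hm h
      rw [Finset.mem_coe, Finset.mem_filter] at hn hm
      have e : (n : ZMod q) = (m : ZMod q) := hn.2.trans hm.2.symm
      rw [ZMod.natCast_eq_natCast_iff'] at e
      simp only at h
      rw [← Nat.div_add_mod n q, ← Nat.div_add_mod m q, h, e]
  rwa [Finset.card_range] at h

/-- trivial bound for one modulus -/
lemma triv_q {x y : ℝ} {q a : ℕ} (hx : 4 ≤ x) (hq : 1 ≤ q) (hqx : (q:ℝ)^2 ≤ x) (hy : y ∈ Set.Icc (2:ℝ) x) :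
    |psiMod y q a - psi y / (q.totient : ℝ)| ≤ 4.2 * (x * Real.log x) * (1/(q:ℝ)) := by
  have hq0 : (1:ℝ) ≤ q := by exact_mod_cast hq
  have hφ0 : (0:ℝ) < q.totient := by exact_mod_cast Nat.totient_pos.2 hq
  have hlx : 1.38629 ≤ Real.log x := by
    have h1 := Real.log_le_log (by norm_num) hx
    have h2 : Real.log 4 = 2 * Real.log 2 := by
      rw [show (4:ℝ) = 2^2 by norm_num, Real.log_pow]; norm_num
    have h3 := Real.log_two_gt_d9
    norm_num at h3 ⊢
    linarith
  set l := Real.log x with hl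
  have hN : (⌊y⌋₊:ℝ) ≤ x := (Nat.floor_le (by linarith [hy.1])).trans hy.2
  have hxl : 0 ≤ x * l := by norm_num at hlx; apply mul_nonneg <;> linarith
  -- first term
  have hA : psiMod y q a ≤ 4.2 * (x * l) * (1/(q:ℝ)) := by
    have h1 : psiMod y q a ≤ ((⌊y⌋₊/q + 1 : ℕ):ℝ) * l := by
      unfold psiMod
      calc _ ≤ ∑ n ∈ (Finset.Icc 1 ⌊y⌋₊).filter (fun n : ℕ => (n : ZMod q) = (a : ZMod q)), l := by
            refine Finset.sum_le_sum fun n hn => ?_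
            rw [Finset.mem_filter, Finset.mem_Icc] at hn
            refine vonMangoldt_le_log.trans (Real.log_le_log ?_ ?_)
            · have : 0 < n := by omega
              exact_mod_cast this
            · have : (n:ℝ) ≤ ⌊y⌋₊ := by exact_mod_cast hn.1.2
              linarith
        _ ≤ _ := by
            rw [Finset.sum_const, nsmul_eq_mul]
            have := card_ap hq ⌊y⌋₊ a
            norm_num at hlx
            gcongr
    have h2 : ((⌊y⌋₊/q + 1 : ℕ):ℝ) ≤ x/q + 1 := by
      push_cast
      have : ((⌊y⌋₊/q : ℕ):ℝ) ≤ (⌊y⌋₊:ℝ)/q := Nat.cast_div_le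
      have h3 : (⌊y⌋₊:ℝ)/q ≤ x/q := by gcongr
      linarith
    have h3 : x/q + 1 ≤ 2 * x / q := by
      have hqx' : (q:ℝ) ≤ x := by nlinarith
      rw [div_add' _ _ _ (by positivity), div_le_div_iff_of_pos_right (by positivity)]
      linarith
    calc psiMod y q a ≤ (2*x/q) * l := h1.trans (by norm_num at hlx; gcongr; linarith)
      _ = 2 * (x * l) * (1/(q:ℝ)) := by ring
      _ ≤ _ := by gcongr; norm_num
  have hP : psi y / (q.totient : ℝ) ≤ 4.2 * (x * l) * (1/(q:ℝ)) := by
    have h1 : psi y ≤ 2.86 * x := by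
      have := lam_sum ⌊y⌋₊
      unfold psi
      norm_num at this ⊢
      linarith
    have h2 := tot_ge hq
    have h3 : (q.primeFactors.card:ℝ) ≤ 0.7214 * l := by
      apply omega_num hq
      have := Real.log_le_log (by positivity) hqx
      rw [Real.log_pow] at this
      push_cast at this
      linarith
    have h4 : (q:ℝ) ≤ q.totient * (1.4429 * l) := by
      refine h2.trans ?_
      gcongr
      norm_num at h3 hlx ⊢
      linarith
    rw [mul_one_div, div_le_div_iff₀ hφ0 (by linarith)]
    have hx0 : 0 ≤ x := by linarith
    calc psi y * q ≤ (2.86 * x) * (q.totient * (1.4429 * l)) := by gcongr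
      _ = (2.86*1.4429) * (x * l * q.totient) := by ring
      _ ≤ 4.2 * (x * l * q.totient) := by gcongr; norm_num
      _ = _ := by ring
  have hA0 : 0 ≤ psiMod y q a := Finset.sum_nonneg fun _ _ => vonMangoldt_nonneg
  have hP0 : 0 ≤ psi y / (q.totient : ℝ) := div_nonneg (Finset.sum_nonneg fun _ _ => vonMangoldt_nonneg) hφ0.le
  rw [abs_le]
  constructor <;> linarith

lemma triv {x Q Q₁ : ℝ} (hx : 4 ≤ x) (hQ₁ : 1 ≤ Q₁) (hQ : Q₁ ≤ Q) (hQx : Q^2 ≤ x) :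
    ∑ q ∈ (Finset.Icc 1 ⌊Q⌋₊).filter (fun q => Q₁ < (q.minFac : ℝ)),
      ⨆ y ∈ Set.Icc (2 : ℝ) x, ⨆ a ∈ {a : ℕ | Nat.Coprime a q},
        |psiMod y q a - psi y / (q.totient : ℝ)| ≤ 4.2 * (x * Real.log x) * (1/Q₁ + Real.log (Q/Q₁)) := by
  have hQ0 : 0 < Q := by linarith
  have hlx : 0 ≤ Real.log x := Real.log_nonneg (by linarith)
  have hc : 0 ≤ 4.2 * (x * Real.log x) := by positivity
  have h1 : ∑ q ∈ (Finset.Icc 1 ⌊Q⌋₊).filter (fun q => Q₁ < (q.minFac : ℝ)),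
      (⨆ y ∈ Set.Icc (2 : ℝ) x, ⨆ a ∈ {a : ℕ | Nat.Coprime a q},
        |psiMod y q a - psi y / (q.totient : ℝ)|) ≤
      ∑ q ∈ (Finset.Icc 1 ⌊Q⌋₊).filter (fun q => Q₁ < (q.minFac : ℝ)), 4.2 * (x * Real.log x) * (1/(q:ℝ)) := by
    refine Finset.sum_le_sum fun q hq => ?_
    rw [Finset.mem_filter, Finset.mem_Icc] at hq
    have hqQ : (q:ℝ) ≤ Q := (Nat.le_floor_iff hQ0.le).1 hq.1.2
    have h0 : 0 ≤ 4.2 * (x * Real.log x) * (1/(q:ℝ)) := by positivity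
    refine Real.iSup_le (fun y => Real.iSup_le (fun hy => Real.iSup_le (fun a => Real.iSup_le (fun ha => ?_) h0) h0) h0) h0
    apply triv_q hx hq.1.1 _ hy
    have : (0:ℝ) ≤ q := by positivity
    nlinarith
  refine h1.trans ?_
  rw [← Finset.mul_sum]
  refine mul_le_mul_of_nonneg_left ?_ hc
  have hsub : (Finset.Icc 1 ⌊Q⌋₊).filter (fun q => Q₁ < (q.minFac : ℝ)) ⊆ Finset.Ioc ⌊Q₁⌋₊ ⌊Q⌋₊ := by
    intro q hq
    rw [Finset.mem_filter, Finset.mem_Icc] at hq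
    rw [Finset.mem_Ioc]
    refine ⟨?_, hq.1.2⟩
    rw [Nat.floor_lt (by linarith)]
    have h2 : (q.minFac:ℝ) ≤ q := by exact_mod_cast Nat.minFac_le hq.1.1
    linarith
  refine (Finset.sum_le_sum_of_subset_of_nonneg hsub (by intros; positivity)).trans ?_
  have hlog : 0 ≤ Real.log (Q/Q₁) := Real.log_nonneg (by rw [le_div_iff₀ (by linarith)]; linarith)
  rcases Nat.lt_or_ge ⌊Q₁⌋₊ ⌊Q⌋₊ with h | h
  · refine (inv_Ioc _ _ h).trans ?_
    have h2 : Q₁ < (⌊Q₁⌋₊:ℝ) + 1 := Nat.lt_floor_add_one Q₁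
    have h3 : (⌊Q⌋₊:ℝ) ≤ Q := Nat.floor_le hQ0.le
    have h4 : (0:ℝ) < ⌊Q⌋₊ := by exact_mod_cast (show 0 < ⌊Q⌋₊ by omega)
    apply add_le_add
    · gcongr
    · apply Real.log_le_log (by positivity)
      gcongr
  · rw [Finset.Ioc_eq_empty (by omega), Finset.sum_empty]
    positivity

end BV

namespace BV

lemma T_small {w T l : ℝ} (hw0 : 0 < w) (hT0 : 0 < T) (hwl : w^4 = l) (hl1 : 1 ≤ l) (hl2 : l ≤ 75)
    (hT : l = 6 * Real.log T) : T ≤ 8 * w^10 := by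
  have h4 : Real.log l = 4 * Real.log w := by rw [← hwl, Real.log_pow]; norm_num
  have h75 : 4.3 ≤ Real.log 75 := by
    have h1 : Real.log 75 = 6 * Real.log 2 + Real.log (75/64) := by
      rw [show (75:ℝ) = 2^6 * (75/64) by norm_num, Real.log_mul (by norm_num) (by norm_num), Real.log_pow]
      norm_num
    have h5 := Real.one_sub_inv_le_log_of_pos (show (0:ℝ) < 75/64 by norm_num)
    have h6 := Real.log_two_gt_d9
    norm_num at h5 h6 ⊢
    linarith
  have hconc := strictConcaveOn_log_Ioi.concaveOn
  have hch := hconc.2 (Set.mem_Ioi.2 (by norm_num : (0:ℝ) < 1)) (Set.mem_Ioi.2 (by norm_num : (0:ℝ) < 75))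
    (show 0 ≤ (75 - l)/74 by apply div_nonneg <;> linarith) (show 0 ≤ (l-1)/74 by apply div_nonneg <;> linarith) (by ring)
  simp only [smul_eq_mul, Real.log_one, mul_zero, zero_add] at hch
  rw [show (75 - l)/74 * 1 + (l-1)/74 * 75 = l by ring] at hch
  have h8 : (l-1)/74 * 4.3 ≤ (l-1)/74 * Real.log 75 := by
    apply mul_le_mul_of_nonneg_left h75
    apply div_nonneg <;> linarith
  have h2 := Real.log_two_gt_d9
  have key : Real.log T ≤ Real.log (8 * w^10) := by
    rw [Real.log_mul (by norm_num) (by positivity), Real.log_pow, show (8:ℝ) = 2^3 by norm_num, Real.log_pow]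
    push_cast
    have h9 : Real.log w = Real.log l / 4 := by rw [h4]; ring
    rw [h9]
    norm_num at h8 h2
    linarith
  exact (Real.log_le_log_iff hT0 (by positivity)).1 key

lemma fin_small {w T q1 lg : ℝ} (hw1 : 1 ≤ w) (hT0 : 0 < T) (hT : T ≤ 8 * w^10) (hq1 : 0 < q1) (hlg : 0 ≤ lg) :
    4.2 * (T^6 * w^4) * (q1 + lg) < w^14 * (126 * (T^6 * q1) + 36 * (T^5 * lg)) := by
  have hw0 : 0 < w := by linarith
  have h1 : 4.2 * (T^6 * w^4) * lg ≤ w^14 * (36 * (T^5 * lg)) := by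
    calc 4.2 * (T^6 * w^4) * lg = (4.2 * (T^5 * w^4) * lg) * T := by ring
      _ ≤ (4.2 * (T^5 * w^4) * lg) * (8 * w^10) := by gcongr
      _ = 33.6 * (w^14 * (T^5 * lg)) := by ring
      _ ≤ 36 * (w^14 * (T^5 * lg)) := by gcongr; norm_num
      _ = _ := by ring
  have h2 : 4.2 * (T^6 * w^4) * q1 < w^14 * (126 * (T^6 * q1)) := by
    have h3 : w^4 ≤ w^14 := pow_le_pow_right₀ hw1 (by norm_num)
    have h4 : 0 < T^6 * q1 * w^14 := by positivity
    calc 4.2 * (T^6 * w^4) * q1 = 4.2 * (T^6 * q1 * w^4) := by ring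
      _ ≤ 4.2 * (T^6 * q1 * w^14) := by gcongr
      _ < 126 * (T^6 * q1 * w^14) := by apply mul_lt_mul_of_pos_right _ h4; norm_num
      _ = _ := by ring
  nlinarith

lemma fin_mid {w T Q₁ lg : ℝ} (hw0 : 0 < w) (h75 : 75 ≤ w^4) (hT0 : 0 < T) (hQ1 : 1 ≤ Q₁) (hQ : Q₁ ≤ 31 * w^6) (hlg : lg ≤ w^4/2) :
    4.2 * (T^6 * w^4) * (1/Q₁ + lg) < w^14 * (126 * (T^6 * (1/Q₁))) := by
  have hQ0 : 0 < Q₁ := by linarith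
  have h1 : 1/Q₁ ≤ 1 := by rw [div_le_one hQ0]; exact hQ1
  have h2 : 1/Q₁ + lg ≤ 0.52 * w^4 := by norm_num at *; linarith
  have h3 : 1/(31 * w^6) ≤ 1/Q₁ := by gcongr
  have h4 : 0 < T^6 * w^8 := by positivity
  calc 4.2 * (T^6 * w^4) * (1/Q₁ + lg) ≤ 4.2 * (T^6 * w^4) * (0.52 * w^4) := by gcongr
    _ = (4.2 * 0.52) * (T^6 * w^8) := by ring
    _ < (126/31) * (T^6 * w^8) := by apply mul_lt_mul_of_pos_right _ h4; norm_num
    _ = w^14 * (126 * (T^6 * (1/(31*w^6)))) := by field_simp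
    _ ≤ _ := by gcongr

theorem main {x w T Q Q₁ : ℝ} (hx : 4 ≤ x) (hQ₁ : 1 ≤ Q₁) (hQ : Q₁ ≤ Q) (hw0 : 0 < w) (hwl : w^4 = Real.log x)
    (hT : x = T^6) (hT0 : 0 < T) (hQT : Q ≤ T^3) :
    ∑ q ∈ (Finset.Icc 1 ⌊Q⌋₊).filter (fun q => Q₁ < (q.minFac : ℝ)),
      ⨆ y ∈ Set.Icc (2 : ℝ) x, ⨆ a ∈ {a : ℕ | Nat.Coprime a q},
        |psiMod y q a - psi y / (q.totient : ℝ)| <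
      w^14 * (126 * (T^6 * (1/Q₁)) + 36 * (T^3 * Q) + 135 * (T^4 * Real.sqrt Q) + 36 * (T^5 * Real.log (Q/Q₁))) := by
  have hQ0 : 0 < Q := by linarith
  have hQ10 : 0 < Q₁ := by linarith
  have hlog : 0 ≤ Real.log (Q/Q₁) := Real.log_nonneg (by rw [le_div_iff₀ hQ10]; linarith)
  have hlx : 1.38629 ≤ Real.log x := by
    have h1 := Real.log_le_log (by norm_num) hx
    have h2 : Real.log 4 = 2 * Real.log 2 := by
      rw [show (4:ℝ) = 2^2 by norm_num, Real.log_pow]; norm_num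
    have h3 := Real.log_two_gt_d9
    norm_num at h3 ⊢
    linarith
  have hl6 : Real.log x = 6 * Real.log T := by rw [hT, Real.log_pow]; norm_num
  have hw1 : 1 ≤ w := by
    by_contra h
    push Not at h
    have : w^4 < 1 := pow_lt_one₀ hw0.le h (by norm_num)
    rw [hwl] at this
    norm_num at hlx
    linarith
  have hT1 : 1 ≤ T := by
    by_contra h
    push Not at h
    have : T^6 < 1 := pow_lt_one₀ hT0.le h (by norm_num)
    linarith
  have p0 : 0 ≤ w^14 * (126 * (T^6 * (1/Q₁))) := by positivity
  have p1 : 0 < w^14 * (36 * (T^3 * Q)) := by positivity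
  have p2 : 0 ≤ w^14 * (135 * (T^4 * Real.sqrt Q)) := by positivity
  have p3 : 0 ≤ w^14 * (36 * (T^5 * Real.log (Q/Q₁))) := by positivity
  have htr := triv hx hQ₁ hQ (by
    rw [hT]
    calc Q^2 ≤ (T^3)^2 := by gcongr
      _ = T^6 := by ring)
  rw [← hwl] at htr
  rcases le_or_gt (Real.log x) 75 with h75 | h75
  · have hTs := T_small hw0 hT0 hwl (by norm_num at hlx; linarith) h75 hl6
    have := fin_small hw1 hT0 hTs (by positivity : 0 < 1/Q₁) hlog
    rw [show x * w^4 = T^6 * w^4 by rw [← hT]] at htr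
    refine lt_of_le_of_lt htr (lt_of_lt_of_le this ?_)
    rw [mul_add, mul_add, mul_add, mul_add]
    linarith
  · rcases le_or_gt Q₁ (31 * w^6) with hq | hq
    · have hlg : Real.log (Q/Q₁) ≤ w^4/2 := by
        have h1 : Real.log (Q/Q₁) ≤ Real.log Q := by
          apply Real.log_le_log (by positivity)
          exact div_le_self hQ0.le hQ₁
        have h2 := Real.log_le_log hQ0 hQT
        rw [Real.log_pow] at h2
        push_cast at h2
        linarith
      have := fin_mid (T := T) hw0 (by linarith) hT0 hQ₁ hq hlg
      rw [show x * w^4 = T^6 * w^4 by rw [← hT]] at htr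
      refine lt_of_le_of_lt htr (lt_of_lt_of_le this ?_)
      rw [mul_add, mul_add, mul_add]
      linarith
    · have hb := main_big hw0 hwl h75.le hx hT hT0 hT1 hq.le hQ hQT
      refine lt_of_le_of_lt hb ?_
      have e : 64 * w^14 * T^6 / Q₁ + 20 * w^14 * T^3 * Q + 100 * w^14 * T^4 * Real.sqrt Q
        = 64 / 126 * (w^14 * (126 * (T^6 * (1/Q₁)))) + 20/36 * (w^14 * (36 * (T^3 * Q))) + 100/135 * (w^14 * (135 * (T^4 * Real.sqrt Q))) := by
        field_simp
      rw [e, mul_add, mul_add, mul_add]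
      linarith

end BV

theorem bombieri_vinogradov_explicit (x Q Q₁ : ℝ) (hx : 4 ≤ x) (hQ₁ : 1 ≤ Q₁) (hQ : Q₁ ≤ Q)
    (hQx : Q ≤ x ^ ((1 : ℝ) / 2)) :
    ∑ q ∈ (Finset.Icc 1 ⌊Q⌋₊).filter (fun q => Q₁ < (q.minFac : ℝ)),
      ⨆ y ∈ Set.Icc (2 : ℝ) x, ⨆ a ∈ {a : ℕ | Nat.Coprime a q},
        |psiMod y q a - psi y / (q.totient : ℝ)| <
    c₁ * (14 * x / Q₁ + 4 * x ^ ((1 : ℝ) / 2) * Q + 15 * x ^ ((2 : ℝ) / 3) * Q ^ ((1 : ℝ) / 2) +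
        4 * x ^ ((5 : ℝ) / 6) * Real.log (Q / Q₁)) * Real.log x ^ ((7 : ℝ) / 2) := by
  have hx0 : 0 < x := by linarith
  have hQ0 : 0 < Q := by linarith
  have hQ10 : 0 < Q₁ := by linarith
  have hl0 : 0 < Real.log x := Real.log_pos (by linarith)
  have hlog : 0 ≤ Real.log (Q/Q₁) := Real.log_nonneg (by rw [le_div_iff₀ hQ10]; linarith)
  have hpw : ∀ (z : ℝ), 0 < z → ∀ (a b : ℝ) (n : ℕ), a * n = b → z ^ b = (z ^ a)^n := by
    intro z hz a b n h
    rw [← Real.rpow_natCast, ← Real.rpow_mul hz.le, h]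
  set T := x ^ ((1:ℝ)/6) with hT
  set w := (Real.log x) ^ ((1:ℝ)/4) with hw
  have hT0 : 0 < T := by positivity
  have hw0 : 0 < w := by positivity
  have e1 : x ^ ((1:ℝ)/2) = T^3 := hpw x hx0 _ _ 3 (by norm_num)
  have e2 : x ^ ((2:ℝ)/3) = T^4 := hpw x hx0 _ _ 4 (by norm_num)
  have e3 : x ^ ((5:ℝ)/6) = T^5 := hpw x hx0 _ _ 5 (by norm_num)
  have e4 : x = T^6 := by
    have := hpw x hx0 (1/6) 1 6 (by norm_num)
    rwa [Real.rpow_one] at this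
  have e5 : Real.log x ^ ((7:ℝ)/2) = w^14 := hpw _ hl0 _ _ 14 (by norm_num)
  have e6 : w^4 = Real.log x := by
    have := hpw _ hl0 (1/4) 1 4 (by norm_num)
    rw [Real.rpow_one] at this
    exact this.symm
  rw [e1] at hQx
  have hm := BV.main hx hQ₁ hQ hw0 e6 e4 hT0 hQx
  refine lt_of_lt_of_le hm ?_
  rw [e1, e2, e3, e5, ← Real.sqrt_eq_rpow]
  have hc := BV.c1_nine
  have hp : 0 ≤ (14 * x / Q₁ + 4 * T^3 * Q + 15 * T^4 * Real.sqrt Q + 4 * T^5 * Real.log (Q/Q₁)) * w^14 := by positivity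
  have h9 := mul_le_mul_of_nonneg_right hc hp
  have hxq : 14 * x / Q₁ = 14 * (T^6 * (1/Q₁)) := by
    rw [← e4]; ring
  rw [hxq] at h9 ⊢
  linarith
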